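/- Let N ≥ 2, p > 1, let Ω ⊂ ℝ^N be a bounded domain with boundary of class C^{2,α}, and let H be a norm of class I_p. If there exists a weak solution u of Δ_p^H u = −1 in Ω with u = 0 on ∂Ω which moreover satisfies H(Du) = C on ∂Ω for some constant C > 0, then Ω is Wulff shape: up to a translation there exists r > 0 with Ω = B_{H_0}(r), and u(x) = (p−1)(r^{p/(p−1)} − H_0(x)^{p/(p−1)})/(p N^{1/(p−1)}). -/

import Mathlib

open MeasureTheory Filter Set
open scoped Topology RealInnerProductSpace NNReal

noncomputable section

abbrev Euc (N : ℕ) := EuclideanSpace ℝ (Fin N)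

variable {N : ℕ}

/-- The partial derivative of `f` in the `i`-th coordinate direction. -/
def pd (i : Fin N) (f : Euc N → ℝ) (x : Euc N) : ℝ :=
  fderiv ℝ f x (EuclideanSpace.single i 1)

/-- The Hessian matrix of `f` at `x`. -/
def hessM (f : Euc N → ℝ) (x : Euc N) : Matrix (Fin N) (Fin N) ℝ :=
  Matrix.of fun i j => pd i (pd j f) x

/-- Interpret a plain function `Fin N → ℝ` as a point of Euclidean space. -/
def toEuc {N : ℕ} (f : Fin N → ℝ) : Euc N := (WithLp.equiv 2 (Fin N → ℝ)).symm f

/-- The divergence of a vector field. -/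
def divVF (X : Euc N → Euc N) (x : Euc N) : ℝ := ∑ i, pd i (fun y => X y i) x

/-- The quadratic form associated to a matrix. -/
def qForm (A : Matrix (Fin N) (Fin N) ℝ) (ζ : Euc N) : ℝ := ∑ i, ∑ j, A i j * ζ i * ζ j

/-- Local `α`-Hölder continuity of `g` on `s` (uniform on compact subsets). -/
def LocHolderOn {X Y : Type*} [NormedAddCommGroup X] [NormedAddCommGroup Y]
    (α : ℝ) (g : X → Y) (s : Set X) : Prop :=
  ∀ K : Set X, K ⊆ s → IsCompact K → ∃ C : ℝ, ∀ x ∈ K, ∀ y ∈ K, ‖g x - g y‖ ≤ C * ‖x - y‖ ^ α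

/-- The dual norm `H₀(x) = sup_{ξ ≠ 0} ⟨x, ξ⟩ / H(ξ)`. -/
def dualNorm (H : Euc N → ℝ) (x : Euc N) : ℝ :=
  ⨆ ξ : {ξ : Euc N // ξ ≠ 0}, ⟪x, (ξ : Euc N)⟫ / H ξ

/-- `V = H^p / p`. -/
def Vfun (H : Euc N → ℝ) (p : ℝ) : Euc N → ℝ := fun ξ => H ξ ^ p / p

/-- `H` is a norm of class `I_p`: a norm which is `C^{2,α}` away from the origin, for some
`α ∈ (0,1)`, such that `V = H^p/p` is `C²` away from the origin with Hessian having positive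
eigenvalues uniformly bounded away from `0` on the unit sphere. -/
structure IsIpNorm (p : ℝ) (H : Euc N → ℝ) : Prop where
  convex : ConvexOn ℝ Set.univ H
  homog : ∀ (t : ℝ) (ξ : Euc N), H (t • ξ) = |t| * H ξ
  pos : ∀ ξ : Euc N, ξ ≠ 0 → 0 < H ξ
  smooth : ContDiffOn ℝ 2 H {(0 : Euc N)}ᶜ
  holder : ∃ α ∈ Set.Ioo (0:ℝ) 1,
    LocHolderOn α (iteratedFDerivWithin ℝ 2 H {(0 : Euc N)}ᶜ) {(0 : Euc N)}ᶜ
  Vsmooth : ContDiffOn ℝ 2 (Vfun H p) {(0 : Euc N)}ᶜ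
  hessV_pos : ∃ c > 0, ∀ ξ : Euc N, ‖ξ‖ = 1 → ∀ ζ : Euc N,
    c * ‖ζ‖ ^ 2 ≤ qForm (hessM (Vfun H p) ξ) ζ

/-- `Ω` is, up to a translation, the Wulff shape `B_{H₀}(r)` of `H` for some `r > 0`. -/
def IsWulffShape (H : Euc N → ℝ) (Ω : Set (Euc N)) : Prop :=
  ∃ (x₀ : Euc N) (r : ℝ), 0 < r ∧ Ω = {x | dualNorm H (x - x₀) < r}

/-- An open set with boundary of class `C^{2,α}`, described by a `C^{2,α}` defining function. -/
def IsC2alphaDomain (Ω : Set (Euc N)) : Prop :=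
  IsOpen Ω ∧ ∃ f : Euc N → ℝ, ContDiff ℝ 2 f ∧
    (∃ α ∈ Set.Ioo (0:ℝ) 1, LocHolderOn α (iteratedFDeriv ℝ 2 f) (Set.univ : Set (Euc N))) ∧
    Ω = {x | f x < 0} ∧ frontier Ω = {x | f x = 0} ∧
    ∀ x ∈ frontier Ω, gradient f x ≠ 0

/-- Weak solution of `Δ_p^H u = -1` in `Ω`, `u = 0` on `∂Ω`. -/
structure IsInteriorSol (H : Euc N → ℝ) (p : ℝ) (Ω : Set (Euc N)) (u : Euc N → ℝ) : Prop where
  contOn : ContinuousOn u (closure Ω)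
  diff : ∀ x ∈ Ω, DifferentiableAt ℝ u x
  bdry : ∀ x ∈ frontier Ω, u x = 0
  int_u : IntegrableOn u Ω
  int_grad : IntegrableOn (fun x => H (gradient u x) ^ p) Ω
  weak : ∀ φ : Euc N → ℝ, ContDiff ℝ 1 φ → HasCompactSupport φ → tsupport φ ⊆ Ω →
    (∫ x in Ω, H (gradient u x) ^ (p - 1) * ⟪gradient H (gradient u x), gradient φ x⟫)
      = ∫ x in Ω, φ x

/-- Solution of the exterior problem: `Δ_p^H u = 0` weakly in `ℝ^N ∖ cl Ω`, `u = 1` on `∂Ω`,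
`u → 0` at infinity. -/
structure IsExteriorSol (H : Euc N → ℝ) (p : ℝ) (Ω : Set (Euc N)) (u : Euc N → ℝ) : Prop where
  contOn : ContinuousOn u Ωᶜ
  diff : ∀ x ∈ (closure Ω)ᶜ, DifferentiableAt ℝ u x
  bdry : ∀ x ∈ frontier Ω, u x = 1
  decay : Tendsto u (cocompact (Euc N)) (𝓝 0)
  weak : ∀ φ : Euc N → ℝ, ContDiff ℝ 1 φ → HasCompactSupport φ → tsupport φ ⊆ (closure Ω)ᶜ →
    (∫ x in (closure Ω)ᶜ,
      H (gradient u x) ^ (p - 1) * ⟪gradient H (gradient u x), gradient φ x⟫) = 0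

/-- The inward unit normal field associated to a defining function `f` (with `Ω = {f < 0}`). -/
def inwardField (f : Euc N → ℝ) (x : Euc N) : Euc N := -(‖gradient f x‖)⁻¹ • gradient f x

/-- `ν` is the inward unit normal of `Ω` and `M` its anisotropic mean curvature
`M = -div(∇_ξ H(ν))`, computed via a `C²` defining function. -/
def IsNormalCurv (H : Euc N → ℝ) (Ω : Set (Euc N)) (ν : Euc N → Euc N) (M : Euc N → ℝ) : Prop :=
  ∃ f : Euc N → ℝ, ContDiff ℝ 2 f ∧ Ω = {x | f x < 0} ∧ frontier Ω = {x | f x = 0} ∧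
    (∀ x ∈ frontier Ω, gradient f x ≠ 0) ∧
    (∀ x ∈ frontier Ω, ν x = inwardField f x) ∧
    (∀ x ∈ frontier Ω, M x = - divVF (fun y => gradient H (inwardField f y)) x)

/-- `ν` is the inward unit normal field of `Ω`, computed via a `C²` defining function. -/
def IsInwardNormal (Ω : Set (Euc N)) (ν : Euc N → Euc N) : Prop :=
  ∃ f : Euc N → ℝ, ContDiff ℝ 2 f ∧ Ω = {x | f x < 0} ∧ frontier Ω = {x | f x = 0} ∧
    (∀ x ∈ frontier Ω, gradient f x ≠ 0) ∧
    ∀ x ∈ frontier Ω, ν x = inwardField f x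

/-- Second elementary symmetric function of a matrix. -/
def S2 (A : Matrix (Fin N) (Fin N) ℝ) : ℝ := ((Matrix.trace A) ^ 2 - Matrix.trace (A * A)) / 2

/-- `S²_{ij}(A) = -a_{ji} + δ_{ij} Tr A`. -/
def S2ij (A : Matrix (Fin N) (Fin N) ℝ) (i j : Fin N) : ℝ :=
  -A j i + (if i = j then Matrix.trace A else 0)

/-- The matrix `W = ∇²_ξ V(Dv) D²v`. -/
def Wmat (H : Euc N → ℝ) (p : ℝ) (v : Euc N → ℝ) (x : Euc N) : Matrix (Fin N) (Fin N) ℝ :=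
  hessM (Vfun H p) (gradient v x) * hessM v x

/-- `G` is the weak (distributional) Jacobian matrix of the vector field `Z` on `Ω`, with both
`Z` and `G` square-integrable (i.e. `Z ∈ W^{1,2}(Ω)` with Jacobian `G`). -/
def IsWeakJacobianOn (Z : Euc N → Euc N) (G : Euc N → Matrix (Fin N) (Fin N) ℝ)
    (Ω : Set (Euc N)) : Prop :=
  IntegrableOn (fun x => ∑ i, (Z x i) ^ 2) Ω ∧
  IntegrableOn (fun x => ∑ i, ∑ j, (G x i j) ^ 2) Ω ∧
  ∀ (i j : Fin N) (φ : Euc N → ℝ), ContDiff ℝ 1 φ → HasCompactSupport φ → tsupport φ ⊆ Ω →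
    (∫ x in Ω, Z x i * pd j φ x) = - ∫ x in Ω, G x i j * φ x

/-- The vector field `Z` belongs to `W^{1,2}(Ω)`. -/
def MemW12 (Z : Euc N → Euc N) (Ω : Set (Euc N)) : Prop := ∃ G, IsWeakJacobianOn Z G Ω


/-- The anisotropic `p`-capacity of `Ω`. -/
def pCapacity (H : Euc N → ℝ) (p : ℝ) (Ω : Set (Euc N)) : ℝ :=
  sInf {r : ℝ | ∃ φ : Euc N → ℝ, ContDiff ℝ (⊤ : ℕ∞) φ ∧ HasCompactSupport φ ∧
    (∀ x ∈ Ω, 1 ≤ φ x) ∧ r = (1 / p) * ∫ x, H (gradient φ x) ^ p}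

/-- The `(N-1)`-dimensional Hausdorff (surface) measure on `ℝ^N`. -/
def surf (N : ℕ) : Measure (Euc N) := Measure.hausdorffMeasure ((N : ℝ) - 1)

end

noncomputable section
open MeasureTheory Filter Set
open scoped Topology RealInnerProductSpace NNReal

section

open scoped ENNReal
open EuclideanSpace (single proj)
open Filter.Eventually (of_forall)

variable {N : ℕ} {F : Type*} [NormedAddCommGroup F] [NormedSpace ℝ F]

set_option hygiene false in
local notation "E" => Euc N
local notation "Df" => fderiv ℝ
local notation:max "𝐞" i:max => EuclideanSpace.single i (1 : ℝ)

variable {p C t a b c s ε B : ℝ} {r : ℝ≥0∞} {κ : ℝ → ℝ} {x : E} {f G : E → F} {H u g φ : E → ℝ}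
  {q m w : E → E} {S : E → E →L[ℝ] E} {Ω K : Set E} {ξ : E}

set_option hygiene false in
local notation "V" => Vfun H p
set_option hygiene false in
local notation "Ip" => IsIpNorm p H

/-- The gradient of `V = H^p / p`. -/
def stress (H : E → ℝ) (p : ℝ) (ξ : E) : E := gradient (V) ξ

set_option hygiene false in
local notation "∇V" => stress H p

namespace IsIpNorm

lemma map_zero (hH : Ip) : H 0 = 0 := by simpa using hH.homog 0 0

lemma nonneg (hH : Ip) (ξ : E) : 0 ≤ H ξ := by
  by_cases h : ξ = 0
  · simp [h, hH.map_zero]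
  · exact (hH.pos ξ h).le

lemma map_neg (hH : Ip) (ξ : E) : H (-ξ) = H ξ := by
  simpa using hH.homog (-1) ξ

lemma continuous (hH : Ip) : Continuous H :=
  hH.convex.locallyLipschitz.continuous

lemma homog_pos (hH : Ip) (ht : 0 ≤ t) (ξ : E) : H (t • ξ) = t * H ξ := by
  rw [hH.homog, abs_of_nonneg ht]

lemma add_le (hH : Ip) (x y : E) : H (x + y) ≤ H x + H y := by
  have h := hH.convex.2 (mem_univ ((2:ℝ) • x)) (mem_univ ((2:ℝ) • y))
    (show (0:ℝ) ≤ 1/2 by norm_num) (show (0:ℝ) ≤ 1/2 by norm_num) (by norm_num)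
  simpa [smul_smul, hH.homog] using h

lemma exists_bounds (hH : Ip) :
    ∃ c K : ℝ, 0 < c ∧ 0 < K ∧ ∀ ξ : E, c * ‖ξ‖ ≤ H ξ ∧ H ξ ≤ K * ‖ξ‖ := by
  by_cases hne : (Metric.sphere (0 : E) 1).Nonempty
  · have hc : IsCompact (Metric.sphere (0 : E) 1) := isCompact_sphere 0 1
    obtain ⟨a, ha, hmin⟩ := hc.exists_isMinOn hne hH.continuous.continuousOn
    obtain ⟨b, hb, hmax⟩ := hc.exists_isMaxOn hne hH.continuous.continuousOn
    have ha0 : a ≠ 0 := by rintro rfl; simp at ha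
    have hb0 : b ≠ 0 := by rintro rfl; simp at hb
    refine ⟨H a, H b, hH.pos a ha0, hH.pos b hb0, fun ξ => ?_⟩
    by_cases h : ξ = 0
    · simp [h, hH.map_zero]
    have hn : 0 < ‖ξ‖ := norm_pos_iff.2 h
    have hmem : ‖ξ‖⁻¹ • ξ ∈ Metric.sphere (0 : E) 1 := by
      simp [norm_smul, hn.ne']
    have e : H (‖ξ‖⁻¹ • ξ) = ‖ξ‖⁻¹ * H ξ := hH.homog_pos (by positivity) ξ
    have h1 : H a ≤ H (‖ξ‖⁻¹ • ξ) := hmin hmem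
    have h2 : H (‖ξ‖⁻¹ • ξ) ≤ H b := hmax hmem
    rw [e] at h1 h2
    rw [inv_mul_eq_div] at h1 h2
    exact ⟨(le_div_iff₀ hn).1 h1, (div_le_iff₀ hn).1 h2⟩
  · refine ⟨1, 1, one_pos, one_pos, fun ξ => ?_⟩
    by_cases h : ξ = 0
    · simp [h, hH.map_zero]
    · refine absurd ⟨‖ξ‖⁻¹ • ξ, ?_⟩ hne
      have hn : 0 < ‖ξ‖ := norm_pos_iff.2 h
      simp [norm_smul, hn.ne']

lemma V_nonneg (hH : Ip) (hp : 1 < p) (ξ : E) : 0 ≤ V ξ := by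
  have := hH.nonneg ξ
  unfold Vfun; positivity

lemma V_continuous (hH : Ip) (hp : 1 < p) : Continuous (V) :=
  (hH.continuous.rpow_const fun _ => Or.inr (by linarith)).div_const p

lemma V_zero (hH : Ip) (hp : 1 < p) : V 0 = 0 := by
  simp [Vfun, hH.map_zero, Real.zero_rpow (by linarith : p ≠ 0)]

lemma V_pos (hH : Ip) (hp : 1 < p) (h : ξ ≠ 0) : 0 < V ξ := by
  have := hH.pos ξ h
  unfold Vfun; positivity

lemma V_smul (hH : Ip) (ht : 0 ≤ t) (ξ : E) :
    V (t • ξ) = t ^ p * V ξ := by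
  simp only [Vfun]
  rw [hH.homog_pos ht, Real.mul_rpow ht (hH.nonneg ξ), mul_div_assoc]

lemma V_convex (hH : Ip) (hp : 1 < p) : ConvexOn ℝ univ (V) := by
  have h1 : ConvexOn ℝ (Ici 0) fun t : ℝ => t ^ p := convexOn_rpow hp.le
  refine ⟨convex_univ, fun x _ y _ a b ha hb hab => ?_⟩
  have h2 := hH.convex.2 (mem_univ x) (mem_univ y) ha hb hab
  have h3 := h1.2 (hH.nonneg x : H x ∈ Ici 0) (hH.nonneg y : H y ∈ Ici 0) ha hb hab
  simp only [smul_eq_mul, Vfun] at *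
  have h4 := Real.rpow_le_rpow (hH.nonneg _) h2 (by linarith : 0 ≤ p)
  calc _ ≤ (a * H x ^ p + b * H y ^ p) / p := by gcongr; exact h4.trans h3
    _ = _ := by ring

lemma hasGradientAt_V (hH : Ip) (hp : 1 < p) (ξ : E) :
    HasGradientAt (V) (∇V ξ) ξ := by
  apply DifferentiableAt.hasGradientAt
  by_cases h : ξ = 0
  · subst h
    obtain ⟨c, K, hc, hK, hb⟩ := hH.exists_bounds
    have : HasFDerivAt (V) (0 : E →L[ℝ] ℝ) 0 := by
      rw [hasFDerivAt_iff_isLittleO_nhds_zero]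
      simp only [zero_add, hH.V_zero hp, sub_zero, _root_.zero_apply]
      have h1 : (fun h : E => V h) =O[𝓝 0] fun h => ‖h‖ ^ p := by
        refine Asymptotics.IsBigO.of_bound (K ^ p / p) (of_forall fun x => ?_)
        rw [Real.norm_of_nonneg (hH.V_nonneg hp x), Real.norm_of_nonneg (by positivity)]
        have := Real.rpow_le_rpow (hH.nonneg x) (hb x).2 (by linarith : 0 ≤ p)
        rw [Real.mul_rpow hK.le (norm_nonneg x)] at this
        unfold Vfun
        rw [div_mul_eq_mul_div]
        gcongr
      refine h1.trans_isLittleO ?_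
      have h2 : (fun h : E => ‖h‖ ^ p) = fun h => ‖h‖ ^ (p - 1) * ‖h‖ := by
        funext x
        by_cases hx : x = 0
        · simp [hx, Real.zero_rpow (by linarith : p ≠ 0)]
        · rw [← Real.rpow_add_one (norm_ne_zero_iff.2 hx)]; simp
      rw [h2]
      have h3 : Tendsto (fun h : E => ‖h‖ ^ (p - 1)) (𝓝 0) (𝓝 0) := by
        have : Continuous (fun h : E => ‖h‖ ^ (p - 1)) :=
          continuous_norm.rpow_const fun _ => Or.inr (by linarith)
        simpa [Real.zero_rpow (by linarith : p - 1 ≠ 0)] using this.tendsto 0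
      have h4 : (fun h : E => ‖h‖ ^ (p - 1) * ‖h‖) =o[𝓝 0] fun h => 1 * ‖h‖ :=
        ((Asymptotics.isLittleO_one_iff ℝ).2 h3).mul_isBigO (Asymptotics.isBigO_refl _ _)
      refine Asymptotics.IsLittleO.of_norm_right ?_
      simpa using h4
    exact this.differentiableAt
  · exact (hH.Vsmooth.contDiffAt (isOpen_compl_singleton.mem_nhds h)).differentiableAt (by norm_num)

lemma differentiable_V (hH : Ip) (hp : 1 < p) : Differentiable ℝ (V) :=
  fun ξ => (hH.hasGradientAt_V hp ξ).differentiableAt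

lemma fderiv_V (hH : Ip) (hp : 1 < p) (ξ ζ : E) :
    Df (V) ξ ζ = ⟪∇V ξ, ζ⟫ :=
  (hH.hasGradientAt_V hp ξ).fderiv_apply

/-- Convexity inequality for `V`. -/
lemma V_ge (hH : Ip) (hp : 1 < p) (ξ η : E) :
    V ξ + ⟪∇V ξ, η - ξ⟫ ≤ V η := by
  have h1 : ConvexOn ℝ univ fun t : ℝ => V (ξ + t • (η - ξ)) := by
    refine ⟨convex_univ, fun x _ y _ a b ha hb hab => ?_⟩
    have := (hH.V_convex hp).2 (mem_univ (ξ + x • (η - ξ))) (mem_univ (ξ + y • (η - ξ))) ha hb hab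
    convert! this using 2
    obtain rfl : b = 1 - a := by linarith
    simp only [smul_eq_mul]
    module
  have h2 : HasDerivAt (fun t : ℝ => V (ξ + t • (η - ξ))) (⟪∇V ξ, η - ξ⟫) 0 := by
    have h3 : HasFDerivAt (V) (Df (V) ξ) (ξ + (0:ℝ) • (η - ξ)) := by
      simpa using (hH.differentiable_V hp ξ).hasFDerivAt
    have h4 : HasDerivAt (fun t : ℝ => ξ + t • (η - ξ)) (η - ξ) 0 := by
      simpa using ((hasDerivAt_id (0:ℝ)).smul_const (η - ξ)).const_add ξ
    have := h3.comp_hasDerivAt (0:ℝ) h4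
    rwa [hH.fderiv_V hp] at this
  have h5 := h1.le_slope_of_hasDerivAt (mem_univ 0) (mem_univ 1) one_pos h2
  simp [slope_def_field] at h5
  linarith

lemma stress_zero (hH : Ip) (hp : 1 < p) : ∇V (0 : E) = 0 := by
  have h : IsLocalMin (V) 0 := by
    refine of_forall fun x => ?_
    rw [hH.V_zero hp]; exact hH.V_nonneg hp x
  have := h.fderiv_eq_zero
  have h2 : ⟪∇V (0 : E), ∇V 0⟫ = 0 := by rw [← hH.fderiv_V hp, this]; simp
  simpa using h2

lemma stress_smul (hH : Ip) (hp : 1 < p) (ht : 0 < t) (ξ : E) :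
    ∇V (t • ξ) = t ^ (p - 1) • ∇V ξ := by
  refine ext_inner_right ℝ fun ζ => ?_
  have h1 : HasFDerivAt (fun x : E => V (t • x))
      ((Df (V) (t • ξ)).comp (t • ContinuousLinearMap.id ℝ (E))) ξ :=
    (hH.differentiable_V hp (t • ξ)).hasFDerivAt.comp ξ ((hasFDerivAt_id ξ).const_smul t)
  have h2 : HasFDerivAt (fun x : E => V (t • x)) (t ^ p • Df (V) ξ) ξ := by
    have := (hH.differentiable_V hp ξ).hasFDerivAt.const_smul (t ^ p)
    refine this.congr_of_eventuallyEq (of_forall fun x => ?_)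
    simp [hH.V_smul ht.le]
  have h3 := congrArg (fun L => L ζ) (h1.unique h2)
  simp only [ContinuousLinearMap.comp_apply, _root_.smul_apply,
    ContinuousLinearMap.id_apply, hH.fderiv_V hp, smul_eq_mul, inner_smul_right] at h3
  rw [inner_smul_left]
  simp only [conj_trivial]
  have e : t ^ p = t ^ (p - 1) * t := by rw [← Real.rpow_add_one ht.ne']; simp
  rw [e] at h3
  have : t * (⟪∇V (t • ξ), ζ⟫ - t ^ (p - 1) * ⟪∇V ξ, ζ⟫) = 0 := by linarith
  rcases mul_eq_zero.1 this with h | h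
  · exact absurd h ht.ne'
  · linarith

lemma inner_stress_self (hH : Ip) (hp : 1 < p) (ξ : E) :
    ⟪∇V ξ, ξ⟫ = H ξ ^ p := by
  have h2 : HasDerivAt (fun t : ℝ => V (t • ξ)) (⟪∇V ξ, ξ⟫) 1 := by
    have h3 : HasFDerivAt (V) (Df (V) ξ) ((1:ℝ) • ξ) := by
      simpa using (hH.differentiable_V hp ξ).hasFDerivAt
    have h4 : HasDerivAt (fun t : ℝ => t • ξ) ξ 1 := by
      simpa using (hasDerivAt_id (1:ℝ)).smul_const ξ
    have := h3.comp_hasDerivAt (1:ℝ) h4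
    rwa [hH.fderiv_V hp] at this
  have h5 : HasDerivAt (fun t : ℝ => V (t • ξ)) (p * 1 ^ (p - 1) * V ξ) 1 := by
    have := (Real.hasDerivAt_rpow_const (x := 1) (p := p) (Or.inl one_ne_zero)).mul_const
      (V ξ)
    refine this.congr_of_eventuallyEq ?_
    filter_upwards [lt_mem_nhds (zero_lt_one (α := ℝ))] with t ht
    exact hH.V_smul ht.le ξ
  rw [h2.unique h5]
  have : p ≠ 0 := by linarith
  simp [Vfun]; field_simp

lemma stress_eq (hH : Ip) (hp : 1 < p) (ξ : E) :
    ∇V ξ = H ξ ^ (p - 1) • gradient H ξ := by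
  by_cases h : ξ = 0
  · simp [h, hH.stress_zero hp, hH.map_zero, Real.zero_rpow (by linarith : p - 1 ≠ 0)]
  have hd : DifferentiableAt ℝ H ξ :=
    (hH.smooth.contDiffAt (isOpen_compl_singleton.mem_nhds h)).differentiableAt (by norm_num)
  refine ext_inner_right ℝ fun ζ => ?_
  have h1 : HasFDerivAt (fun x => H x ^ p / p) _ ξ :=
    (hd.hasFDerivAt.rpow_const (p := p) (Or.inl (hH.pos ξ h).ne')).mul_const p⁻¹
  have h2 := hH.fderiv_V hp ξ ζ
  have h3 : Df (V) ξ = _ := h1.fderiv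
  rw [h3] at h2
  rw [← h2, inner_smul_left, inner_gradient_left]
  have : p ≠ 0 := by linarith
  simp; field_simp

lemma inner_gradient_le (hH : Ip) (h : ξ ≠ 0) (ζ : E) :
    ⟪gradient H ξ, ζ⟫ ≤ H ζ := by
  have hd : DifferentiableAt ℝ H ξ :=
    (hH.smooth.contDiffAt (isOpen_compl_singleton.mem_nhds h)).differentiableAt (by norm_num)
  rw [inner_gradient_left]
  have h4 : HasDerivAt (fun t : ℝ => ξ + t • ζ) ζ 0 := by
    simpa using ((hasDerivAt_id (0:ℝ)).smul_const ζ).const_add ξ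
  have h3 : HasFDerivAt H (Df H ξ) (ξ + (0:ℝ) • ζ) := by simpa using hd.hasFDerivAt
  have h5 := h3.comp_hasDerivAt (0:ℝ) h4
  have h6 := h5.tendsto_slope.mono_left (nhdsWithin_mono 0 (show Ioi (0:ℝ) ⊆ {0}ᶜ from
    fun x hx => (ne_of_gt hx)))
  refine le_of_tendsto h6 ?_
  filter_upwards [self_mem_nhdsWithin] with t ht
  have ht : 0 < t := ht
  simp only [slope_def_field, Function.comp, zero_smul, add_zero, sub_zero]
  rw [div_le_iff₀ ht]
  have := hH.add_le ξ (t • ζ)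
  rw [hH.homog_pos ht.le] at this
  linarith

lemma inner_stress_le (hH : Ip) (hp : 1 < p) (ξ ζ : E) :
    ⟪∇V ξ, ζ⟫ ≤ H ξ ^ (p - 1) * H ζ := by
  rw [hH.stress_eq hp, inner_smul_left]
  by_cases h : ξ = 0
  · simp [h, hH.map_zero, Real.zero_rpow (by linarith : p - 1 ≠ 0)]
  · have := hH.nonneg ξ
    exact mul_le_mul_of_nonneg_left (hH.inner_gradient_le h ζ) (by simp; positivity)

lemma norm_stress_le (hH : Ip) (hp : 1 < p) :
    ∃ K : ℝ, 0 < K ∧ ∀ ξ : E, ‖∇V ξ‖ ≤ K * H ξ ^ (p - 1) := by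
  obtain ⟨c, K, hc, hK, hb⟩ := hH.exists_bounds
  refine ⟨K, hK, fun ξ => ?_⟩
  have hn := hH.nonneg ξ
  by_cases h : ‖∇V ξ‖ = 0
  · rw [h]; positivity
  have h1 := hH.inner_stress_le hp ξ (∇V ξ)
  rw [real_inner_self_eq_norm_sq] at h1
  have h2 := (hb (∇V ξ)).2
  have h3 : 0 < ‖∇V ξ‖ := lt_of_le_of_ne (norm_nonneg _) (Ne.symm h)
  have h4 : ‖∇V ξ‖ ^ 2 ≤ K * H ξ ^ (p - 1) * ‖∇V ξ‖ := by
    calc _ ≤ _ := h1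
      _ ≤ H ξ ^ (p - 1) * (K * ‖∇V ξ‖) := by gcongr
      _ = _ := by ring
  rw [sq] at h4
  exact le_of_mul_le_mul_right h4 h3

lemma contDiffAt_stress (hH : Ip) (h : ξ ≠ 0) :
    ContDiffAt ℝ 1 (∇V) ξ := by
  have h1 : ContDiffAt ℝ 2 (V) ξ :=
    hH.Vsmooth.contDiffAt (isOpen_compl_singleton.mem_nhds h)
  have h2 : ContDiffAt ℝ 1 (Df (V)) ξ := h1.fderiv_right (by norm_num)
  exact (InnerProductSpace.toDual ℝ (E)).symm.contDiff.contDiffAt.comp ξ h2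

lemma continuous_stress (hH : Ip) (hp : 1 < p) : Continuous (∇V) := by
  rw [continuous_iff_continuousAt]
  intro ξ
  by_cases h : ξ = 0
  · subst h
    obtain ⟨K, hK, hb⟩ := hH.norm_stress_le hp
    have h1 : Tendsto (fun x : E => K * H x ^ (p - 1)) (𝓝 0) (𝓝 0) := by
      have : Continuous (fun x : E => K * H x ^ (p - 1)) :=
        continuous_const.mul (hH.continuous.rpow_const fun _ => Or.inr (by linarith))
      simpa [hH.map_zero, Real.zero_rpow (by linarith : p - 1 ≠ 0)] using this.tendsto 0
    rw [ContinuousAt, hH.stress_zero hp]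
    exact squeeze_zero_norm hb h1
  · exact (hH.contDiffAt_stress h).continuousAt

lemma inner_stress_sub_nonneg (hH : Ip) (hp : 1 < p) (ξ η : E) :
    0 ≤ ⟪∇V η - ∇V ξ, η - ξ⟫ := by
  have h1 := hH.V_ge hp ξ η
  have h2 := hH.V_ge hp η ξ
  have e : ξ - η = -(η - ξ) := by abel
  rw [e, inner_neg_right] at h2
  rw [inner_sub_left]
  linarith

end IsIpNorm

namespace IsIpNorm

lemma hasFDerivAt_stress (hH : Ip) (h : ξ ≠ 0) :
    HasFDerivAt (∇V) (Df (∇V) ξ) ξ :=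
  ((hH.contDiffAt_stress h).differentiableAt (by norm_num)).hasFDerivAt

lemma pd_pd_V (hH : Ip) (hp : 1 < p) (h : ξ ≠ 0) (i j : Fin N) :
    hessM (V) ξ i j =
      ⟪Df (∇V) ξ (𝐞 i), 𝐞 j⟫ := by
  have e : pd j (V) = fun y => ⟪∇V y, 𝐞 j⟫ := by
    funext y; exact hH.fderiv_V hp y _
  simp only [hessM, Matrix.of_apply, e]
  unfold pd
  have := (hH.hasFDerivAt_stress h).inner ℝ (hasFDerivAt_const (𝐞 j) ξ)
  rw [this.fderiv]
  simp

lemma qForm_hess_V (hH : Ip) (hp : 1 < p) (h : ξ ≠ 0) (ζ : E) :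
    qForm (hessM (V) ξ) ζ = ⟪Df (∇V) ξ ζ, ζ⟫ := by
  have e : ζ = ∑ i, ζ i • 𝐞 i := by
    ext k; simp [Finset.sum_apply, Pi.single_apply]
  conv_rhs => rw [e]
  simp only [map_sum, sum_inner, inner_sum, map_smul, inner_smul_left, inner_smul_right]
  simp only [qForm, hH.pd_pd_V hp h, conj_trivial]
  rw [Finset.sum_comm]
  refine Finset.sum_congr rfl fun i _ => ?_
  rw [Finset.mul_sum]
  exact Finset.sum_congr rfl fun j _ => by ring

lemma hess_symm (hH : Ip) (hp : 1 < p) (h : ξ ≠ 0) (a b : E) :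
    ⟪Df (∇V) ξ a, b⟫ = ⟪a, Df (∇V) ξ b⟫ := by
  have hc : ContDiffAt ℝ 2 (V) ξ :=
    hH.Vsmooth.contDiffAt (isOpen_compl_singleton.mem_nhds h)
  have hd : DifferentiableAt ℝ (Df (V)) ξ :=
    (hc.fderiv_right (m := 1) (by norm_num)).differentiableAt (by norm_num)
  have key : ∀ a b : E, ⟪Df (∇V) ξ a, b⟫ = Df (Df (V)) ξ a b := by
    intro a b
    have h1 := (hH.hasFDerivAt_stress h).inner ℝ (hasFDerivAt_const b ξ)
    have h2 := hd.hasFDerivAt.clm_apply (hasFDerivAt_const b ξ)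
    simp only [hH.fderiv_V hp] at h2
    have h3 := congrArg (fun L => L a) (h1.unique h2)
    simpa using h3
  rw [key, real_inner_comm, key]
  exact hc.isSymmSndFDerivAt (by simp) a b

lemma hess_smul (hH : Ip) (hp : 1 < p) (h : ξ ≠ 0) (ht : 0 < t) :
    Df (∇V) (t • ξ) = t ^ (p - 2) • Df (∇V) ξ := by
  have h1 : HasFDerivAt (fun x : E => ∇V (t • x))
      ((Df (∇V) (t • ξ)).comp (t • ContinuousLinearMap.id ℝ (E))) ξ :=
    (hH.hasFDerivAt_stress (smul_ne_zero ht.ne' h)).comp ξ ((hasFDerivAt_id ξ).const_smul t)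
  have h2 : HasFDerivAt (fun x : E => ∇V (t • x))
      (t ^ (p - 1) • Df (∇V) ξ) ξ := by
    refine ((hH.hasFDerivAt_stress h).const_smul (t ^ (p - 1))).congr_of_eventuallyEq
      (of_forall fun x => ?_)
    simp [hH.stress_smul hp ht]
  ext1 ζ
  have h3 := congrArg (fun L => L ζ) (h1.unique h2)
  simp only [ContinuousLinearMap.comp_apply, _root_.smul_apply, map_smul,
    ContinuousLinearMap.id_apply] at h3
  have e : t ^ (p - 1) = t * t ^ (p - 2) := by
    rw [mul_comm, ← Real.rpow_add_one ht.ne']; ring_nf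
  rw [e, mul_smul] at h3
  exact smul_right_injective _ ht.ne' h3

lemma hess_self (hH : Ip) (hp : 1 < p) (h : ξ ≠ 0) :
    Df (∇V) ξ ξ = (p - 1) • ∇V ξ := by
  have h3 : HasFDerivAt (∇V) (Df (∇V) ξ) ((1:ℝ) • ξ) := by
    simpa using hH.hasFDerivAt_stress h
  have h4 : HasDerivAt (fun t : ℝ => t • ξ) ξ 1 := by
    simpa using (hasDerivAt_id (1:ℝ)).smul_const ξ
  have h2 := h3.comp_hasDerivAt (1:ℝ) h4
  have h5 : HasDerivAt (fun t : ℝ => ∇V (t • ξ))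
      (((p - 1) * 1 ^ (p - 1 - 1)) • ∇V ξ) 1 := by
    have := (Real.hasDerivAt_rpow_const (x := 1) (p := p - 1) (Or.inl one_ne_zero)).smul_const
      (∇V ξ)
    refine this.congr_of_eventuallyEq ?_
    filter_upwards [lt_mem_nhds (zero_lt_one (α := ℝ))] with t ht
    exact hH.stress_smul hp ht ξ
  simpa using h2.unique h5

lemma hess_lower (hH : Ip) (hp : 1 < p) : ∃ c > 0, ∀ ξ : E, ξ ≠ 0 → ∀ ζ : E,
    c * ‖ξ‖ ^ (p - 2) * ‖ζ‖ ^ 2 ≤ ⟪Df (∇V) ξ ζ, ζ⟫ := by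
  obtain ⟨c, hc, hb⟩ := hH.hessV_pos
  refine ⟨c, hc, fun ξ h ζ => ?_⟩
  have hn : 0 < ‖ξ‖ := norm_pos_iff.2 h
  have h1 : ‖‖ξ‖⁻¹ • ξ‖ = 1 := by simp [norm_smul, hn.ne']
  have h0 : ‖ξ‖⁻¹ • ξ ≠ 0 := smul_ne_zero (by positivity) h
  have h2 := hb _ h1 ζ
  rw [hH.qForm_hess_V hp h0] at h2
  have h3 := hH.hess_smul hp h0 hn
  rw [smul_smul, mul_inv_cancel₀ hn.ne', one_smul] at h3
  rw [h3, _root_.smul_apply, inner_smul_left]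
  simp only [conj_trivial]
  calc c * ‖ξ‖ ^ (p - 2) * ‖ζ‖ ^ 2 = ‖ξ‖ ^ (p - 2) * (c * ‖ζ‖ ^ 2) := by ring
    _ ≤ _ := by gcongr

lemma hess_upper (hH : Ip) (hp : 1 < p) : ∃ K > 0, ∀ ξ : E, ξ ≠ 0 →
    ‖Df (∇V) ξ‖ ≤ K * ‖ξ‖ ^ (p - 2) := by
  have hcont : ContinuousOn (fun ξ => Df (∇V) ξ) (Metric.sphere (0 : E) 1) := by
    intro ξ hξ
    have : ξ ≠ 0 := by rintro rfl; simp at hξ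
    exact ((hH.contDiffAt_stress this).continuousAt_fderiv (by norm_num)).continuousWithinAt
  obtain ⟨K, hK⟩ := (isCompact_sphere (0 : E) 1).exists_bound_of_continuousOn hcont
  refine ⟨max K 1, by positivity, fun ξ h => ?_⟩
  have hn : 0 < ‖ξ‖ := norm_pos_iff.2 h
  have h1 : ‖ξ‖⁻¹ • ξ ∈ Metric.sphere (0 : E) 1 := by simp [norm_smul, hn.ne']
  have h0 : ‖ξ‖⁻¹ • ξ ≠ 0 := smul_ne_zero (by positivity) h
  have h3 := hH.hess_smul hp h0 hn
  rw [smul_smul, mul_inv_cancel₀ hn.ne', one_smul] at h3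
  rw [h3, norm_smul, Real.norm_of_nonneg (by positivity), mul_comm]
  gcongr
  exact (hK _ h1).trans (le_max_left _ _)

lemma rpow_lower_aux {r R : ℝ} (hr : 0 < r) (q : ℝ) :
    ∃ c > 0, ∀ x ∈ Icc r R, c ≤ x ^ q := by
  by_cases hne : (Icc r R).Nonempty
  · obtain ⟨a, ha, hmin⟩ := isCompact_Icc.exists_isMinOn hne
      (show ContinuousOn (fun x : ℝ => x ^ q) (Icc r R) from
        continuousOn_id.rpow_const fun x hx => Or.inl (hr.trans_le hx.1).ne')
    exact ⟨a ^ q, Real.rpow_pos_of_pos (hr.trans_le ha.1) q, fun x hx => hmin hx⟩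
  · exact ⟨1, one_pos, fun x hx => absurd ⟨x, hx⟩ hne⟩

/-- Quantitative strict monotonicity of `∇V` away from the origin. -/
lemma stress_coercive (hH : Ip) (hp : 1 < p) {r R : ℝ} (hr : 0 < r) :
    ∃ c > 0, ∀ ξ η : E, r ≤ ‖ξ‖ → ‖ξ‖ ≤ R → ‖η‖ ≤ R →
      c * ‖η - ξ‖ ^ 2 ≤ ⟪∇V η - ∇V ξ, η - ξ⟫ := by
  obtain ⟨c, hc, hlow⟩ := hH.hess_lower hp
  obtain ⟨c', hc', hlow'⟩ := rpow_lower_aux (r := r / 2) (R := R + r) (by positivity) (p - 2)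
  set τ : ℝ := min 1 (r / (4 * (|R| + 1))) with hτ
  have hRp : 0 < 4 * (|R| + 1) := by positivity
  have hτ0 : 0 < τ := lt_min one_pos (by positivity)
  have hτ1 : τ ≤ 1 := min_le_left _ _
  refine ⟨c * c' * τ, by positivity, fun ξ η h1 h2 h3 => ?_⟩
  set d := η - ξ with hd
  have hdR : ‖d‖ ≤ 2 * (|R| + 1) := by
    have := norm_sub_le η ξ
    have := le_abs_self R
    linarith
  have hτd : τ * ‖d‖ ≤ r / 2 := by
    calc τ * ‖d‖ ≤ (r / (4 * (|R| + 1))) * (2 * (|R| + 1)) := by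
          gcongr; exact min_le_right _ _
      _ = r / 2 := by field_simp; norm_num
  have hseg : ∀ t ∈ Icc 0 τ, r / 2 ≤ ‖ξ + t • d‖ ∧ ‖ξ + t • d‖ ≤ R + r := by
    intro t ht
    have : ‖t • d‖ ≤ r / 2 := by
      rw [norm_smul, Real.norm_of_nonneg ht.1]
      exact (mul_le_mul_of_nonneg_right ht.2 (norm_nonneg _)).trans hτd
    have h5 := norm_add_le ξ (t • d)
    have h6 := norm_sub_le (ξ + t • d) (t • d)
    rw [add_sub_cancel_right] at h6
    constructor <;> linarith
  have hder : ∀ t ∈ Icc 0 τ, HasDerivAt (fun t : ℝ => ⟪∇V (ξ + t • d), d⟫)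
      (⟪Df (∇V) (ξ + t • d) d, d⟫) t := by
    intro t ht
    have hne : ξ + t • d ≠ 0 := by
      intro h0; have := (hseg t ht).1; rw [h0, norm_zero] at this; linarith
    have h4 : HasDerivAt (fun t : ℝ => ξ + t • d) d t := by
      simpa using ((hasDerivAt_id t).smul_const d).const_add ξ
    have := (hH.hasFDerivAt_stress hne).comp_hasDerivAt t h4
    simpa using this.inner ℝ (hasDerivAt_const t d)
  obtain ⟨s, hs, hs'⟩ := exists_hasDerivAt_eq_slope
    (fun t : ℝ => ⟪∇V (ξ + t • d), d⟫)
    (fun t => ⟪Df (∇V) (ξ + t • d) d, d⟫) hτ0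
    (fun t ht => (hder t ht).continuousAt.continuousWithinAt)
    (fun t ht => hder t ⟨ht.1.le, ht.2.le⟩)
  have hs2 : s ∈ Icc 0 τ := ⟨hs.1.le, hs.2.le⟩
  have hne : ξ + s • d ≠ 0 := by
    intro h0; have := (hseg s hs2).1; rw [h0, norm_zero] at this; linarith
  have h6 := hlow _ hne d
  have h7 := hlow' _ ⟨(hseg s hs2).1, (hseg s hs2).2⟩
  rw [hs'] at h6
  simp only [zero_smul, add_zero, sub_zero] at h6
  have h8 : c * c' * ‖d‖ ^ 2 ≤ (⟪∇V (ξ + τ • d), d⟫ - ⟪∇V ξ, d⟫) / τ :=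
    le_trans (by gcongr) h6
  rw [le_div_iff₀ hτ0] at h8
  have h9 : ⟪∇V (ξ + τ • d), d⟫ ≤ ⟪∇V η, d⟫ := by
    rcases hτ1.eq_or_lt with h | h
    · rw [h, one_smul, hd]; simp
    · have := hH.inner_stress_sub_nonneg hp (ξ + τ • d) η
      have e : η - (ξ + τ • d) = (1 - τ) • d := by rw [hd]; module
      rw [e, inner_smul_right, inner_sub_left] at this
      have := (mul_nonneg_iff_of_pos_left (by linarith)).1 this
      linarith
  rw [inner_sub_left]
  linarith [h8, h9]

lemma stress_strictMono (hH : Ip) (hp : 1 < p) {η : E} (h : ξ ≠ η) :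
    0 < ⟪∇V η - ∇V ξ, η - ξ⟫ := by
  wlog h0 : ξ ≠ 0 generalizing ξ η
  · have h0 : ξ = 0 := not_not.1 h0
    have := this h.symm (by rw [← h0]; exact h.symm)
    have e : ⟪∇V η - ∇V ξ, η - ξ⟫ = ⟪∇V ξ - ∇V η, ξ - η⟫ := by
      rw [← neg_sub ξ η, ← neg_sub (∇V ξ), inner_neg_neg]
    rwa [e]
  obtain ⟨c, hc, hb⟩ := hH.stress_coercive hp (r := ‖ξ‖) (R := max ‖ξ‖ ‖η‖) (norm_pos_iff.2 h0)
  refine lt_of_lt_of_le ?_ (hb ξ η le_rfl (le_max_left _ _) (le_max_right _ _))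
  have : 0 < ‖η - ξ‖ := norm_pos_iff.2 (sub_ne_zero.2 h.symm)
  positivity

lemma one_add_rpow_aux (hp : 1 < p) : ∃ K : ℝ, 0 < K ∧ ∀ s : ℝ, |s| ≤ 1 / 2 →
    (1 + s) ^ p ≤ 1 + p * s + K * s ^ 2 := by
  obtain ⟨c, hc⟩ := isCompact_Icc.exists_bound_of_continuousOn
    (show ContinuousOn (fun x : ℝ => (p - 1) * x ^ (p - 1 - 1)) (Icc (1/2) (3/2)) from
      continuousOn_const.mul (continuousOn_id.rpow_const fun x hx =>
        Or.inl (by have := hx.1; simp only [id]; linarith)))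
  have hlip : ∀ x ∈ Icc (1/2 : ℝ) (3/2), |x ^ (p - 1) - 1| ≤ c * |x - 1| := by
    intro x hx
    have := (convex_Icc (1/2 : ℝ) (3/2)).norm_image_sub_le_of_norm_hasDerivWithin_le
      (f := fun x : ℝ => x ^ (p - 1)) (f' := fun x : ℝ => (p - 1) * x ^ (p - 1 - 1)) (C := c)
      (fun y hy => (Real.hasDerivAt_rpow_const
        (Or.inl (by have := hy.1; linarith))).hasDerivWithinAt)
      hc (show (1:ℝ) ∈ Icc (1/2 : ℝ) (3/2) by constructor <;> norm_num) hx
    simpa using this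
  have hc0 : 0 ≤ c := (norm_nonneg _).trans (hc 1 (by constructor <;> norm_num))
  refine ⟨p * c + 1, by positivity, fun s hs => ?_⟩
  rw [abs_le] at hs
  have hx : 1 + s ∈ Icc (1/2 : ℝ) (3/2) := ⟨by linarith, by linarith⟩
  have hpos : 0 < 1 + s := by linarith
  have h1 := hlip _ hx
  rw [add_sub_cancel_left] at h1
  have h2 : 1 + p * ((1 + s)⁻¹ - 1) ≤ ((1 + s)⁻¹) ^ p := by
    have := one_add_mul_self_le_rpow_one_add (s := (1 + s)⁻¹ - 1) (by
      have : 0 < (1 + s)⁻¹ := by positivity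
      linarith) hp.le
    simpa using this
  rw [Real.inv_rpow hpos.le] at h2
  have hP : 0 < (1 + s) ^ p := by positivity
  have e : (1 + s) ^ p = (1 + s) ^ (p - 1) * (1 + s) := by
    rw [← Real.rpow_add_one hpos.ne']; simp
  have h3 : (1 + s) ^ p ≤ 1 + p * s * (1 + s) ^ (p - 1) := by
    have h4 := mul_le_mul_of_nonneg_left h2 hP.le
    rw [mul_inv_cancel₀ hP.ne'] at h4
    have h5 : (1 + s) ^ p * ((1 + s)⁻¹ - 1) = - s * (1 + s) ^ (p - 1) := by
      rw [e]; field_simp; ring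
    nlinarith
  have h6 : s * ((1 + s) ^ (p - 1) - 1) ≤ c * s ^ 2 := by
    calc _ ≤ |s * ((1 + s) ^ (p - 1) - 1)| := le_abs_self _
      _ = |s| * |(1 + s) ^ (p - 1) - 1| := abs_mul _ _
      _ ≤ |s| * (c * |s|) := by gcongr
      _ = c * |s| ^ 2 := by ring
      _ = c * s ^ 2 := by rw [sq_abs]
  nlinarith [sq_nonneg s]

/-- The radial part of an increment of `∇V` is controlled by the monotonicity pairing. -/
lemma stress_radial (hH : Ip) (hp : 1 < p) (L : ℝ) :
    ∃ K : ℝ, 0 < K ∧ ∀ ξ η : E, H ξ ≤ L → H η ≤ L →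
      ⟪∇V η - ∇V ξ, ξ⟫ ^ 2 ≤ K * ⟪∇V η - ∇V ξ, η - ξ⟫ := by
  obtain ⟨K, hK, hb⟩ := one_add_rpow_aux hp
  set L' := max L 1
  have hL' : 0 < L' := lt_of_lt_of_le one_pos (le_max_right _ _)
  set M := 2 * L' ^ p with hM
  have hM0 : 0 < M := by positivity
  set δ := min (1 / (2 * M)) (1 / (2 * K * L' ^ p)) with hδ
  have hLp : 0 < L' ^ p := by positivity
  have hδ0 : 0 < δ := lt_min (by positivity) (by positivity)
  refine ⟨2 / δ, by positivity, fun ξ η h1 h2 => ?_⟩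
  set X := ⟪∇V η - ∇V ξ, ξ⟫ with hX
  have h1' : H ξ ≤ L' := h1.trans (le_max_left _ _)
  have h2' : H η ≤ L' := h2.trans (le_max_left _ _)
  have hbound : ∀ a b : E, H a ≤ L' → H b ≤ L' → |⟪∇V a, b⟫| ≤ L' ^ p := by
    intro a b ha hb
    have e : L' ^ p = L' ^ (p - 1) * L' := by rw [← Real.rpow_add_one hL'.ne']; simp
    have ha0 := hH.nonneg a
    have h3 : H a ^ (p - 1) * H b ≤ L' ^ p := by
      rw [e]
      have := hH.nonneg b
      have := Real.rpow_le_rpow ha0 ha (by linarith : 0 ≤ p - 1)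
      gcongr
    rw [abs_le]
    have h4 := hH.inner_stress_le hp a b
    have h5 := hH.inner_stress_le hp a (-b)
    rw [inner_neg_right, hH.map_neg] at h5
    constructor <;> linarith
  have hXM : |X| ≤ M := by
    rw [hX, inner_sub_left]
    have := abs_sub (⟪∇V η, ξ⟫) (⟪∇V ξ, ξ⟫)
    have := hbound η ξ h2' h1'
    have := hbound ξ ξ h1' h1'
    linarith
  set s := δ * X with hs
  have hs2 : |s| ≤ 1 / 2 := by
    rw [hs, abs_mul, abs_of_pos hδ0]
    calc δ * |X| ≤ 1 / (2 * M) * M := by gcongr; exact min_le_left _ _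
      _ = 1 / 2 := by field_simp
  have h3 := hb s hs2
  have h4 : V ((1 + s) • ξ) = (1 + s) ^ p * V ξ :=
    hH.V_smul (by rw [abs_le] at hs2; linarith) ξ
  have h5 := hH.V_ge hp η ((1 + s) • ξ)
  have h6 := hH.V_ge hp ξ η
  have h7 : p * V ξ = ⟪∇V ξ, ξ⟫ := by
    rw [hH.inner_stress_self hp]; unfold Vfun
    have : p ≠ 0 := by linarith
    field_simp
  have h8 : V ξ ≤ L' ^ p := by
    have := hbound ξ ξ h1' h1'
    rw [← h7] at this
    have h9 := hH.V_nonneg hp ξ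
    have := le_of_abs_le this
    nlinarith
  have h9 := hH.V_nonneg hp ξ
  have h10 : (1 + s) ^ p * V ξ ≤ V ξ + s * ⟪∇V ξ, ξ⟫ + K * s ^ 2 * L' ^ p := by
    calc _ ≤ (1 + p * s + K * s ^ 2) * V ξ := by gcongr
      _ = V ξ + s * (p * V ξ) + K * s ^ 2 * V ξ := by ring
      _ ≤ _ := by rw [h7]; gcongr
  have e1 : ⟪∇V η, (1 + s) • ξ - η⟫ = ⟪∇V η, ξ - η⟫ + s * ⟪∇V η, ξ⟫ := by
    rw [← inner_smul_right, ← inner_add_right]; congr 1; module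
  have e2 : ⟪∇V η - ∇V ξ, η - ξ⟫
      = -⟪∇V η, ξ - η⟫ - ⟪∇V ξ, η - ξ⟫ := by
    rw [inner_sub_left, ← inner_neg_right, neg_sub]
  have e3 : s * X = s * ⟪∇V η, ξ⟫ - s * ⟪∇V ξ, ξ⟫ := by
    rw [hX, inner_sub_left]; ring
  have h11 : s * X ≤ ⟪∇V η - ∇V ξ, η - ξ⟫ + K * s ^ 2 * L' ^ p := by
    rw [e2, e3]; rw [h4, e1] at h5; linarith
  have h12 : K * s ^ 2 * L' ^ p ≤ δ * X ^ 2 / 2 := by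
    have : δ ≤ 1 / (2 * K * L' ^ p) := min_le_right _ _
    rw [le_div_iff₀ (by positivity)] at this
    rw [hs]
    calc K * (δ * X) ^ 2 * L' ^ p = δ * X ^ 2 / 2 * (δ * (2 * K * L' ^ p)) := by ring
      _ ≤ δ * X ^ 2 / 2 * 1 := by gcongr
      _ = _ := by ring
  have h13 : δ * X ^ 2 / 2 ≤ ⟪∇V η - ∇V ξ, η - ξ⟫ := by
    have : s * X = δ * X ^ 2 := by rw [hs]; ring
    linarith
  rw [div_mul_eq_mul_div, le_div_iff₀ hδ0]
  linarith

end IsIpNorm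

section

open scoped Convolution
open ContinuousLinearMap (lsmul)

section Mollifier

lemma tendsto_eLpNorm_translate {g : E → F} (hr : 1 ≤ r) (hr' : r ≠ ∞) (hg : MemLp g r) :
    Tendsto (fun z : E => eLpNorm (fun x => g (x - z) - g x) r) (𝓝 0) (𝓝 0) := by
  haveI : Fact (1 ≤ r) := ⟨hr⟩
  let h : E → C(E, E) := fun z => ⟨fun x => x - z, by fun_prop⟩
  have hcont : Continuous h :=
    ContinuousMap.continuous_of_continuous_uncurry _ (by
      change Continuous fun q : E × E => q.2 - q.1
      fun_prop)
  have hmp : ∀ z, MeasurePreserving (h z) volume volume := fun z =>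
    measurePreserving_sub_right volume z
  have h1 : Continuous fun z => Lp.compMeasurePreserving (h z) (hmp z) (hg.toLp g) :=
    Continuous.compMeasurePreservingLp continuous_const hcont hmp hr'
  have h2 := (tendsto_iff_edist_tendsto_0.1 (h1.tendsto 0))
  refine h2.congr fun z => ?_
  rw [Lp.toLp_compMeasurePreserving, Lp.toLp_compMeasurePreserving, Lp.edist_toLp_toLp]
  refine eLpNorm_congr_ae (of_forall fun x => ?_)
  simp [h]

lemma eLpNorm_integral_le_of_forall {Z : Type*} [MeasurableSpace Z] {μ : Measure Z}
    [IsProbabilityMeasure μ] {G : Z → E → F} (hG : StronglyMeasurable (Function.uncurry G))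
    (hr : 1 ≤ r) (hr' : r ≠ ∞) {c : ℝ≥0∞} (hc : ∀ᵐ z ∂μ, eLpNorm (G z) r ≤ c) :
    eLpNorm (fun x => ∫ z, G z x ∂μ) r ≤ c := by
  have hr0 : r ≠ 0 := (one_pos.trans_le hr).ne'
  have hrt : 0 < r.toReal := ENNReal.toReal_pos hr0 hr'
  have key : ∀ x, ‖∫ z, G z x ∂μ‖ₑ ^ r.toReal ≤ ∫⁻ z, ‖G z x‖ₑ ^ r.toReal ∂μ := by
    intro x
    have hGx : StronglyMeasurable fun z => G z x :=
      hG.comp_measurable (measurable_id.prodMk measurable_const)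
    have h1 : ‖∫ z, G z x ∂μ‖ₑ ≤ eLpNorm (fun z => G z x) 1 μ := by
      rw [eLpNorm_one_eq_lintegral_enorm]
      exact enorm_integral_le_lintegral_enorm _
    have h2 := h1.trans (eLpNorm_le_eLpNorm_of_exponent_le hr hGx.aestronglyMeasurable)
    rw [eLpNorm_eq_lintegral_rpow_enorm_toReal hr0 hr'] at h2
    calc _ ≤ _ := ENNReal.rpow_le_rpow h2 hrt.le
      _ = _ := by rw [← ENNReal.rpow_mul, one_div, inv_mul_cancel₀ hrt.ne', ENNReal.rpow_one]
  rw [eLpNorm_eq_lintegral_rpow_enorm_toReal hr0 hr']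
  have h3 : ∫⁻ x, ‖∫ z, G z x ∂μ‖ₑ ^ r.toReal ≤ c ^ r.toReal := by
    calc _ ≤ ∫⁻ x, ∫⁻ z, ‖G z x‖ₑ ^ r.toReal ∂μ := lintegral_mono key
      _ = ∫⁻ z, ∫⁻ x, ‖G z x‖ₑ ^ r.toReal ∂volume ∂μ := by
        refine lintegral_lintegral_swap (Measurable.aemeasurable ?_)
        exact ((hG.comp_measurable measurable_swap).enorm).pow_const _
      _ ≤ ∫⁻ z, c ^ r.toReal ∂μ := by
        refine lintegral_mono_ae ?_
        filter_upwards [hc] with z this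
        rw [eLpNorm_eq_lintegral_rpow_enorm_toReal hr0 hr'] at this
        calc _ = ((∫⁻ x, ‖G z x‖ₑ ^ r.toReal) ^ (1 / r.toReal)) ^ r.toReal := by
              rw [← ENNReal.rpow_mul, one_div, inv_mul_cancel₀ hrt.ne', ENNReal.rpow_one]
          _ ≤ _ := ENNReal.rpow_le_rpow this hrt.le
      _ = c ^ r.toReal := by simp
  calc _ ≤ (c ^ r.toReal) ^ (1 / r.toReal) := ENNReal.rpow_le_rpow h3 (by positivity)
    _ = c := by rw [← ENNReal.rpow_mul, one_div, mul_inv_cancel₀ hrt.ne', ENNReal.rpow_one]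

lemma eLpNorm_integral_normed_smul_le (b : ContDiffBump (0 : E)) {G : E → E → F}
    (hG : StronglyMeasurable (Function.uncurry G)) (hr : 1 ≤ r) (hr' : r ≠ ∞) {c : ℝ≥0∞}
    (hc : ∀ z ∈ Metric.ball (0 : E) b.rOut, eLpNorm (G z) r ≤ c) :
    eLpNorm (fun x => ∫ z, b.normed volume z • G z x) r ≤ c := by
  set ρ : E → ℝ≥0 := fun z => (b.normed volume z).toNNReal with hρ
  have hρm : Measurable ρ := (b.continuous_normed (μ := volume)).measurable.real_toNNReal
  set μ : Measure (E) := volume.withDensity fun z => (ρ z : ℝ≥0∞) with hμ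
  haveI : IsProbabilityMeasure μ := ⟨by
    rw [hμ, withDensity_apply _ MeasurableSet.univ, Measure.restrict_univ]
    change ∫⁻ z, ENNReal.ofReal (b.normed volume z) = 1
    rw [← ofReal_integral_eq_lintegral_ofReal b.integrable_normed
        (of_forall fun z => b.nonneg_normed z), b.integral_normed, ENNReal.ofReal_one]⟩
  have e : (fun x => ∫ z, b.normed volume z • G z x) = fun x => ∫ z, G z x ∂μ := by
    funext x
    rw [hμ, integral_withDensity_eq_integral_smul hρm]
    refine integral_congr_ae (of_forall fun z => ?_)
    simp only [hρ, NNReal.smul_def, Real.coe_toNNReal _ (b.nonneg_normed z)]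
  rw [e]
  refine eLpNorm_integral_le_of_forall hG hr hr' ?_
  rw [hμ, ae_withDensity_iff hρm.coe_nnreal_ennreal]
  refine of_forall fun z hz => hc z ?_
  rw [← b.support_normed_eq (μ := volume)]
  intro h0
  exact hz (by simp [hρ, h0])

/-- A fixed sequence of bumps concentrating at the origin. -/
def bumpSeq (N n : ℕ) : ContDiffBump (0 : E) where
  rIn := 1 / (2 * ((n : ℝ) + 1))
  rOut := 1 / ((n : ℝ) + 1)
  rIn_pos := by positivity
  rIn_lt_rOut := by
    apply one_div_lt_one_div_of_lt <;> linarith [n.cast_nonneg (α := ℝ)]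

lemma tendsto_bumpSeq_rOut : Tendsto (fun n => (bumpSeq N n).rOut) atTop (𝓝 0) :=
  tendsto_one_div_add_atTop_nhds_zero_nat

/-- The mollification of `f` at scale `n`. -/
def mollify (n : ℕ) (f : E → F) : E → F :=
  (bumpSeq N n).normed volume ⋆[lsmul ℝ ℝ, volume] f

lemma mollify_apply (n : ℕ) (f : E → F) (x : E) :
    mollify n f x = ∫ z, (bumpSeq N n).normed volume z • f (x - z) := rfl

lemma contDiff_mollify (n : ℕ) (hf : LocallyIntegrable f) {k : ℕ∞} :
    ContDiff ℝ k (mollify n f) :=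
  (bumpSeq N n).hasCompactSupport_normed.contDiff_convolution_left _
    (bumpSeq N n).contDiff_normed hf

lemma integrable_normed_smul_comp (n : ℕ) (hf : LocallyIntegrable f) (x : E)
    : Integrable fun z => (bumpSeq N n).normed volume z • f (x - z) :=
  ((bumpSeq N n).hasCompactSupport_normed.convolutionExists_left (lsmul ℝ ℝ)
    (bumpSeq N n).continuous_normed hf x)

lemma mollify_eq_zero {n : ℕ} (h : ∀ y ∈ Metric.ball x (bumpSeq N n).rOut, f y = 0)
    : mollify n f x = 0 := by
  rw [mollify_apply]
  refine integral_eq_zero_of_ae (of_forall fun z => ?_)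
  by_cases hz : z ∈ Metric.ball (0 : E) (bumpSeq N n).rOut
  · have : f (x - z) = 0 := h _ (by simpa [dist_eq_norm] using hz)
    simp [this]
  · rw [← (bumpSeq N n).support_normed_eq (μ := volume), Function.notMem_support] at hz
    simp [hz]

lemma norm_mollify_le (n : ℕ) (hB : ∀ x, ‖f x‖ ≤ B) (x : E) :
    ‖mollify n f x‖ ≤ B := by
  rw [mollify_apply]
  calc _ ≤ ∫ z, (bumpSeq N n).normed volume z * B := by
        refine norm_integral_le_of_norm_le ((bumpSeq N n).integrable_normed.mul_const B)
          (of_forall fun z => ?_)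
        rw [norm_smul, Real.norm_of_nonneg ((bumpSeq N n).nonneg_normed z)]
        exact mul_le_mul_of_nonneg_left (hB _) ((bumpSeq N n).nonneg_normed z)
    _ = B := by rw [integral_mul_const, (bumpSeq N n).integral_normed, one_mul]

lemma eLpNorm_mollify_le (n : ℕ) (hf : StronglyMeasurable f) (hr : 1 ≤ r) (hr' : r ≠ ∞)
    : eLpNorm (mollify n f) r ≤ eLpNorm f r := by
  refine eLpNorm_integral_normed_smul_le (bumpSeq N n) (G := fun z x => f (x - z))
    (hf.comp_measurable (measurable_snd.sub measurable_fst)) hr hr' fun z _ => le_of_eq ?_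
  exact eLpNorm_comp_measurePreserving hf.aestronglyMeasurable
    (measurePreserving_sub_right volume z)

lemma tendsto_eLpNorm_mollify_sub [CompleteSpace F] (hf : StronglyMeasurable f) (hr : 1 ≤ r)
    (hr' : r ≠ ∞) (hfr : MemLp f r) :
    Tendsto (fun n => eLpNorm (fun x => mollify n f x - f x) r) atTop (𝓝 0) := by
  have hli : LocallyIntegrable f := hfr.locallyIntegrable hr
  rw [ENNReal.tendsto_nhds_zero]
  intro ε hε
  have h1 := (ENNReal.tendsto_nhds_zero.1 (tendsto_eLpNorm_translate hr hr' hfr)) ε hε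
  obtain ⟨δ, hδ, hball⟩ := Metric.eventually_nhds_iff_ball.1 h1
  filter_upwards [(tendsto_order.1 (tendsto_bumpSeq_rOut (N := N))).2 δ hδ] with n hn
  have e : (fun x => mollify n f x - f x)
      = fun x => ∫ z, (bumpSeq N n).normed volume z • (f (x - z) - f x) := by
    funext x
    have : ∫ z, (bumpSeq N n).normed volume z • f x = f x := by
      rw [integral_smul_const, (bumpSeq N n).integral_normed, one_smul]
    simp_rw [smul_sub]
    rw [integral_sub (integrable_normed_smul_comp n hli x)
      ((bumpSeq N n).integrable_normed.smul_const _), this, mollify_apply]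
  rw [e]
  refine eLpNorm_integral_normed_smul_le (bumpSeq N n) (G := fun z x => f (x - z) - f x)
    ((hf.comp_measurable (measurable_snd.sub measurable_fst)).sub
      (hf.comp_measurable measurable_snd)) hr hr' fun z hz => hball z ?_
  exact Metric.ball_subset_ball hn.le hz

lemma tendsto_mollify [CompleteSpace F] (hf : Continuous f) (x : E) :
    Tendsto (fun n => mollify n f x) atTop (𝓝 (f x)) :=
  ContDiffBump.convolution_tendsto_right_of_continuous
    (φ := fun n => bumpSeq N n) tendsto_bumpSeq_rOut hf x

lemma ae_tendsto_mollify [CompleteSpace F] (hf : LocallyIntegrable f) :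
    ∀ᵐ x, Tendsto (fun n => mollify n f x) atTop (𝓝 (f x)) := by
  refine ContDiffBump.ae_convolution_tendsto_right_of_locallyIntegrable
    (φ := fun n => bumpSeq N n) (K := 2) tendsto_bumpSeq_rOut
    (of_forall fun n => le_of_eq ?_) hf
  simp only [bumpSeq]; field_simp

lemma fderiv_mollify (n : ℕ) {f : E → ℝ} (hf : Differentiable ℝ f)
    (hf' : LocallyIntegrable (Df f)) (x : E) :
    Df (mollify n f) x = mollify n (Df f) x := by
  set ρ := (bumpSeq N n).normed (volume : Measure (E)) with hρ
  have hρd : ContDiff ℝ 1 ρ := (bumpSeq N n).contDiff_normed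
  have hρc : HasCompactSupport ρ := (bumpSeq N n).hasCompactSupport_normed
  have hli : LocallyIntegrable f := hf.continuous.locallyIntegrable
  ext v
  rw [show Df (mollify n f) x = _ from
    (hρc.hasFDerivAt_convolution_left (lsmul ℝ ℝ) hρd hli x).fderiv]
  have hd : Differentiable ℝ ρ := hρd.differentiable one_ne_zero
  have hcf : HasCompactSupport (Df ρ) := hρc.fderiv ℝ
  have hdc : Continuous (Df ρ) := hρd.continuous_fderiv one_ne_zero
  have h1 : ((Df ρ ⋆[(lsmul ℝ ℝ).precompL (E), volume] f) x) v
      = ∫ z, Df ρ z v * f (x - z) := by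
    have hi : Integrable fun z => (lsmul ℝ ℝ).precompL (E) (Df ρ z) (f (x - z)) :=
      hcf.convolutionExists_left _ hdc hli x
    rw [convolution_def, ContinuousLinearMap.integral_apply hi]
    rfl
  have hint2 : Integrable fun z => ρ z • Df f (x - z) := integrable_normed_smul_comp n hf' x
  have h2 : mollify n (Df f) x v = ∫ z, ρ z * Df f (x - z) v := by
    rw [mollify_apply, ContinuousLinearMap.integral_apply hint2]
    rfl
  rw [h1, h2]
  have hfd : ∀ z, HasFDerivAt (fun z => f (x - z)) (-(Df f (x - z))) z := by
    intro z
    have := (hf (x - z)).hasFDerivAt.comp z ((hasFDerivAt_id z).const_sub x)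
    convert! this using 1
    ext w; simp
  have hfx : ∀ z, Df (fun z => f (x - z)) z v = - (Df f (x - z) v) := by
    intro z; rw [(hfd z).fderiv]; rfl
  have := integral_mul_fderiv_eq_neg_fderiv_mul_of_integrable (μ := (volume : Measure (E)))
    (f := ρ) (g := fun z => f (x - z)) (v := v)
    (Continuous.integrable_of_hasCompactSupport ((hdc.clm_apply continuous_const).mul
      (hf.continuous.comp (continuous_const.sub continuous_id)))
      (HasCompactSupport.mul_right (hcf.comp_left (g := fun L : E →L[ℝ] ℝ => L v) rfl)))
    (by
      simp_rw [hfx]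
      have := (hint2.apply_continuousLinearMap v).neg
      refine this.congr (of_forall fun z => ?_)
      simp)
    ((hρd.continuous.mul (hf.continuous.comp (by fun_prop))).integrable_of_hasCompactSupport
      hρc.mul_right)
    (fun z _ => hd z) (fun z _ => (hfd z).differentiableAt)
  simp_rw [hfx, mul_neg, integral_neg] at this
  linarith

end Mollifier

end

section

section Lp

variable {G : Type*} [NormedAddCommGroup G] [NormedSpace ℝ G]

lemma tendsto_eLpNorm_zero_of_dominated (hr : 1 ≤ r) (hr' : r ≠ ∞) {h : ℕ → E → F}
    (hm : ∀ n, AEStronglyMeasurable (h n)) (hb : ∀ n, ∀ᵐ x, ‖h n x‖ ≤ g x) (hg : MemLp g r)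
    (hl : ∀ᵐ x, Tendsto (fun n => h n x) atTop (𝓝 0)) :
    Tendsto (fun n => eLpNorm (h n) r) atTop (𝓝 0) := by
  have hr0 : r ≠ 0 := (one_pos.trans_le hr).ne'
  have hrt : 0 < r.toReal := ENNReal.toReal_pos hr0 hr'
  have h1 : Tendsto (fun n => ∫⁻ x, ‖h n x‖ₑ ^ r.toReal) atTop (𝓝 (∫⁻ _ : E, 0)) := by
    refine tendsto_lintegral_of_dominated_convergence' (fun x => ‖g x‖ₑ ^ r.toReal)
      (fun n => (hm n).enorm.pow_const _) (fun n => ?_) ?_ ?_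
    · filter_upwards [hb n] with x hx
      refine ENNReal.rpow_le_rpow ?_ hrt.le
      exact enorm_le_iff_norm_le.2 (hx.trans (le_abs_self _))
    · exact (lintegral_rpow_enorm_lt_top_of_eLpNorm_lt_top hr0 hr' hg.2).ne
    · filter_upwards [hl] with x hx
      have : Tendsto (fun n => ‖h n x‖ₑ ^ r.toReal) atTop (𝓝 (‖(0:F)‖ₑ ^ r.toReal)) :=
        (ENNReal.continuous_rpow_const.tendsto _).comp ((continuous_enorm.tendsto _).comp hx)
      simpa [ENNReal.zero_rpow_of_pos hrt] using this
  rw [lintegral_zero] at h1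
  have h2 := (ENNReal.continuous_rpow_const (y := 1 / r.toReal)).tendsto 0 |>.comp h1
  rw [ENNReal.zero_rpow_of_pos (by positivity)] at h2
  refine h2.congr fun n => ?_
  rw [eLpNorm_eq_lintegral_rpow_enorm_toReal hr0 hr']; rfl

lemma memLp_of_bound_of_eq_zero (hK : IsCompact K) (hf : AEStronglyMeasurable f)
    (hB : ∀ᵐ x, ‖f x‖ ≤ B) (h0 : ∀ᵐ x, x ∉ K → f x = 0) (r : ℝ≥0∞) : MemLp f r := by
  have h1 : MemLp (K.indicator fun _ => B) r :=
    memLp_indicator_const r hK.measurableSet B (Or.inr hK.measure_lt_top.ne)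
  refine h1.of_le hf ?_
  filter_upwards [hB, h0] with x hx hx0
  by_cases hxK : x ∈ K
  · rw [indicator_of_mem hxK]; exact hx.trans (le_abs_self _)
  · rw [hx0 hxK]; simp

lemma aestronglyMeasurable_clm_apply {Φ : E → F →L[ℝ] G} {X : E → F}
    (hΦ : AEStronglyMeasurable Φ) (hX : AEStronglyMeasurable X) :
    AEStronglyMeasurable fun x => Φ x (X x) :=
  (isBoundedBilinearMap_apply : IsBoundedBilinearMap ℝ
    fun z : (F →L[ℝ] G) × F => z.1 z.2).continuous.comp_aestronglyMeasurable
    (hΦ.prodMk hX)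

lemma eLpNorm_clm_apply_le {s : ℝ≥0∞} [r.HolderConjugate s] {Φ : E → F →L[ℝ] G}
    {X : E → F} (hΦ : AEStronglyMeasurable Φ) (hX : AEStronglyMeasurable X) :
    eLpNorm (fun x => Φ x (X x)) 1 ≤ eLpNorm Φ r * eLpNorm X s := by
  have := eLpNorm_le_eLpNorm_mul_eLpNorm_of_nnnorm (p := r) (q := s) (r := 1) hΦ hX
    (fun (L : F →L[ℝ] G) v => L v) 1 (of_forall fun x => by
      rw [one_mul]; exact (Φ x).le_opNNNorm _)
  simpa using this

lemma integrable_clm_apply {s : ℝ≥0∞} [r.HolderConjugate s] {Φ : E → F →L[ℝ] G}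
    {X : E → F} (hΦ : MemLp Φ r) (hX : MemLp X s) : Integrable fun x => Φ x (X x) := by
  rw [← memLp_one_iff_integrable]
  exact ⟨aestronglyMeasurable_clm_apply hΦ.1 hX.1,
    (eLpNorm_clm_apply_le (r := r) (s := s) hΦ.1 hX.1).trans_lt
      (ENNReal.mul_lt_top hΦ.2 hX.2)⟩

lemma tendsto_integral_clm_apply {ι : Type*} {l : Filter ι} {s : ℝ≥0∞} [r.HolderConjugate s]
    {Φn : ι → E → F →L[ℝ] G} {Φ : E → F →L[ℝ] G} {X : E → F}
    (hΦn : ∀ᶠ n in l, MemLp (Φn n) r) (hΦ : MemLp Φ r) (hX : MemLp X s)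
    (h : Tendsto (fun n => eLpNorm (fun x => Φn n x - Φ x) r) l (𝓝 0)) :
    Tendsto (fun n => ∫ x, Φn n x (X x)) l (𝓝 (∫ x, Φ x (X x))) := by
  refine tendsto_integral_of_L1 _ (integrable_clm_apply hΦ hX).aestronglyMeasurable
    (hΦn.mono fun n hn => integrable_clm_apply hn hX) ?_
  have h1 : Tendsto (fun n => eLpNorm (fun x => Φn n x - Φ x) r * eLpNorm X s) l (𝓝 0) := by
    simpa using ENNReal.Tendsto.mul_const h (Or.inr hX.2.ne)
  refine tendsto_of_tendsto_of_tendsto_of_le_of_le' tendsto_const_nhds h1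
    (of_forall fun _ => zero_le') (hΦn.mono fun n hn => ?_)
  rw [← eLpNorm_one_eq_lintegral_enorm]
  have := eLpNorm_clm_apply_le (r := r) (s := s) (hn.1.sub hΦ.1) hX.1
  exact this

lemma eLpNorm_comp_add_right (hf : AEStronglyMeasurable f) (h : E) (r : ℝ≥0∞)
    : eLpNorm (fun x => f (x + h)) r = eLpNorm f r :=
  eLpNorm_comp_measurePreserving hf (measurePreserving_add_right volume h)

lemma MemLp.comp_add_right (hf : MemLp f r) (h : E) :
    MemLp (fun x => f (x + h)) r :=
  hf.comp_measurePreserving (measurePreserving_add_right volume h)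

end Lp

section Weak

/-- `div X = -c` weakly in `Ω`, with compactly supported `C¹` test functions. -/
def WeakDiv (Ω : Set E) (X : E → E) (c : ℝ) : Prop :=
  ∀ φ : E → ℝ, ContDiff ℝ 1 φ → HasCompactSupport φ → tsupport φ ⊆ Ω →
    ∫ x, Df φ x (X x) = c * ∫ x, φ x

lemma fderiv_eq_zero_of_notMem (hK : IsClosed K) (h0 : ∀ x, x ∉ K → f x = 0) (hx : x ∉ K)
    : Df f x = 0 := by
  have : f =ᶠ[𝓝 x] fun _ => 0 := by
    filter_upwards [hK.isOpen_compl.mem_nhds hx] with y hy using h0 y hy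
  rw [this.fderiv_eq]; simp

lemma tsupport_subset_of_eq_zero {F : Type*} [Zero F] (hK : IsClosed K) {f : E → F}
    (h0 : ∀ x, x ∉ K → f x = 0) : tsupport f ⊆ K :=
  closure_minimal (fun x hx => by by_contra h; exact hx (h0 x h)) hK

lemma mollify_eq_zero_of_notMem_cthickening (h0 : ∀ x, x ∉ K → f x = 0) {δ : ℝ} {n : ℕ}
    (hn : (bumpSeq N n).rOut ≤ δ) (hx : x ∉ Metric.cthickening δ K) :
    mollify n f x = 0 := by
  refine mollify_eq_zero fun y hy => h0 y fun hyK => hx ?_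
  refine Metric.mem_cthickening_of_dist_le x y δ K hyK ?_
  rw [dist_comm]; exact (Metric.mem_ball.1 hy).le.trans hn

lemma WeakDiv.of_differentiable (hΩ : IsOpen Ω) {X : E → E} (hX : WeakDiv Ω X c)
    {s : ℝ≥0∞} [r.HolderConjugate s] (hr' : r ≠ ∞) (hXs : MemLp X s) (hK : IsCompact K)
    (hKΩ : K ⊆ Ω) (hφ : Differentiable ℝ φ) (h0 : ∀ x, x ∉ K → φ x = 0) (hφr : MemLp (Df φ) r)
    :
    ∫ x, Df φ x (X x) = c * ∫ x, φ x := by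
  have hr : 1 ≤ r := ENNReal.HolderConjugate.one_le r s
  obtain ⟨δ, hδ, hδΩ⟩ := hK.exists_cthickening_subset_open hΩ hKΩ
  have hli : LocallyIntegrable (Df φ) := hφr.locallyIntegrable hr
  have hm : StronglyMeasurable (Df φ) := (measurable_fderiv ℝ φ).stronglyMeasurable
  have e : ∀ n, Df (mollify n φ) = mollify n (Df φ) := fun n =>
    funext fun x => fderiv_mollify n hφ hli x
  have hcs : HasCompactSupport φ := HasCompactSupport.intro hK h0
  have hφi : Integrable φ := hφ.continuous.integrable_of_hasCompactSupport hcs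
  have hK' : IsCompact (Metric.cthickening δ K) := hK.cthickening
  have hcd : ∀ n, ContDiff ℝ 1 (mollify n φ) := fun n =>
    contDiff_mollify n hφ.continuous.locallyIntegrable (k := 1)
  have ht1 : Tendsto (fun n => ∫ x, Df (mollify n φ) x (X x)) atTop
      (𝓝 (∫ x, Df φ x (X x))) := by
    refine tendsto_integral_clm_apply (r := r) (s := s) (of_forall fun n => ?_) hφr hXs ?_
    · refine ⟨((hcd n).continuous_fderiv one_ne_zero).aestronglyMeasurable, ?_⟩
      rw [e n]
      exact (eLpNorm_mollify_le n hm hr hr').trans_lt hφr.2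
    · simp_rw [e]; exact tendsto_eLpNorm_mollify_sub hm hr hr' hφr
  have ht2 : Tendsto (fun n => ∫ x, mollify n φ x) atTop (𝓝 (∫ x, φ x)) := by
    refine tendsto_integral_of_L1 _ hφi.aestronglyMeasurable ?_ ?_
    · filter_upwards [(tendsto_order.1 (tendsto_bumpSeq_rOut (N := N))).2 δ hδ] with n hn
      exact (hcd n).continuous.integrable_of_hasCompactSupport (HasCompactSupport.intro hK'
        fun x hx => mollify_eq_zero_of_notMem_cthickening h0 hn.le hx)
    · have := tendsto_eLpNorm_mollify_sub (r := 1) hφ.continuous.stronglyMeasurable le_rfl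
        (by simp) (memLp_one_iff_integrable.2 hφi)
      simpa only [eLpNorm_one_eq_lintegral_enorm] using this
  refine tendsto_nhds_unique ht1 ((ht2.const_mul c).congr' ?_)
  filter_upwards [(tendsto_order.1 (tendsto_bumpSeq_rOut (N := N))).2 δ hδ] with n hn
  have hz : ∀ x, x ∉ Metric.cthickening δ K → mollify n φ x = 0 :=
    fun x hx => mollify_eq_zero_of_notMem_cthickening h0 hn.le hx
  exact (hX _ (hcd n) (HasCompactSupport.intro hK' hz)
    ((tsupport_subset_of_eq_zero hK'.isClosed hz).trans hδΩ)).symm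

end Weak

end

section

/-- `φ` is the limit of a bounded sequence of `C¹` functions supported in the compact set `K`,
whose derivatives converge in `L²` to `Φ`. -/
def Sob (K : Set E) (φ : E → F) (Φ : E → E →L[ℝ] F) : Prop :=
  IsCompact K ∧ MemLp Φ 2 ∧ ∃ (B : ℝ) (f : ℕ → E → F), (∀ n, ContDiff ℝ 1 (f n)) ∧
    (∀ n x, x ∉ K → f n x = 0) ∧ (∀ n x, ‖f n x‖ ≤ B) ∧
    (∀ᵐ x, Tendsto (fun n => f n x) atTop (𝓝 (φ x))) ∧
    Tendsto (fun n => eLpNorm (fun x => Df (f n) x - Φ x) 2) atTop (𝓝 0)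

lemma tendsto_eLpNorm_zero_of_add {Z F : Type*} [MeasurableSpace Z] {μ : Measure Z}
    [NormedAddCommGroup F] {ι : Type*} {l : Filter ι} {f g k : ι → Z → F}
    (hf : Tendsto (fun n => eLpNorm (f n) 2 μ) l (𝓝 0))
    (hg : Tendsto (fun n => eLpNorm (g n) 2 μ) l (𝓝 0))
    (hfm : ∀ n, AEStronglyMeasurable (f n) μ) (hgm : ∀ n, AEStronglyMeasurable (g n) μ)
    (h : ∀ n x, k n x = f n x + g n x) : Tendsto (fun n => eLpNorm (k n) 2 μ) l (𝓝 0) := by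
  have ht := hf.add hg
  rw [add_zero] at ht
  refine tendsto_of_tendsto_of_tendsto_of_le_of_le tendsto_const_nhds ht (fun _ => zero_le')
    fun n => ?_
  rw [show k n = f n + g n from funext (h n)]
  exact eLpNorm_add_le (hfm n) (hgm n) (by norm_num)

lemma eLpNorm_two_sub_self {Z F : Type*} [MeasurableSpace Z] {μ : Measure Z}
    [NormedAddCommGroup F] (f : Z → F) : eLpNorm (fun x => f x - f x) 2 μ = 0 := by
  simp

lemma contDiff_memLp_fderiv (hK : IsCompact K) (hf : ContDiff ℝ 1 f) (h0 : ∀ x, x ∉ K → f x = 0)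
    (r : ℝ≥0∞) : MemLp (Df f) r :=
  (hf.continuous_fderiv one_ne_zero).memLp_of_hasCompactSupport
    (HasCompactSupport.intro hK fun x hx => fderiv_eq_zero_of_notMem hK.isClosed h0 hx)

namespace Sob

variable {G : Type*} [NormedAddCommGroup G] [NormedSpace ℝ G] {φ : Euc N → F} {Φ : Euc N → Euc N →L[ℝ] F}

lemma congr {ψ : E → F} {Ψ : E → E →L[ℝ] F} (h : Sob K φ Φ) (h1 : φ =ᵐ[volume] ψ)
    (h2 : Φ =ᵐ[volume] Ψ) : Sob K ψ Ψ := by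
  obtain ⟨hK, hm, B, f, a, b, c, d, e⟩ := h
  refine ⟨hK, hm.ae_eq h2, B, f, a, b, c, ?_, e.congr fun n => eLpNorm_congr_ae ?_⟩
  · filter_upwards [d, h1] with x hx hx1; rwa [← hx1]
  · filter_upwards [h2] with x hx; rw [hx]

lemma mono {K' : Set E} (h : Sob K φ Φ) (hK' : IsCompact K') (hKK : K ⊆ K') :
    Sob K' φ Φ := by
  obtain ⟨_, hm, B, f, a, b, c⟩ := h
  exact ⟨hK', hm, B, f, a, fun n x hx => b n x fun h => hx (hKK h), c⟩

lemma isCompact (h : Sob K φ Φ) : IsCompact K := h.1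

lemma memLp_fderiv (h : Sob K φ Φ) : MemLp Φ 2 := h.2.1

lemma aestronglyMeasurable (h : Sob K φ Φ) : AEStronglyMeasurable φ := by
  obtain ⟨hK, hm, B, f, a, b, c, d, e⟩ := h
  exact aestronglyMeasurable_of_tendsto_ae atTop (fun n => (a n).continuous.aestronglyMeasurable) d

lemma exists_bound (h : Sob K φ Φ) : ∃ B : ℝ, ∀ᵐ x, ‖φ x‖ ≤ B := by
  obtain ⟨hK, hm, B, f, a, b, c, d, e⟩ := h
  refine ⟨B, ?_⟩
  filter_upwards [d] with x hx
  exact le_of_tendsto hx.norm (of_forall fun n => c n x)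

lemma eq_zero (h : Sob K φ Φ) : ∀ᵐ x, x ∉ K → φ x = 0 := by
  obtain ⟨hK, hm, B, f, a, b, c, d, e⟩ := h
  filter_upwards [d] with x hx hxK
  refine tendsto_nhds_unique hx ?_
  simp_rw [fun n => b n x hxK]; exact tendsto_const_nhds

lemma memLp (h : Sob K φ Φ) (r : ℝ≥0∞) : MemLp φ r := by
  obtain ⟨B, hB⟩ := h.exists_bound
  exact memLp_of_bound_of_eq_zero h.isCompact h.aestronglyMeasurable hB h.eq_zero r

lemma fderiv_eq_zero (h : Sob K φ Φ) : ∀ᵐ x, x ∉ K → Φ x = 0 := by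
  obtain ⟨hK, hm, B, f, a, b, c, d, e⟩ := h
  have h1 : ∀ n, eLpNorm (Kᶜ.indicator Φ) 2 ≤ eLpNorm (fun x => Df (f n) x - Φ x) 2 := by
    intro n
    refine eLpNorm_mono fun x => ?_
    by_cases hx : x ∈ K
    · rw [indicator_of_notMem (by simpa using hx)]; simp
    · rw [indicator_of_mem (by simpa using hx), fderiv_eq_zero_of_notMem hK.isClosed (b n) hx]
      simp
  have h2 : eLpNorm (Kᶜ.indicator Φ) 2 = 0 :=
    le_antisymm (ge_of_tendsto' e h1) zero_le'
  rw [eLpNorm_eq_zero_iff (hm.1.indicator hK.measurableSet.compl) (by simp)] at h2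
  filter_upwards [h2] with x hx hxK
  rwa [indicator_of_mem (by simpa using hxK)] at hx

lemma of_contDiff (hK : IsCompact K) (hf : ContDiff ℝ 1 φ) (h0 : ∀ x, x ∉ K → φ x = 0) :
    Sob K φ (Df φ) := by
  have hcs : HasCompactSupport φ := HasCompactSupport.intro hK h0
  obtain ⟨B, hB⟩ := hcs.exists_bound_of_continuous hf.continuous
  have h1 : Tendsto (fun _ : ℕ => eLpNorm (fun x => Df φ x - Df φ x) 2) atTop
      (𝓝 0) := by
    rw [eLpNorm_two_sub_self]
    exact tendsto_const_nhds
  exact ⟨hK, contDiff_memLp_fderiv hK hf h0 2, B, fun _ => φ, fun _ => hf, fun _ => h0,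
    fun _ => hB, of_forall fun _ => tendsto_const_nhds, h1⟩

lemma of_differentiable {φ : E → ℝ} (hK : IsCompact K) {δ : ℝ} (hδ : 0 < δ)
    (hφ : Differentiable ℝ φ) (h0 : ∀ x, x ∉ K → φ x = 0) (hφ2 : MemLp (Df φ) 2) :
    Sob (Metric.cthickening δ K) φ (Df φ) := by
  have hcs : HasCompactSupport φ := HasCompactSupport.intro hK h0
  obtain ⟨B, hB⟩ := hcs.exists_bound_of_continuous hφ.continuous
  have hli : LocallyIntegrable (Df φ) := hφ2.locallyIntegrable (by norm_num)
  have hm : StronglyMeasurable (Df φ) := (measurable_fderiv ℝ φ).stronglyMeasurable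
  have e : ∀ n, Df (mollify n φ) = mollify n (Df φ) := fun n =>
    funext fun x => fderiv_mollify n hφ hli x
  obtain ⟨n0, hn0⟩ := eventually_atTop.1 ((tendsto_order.1 (tendsto_bumpSeq_rOut (N := N))).2 δ hδ)
  refine ⟨hK.cthickening, hφ2, B, fun n => mollify (n + n0) φ,
    fun n => contDiff_mollify _ hφ.continuous.locallyIntegrable (k := 1),
    fun n x hx => mollify_eq_zero_of_notMem_cthickening h0 (hn0 _ (by omega)).le hx,
    fun n x => norm_mollify_le _ hB x, of_forall fun x => ?_, ?_⟩
  · exact (tendsto_mollify hφ.continuous x).comp (tendsto_add_atTop_nat n0)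
  · simp_rw [e]
    exact (tendsto_eLpNorm_mollify_sub hm (by norm_num) (by norm_num) hφ2).comp
      (tendsto_add_atTop_nat n0)

lemma comp_contDiff [ProperSpace F] (h : Sob K φ Φ) {Ψ : F → G} (hΨ : ContDiff ℝ 1 Ψ)
    (hΨ0 : Ψ 0 = 0) :
    Sob K (fun x => Ψ (φ x)) (fun x => (Df Ψ (φ x)).comp (Φ x)) := by
  have hφm := h.aestronglyMeasurable
  obtain ⟨hK, hm, B, f, a, b, c, d, e⟩ := h
  have hΨ' : Continuous (Df Ψ) := hΨ.continuous_fderiv one_ne_zero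
  have hcomp : Continuous fun q : (F →L[ℝ] G) × (E →L[ℝ] F) => q.1.comp q.2 :=
    isBoundedBilinearMap_comp.continuous
  obtain ⟨M, hM⟩ := (isCompact_closedBall (0 : F) B).exists_bound_of_continuousOn hΨ'.continuousOn
  obtain ⟨M', hM'⟩ :=
    (isCompact_closedBall (0 : F) B).exists_bound_of_continuousOn hΨ.continuous.continuousOn
  have hφB : ∀ᵐ x, φ x ∈ Metric.closedBall (0 : F) B := by
    filter_upwards [d] with x hx
    rw [mem_closedBall_zero_iff]
    exact le_of_tendsto hx.norm (of_forall fun n => c n x)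
  have hmem : MemLp (fun x => (Df Ψ (φ x)).comp (Φ x)) 2 := by
    refine hm.of_le_mul (c := M) (hcomp.comp_aestronglyMeasurable
      ((hΨ'.comp_aestronglyMeasurable hφm).prodMk hm.1)) ?_
    filter_upwards [hφB] with x hx
    exact (ContinuousLinearMap.opNorm_comp_le _ _).trans
      (mul_le_mul_of_nonneg_right (hM _ hx) (norm_nonneg _))
  have hfd : ∀ n x, Df (fun y => Ψ (f n y)) x
      = (Df Ψ (f n x)).comp (Df (f n) x) := fun n x =>
    fderiv_comp x (hΨ.differentiable one_ne_zero _) ((a n).differentiable one_ne_zero _)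
  refine ⟨hK, hmem, M', fun n x => Ψ (f n x), fun n => hΨ.comp (a n),
    fun n x hx => (congrArg Ψ (b n x hx)).trans hΨ0,
    fun n x => hM' _ (by simpa using c n x), ?_, ?_⟩
  · filter_upwards [d] with x hx using (hΨ.continuous.tendsto _).comp hx
  · simp_rw [hfd]
    have hb1 : ∀ n, eLpNorm (fun x => (Df Ψ (f n x)).comp (Df (f n) x - Φ x)) 2
        ≤ ENNReal.ofReal M * eLpNorm (fun x => Df (f n) x - Φ x) 2 := fun n =>
      eLpNorm_le_mul_eLpNorm_of_ae_le_mul (of_forall fun x =>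
        (ContinuousLinearMap.opNorm_comp_le _ _).trans
          (mul_le_mul_of_nonneg_right (hM _ (by simpa using c n x)) (norm_nonneg _))) 2
    have ht1 : Tendsto (fun n => eLpNorm (fun x => (Df Ψ (f n x)).comp
        (Df (f n) x - Φ x)) 2) atTop (𝓝 0) := by
      refine tendsto_of_tendsto_of_tendsto_of_le_of_le tendsto_const_nhds ?_
        (fun _ => zero_le') hb1
      simpa using ENNReal.Tendsto.const_mul e (Or.inr ENNReal.ofReal_ne_top)
    have ht2 : Tendsto (fun n => eLpNorm (fun x => (Df Ψ (f n x)
        - Df Ψ (φ x)).comp (Φ x)) 2) atTop (𝓝 0) := by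
      refine tendsto_eLpNorm_zero_of_dominated (by norm_num) (by norm_num)
        (g := fun x => (M + M) * ‖Φ x‖) (fun n => ?_) (fun n => ?_)
        (hm.norm.const_mul _) ?_
      · exact hcomp.comp_aestronglyMeasurable ((((hΨ'.comp (a n).continuous).aestronglyMeasurable).sub
          (hΨ'.comp_aestronglyMeasurable hφm)).prodMk hm.1)
      · filter_upwards [hφB] with x hx
        refine (ContinuousLinearMap.opNorm_comp_le _ _).trans
          (mul_le_mul_of_nonneg_right ((norm_sub_le _ _).trans ?_) (norm_nonneg _))
        exact add_le_add (hM _ (by simpa using c n x)) (hM _ hx)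
      · filter_upwards [d] with x hx
        have h1 : Tendsto (fun n => Df Ψ (f n x) - Df Ψ (φ x)) atTop (𝓝 0) := by
          have := ((hΨ'.tendsto _).comp hx).sub_const (Df Ψ (φ x))
          simpa using this
        have h2 : Tendsto (fun n => ((Df Ψ (f n x) - Df Ψ (φ x)).comp (Φ x))) atTop
            (𝓝 ((0 : F →L[ℝ] G).comp (Φ x))) :=
          (hcomp.tendsto (0, Φ x)).comp (h1.prodMk_nhds tendsto_const_nhds)
        rwa [ContinuousLinearMap.zero_comp] at h2
    refine tendsto_eLpNorm_zero_of_add ht1 ht2 (fun n => ?_) (fun n => ?_) (fun n x => ?_)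
    · exact (hcomp.comp_aestronglyMeasurable (((hΨ'.comp (a n).continuous).aestronglyMeasurable).prodMk
        ((((a n).continuous_fderiv one_ne_zero).aestronglyMeasurable).sub hm.1)))
    rotate_left
    · rw [ContinuousLinearMap.comp_sub, ContinuousLinearMap.sub_comp]
      abel
    · exact hcomp.comp_aestronglyMeasurable ((((hΨ'.comp (a n).continuous).aestronglyMeasurable).sub
          (hΨ'.comp_aestronglyMeasurable hφm)).prodMk hm.1)

lemma prodMk {ψ : E → G} {Ψ : E → E →L[ℝ] G} (h : Sob K φ Φ) (h' : Sob K ψ Ψ) :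
    Sob K (fun x => (φ x, ψ x)) (fun x => (Φ x).prod (Ψ x)) := by
  obtain ⟨hK, hm, B, f, a, b, c, d, e⟩ := h
  obtain ⟨_, hm', B', f', a', b', c', d', e'⟩ := h'
  have hprod : Continuous fun q : (E →L[ℝ] F) × (E →L[ℝ] G) => q.1.prod q.2 :=
    (ContinuousLinearMap.prodₗᵢ (𝕜 := ℝ) ℝ).continuous
  have hnorm : ∀ (L : E →L[ℝ] F) (M : E →L[ℝ] G), ‖L.prod M‖ ≤ ‖L‖ + ‖M‖ := by
    intro L M
    rw [ContinuousLinearMap.opNorm_prod]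
    exact (max_le_add_of_nonneg (norm_nonneg _) (norm_nonneg _))
  refine ⟨hK, ?_, max B B', fun n x => (f n x, f' n x), fun n => (a n).prodMk (a' n),
    fun n x hx => by
      show (f n x, f' n x) = 0
      rw [b n x hx, b' n x hx]; rfl,
    fun n x => max_le_max (c n x) (c' n x), ?_, ?_⟩
  · refine (hm.norm.add hm'.norm).of_le (hprod.comp_aestronglyMeasurable (hm.1.prodMk hm'.1))
      (of_forall fun x => (hnorm _ _).trans (le_abs_self _))
  · filter_upwards [d, d'] with x hx hx' using hx.prodMk_nhds hx'
  · have ht := e.add e'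
    rw [add_zero] at ht
    refine tendsto_of_tendsto_of_tendsto_of_le_of_le tendsto_const_nhds ht (fun _ => zero_le')
      fun n => ?_
    have hm1 : AEStronglyMeasurable fun x => Df (f n) x - Φ x :=
      (((a n).continuous_fderiv one_ne_zero).aestronglyMeasurable).sub hm.1
    have hm2 : AEStronglyMeasurable fun x => Df (f' n) x - Ψ x :=
      (((a' n).continuous_fderiv one_ne_zero).aestronglyMeasurable).sub hm'.1
    have h4 := eLpNorm_add_le hm1.norm hm2.norm one_le_two
    rw [eLpNorm_norm, eLpNorm_norm] at h4
    refine le_trans (eLpNorm_mono fun x => ?_) h4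
    have hfd : Df (fun x => (f n x, f' n x)) x
        = (Df (f n) x).prod (Df (f' n) x) :=
      ((a n).differentiable one_ne_zero x).fderiv_prodMk ((a' n).differentiable one_ne_zero x)
    rw [hfd]
    have : (Df (f n) x).prod (Df (f' n) x) - (Φ x).prod (Ψ x)
        = (Df (f n) x - Φ x).prod (Df (f' n) x - Ψ x) := by ext <;> simp
    rw [this]
    exact (hnorm _ _).trans (le_abs_self _)

lemma clm_comp [ProperSpace F] (h : Sob K φ Φ) (L : F →L[ℝ] G) :
    Sob K (fun x => L (φ x)) (fun x => L.comp (Φ x)) := by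
  have := h.comp_contDiff L.contDiff (map_zero L)
  simp only [ContinuousLinearMap.fderiv] at this
  exact this

lemma weakDiv {φ : E → ℝ} {Φ : E → E →L[ℝ] ℝ} (h : Sob K φ Φ) (hKΩ : K ⊆ Ω)
    {X : E → E} (hX : WeakDiv Ω X c) (hX2 : MemLp X 2) :
    ∫ x, Φ x (X x) = c * ∫ x, φ x := by
  have hφ1 := (h.memLp 1)
  obtain ⟨hK, hm, B, f, a, b, c', d, e⟩ := h
  have ht1 : Tendsto (fun n => ∫ x, Df (f n) x (X x)) atTop (𝓝 (∫ x, Φ x (X x))) :=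
    tendsto_integral_clm_apply (r := 2) (s := 2)
      (of_forall fun n => contDiff_memLp_fderiv hK (a n) (b n) 2) hm hX2 e
  have ht2 : Tendsto (fun n => ∫ x, f n x) atTop (𝓝 (∫ x, φ x)) := by
    refine tendsto_integral_of_dominated_convergence (K.indicator fun _ => B)
      (fun n => (a n).continuous.aestronglyMeasurable) ?_ (fun n => of_forall fun x => ?_) d
    · exact (integrable_indicator_iff hK.measurableSet).2
        (integrableOn_const hK.measure_lt_top.ne)
    · by_cases hx : x ∈ K
      · rw [indicator_of_mem hx]; exact c' n x
      · rw [indicator_of_notMem hx, b n x hx, norm_zero]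
  refine tendsto_nhds_unique ht1 ((ht2.const_mul c).congr fun n => ?_)
  exact (hX _ (a n) (HasCompactSupport.intro hK (b n))
    ((tsupport_subset_of_eq_zero hK.isClosed (b n)).trans hKΩ)).symm

lemma integral_fderiv_eq_zero {φ : E → ℝ} {Φ : E → E →L[ℝ] ℝ} (h : Sob K φ Φ)
    (v : E) : ∫ x, Φ x v = 0 := by
  have h2 : MemLp (K.indicator fun _ => v) 2 :=
    memLp_indicator_const 2 h.isCompact.measurableSet v (Or.inr h.isCompact.measure_lt_top.ne)
  have h0 := h.fderiv_eq_zero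
  obtain ⟨hK, hm, B, f, a, b, c', d, e⟩ := h
  have ht1 : Tendsto (fun n => ∫ x, Df (f n) x (K.indicator (fun _ => v) x)) atTop
      (𝓝 (∫ x, Φ x (K.indicator (fun _ => v) x))) :=
    tendsto_integral_clm_apply (r := 2) (s := 2)
      (of_forall fun n => contDiff_memLp_fderiv hK (a n) (b n) 2) hm h2 e
  have e1 : ∫ x, Φ x (K.indicator (fun _ => v) x) = ∫ x, Φ x v := by
    refine integral_congr_ae ?_
    filter_upwards [h0] with x hx
    by_cases hxK : x ∈ K
    · rw [indicator_of_mem hxK]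
    · rw [hx hxK]; simp
  have e2 : ∀ n, ∫ x, Df (f n) x (K.indicator (fun _ => v) x) = 0 := by
    intro n
    have hcd : Integrable fun x => Df (f n) x v :=
      (memLp_one_iff_integrable.1 (contDiff_memLp_fderiv hK (a n) (b n) 1)).apply_continuousLinearMap v
    have hfi : Integrable (f n) := (a n).continuous.integrable_of_hasCompactSupport
      (HasCompactSupport.intro hK (b n))
    have := integral_mul_fderiv_eq_neg_fderiv_mul_of_integrable
      (μ := (volume : Measure (E))) (f := fun _ => (1:ℝ)) (g := f n) (v := v)
      (by simp) (by simpa using hcd) (by simpa using hfi)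
      (fun x _ => differentiableAt_const _) (fun x _ => (a n).differentiable one_ne_zero x)
    simp only [one_mul, fderiv_fun_const, Pi.zero_apply, _root_.zero_apply, zero_mul,
      integral_zero, neg_zero] at this
    rw [← this]
    refine integral_congr_ae (of_forall fun x => ?_)
    by_cases hxK : x ∈ K
    · simp only [indicator_of_mem hxK]
    · simp only [fderiv_eq_zero_of_notMem hK.isClosed (b n) hxK]; simp
  rw [← e1]
  refine tendsto_nhds_unique ht1 ?_
  simp_rw [e2]; exact tendsto_const_nhds

lemma mul {φ ψ : E → ℝ} {Φ Ψ : E → E →L[ℝ] ℝ} (h : Sob K φ Φ) (h' : Sob K ψ Ψ) :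
    Sob K (fun x => φ x * ψ x) (fun x => φ x • Ψ x + ψ x • Φ x) := by
  have := (h.prodMk h').comp_contDiff (Ψ := fun q : ℝ × ℝ => q.1 * q.2)
    (contDiff_fst.mul contDiff_snd) (by simp)
  refine this.congr (of_forall fun _ => rfl) (of_forall fun x => ?_)
  have h1 : HasFDerivAt (fun q : ℝ × ℝ => q.1 * q.2)
      (φ x • ContinuousLinearMap.snd ℝ ℝ ℝ + ψ x • ContinuousLinearMap.fst ℝ ℝ ℝ) (φ x, ψ x) :=
    (hasFDerivAt_fst (𝕜 := ℝ) (p := (φ x, ψ x))).fun_mul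
      (hasFDerivAt_snd (𝕜 := ℝ) (p := (φ x, ψ x)))
  simp only [h1.fderiv]
  ext v; simp

lemma integral_mul_fderiv {φ ψ : E → ℝ} {Φ Ψ : E → E →L[ℝ] ℝ} (h : Sob K φ Φ)
    (h' : Sob K ψ Ψ) (v : E) : ∫ x, φ x * Ψ x v = - ∫ x, Φ x v * ψ x := by
  have h1 := (h.mul h').integral_fderiv_eq_zero v
  have i1 : Integrable fun x => φ x * Ψ x v :=
    (h.memLp 2).integrable_mul
      ((h'.memLp_fderiv).continuousLinearMap_comp (ContinuousLinearMap.apply ℝ ℝ v))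
  have i2 : Integrable fun x => Φ x v * ψ x :=
    ((h.memLp_fderiv).continuousLinearMap_comp (ContinuousLinearMap.apply ℝ ℝ v)).integrable_mul
      (h'.memLp 2)
  have e : ∀ x, (φ x • Ψ x + ψ x • Φ x) v = φ x * Ψ x v + Φ x v * ψ x := fun x => by
    simp [mul_comm]
  simp_rw [e] at h1
  rw [integral_add i1 i2] at h1
  linarith

end Sob

end

namespace IsIpNorm

lemma dualNorm_bddAbove (hH : Ip) (x : E) :
    BddAbove (range fun ξ : {ξ : E // ξ ≠ 0} => ⟪x, (ξ : E)⟫ / H ξ) := by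
  obtain ⟨c, K, hc, hK, hb⟩ := hH.exists_bounds
  refine ⟨‖x‖ / c, ?_⟩
  rintro _ ⟨ξ, rfl⟩
  have h1 := hH.pos ξ ξ.2
  show ⟪x, (ξ : E)⟫ / H ξ ≤ ‖x‖ / c
  rw [div_le_div_iff₀ h1 hc]
  calc ⟪x, (ξ : E)⟫ * c ≤ ‖x‖ * ‖(ξ : E)‖ * c :=
        mul_le_mul_of_nonneg_right (real_inner_le_norm _ _) hc.le
    _ = ‖x‖ * (c * ‖(ξ : E)‖) := by ring
    _ ≤ ‖x‖ * H ξ := mul_le_mul_of_nonneg_left (hb _).1 (norm_nonneg _)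

lemma inner_le_dualNorm (hH : Ip) (x ξ : E) : ⟪x, ξ⟫ ≤ dualNorm H x * H ξ := by
  by_cases h : ξ = 0
  · simp [h, hH.map_zero]
  · rw [← div_le_iff₀ (hH.pos ξ h)]
    exact le_ciSup (hH.dualNorm_bddAbove x) ⟨ξ, h⟩

lemma dualNorm_le (hH : Ip) (hB : 0 ≤ B) (h : ∀ ξ, ⟪x, ξ⟫ ≤ B * H ξ) : dualNorm H x ≤ B :=
  Real.iSup_le (fun ξ => (div_le_iff₀ (hH.pos ξ ξ.2)).2 (h ξ)) hB

lemma dualNorm_zero (H : E → ℝ) : dualNorm H (0 : E) = 0 := by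
  simp [dualNorm]

lemma dualNorm_pos (hH : Ip) (hx : x ≠ 0) : 0 < dualNorm H x := by
  have h1 := hH.inner_le_dualNorm x x
  rw [real_inner_self_eq_norm_sq] at h1
  have h2 := hH.pos x hx
  have h3 : 0 < ‖x‖ ^ 2 := by positivity
  by_contra h
  nlinarith

lemma dualNorm_nonneg (hH : Ip) (x : E) : 0 ≤ dualNorm H x := by
  by_cases h : x = 0
  · rw [h, dualNorm_zero]
  · exact (hH.dualNorm_pos h).le

lemma dualNorm_smul (hH : Ip) (ht : 0 ≤ t) (x : E) :
    dualNorm H (t • x) = t * dualNorm H x := by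
  have key : ∀ s : ℝ, 0 ≤ s → ∀ y, dualNorm H (s • y) ≤ s * dualNorm H y := fun s hs y =>
    hH.dualNorm_le (mul_nonneg hs (hH.dualNorm_nonneg y)) fun ξ => by
      rw [real_inner_smul_left, mul_assoc]
      exact mul_le_mul_of_nonneg_left (hH.inner_le_dualNorm y ξ) hs
  rcases ht.eq_or_lt with h | h
  · simp [← h, dualNorm_zero]
  · refine le_antisymm (key t ht x) ?_
    have := key t⁻¹ (by positivity) (t • x)
    rw [smul_smul, inv_mul_cancel₀ h.ne', one_smul] at this
    calc t * dualNorm H x ≤ t * (t⁻¹ * dualNorm H (t • x)) := mul_le_mul_of_nonneg_left this ht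
      _ = _ := by field_simp

lemma dualNorm_neg (hH : Ip) (x : E) : dualNorm H (-x) = dualNorm H x := by
  have key : ∀ y, dualNorm H (-y) ≤ dualNorm H y := fun y =>
    hH.dualNorm_le (hH.dualNorm_nonneg y) fun ξ => by
      have := hH.inner_le_dualNorm y (-ξ)
      rwa [inner_neg_right, hH.map_neg, ← inner_neg_left] at this
  refine le_antisymm (key x) ?_
  simpa using key (-x)

lemma dualNorm_add_le (hH : Ip) (x y : E) :
    dualNorm H (x + y) ≤ dualNorm H x + dualNorm H y :=
  hH.dualNorm_le (add_nonneg (hH.dualNorm_nonneg x) (hH.dualNorm_nonneg y)) fun ξ => by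
    rw [inner_add_left, add_mul]
    exact add_le_add (hH.inner_le_dualNorm x ξ) (hH.inner_le_dualNorm y ξ)

lemma dualNorm_exists_bounds (hH : Ip) :
    ∃ c K : ℝ, 0 < c ∧ 0 < K ∧ ∀ x : E, c * ‖x‖ ≤ dualNorm H x ∧ dualNorm H x ≤ K * ‖x‖ := by
  obtain ⟨c, K, hc, hK, hb⟩ := hH.exists_bounds
  refine ⟨K⁻¹, c⁻¹, by positivity, by positivity, fun x => ⟨?_, ?_⟩⟩
  · by_cases h : x = 0
    · simp [h, dualNorm_zero]
    have h1 := hH.inner_le_dualNorm x x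
    rw [real_inner_self_eq_norm_sq] at h1
    have h0 : 0 < ‖x‖ := norm_pos_iff.2 h
    have h2 : ‖x‖ ^ 2 ≤ dualNorm H x * (K * ‖x‖) :=
      h1.trans (mul_le_mul_of_nonneg_left (hb x).2 (hH.dualNorm_nonneg x))
    rw [inv_mul_le_iff₀ hK]
    nlinarith
  · refine hH.dualNorm_le (by positivity) fun ξ => ?_
    refine (real_inner_le_norm _ _).trans ?_
    calc ‖x‖ * ‖ξ‖ = c⁻¹ * ‖x‖ * (c * ‖ξ‖) := by field_simp
      _ ≤ _ := mul_le_mul_of_nonneg_left (hb ξ).1 (by positivity)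

lemma continuous_dualNorm (hH : Ip) : Continuous (dualNorm H) := by
  obtain ⟨c, K, hc, hK, hb⟩ := hH.dualNorm_exists_bounds
  refine (LipschitzWith.of_le_add_mul ⟨K, hK.le⟩ fun x y => ?_).continuous
  have h1 := hH.dualNorm_add_le (x - y) y
  rw [sub_add_cancel] at h1
  have h2 := (hb (x - y)).2
  rw [dist_eq_norm]
  show _ ≤ _ + K * _
  linarith

lemma dualNorm_stress_le (hH : Ip) (hp : 1 < p) (ξ : E) :
    dualNorm H (∇V ξ) ≤ H ξ ^ (p - 1) :=
  hH.dualNorm_le (Real.rpow_nonneg (hH.nonneg ξ) _) fun ζ => hH.inner_stress_le hp ξ ζ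

/-- If `⟪ξ, d⟫ ≤ C H₀(d)` for all `d`, then `H ξ ≤ C`. -/
lemma le_of_inner_le (hH : Ip) (hp : 1 < p) (hC : 0 ≤ C)
    (h : ∀ d, ⟪ξ, d⟫ ≤ C * dualNorm H d) : H ξ ≤ C := by
  by_cases h0 : ξ = 0
  · rwa [h0, hH.map_zero]
  have h1 := h (∇V ξ)
  rw [real_inner_comm, hH.inner_stress_self hp] at h1
  have hpos := hH.pos ξ h0
  have h2 := h1.trans (mul_le_mul_of_nonneg_left (hH.dualNorm_stress_le hp ξ) hC)
  have h3 : H ξ ^ p = H ξ * H ξ ^ (p - 1) := by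
    rw [← Real.rpow_one_add' hpos.le (by linarith)]; congr 1; ring
  rw [h3] at h2
  exact le_of_mul_le_mul_right h2 (Real.rpow_pos_of_pos hpos _)

end IsIpNorm

namespace Sob

lemma tendsto_eLpNorm_apply {ι : Type*} {l : Filter ι} {Φn : ι → E → E →L[ℝ] ℝ}
    {Φ : E → E →L[ℝ] ℝ} (e : Tendsto (fun n => eLpNorm (fun x => Φn n x - Φ x) 2) l (𝓝 0))
    (v : E) : Tendsto (fun n => eLpNorm (fun x => Φn n x v - Φ x v) 2) l (𝓝 0) := by
  have h : ∀ n, eLpNorm (fun x => Φn n x v - Φ x v) 2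
      ≤ ENNReal.ofReal ‖v‖ * eLpNorm (fun x => Φn n x - Φ x) 2 := fun n =>
    eLpNorm_le_mul_eLpNorm_of_ae_le_mul (of_forall fun x => by
      rw [← _root_.sub_apply, mul_comm]; exact ContinuousLinearMap.le_opNorm _ _) 2
  have h2 := ENNReal.Tendsto.const_mul (a := ENNReal.ofReal ‖v‖) e (Or.inr ENNReal.ofReal_ne_top)
  rw [mul_zero] at h2
  exact tendsto_of_tendsto_of_tendsto_of_le_of_le tendsto_const_nhds h2 (fun _ => zero_le') h

lemma tendsto_integral_mul {f g : ℕ → E → ℝ} {f0 g0 : E → ℝ}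
    (hf : ∀ n, MemLp (f n) 2) (hf0 : MemLp f0 2) (hg : ∀ n, MemLp (g n) 2) (hg0 : MemLp g0 2)
    (h1 : Tendsto (fun n => eLpNorm (fun x => f n x - f0 x) 2) atTop (𝓝 0))
    (h2 : Tendsto (fun n => eLpNorm (fun x => g n x - g0 x) 2) atTop (𝓝 0)) :
    Tendsto (fun n => ∫ x, f n x * g n x) atTop (𝓝 (∫ x, f0 x * g0 x)) := by
  have t1 := (Lp.tendsto_Lp_iff_tendsto_eLpNorm' (fun n => (hf n).toLp) hf0.toLp).2 (by
    refine h1.congr fun n => eLpNorm_congr_ae ?_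
    filter_upwards [(hf n).coeFn_toLp, hf0.coeFn_toLp] with x hx hy
    rw [Pi.sub_apply, hx, hy])
  have t2 := (Lp.tendsto_Lp_iff_tendsto_eLpNorm' (fun n => (hg n).toLp) hg0.toLp).2 (by
    refine h2.congr fun n => eLpNorm_congr_ae ?_
    filter_upwards [(hg n).coeFn_toLp, hg0.coeFn_toLp] with x hx hy
    rw [Pi.sub_apply, hx, hy])
  have e : ∀ {a b : E → ℝ} (ha : MemLp a 2) (hb : MemLp b 2),
      inner ℝ ha.toLp hb.toLp = ∫ x, a x * b x := by
    intro a b ha hb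
    rw [L2.inner_def]
    refine integral_congr_ae ?_
    filter_upwards [ha.coeFn_toLp, hb.coeFn_toLp] with x hx hy
    rw [hx, hy]; simp [mul_comm]
  have := t1.inner (𝕜 := ℝ) t2
  simp only [e] at this
  exact this

lemma integral_fderiv_mul_fderiv_comm {ψ : E → ℝ} {Φ Ψ : E → E →L[ℝ] ℝ}
    (h : Sob K φ Φ) (h' : Sob K ψ Ψ) (v w : E) :
    ∫ x, Φ x v * Ψ x w = ∫ x, Φ x w * Ψ x v := by
  -- smooth case for the first factor
  have smooth : ∀ {f : E → ℝ} {K' : Set E}, IsCompact K' → K ⊆ K' → ContDiff ℝ 2 f →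
      (∀ x, x ∉ K' → f x = 0) → ∀ a b : E,
      ∫ x, Df f x a * Ψ x b = - ∫ x, Df (Df f) x b a * ψ x := by
    intro f K' hK' hKK hf h0 a b
    have hd : ContDiff ℝ 1 (Df f) := hf.fderiv_right (by norm_num)
    have hS : Sob K' (fun x => Df f x a) (Df fun x => Df f x a) :=
      of_contDiff hK' (hd.clm_apply contDiff_const) fun x hx => by
        rw [fderiv_eq_zero_of_notMem hK'.isClosed h0 hx]; rfl
    rw [hS.integral_mul_fderiv (h'.mono hK' hKK) b]
    congr 1
    refine integral_congr_ae (of_forall fun x => ?_)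
    have : HasFDerivAt (fun x => Df f x a)
        ((ContinuousLinearMap.apply ℝ ℝ a).comp (Df (Df f) x)) x :=
      (ContinuousLinearMap.apply ℝ ℝ a).hasFDerivAt.comp x
        (hd.differentiable one_ne_zero x).hasFDerivAt
    simp only [this.fderiv]
    rfl
  have smooth' : ∀ {f : E → ℝ} {K' : Set E}, IsCompact K' → K ⊆ K' → ContDiff ℝ 2 f →
      (∀ x, x ∉ K' → f x = 0) →
      ∫ x, Df f x v * Ψ x w = ∫ x, Df f x w * Ψ x v := by
    intro f K' hK' hKK hf h0
    rw [smooth hK' hKK hf h0, smooth hK' hKK hf h0]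
    congr 1
    refine integral_congr_ae (of_forall fun x => ?_)
    have : IsSymmSndFDerivAt ℝ f x := hf.contDiffAt.isSymmSndFDerivAt (by simp)
    simp only [this.eq v w]
  -- approximation
  have step : ∀ {f : ℕ → E → E →L[ℝ] ℝ} {g : E → E →L[ℝ] ℝ},
      (∀ n, MemLp (f n) 2) → MemLp g 2 →
      Tendsto (fun n => eLpNorm (fun x => f n x - g x) 2) atTop (𝓝 0) →
      (∀ n, ∫ x, f n x v * Ψ x w = ∫ x, f n x w * Ψ x v) →
      ∫ x, g x v * Ψ x w = ∫ x, g x w * Ψ x v := by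
    intro f g hf hg hfg he
    have ap : ∀ {k : E → E →L[ℝ] ℝ}, MemLp k 2 → ∀ a : E, MemLp (fun x => k x a) 2 :=
      fun hk a => hk.continuousLinearMap_comp (ContinuousLinearMap.apply ℝ ℝ a)
    have hΨ := h'.memLp_fderiv
    have z : ∀ a : E, Tendsto (fun _ : ℕ => eLpNorm (fun x => Ψ x a - Ψ x a) 2) atTop (𝓝 0) := by
      intro a
      simp only [eLpNorm_two_sub_self]
      exact tendsto_const_nhds
    refine tendsto_nhds_unique
      (tendsto_integral_mul (fun n => ap (hf n) v) (ap hg v) (fun _ => ap hΨ w) (ap hΨ w)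
        (tendsto_eLpNorm_apply hfg v) (z w)) ?_
    simp_rw [he]
    exact tendsto_integral_mul (fun n => ap (hf n) w) (ap hg w) (fun _ => ap hΨ v) (ap hΨ v)
        (tendsto_eLpNorm_apply hfg w) (z v)
  obtain ⟨hK, hm, B, f, a, b, c, d, e⟩ := h
  refine step (fun n => contDiff_memLp_fderiv hK (a n) (b n) 2) hm e fun n => ?_
  have hf2 := contDiff_memLp_fderiv hK (a n) (b n) 2
  have hcont := (a n).continuous_fderiv one_ne_zero
  have hfd : ∀ m, Df (mollify m (f n)) = mollify m (Df (f n)) := fun m =>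
    funext fun x => fderiv_mollify m ((a n).differentiable one_ne_zero) hcont.locallyIntegrable x
  have hz : ∀ m x, x ∉ Metric.cthickening 1 K → mollify m (f n) x = 0 := fun m x hx =>
    mollify_eq_zero_of_notMem_cthickening (b n) (by
      show (bumpSeq N m).rOut ≤ 1
      simp only [bumpSeq]
      rw [div_le_one (by positivity)]; linarith [(Nat.cast_nonneg m : (0:ℝ) ≤ m)]) hx
  have hsm : ∀ m, ContDiff ℝ 2 (mollify m (f n)) := fun m =>
    contDiff_mollify m (a n).continuous.locallyIntegrable (k := 2)
  refine step (f := fun m => Df (mollify m (f n)))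
    (fun m => contDiff_memLp_fderiv hK.cthickening ((hsm m).of_le (by norm_num)) (hz m) 2) hf2 ?_
    fun m => smooth' hK.cthickening (Metric.self_subset_cthickening K) (hsm m) (hz m)
  simp_rw [hfd]
  exact tendsto_eLpNorm_mollify_sub hcont.stronglyMeasurable (by norm_num) (by norm_num) hf2

end Sob

section

lemma hasDerivAt_sq_max (s : ℝ) : HasDerivAt (fun s : ℝ => (max s 0) ^ 2) (2 * max s 0) s := by
  rcases lt_trichotomy s 0 with h | h | h
  · have e : (fun s : ℝ => (max s 0) ^ 2) =ᶠ[𝓝 s] fun _ => 0 := by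
      filter_upwards [Iio_mem_nhds h] with t ht
      rw [max_eq_right (le_of_lt ht)]; norm_num
    rw [max_eq_right h.le, mul_zero]
    exact (hasDerivAt_const s (0:ℝ)).congr_of_eventuallyEq e
  · subst h
    rw [max_self, mul_zero, hasDerivAt_iff_isLittleO_nhds_zero]
    have h1 : (fun h : ℝ => (max (0 + h) 0) ^ 2 - (max (0:ℝ) 0) ^ 2 - h • (0:ℝ))
        =O[𝓝 0] fun h : ℝ => h ^ 2 := by
      refine Asymptotics.isBigO_of_le _ fun h => ?_
      simp only [zero_add, max_self, smul_zero, norm_pow, Real.norm_eq_abs]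
      rcases le_total h 0 with hh | hh
      · rw [max_eq_right hh]; simp; positivity
      · rw [max_eq_left hh]; simp
    exact h1.trans_isLittleO (Asymptotics.isLittleO_pow_id one_lt_two)
  · have e : (fun s : ℝ => (max s 0) ^ 2) =ᶠ[𝓝 s] fun s => s ^ 2 := by
      filter_upwards [Ioi_mem_nhds h] with t ht
      rw [max_eq_left (le_of_lt ht)]
    rw [max_eq_left h.le]
    simpa using (hasDerivAt_pow 2 s).congr_of_eventuallyEq e

lemma eq_zero_of_fderiv_ae_eq_zero (hN : 1 ≤ N) (hK : IsCompact K) (h0 : ∀ x, x ∉ K → φ x = 0)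
    (hφ : Differentiable ℝ φ) (h : ∀ᵐ x, Df φ x = 0) (x : E) : φ x = 0 := by
  have hli : LocallyIntegrable (Df φ) := by
    have : Integrable (Df φ) := (integrable_zero (E) (E →L[ℝ] ℝ) volume).congr
      (by filter_upwards [h] with x hx; exact hx.symm)
    exact this.locallyIntegrable
  haveI : Nontrivial (E) := by
    haveI : Nonempty (Fin N) := ⟨⟨0, hN⟩⟩
    infer_instance
  have key : ∀ n, mollify n φ x = 0 := by
    intro n
    have hd : Differentiable ℝ (mollify n φ) :=
      (contDiff_mollify n hφ.continuous.locallyIntegrable (k := 1)).differentiable one_ne_zero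
    have hf : ∀ y, Df (mollify n φ) y = 0 := by
      intro y
      rw [fderiv_mollify n hφ hli, mollify_apply]
      refine integral_eq_zero_of_ae ?_
      have := (Measure.measurePreserving_sub_left volume y).quasiMeasurePreserving.ae h
      filter_upwards [this] with t ht
      rw [ht, smul_zero]; rfl
    have hb : Bornology.IsBounded (Metric.cthickening 1 K) := hK.isBounded.cthickening
    obtain ⟨y, hy⟩ : ∃ y, y ∉ Metric.cthickening 1 K := by
      by_contra hcon
      push Not at hcon
      exact NormedSpace.unbounded_univ ℝ (E)
        (hb.subset fun y _ => hcon y)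
    rw [is_const_of_fderiv_eq_zero hd hf x y]
    refine mollify_eq_zero_of_notMem_cthickening h0 ?_ hy
    show (bumpSeq N n).rOut ≤ 1
    simp only [bumpSeq]
    rw [div_le_one (by positivity)]; linarith [(Nat.cast_nonneg n : (0:ℝ) ≤ n)]
  refine tendsto_nhds_unique (tendsto_mollify hφ.continuous x) ?_
  simp_rw [key]; exact tendsto_const_nhds

lemma IsIpNorm.memLp_stress (hH : Ip) (hp : 1 < p) (hq : MemLp q (ENNReal.ofReal p)) :
    MemLp (fun x => ∇V (q x)) (ENNReal.ofReal (p / (p - 1))) := by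
  obtain ⟨K, hK, hb⟩ := hH.norm_stress_le hp
  obtain ⟨c, K', hc, hK', hb'⟩ := hH.exists_bounds
  have h1 := hq.norm_rpow_div (ENNReal.ofReal (p - 1))
  rw [ENNReal.toReal_ofReal (by linarith), ← ENNReal.ofReal_div_of_pos (by linarith)] at h1
  refine h1.of_le_mul (c := K * K' ^ (p - 1))
    ((hH.continuous_stress hp).comp_aestronglyMeasurable hq.1) (of_forall fun x => ?_)
  rw [Real.norm_of_nonneg (by positivity), mul_assoc, ← Real.mul_rpow hK'.le (norm_nonneg _)]
  exact (hb _).trans (mul_le_mul_of_nonneg_left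
    (Real.rpow_le_rpow (hH.nonneg _) (hb' _).2 (by linarith)) hK.le)

/-- `u`, extended by zero outside the bounded open set `Ω`, is a continuous weak solution of
`-div T(∇u) = 1` in `Ω` with gradient field `q`. -/
structure Sol (H : E → ℝ) (p : ℝ) (Ω : Set E) (u : E → ℝ) (q : E → E)
    : Prop where
  isOpen : IsOpen Ω
  bounded : Bornology.IsBounded Ω
  cont : Continuous u
  zero : ∀ x, x ∉ Ω → u x = 0
  grad : ∀ x ∈ Ω, HasFDerivAt u (innerSL ℝ (q x)) x
  q_zero : ∀ x, x ∉ Ω → q x = 0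
  q_memLp : MemLp q (ENNReal.ofReal p)
  weak : WeakDiv Ω (fun x => ∇V (q x)) 1

lemma holderConjugate_ofReal (hp : 1 < p) :
    (ENNReal.ofReal p).HolderConjugate (ENNReal.ofReal (p / (p - 1))) :=
  (Real.HolderConjugate.conjExponent hp).ennrealOfReal

lemma sq_max_test {U : Set E} (hUb : Bornology.IsBounded U) {w : E → ℝ}
    {g : E → E} (hwc : Continuous w) (hKU : {x | 0 ≤ w x} ⊆ U)
    (hw : ∀ x ∈ U, HasFDerivAt w (innerSL ℝ (g x)) x) (hg : MemLp g r) :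
    IsCompact {x | 0 ≤ w x} ∧ (∀ x, x ∉ {x | 0 ≤ w x} → (max (w x) 0) ^ 2 = 0) ∧
    (∀ x, HasFDerivAt (fun x => (max (w x) 0) ^ 2) ((2 * max (w x) 0) • innerSL ℝ (g x)) x) ∧
    MemLp (Df fun x => (max (w x) 0) ^ 2) r := by
  set K : Set E := {x | 0 ≤ w x} with hKdef
  have hK : IsCompact K := Metric.isCompact_of_isClosed_isBounded
    (isClosed_le continuous_const hwc) (hUb.subset hKU)
  have h0 : ∀ x, x ∉ K → (max (w x) 0) ^ 2 = 0 := fun x hx => by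
    have : w x < 0 := not_le.1 hx
    simp only [max_eq_right this.le]; norm_num
  have hd : ∀ x, HasFDerivAt (fun x => (max (w x) 0) ^ 2)
      ((2 * max (w x) 0) • innerSL ℝ (g x)) x := by
    intro x
    by_cases hx : x ∈ U
    · exact (hasDerivAt_sq_max (w x)).comp_hasFDerivAt x (hw x hx)
    · have hxK : x ∉ K := fun hc => hx (hKU hc)
      have hwx : w x < 0 := not_le.1 hxK
      rw [max_eq_right hwx.le, mul_zero, zero_smul]
      refine (hasFDerivAt_const (0:ℝ) x).congr_of_eventuallyEq ?_
      filter_upwards [hK.isClosed.isOpen_compl.mem_nhds hxK] with y hy using h0 y hy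
  obtain ⟨B, hB⟩ := hK.exists_bound_of_continuousOn (f := fun x => 2 * max (w x) 0)
    (by fun_prop)
  refine ⟨hK, h0, hd, hg.of_le_mul (c := max B 0)
    (measurable_fderiv ℝ _).aestronglyMeasurable (of_forall fun x => ?_)⟩
  by_cases hx : x ∈ K
  · rw [(hd x).fderiv, norm_smul, innerSL_apply_norm]
    exact mul_le_mul_of_nonneg_right ((hB x hx).trans (le_max_left _ _)) (norm_nonneg _)
  · rw [fderiv_eq_zero_of_notMem hK.isClosed h0 hx, norm_zero]
    positivity

lemma WeakDiv.affine {X : E → E} (h : WeakDiv Ω X c) (hs : 0 < s) (z : E) :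
    WeakDiv ((fun x => s⁻¹ • (x - z)) ⁻¹' Ω) (fun x => s • X (s⁻¹ • (x - z))) c := by
  intro φ h1 h2 h3
  have hinv : ∀ x : E, z + s • (s⁻¹ • (x - z)) = x := fun x => by
    rw [smul_smul, mul_inv_cancel₀ hs.ne', one_smul]; abel
  have hinv' : ∀ y : E, s⁻¹ • ((z + s • y) - z) = y := fun y => by
    rw [add_sub_cancel_left, smul_smul, inv_mul_cancel₀ hs.ne', one_smul]
  set ψ : E → ℝ := fun y => φ (z + s • y) with hψ
  have hψd : ∀ y, Df ψ y = s • Df φ (z + s • y) := by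
    intro y
    have g1 : HasFDerivAt (fun y : E => z + s • y) (s • ContinuousLinearMap.id ℝ (E)) y :=
      ((hasFDerivAt_id y).const_smul s).const_add z
    have g2 := ((h1.differentiable one_ne_zero (z + s • y)).hasFDerivAt).comp y g1
    rw [show ψ = φ ∘ fun y => z + s • y from rfl, g2.fderiv]
    ext v; simp
  let e : E ≃ₜ E :=
    { toFun := fun y => z + s • y, invFun := fun x => s⁻¹ • (x - z), left_inv := hinv',
      right_inv := hinv, continuous_toFun := by fun_prop, continuous_invFun := by fun_prop }
  have hψc : HasCompactSupport ψ := h2.comp_homeomorph e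
  have hψs : tsupport ψ ⊆ Ω := by
    intro y hy
    have : tsupport ψ = e ⁻¹' tsupport φ := tsupport_comp_eq_preimage φ e
    rw [this] at hy
    have h4 : s⁻¹ • (e y - z) ∈ Ω := h3 hy
    rwa [show s⁻¹ • (e y - z) = y from hinv' y] at h4
  have hw := h ψ (h1.comp (by fun_prop)) hψc hψs
  have cv : ∀ G : E → ℝ, ∫ x, G (s⁻¹ • (x - z))
      = |((s⁻¹) ^ Module.finrank ℝ (E))⁻¹| * ∫ x, G x := by
    intro G
    rw [integral_sub_right_eq_self (fun x => G (s⁻¹ • x)) z, Measure.integral_comp_smul,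
      smul_eq_mul]
  have e1 : ∀ x, Df φ x (s • X (s⁻¹ • (x - z)))
      = (fun y => Df ψ y (X y)) (s⁻¹ • (x - z)) := by
    intro x
    simp only [hψd, hinv, _root_.smul_apply, map_smul]
  have e2 : ∀ x, φ x = ψ (s⁻¹ • (x - z)) := fun x => by simp only [hψ, hinv]
  rw [integral_congr_ae (of_forall e1), cv (fun y => Df ψ y (X y)), hw,
    integral_congr_ae (of_forall e2), cv ψ]
  ring

namespace Sol

variable {Ω' : Set (Euc N)} {u' : Euc N → ℝ} {q' : Euc N → Euc N}

lemma comparison (hN : 1 ≤ N) (hH : Ip) (hp : 1 < p) (h : Sol H p Ω u q)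
    (h' : Sol H p Ω' u' q') {m : ℝ} (hm : ∀ x, x ∉ Ω ∩ Ω' → u x - u' x ≤ m) (x : E) :
    u x - u' x ≤ m := by
  refine le_of_forall_pos_le_add fun ε hε => ?_
  set w : E → ℝ := fun x => u x - u' x - m - ε with hw
  have hwc : Continuous w := by have := h.cont; have := h'.cont; fun_prop
  set K : Set E := {x | 0 ≤ w x} with hKdef
  have hKU : K ⊆ Ω ∩ Ω' := fun y hy => by
    by_contra hc
    have h1 := hm y hc
    have h2 : 0 ≤ u y - u' y - m - ε := hy
    linarith
  obtain ⟨hK, h0, hd, hφp⟩ := sq_max_test (U := Ω ∩ Ω') (g := q - q')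
    (h.bounded.subset inter_subset_left) hwc hKU (fun x hx => by
      rw [Pi.sub_apply, map_sub]
      exact (((h.grad x hx.1).sub (h'.grad x hx.2)).sub_const m).sub_const ε)
    (h.q_memLp.sub h'.q_memLp)
  set φ : E → ℝ := fun x => (max (w x) 0) ^ 2 with hφ
  have hdiff : Differentiable ℝ φ := fun x => (hd x).differentiableAt
  haveI := holderConjugate_ofReal hp
  have i1 := h.weak.of_differentiable (r := ENNReal.ofReal p) (s := ENNReal.ofReal (p / (p - 1)))
    h.isOpen ENNReal.ofReal_ne_top (hH.memLp_stress hp h.q_memLp) hK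
    (hKU.trans inter_subset_left) hdiff h0 hφp
  have i2 := h'.weak.of_differentiable (r := ENNReal.ofReal p) (s := ENNReal.ofReal (p / (p - 1)))
    h'.isOpen ENNReal.ofReal_ne_top (hH.memLp_stress hp h'.q_memLp) hK
    (hKU.trans inter_subset_right) hdiff h0 hφp
  have j1 := integrable_clm_apply hφp (hH.memLp_stress hp h.q_memLp)
  have j2 := integrable_clm_apply hφp (hH.memLp_stress hp h'.q_memLp)
  have hint : ∫ x, (Df φ x (∇V (q x)) - Df φ x (∇V (q' x))) = 0 := by
    rw [integral_sub j1 j2, i1, i2, sub_self]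
  have e : ∀ x, Df φ x (∇V (q x)) - Df φ x (∇V (q' x))
      = 2 * max (w x) 0 * ⟪∇V (q x) - ∇V (q' x), q x - q' x⟫ := fun x => by
    rw [(hd x).fderiv, ← map_sub, _root_.smul_apply, innerSL_apply_apply, smul_eq_mul,
      real_inner_comm, Pi.sub_apply]
  have hae := (integral_eq_zero_iff_of_nonneg (fun x => by
    show 0 ≤ Df φ x (∇V (q x)) - Df φ x (∇V (q' x))
    rw [e]
    exact mul_nonneg (by positivity) (hH.inner_stress_sub_nonneg hp _ _)) (j1.sub j2)).1 hint
  have hz : ∀ᵐ x, Df φ x = 0 := by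
    filter_upwards [hae] with x hx
    have hx : Df φ x (∇V (q x)) - Df φ x (∇V (q' x)) = 0 := hx
    rw [e] at hx
    rcases mul_eq_zero.1 hx with h1 | h1
    · rw [(hd x).fderiv, h1, zero_smul]
    · have h2 : q x = q' x := by
        by_contra hne
        exact (hH.stress_strictMono hp (Ne.symm hne)).ne' h1
      rw [(hd x).fderiv, Pi.sub_apply, h2, sub_self, map_zero, smul_zero]
  have h1 := eq_zero_of_fderiv_ae_eq_zero hN hK h0 hdiff hz x
  have h2 : max (w x) 0 = 0 := by
    have : (max (w x) 0) ^ 2 = 0 := h1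
    exact pow_eq_zero_iff (two_ne_zero) |>.1 this
  have h3 : u x - u' x - m - ε ≤ 0 := h2 ▸ le_max_left (w x) 0
  linarith

end Sol

end

section

lemma MemLp.comp_affine (hf : MemLp f r) (hs : 0 < s) (z : E) :
    MemLp (fun x => f (s⁻¹ • (x - z))) r := by
  have h1 : MemLp (fun x => f (s⁻¹ • x)) r := by
    have e : MeasurableEmbedding (fun x : E => s⁻¹ • x) :=
      (Homeomorph.smulOfNeZero s⁻¹ (inv_ne_zero hs.ne')).measurableEmbedding
    refine (e.memLp_map_measure_iff (g := f)).1 ?_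
    rw [Measure.map_addHaar_smul _ (inv_ne_zero hs.ne')]
    exact hf.smul_measure ENNReal.ofReal_ne_top
  have h2 := _root_.MemLp.comp_add_right h1 (-z)
  simpa only [sub_eq_add_neg] using h2

namespace Sol

variable {Ω' : Set (Euc N)} {u' : Euc N → ℝ} {q' : Euc N → Euc N}

lemma affine (h : Sol H p Ω u q) (hH : Ip) (hp : 1 < p) (hs : 0 < s) (z : E) :
    Sol H p ((fun x => s⁻¹ • (x - z)) ⁻¹' Ω) (fun x => s ^ (p / (p - 1)) * u (s⁻¹ • (x - z)))
      (fun x => s ^ (1 / (p - 1)) • q (s⁻¹ • (x - z))) where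
  isOpen := h.isOpen.preimage (by fun_prop)
  bounded := by
    obtain ⟨R, hR⟩ := h.bounded.exists_norm_le
    refine (isBounded_iff_forall_norm_le).2 ⟨‖z‖ + s * R, fun x hx => ?_⟩
    have h1 := hR _ hx
    have h2 : x = z + s • (s⁻¹ • (x - z)) := by
      rw [smul_smul, mul_inv_cancel₀ hs.ne', one_smul]; abel
    calc ‖x‖ = ‖z + s • (s⁻¹ • (x - z))‖ := by rw [← h2]
      _ ≤ ‖z‖ + ‖s • (s⁻¹ • (x - z))‖ := norm_add_le _ _
      _ = ‖z‖ + s * ‖s⁻¹ • (x - z)‖ := by rw [norm_smul s, Real.norm_of_nonneg hs.le]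
      _ ≤ _ := by gcongr
  cont := by have := h.cont; fun_prop
  zero := fun x hx => by rw [h.zero _ hx, mul_zero]
  grad := fun x hx => by
    have g1 : HasFDerivAt (fun x : E => s⁻¹ • (x - z))
        (s⁻¹ • ContinuousLinearMap.id ℝ (E)) x :=
      ((hasFDerivAt_id x).sub_const z).const_smul s⁻¹
    have g2 := ((h.grad _ hx).comp x g1).const_mul (s ^ (p / (p - 1)))
    refine g2.congr_fderiv ?_
    have e : s ^ (1 / (p - 1)) = s ^ (p / (p - 1)) * s⁻¹ := by
      rw [← Real.rpow_neg_one, ← Real.rpow_add hs]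
      congr 1
      have : p - 1 ≠ 0 := by linarith
      field_simp; ring
    rw [e]
    ext v
    simp [inner_smul_left]
    ring
  q_zero := fun x hx => by rw [h.q_zero _ hx, smul_zero]
  q_memLp := (MemLp.comp_affine h.q_memLp hs z).const_smul (s ^ (1 / (p - 1)))
  weak := by
    have h1 := h.weak.affine hs z
    have e : ∀ x, ∇V (s ^ (1 / (p - 1)) • q (s⁻¹ • (x - z)))
        = s • ∇V (q (s⁻¹ • (x - z))) := fun x => by
      rw [hH.stress_smul hp (by positivity), ← Real.rpow_mul hs.le,
        one_div_mul_cancel (by linarith), Real.rpow_one]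
    simp_rw [e]
    exact h1

lemma nonneg (hH : Ip) (hp : 1 < p) (h : Sol H p Ω u q) (x : E) : 0 ≤ u x := by
  by_contra hx
  push Not at hx
  set ε := - u x / 2 with hε
  have hε0 : 0 < ε := by linarith
  set w : E → ℝ := fun x => - u x - ε with hw
  have hwc : Continuous w := by have := h.cont; fun_prop
  set K : Set E := {x | 0 ≤ w x} with hKdef
  have hKU : K ⊆ Ω := fun y hy => by
    by_contra hc
    have h1 := h.zero y hc
    have h2 : 0 ≤ - u y - ε := hy
    linarith
  obtain ⟨hK, h0, hd, hφp⟩ := sq_max_test (U := Ω) (g := -q) h.bounded hwc hKU (fun y hy => by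
      rw [Pi.neg_apply, map_neg]
      exact ((h.grad y hy).neg).sub_const ε) h.q_memLp.neg
  set φ : E → ℝ := fun x => (max (w x) 0) ^ 2 with hφ
  have hdiff : Differentiable ℝ φ := fun x => (hd x).differentiableAt
  haveI := holderConjugate_ofReal hp
  have i1 := h.weak.of_differentiable (r := ENNReal.ofReal p) (s := ENNReal.ofReal (p / (p - 1)))
    h.isOpen ENNReal.ofReal_ne_top (hH.memLp_stress hp h.q_memLp) hK hKU hdiff h0 hφp
  have h1 : ∫ x, Df φ x (∇V (q x)) ≤ 0 := by
    refine integral_nonpos fun y => ?_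
    show Df φ y (∇V (q y)) ≤ 0
    rw [(hd y).fderiv, _root_.smul_apply, innerSL_apply_apply, smul_eq_mul, Pi.neg_apply,
      inner_neg_left, real_inner_comm, hH.inner_stress_self hp]
    have : 0 ≤ 2 * max (w y) 0 * H (q y) ^ p :=
      mul_nonneg (by positivity) (Real.rpow_nonneg (hH.nonneg _) _)
    linarith
  have hφc : Continuous φ := by fun_prop
  have hφs : HasCompactSupport φ := HasCompactSupport.intro hK h0
  have h2 : 0 < ∫ x, φ x := by
    refine hφc.integral_pos_of_hasCompactSupport_nonneg_nonzero hφs (fun y => by positivity)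
      (x := x) ?_
    have : w x = ε := by simp only [hw, hε]; ring
    simp only [hφ, this]
    positivity
  linarith

lemma pos (hN : 1 ≤ N) (hH : Ip) (hp : 1 < p) (h : Sol H p Ω u q) {z : E}
    (hz : z ∈ Ω) : 0 < u z := by
  have hy : ∃ y, 0 < u y := by
    by_contra hc
    push Not at hc
    have hu0 : u = fun _ => 0 := funext fun y => le_antisymm (hc y) (h.nonneg hH hp y)
    have hq : ∀ x, q x = 0 := fun x => by
      by_cases hx : x ∈ Ω
      · have h1 := h.grad x hx
        rw [hu0] at h1
        have h2 := h1.unique (hasFDerivAt_const (0:ℝ) x)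
        have h3 := congrArg (fun L => L (q x)) h2
        simpa using h3
      · exact h.q_zero x hx
    obtain ⟨φ, h1, h2, h3, h4, h5⟩ := exists_contDiff_tsupport_subset (n := 1)
      (h.isOpen.mem_nhds hz)
    have h6 := h.weak φ h3 h2 h1
    simp only [hq, hH.stress_zero hp, map_zero, integral_zero, one_mul] at h6
    have h7 : 0 < ∫ x, φ x := by
      refine h3.continuous.integral_pos_of_hasCompactSupport_nonneg_nonzero h2 (fun y => ?_)
        (x := z) (by rw [h5]; exact one_ne_zero)
      exact (h4 ⟨y, rfl⟩).1
    linarith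
  obtain ⟨y, hy⟩ := hy
  obtain ⟨R, hR⟩ := h.bounded.exists_norm_le
  obtain ⟨δ, hδ, hball⟩ := Metric.isOpen_iff.1 h.isOpen z hz
  set s : ℝ := δ / (|R| + ‖y‖ + 1) with hs
  have hpos : 0 < |R| + ‖y‖ + 1 := by positivity
  have hs0 : 0 < s := by positivity
  have h1 := h.affine hH hp hs0 (z - s • y)
  have h2 := comparison hN hH hp h1 h (m := 0) (fun x hx => by
    by_cases hx1 : x ∈ (fun x => s⁻¹ • (x - (z - s • y))) ⁻¹' Ω
    · exfalso
      refine hx ⟨hx1, hball ?_⟩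
      have h3 := hR _ hx1
      have h4 : x - z = s • (s⁻¹ • (x - (z - s • y)) - y) := by
        rw [smul_sub, smul_smul, mul_inv_cancel₀ hs0.ne', one_smul]; abel
      rw [mem_ball_iff_norm, h4, norm_smul, Real.norm_of_nonneg hs0.le]
      calc s * ‖s⁻¹ • (x - (z - s • y)) - y‖ ≤ s * (|R| + ‖y‖) := by
            gcongr
            exact (norm_sub_le _ _).trans (add_le_add (h3.trans (le_abs_self R)) le_rfl)
        _ < s * (|R| + ‖y‖ + 1) := mul_lt_mul_of_pos_left (by linarith) hs0
        _ = δ := by rw [hs]; field_simp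
    · have : (fun x => s ^ (p / (p - 1)) * u (s⁻¹ • (x - (z - s • y)))) x = 0 := h1.zero x hx1
      simp only at this
      rw [this]
      linarith [h.nonneg hH hp x]) z
  rw [sub_sub_cancel, smul_smul, inv_mul_cancel₀ hs0.ne', one_smul] at h2
  have : 0 < s ^ (p / (p - 1)) * u y := by positivity
  linarith

lemma hasCompactSupport (h : Sol H p Ω u q) : HasCompactSupport u :=
  HasCompactSupport.intro h.bounded.isCompact_closure
    fun x hx => h.zero x fun hc => hx (subset_closure hc)

end Sol

end

section

/-- The gradient of `u` at the boundary (from inside) exists and has `H`-norm at most `C`. -/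
def BdryGrad (H : E → ℝ) (C : ℝ) (Ω : Set E) (u : E → ℝ) : Prop :=
  ∀ y ∈ frontier Ω, ∃ ξ, H ξ = C ∧ HasFDerivWithinAt u (innerSL ℝ ξ) (closure Ω) y

namespace Sol

variable {Ω' : Set (Euc N)} {u' : Euc N → ℝ} {q' : Euc N → Euc N}

lemma exists_ge_of_translate (hN : 1 ≤ N) (hH : Ip) (hp : 1 < p) (h : Sol H p Ω u q)
    (e : E) {M : ℝ} (hM : 0 < M) {x₀ : E} (hx₀ : M ≤ u x₀ - u (x₀ + e)) :
    ∃ x, ¬ (x ∈ Ω ∧ x + e ∈ Ω) ∧ M ≤ u x - u (x + e) := by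
  by_contra hc
  push Not at hc
  have h1 := h.affine hH hp one_pos (-e)
  simp only [inv_one, one_smul, sub_neg_eq_add, Real.one_rpow, one_mul] at h1
  set d : E → ℝ := fun x => u x - u (x + e) with hd
  have hdc : Continuous d := by have := h.cont; fun_prop
  set L : Set E := closure Ω ∪ closure ((fun x => x + e) ⁻¹' Ω) with hL
  have hLc : IsCompact L := h.bounded.isCompact_closure.union h1.bounded.isCompact_closure
  have hd0 : ∀ x, x ∉ L → d x = 0 := fun x hx => by
    rw [hL, mem_union, not_or] at hx
    have e1 : u (x + e) = 0 := h.zero _ fun hc => hx.2 (subset_closure hc)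
    have e2 : u x = 0 := h.zero _ fun hc => hx.1 (subset_closure hc)
    simp only [hd, e1, e2, sub_zero]
  set S : Set E := L ∩ (Ω ∩ (fun x => x + e) ⁻¹' Ω)ᶜ with hS
  have hSc : IsCompact S := hLc.inter_right (h.isOpen.inter h1.isOpen).isClosed_compl
  have key : ∃ m < M, ∀ x, x ∉ Ω ∩ (fun x => x + e) ⁻¹' Ω → d x ≤ m := by
    by_cases hne : S.Nonempty
    · obtain ⟨x1, hx1, hmax⟩ := hSc.exists_isMaxOn hne hdc.continuousOn
      refine ⟨max 0 (d x1), max_lt hM (hc x1 fun h1 h2 => hx1.2 ⟨h1, h2⟩), fun x hx => ?_⟩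
      by_cases hxL : x ∈ L
      · exact (hmax ⟨hxL, hx⟩).trans (le_max_right _ _)
      · rw [hd0 x hxL]; exact le_max_left _ _
    · refine ⟨0, hM, fun x hx => ?_⟩
      by_cases hxL : x ∈ L
      · exact absurd ⟨x, hxL, hx⟩ hne
      · rw [hd0 x hxL]
  obtain ⟨m, hmM, hm⟩ := key
  have := comparison hN hH hp h h1 hm x₀
  linarith

lemma lipschitz (hN : 1 ≤ N) (hH : Ip) (hp : 1 < p) (h : Sol H p Ω u q) (hC : 0 < C)
    (hb : BdryGrad H C Ω u) (x y : E) :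
    u x - u y ≤ C * dualNorm H (x - y) := by
  suffices hs : ∀ C' > C, u x - u y ≤ C' * dualNorm H (x - y) by
    refine le_of_forall_gt_imp_ge_of_dense fun a ha => ?_
    by_cases hxy : x = y
    · subst hxy
      simp only [sub_self, IsIpNorm.dualNorm_zero, mul_zero] at ha ⊢
      exact ha.le
    · have h0 := hH.dualNorm_pos (sub_ne_zero.2 hxy)
      have := hs (a / dualNorm H (x - y)) (by rwa [gt_iff_lt, lt_div_iff₀ h0])
      rwa [div_mul_cancel₀ _ h0.ne'] at this
  intro C' hC'
  have hC'0 : 0 < C' := hC.trans hC'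
  by_contra hxy
  push Not at hxy
  set F : E × E → ℝ := fun z => u z.1 - u z.2 - C' * dualNorm H (z.1 - z.2) with hF
  have hFc : Continuous F := by
    have := h.cont
    have := hH.continuous_dualNorm
    fun_prop
  obtain ⟨c, K, hc, hK, hbd⟩ := hH.dualNorm_exists_bounds
  obtain ⟨B, hB⟩ := h.hasCompactSupport.exists_bound_of_continuous h.cont
  obtain ⟨R, hR⟩ := h.bounded.exists_norm_le
  have hKc : IsCompact (closure Ω ×ˢ Metric.closedBall (0 : E) (|R| + |B| / (C' * c))) :=
    h.bounded.isCompact_closure.prod (isCompact_closedBall _ _)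
  have hout : ∀ z, z ∉ closure Ω ×ˢ Metric.closedBall (0 : E) (|R| + |B| / (C' * c)) →
      F z ≤ 0 := by
    intro z hz
    have hu2 := h.nonneg hH hp z.2
    have hd0 := hH.dualNorm_nonneg (z.1 - z.2)
    have hd1 : 0 ≤ C' * dualNorm H (z.1 - z.2) := by positivity
    by_cases h1 : z.1 ∈ Ω
    · have h2 : z.2 ∉ Metric.closedBall (0 : E) (|R| + |B| / (C' * c)) := fun hc =>
        hz ⟨subset_closure h1, hc⟩
      rw [mem_closedBall_zero_iff, not_le] at h2
      have h3 := hR _ h1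
      have h4 : |B| / (C' * c) ≤ ‖z.1 - z.2‖ := by
        have := norm_sub_norm_le z.2 z.1
        rw [norm_sub_rev] at this
        linarith [le_abs_self R]
      have h5 : |B| ≤ C' * dualNorm H (z.1 - z.2) := by
        rw [div_le_iff₀ (by positivity)] at h4
        calc |B| ≤ ‖z.1 - z.2‖ * (C' * c) := h4
          _ = C' * (c * ‖z.1 - z.2‖) := by ring
          _ ≤ _ := by gcongr; exact (hbd _).1
      have h6 := (le_abs_self _).trans (hB z.1)
      simp only [hF]
      linarith [le_abs_self B]
    · simp only [hF]
      rw [h.zero _ h1]; linarith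
  have hFxy : 0 < F (x, y) := by simp only [hF]; linarith
  have hmem : (x, y) ∈ closure Ω ×ˢ Metric.closedBall (0 : E) (|R| + |B| / (C' * c)) := by
    by_contra hn
    exact absurd (hout _ hn) (not_le.2 hFxy)
  obtain ⟨z₀, hz₀, hmax⟩ := hKc.exists_isMaxOn ⟨_, hmem⟩ hFc.continuousOn
  have hM0 : 0 < F z₀ := hFxy.trans_le (hmax hmem)
  have hmax' : ∀ z, F z ≤ F z₀ := fun z => by
    by_cases hz : z ∈ closure Ω ×ˢ Metric.closedBall (0 : E) (|R| + |B| / (C' * c))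
    · exact hmax hz
    · exact (hout z hz).trans hM0.le
  set e : E := z₀.2 - z₀.1 with he
  have hHe : dualNorm H (z₀.1 - z₀.2) = dualNorm H e := by
    rw [← hH.dualNorm_neg, neg_sub]
  have he0 : e ≠ 0 := by
    intro h0
    have : z₀.2 = z₀.1 := by rwa [he, sub_eq_zero] at h0
    simp only [hF, this, sub_self, IsIpNorm.dualNorm_zero, mul_zero, lt_irrefl] at hM0
  have hepos := hH.dualNorm_pos he0
  obtain ⟨x₁, hx₁, hge⟩ := h.exists_ge_of_translate hN hH hp e (M := F z₀ + C' * dualNorm H e)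
    (by positivity) (x₀ := z₀.1) (by
      have h1 : z₀.1 + e = z₀.2 := by rw [he, add_sub_cancel]
      rw [h1]
      simp only [hF, hHe, sub_add_cancel, le_refl])
  have hux₁ : 0 < u x₁ := by
    have h1 := h.nonneg hH hp (x₁ + e)
    have h2 : 0 < C' * dualNorm H e := by positivity
    linarith
  have hx₁Ω : x₁ ∈ Ω := by
    by_contra hn; rw [h.zero _ hn] at hux₁; exact lt_irrefl _ hux₁
  have hy₁ : x₁ + e ∉ Ω := fun hc => hx₁ ⟨hx₁Ω, hc⟩
  have hseg : ∀ t ∈ Icc (0:ℝ) 1, t * (C' * dualNorm H e) ≤ u (x₁ + e + t • (-e)) := by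
    intro t ht
    have h1 := hmax' (x₁, x₁ + e + t • (-e))
    have h2 : dualNorm H (x₁ - (x₁ + e + t • (-e))) = (1 - t) * dualNorm H e := by
      rw [← hH.dualNorm_smul (by linarith [ht.2]), ← hH.dualNorm_neg]
      congr 1
      module
    simp only [hF] at h1 hge
    rw [h2] at h1
    rw [h.zero _ hy₁] at hge
    linarith
  have hmemΩ : ∀ t ∈ Ioc (0:ℝ) 1, x₁ + e + t • (-e) ∈ Ω := by
    intro t ht
    by_contra hn
    have := hseg t ⟨ht.1.le, ht.2⟩
    rw [h.zero _ hn] at this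
    have h3 : 0 < t * (C' * dualNorm H e) := mul_pos ht.1 (by positivity)
    linarith
  have hline : ContinuousWithinAt (fun t : ℝ => x₁ + e + t • (-e)) (Ioc 0 1) 0 :=
    (by fun_prop : Continuous fun t : ℝ => x₁ + e + t • (-e)).continuousWithinAt
  have hcl : x₁ + e ∈ closure Ω := by
    have h0 : (0:ℝ) ∈ closure (Ioc (0:ℝ) 1) := by
      rw [closure_Ioc zero_ne_one]; exact ⟨le_rfl, zero_le_one⟩
    have := hline.mem_closure h0 (fun t ht => hmemΩ t ht)
    simpa using this
  have hfr : x₁ + e ∈ frontier Ω := by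
    rw [frontier, h.isOpen.interior_eq]; exact ⟨hcl, hy₁⟩
  obtain ⟨ξ, hξ, hder⟩ := hb _ hfr
  have hder' : HasDerivWithinAt (fun t : ℝ => u (x₁ + e + t • (-e))) ⟪ξ, -e⟫ (Icc 0 1) 0 := by
    have h1 : HasDerivWithinAt (fun t : ℝ => x₁ + e + t • (-e)) (-e) (Icc 0 1) 0 := by
      have := ((hasDerivAt_id (0:ℝ)).smul_const (-e)).const_add (x₁ + e)
      simpa using this.hasDerivWithinAt
    have h2 : HasFDerivWithinAt u (innerSL ℝ ξ) (closure Ω) (x₁ + e + (0:ℝ) • (-e)) := by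
      simpa using hder
    have := h2.comp_hasDerivWithinAt (0:ℝ) h1 (fun t ht => by
      rcases eq_or_lt_of_le ht.1 with h0 | h0
      · simpa [← h0] using hcl
      · exact subset_closure (hmemΩ t ⟨h0, ht.2⟩))
    simpa [Function.comp_def] using this
  have hslope := (hasDerivWithinAt_iff_tendsto_slope.1 hder')
  have hge2 : C' * dualNorm H e ≤ ⟪ξ, -e⟫ := by
    have : (𝓝[Icc (0:ℝ) 1 \ {0}] 0).NeBot := by
      have : Icc (0:ℝ) 1 \ {0} = Ioc 0 1 := by
        ext t; simp only [mem_diff, mem_Icc, mem_singleton_iff, mem_Ioc]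
        constructor
        · rintro ⟨⟨h1, h2⟩, h3⟩; exact ⟨lt_of_le_of_ne h1 (Ne.symm h3), h2⟩
        · rintro ⟨h1, h2⟩; exact ⟨⟨h1.le, h2⟩, h1.ne'⟩
      rw [this]
      exact left_nhdsWithin_Ioc_neBot zero_lt_one
    refine ge_of_tendsto hslope ?_
    filter_upwards [self_mem_nhdsWithin] with t ht
    have ht0 : 0 < t := lt_of_le_of_ne ht.1.1 (Ne.symm ht.2)
    rw [slope_def_field, sub_zero, zero_smul, add_zero, h.zero _ hy₁, sub_zero,
      le_div_iff₀ ht0, mul_comm]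
    exact hseg t ht.1
  have h9 := hH.inner_le_dualNorm (-e) ξ
  rw [hH.dualNorm_neg, hξ, real_inner_comm] at h9
  have h10 : dualNorm H e * C < C' * dualNorm H e := by
    rw [mul_comm]; exact mul_lt_mul_of_pos_right hC' hepos
  linarith

lemma norm_le (hN : 1 ≤ N) (hH : Ip) (hp : 1 < p) (h : Sol H p Ω u q) (hC : 0 < C)
    (hb : BdryGrad H C Ω u) (x : E) : H (q x) ≤ C := by
  by_cases hx : x ∈ Ω
  · refine hH.le_of_inner_le hp hC.le fun d => ?_
    have h1 : HasDerivAt (fun t : ℝ => u (x + t • d)) ⟪q x, d⟫ 0 := by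
      have h2 : HasDerivAt (fun t : ℝ => x + t • d) d 0 := by
        have := ((hasDerivAt_id (0:ℝ)).smul_const d).const_add x
        simpa using this
      have h3 : HasFDerivAt u (innerSL ℝ (q x)) (x + (0:ℝ) • d) := by simpa using h.grad x hx
      simpa [Function.comp_def] using h3.comp_hasDerivAt (0:ℝ) h2
    have h4 := (hasDerivAt_iff_tendsto_slope.1 h1).mono_left
      (nhdsWithin_mono (0:ℝ) (fun t (ht : 0 < t) => ht.ne') : 𝓝[Ioi 0] (0:ℝ) ≤ 𝓝[≠] 0)
    refine le_of_tendsto h4 ?_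
    filter_upwards [self_mem_nhdsWithin] with t ht
    have ht : 0 < t := ht
    rw [slope_def_field, sub_zero, zero_smul, add_zero, div_le_iff₀ ht]
    have h5 := h.lipschitz hN hH hp hC hb (x + t • d) x
    rw [add_sub_cancel_left, hH.dualNorm_smul ht.le] at h5
    linarith
  · rw [h.q_zero x hx, hH.map_zero]; exact hC.le

end Sol

/-- A weak solution with the full regularity obtained from comparison arguments. -/
structure RSol (H : E → ℝ) (p : ℝ) (Ω : Set E) (u : E → ℝ) (q : E → E) (C : ℝ)
    : Prop extends Sol H p Ω u q where
  pos : ∀ x ∈ Ω, 0 < u x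
  C_pos : 0 < C
  le : ∀ x, H (q x) ≤ C
  lip : ∀ x y, u x - u y ≤ C * dualNorm H (x - y)
  meas : Measurable q
  bdry : BdryGrad H C Ω u

lemma IsInteriorSol.exists_rSol (hN : 1 ≤ N) (hp : 1 < p) (hΩ : IsOpen Ω)
    (hb : Bornology.IsBounded Ω) (hH : Ip) (hu : IsInteriorSol H p Ω u) (hC : 0 < C)
    (hover : ∀ x ∈ frontier Ω, H (gradient u x) = C) :
    RSol H p Ω (Ω.indicator u) (Ω.indicator (gradient u)) C := by
  classical
  have hm : Measurable (Ω.indicator (gradient u)) := by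
    refine Measurable.indicator ?_ hΩ.measurableSet
    exact (InnerProductSpace.toDual ℝ (E)).symm.continuous.measurable.comp
      (measurable_fderiv ℝ u)
  have hS : Sol H p Ω (Ω.indicator u) (Ω.indicator (gradient u)) :=
    { isOpen := hΩ
      bounded := hb
      cont := continuous_indicator hu.bdry hu.contOn
      zero := fun x hx => indicator_of_notMem hx _
      grad := fun x hx => by
        have h1 : HasFDerivAt u (innerSL ℝ (gradient u x)) x := (hu.diff x hx).hasGradientAt
        rw [indicator_of_mem hx]
        refine h1.congr_of_eventuallyEq ?_
        filter_upwards [hΩ.mem_nhds hx] with y hy using indicator_of_mem hy _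
      q_zero := fun x hx => indicator_of_notMem hx _
      q_memLp := by
        obtain ⟨c, K, hc, hK, hbd⟩ := hH.exists_bounds
        have hp0 : 0 < p := by linarith
        rw [← integrable_norm_rpow_iff hm.aestronglyMeasurable
          (by simp [hp0]) ENNReal.ofReal_ne_top, ENNReal.toReal_ofReal hp0.le]
        have h1 := (hu.int_grad.integrable_indicator hΩ.measurableSet).const_mul ((c ^ p)⁻¹)
        refine h1.mono' (hm.norm.pow_const p).aestronglyMeasurable
          (of_forall fun x => ?_)
        rw [Real.norm_of_nonneg (by positivity)]
        by_cases hx : x ∈ Ω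
        · rw [indicator_of_mem hx, indicator_of_mem hx, ← div_eq_inv_mul,
            le_div_iff₀ (by positivity), mul_comm, ← Real.mul_rpow hc.le (norm_nonneg _)]
          exact Real.rpow_le_rpow (by positivity) (hbd _).1 hp0.le
        · rw [indicator_of_notMem hx, indicator_of_notMem hx, norm_zero,
            Real.zero_rpow hp0.ne', mul_zero]
      weak := fun φ h1 h2 h3 => by
        have h4 := hu.weak φ h1 h2 h3
        rw [one_mul, ← setIntegral_eq_integral_of_forall_compl_eq_zero (s := Ω)
          (f := φ) (fun x hx => image_eq_zero_of_notMem_tsupport fun hc => hx (h3 hc)), ← h4,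
          ← setIntegral_eq_integral_of_forall_compl_eq_zero (s := Ω)
          (f := fun x => Df φ x (∇V (Ω.indicator (gradient u) x)))
          (fun x hx => by rw [indicator_of_notMem hx, hH.stress_zero hp, map_zero])]
        refine setIntegral_congr_fun hΩ.measurableSet fun x hx => ?_
        have h5 : HasFDerivAt φ (innerSL ℝ (gradient φ x)) x :=
          (h1.differentiable one_ne_zero x).hasGradientAt
        simp only [indicator_of_mem hx]
        rw [hH.stress_eq hp, h5.fderiv, map_smul, innerSL_apply_apply, smul_eq_mul,
          real_inner_comm] }
  have hbd : BdryGrad H C Ω (Ω.indicator u) := fun y hy => by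
    have hd : DifferentiableAt ℝ u y := by
      by_contra hn
      have h1 := hover y hy
      have h0 : gradient u y = 0 := by simp [gradient, fderiv_zero_of_not_differentiableAt hn]
      rw [h0, hH.map_zero] at h1
      exact hC.ne h1
    refine ⟨gradient u y, hover y hy, ?_⟩
    have h1 : HasFDerivAt u (innerSL ℝ (gradient u y)) y := hd.hasGradientAt
    have hyn : y ∉ Ω := by
      rw [frontier, hΩ.interior_eq] at hy; exact hy.2
    refine h1.hasFDerivWithinAt.congr (fun x hx => ?_)
      ((indicator_of_notMem hyn u).trans (hu.bdry y hy).symm)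
    by_cases hxΩ : x ∈ Ω
    · exact indicator_of_mem hxΩ u
    · rw [indicator_of_notMem hxΩ, hu.bdry x]
      rw [frontier, hΩ.interior_eq]; exact ⟨hx, hxΩ⟩
  exact
    { toSol := hS
      pos := fun x hx => hS.pos hN hH hp hx
      C_pos := hC
      le := hS.norm_le hN hH hp hC hbd
      lip := hS.lipschitz hN hH hp hC hbd
      meas := hm
      bdry := hbd }

end

set_option hygiene false in
local notation "RS" => RSol H p Ω u q C

lemma eLpNorm_two_eq {Z F : Type*} [MeasurableSpace Z] {μ : Measure Z} [NormedAddCommGroup F]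
    {f : Z → F} (hf : MemLp f 2 μ) :
    eLpNorm f 2 μ = ENNReal.ofReal (√(∫ x, ‖f x‖ ^ 2 ∂μ)) := by
  rw [hf.eLpNorm_eq_integral_rpow_norm two_ne_zero ENNReal.ofNat_ne_top, ENNReal.toReal_ofNat,
    Real.sqrt_eq_rpow, one_div]
  simp only [Real.rpow_ofNat]

lemma integrable_norm_sq {Z F : Type*} [MeasurableSpace Z] {μ : Measure Z}
    [NormedAddCommGroup F] {f : Z → F} (hf : MemLp f 2 μ) : Integrable (fun x => ‖f x‖ ^ 2) μ :=
  (memLp_two_iff_integrable_sq_norm hf.1).1 hf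

lemma integrable_norm_sq_sub {Z F : Type*} [MeasurableSpace Z] {μ : Measure Z}
    [NormedAddCommGroup F] {f g : Z → F} (hf : MemLp f 2 μ) (hg : MemLp g 2 μ) :
    Integrable (fun x => ‖f x - g x‖ ^ 2) μ :=
  integrable_norm_sq (hf.sub hg)

lemma integrable_norm_sq_add {Z F : Type*} [MeasurableSpace Z] {μ : Measure Z}
    [NormedAddCommGroup F] {f g : Z → F} (hf : MemLp f 2 μ) (hg : MemLp g 2 μ) :
    Integrable (fun x => ‖f x + g x‖ ^ 2) μ :=
  integrable_norm_sq (hf.add hg)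

lemma integral_norm_sq_le {Z F : Type*} [MeasurableSpace Z] {μ : Measure Z}
    [NormedAddCommGroup F] {f : Z → F} (hf : MemLp f 2 μ) {M : ℝ} (hM : 0 ≤ M)
    (h : eLpNorm f 2 μ ≤ ENNReal.ofReal M) : ∫ x, ‖f x‖ ^ 2 ∂μ ≤ M ^ 2 := by
  rw [eLpNorm_two_eq hf, ENNReal.ofReal_le_ofReal_iff hM] at h
  exact (Real.sqrt_le_left hM).1 h

lemma tendsto_eLpNorm_two {ι Z F : Type*} [MeasurableSpace Z] {μ : Measure Z}
    [NormedAddCommGroup F] {l : Filter ι} {f : ι → Z → F} (hf : ∀ n, MemLp (f n) 2 μ)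
    (h : Tendsto (fun n => ∫ x, ‖f n x‖ ^ 2 ∂μ) l (𝓝 0)) :
    Tendsto (fun n => eLpNorm (f n) 2 μ) l (𝓝 0) := by
  have h1 : Tendsto (fun n => ENNReal.ofReal (√(∫ x, ‖f n x‖ ^ 2 ∂μ))) l (𝓝 0) := by
    have h2 := ENNReal.tendsto_ofReal ((Real.continuous_sqrt.tendsto 0).comp h)
    simpa using h2
  refine h1.congr fun n => (eLpNorm_two_eq (hf n)).symm

lemma exists_lim_of_cauchy_two {Z F : Type*} [MeasurableSpace Z] {μ : Measure Z}
    [NormedAddCommGroup F] [CompleteSpace F] {f : ℕ → Z → F} (hf : ∀ n, MemLp (f n) 2 μ)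
    {b : ℕ → ℝ} (hb : Tendsto b atTop (𝓝 0))
    (h : ∀ n m, n ≤ m → ∫ x, ‖f m x - f n x‖ ^ 2 ∂μ ≤ b n) :
    ∃ g, MemLp g 2 μ ∧ Tendsto (fun n => eLpNorm (fun x => f n x - g x) 2 μ) atTop (𝓝 0) := by
  have hc : CauchySeq fun n => (hf n).toLp (f n) := by
    have hb0 : ∀ n, 0 ≤ b n := fun n => (integral_nonneg fun x => by positivity).trans (h n n le_rfl)
    refine cauchySeq_of_le_tendsto_0 (fun n => 2 * √(b n)) (fun n m k hn hm => ?_) ?_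
    · have key : ∀ n, k ≤ n → dist ((hf n).toLp (f n)) ((hf k).toLp (f k)) ≤ √(b k) := by
        intro n hn
        rw [dist_eq_norm, ← MemLp.toLp_sub, Lp.norm_toLp, eLpNorm_two_eq ((hf n).sub (hf k)),
          ENNReal.toReal_ofReal (Real.sqrt_nonneg _)]
        exact Real.sqrt_le_sqrt (h k n hn)
      calc _ ≤ _ := dist_triangle_right _ _ ((hf k).toLp (f k))
        _ ≤ √(b k) + √(b k) := add_le_add (key n hn) (key m hm)
        _ = _ := by ring
    · have h2 := ((Real.continuous_sqrt.tendsto 0).comp hb).const_mul 2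
      simpa using h2
  obtain ⟨g, hg⟩ := cauchySeq_tendsto_of_complete hc
  refine ⟨g, Lp.memLp g, ?_⟩
  have h3 := (Lp.tendsto_Lp_iff_tendsto_eLpNorm' _ _).1 hg
  refine h3.congr fun n => eLpNorm_congr_ae ?_
  filter_upwards [(hf n).coeFn_toLp] with x hx
  rw [Pi.sub_apply, hx]

lemma dual_parallelogram (a b : E →L[ℝ] ℝ) :
    ‖a - b‖ ^ 2 + ‖a + b‖ ^ 2 = 2 * ‖a‖ ^ 2 + 2 * ‖b‖ ^ 2 := by
  have h := parallelogram_law_with_norm ℝ ((InnerProductSpace.toDual ℝ (E)).symm a)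
    ((InnerProductSpace.toDual ℝ (E)).symm b)
  rw [← map_sub, ← map_add] at h
  simp only [LinearIsometryEquiv.norm_map] at h
  nlinarith

set_option maxHeartbeats 1000000 in
/-- Approximations of `w` by uniformly bounded `C¹` functions supported in a fixed compact set,
with bounded energy, can be improved to approximations converging in `H¹`. -/
lemma Sob.of_bounded_energy (hK : IsCompact K) {w : E → ℝ} (hw : MemLp w 2) {M : ℝ}
    (h : ∀ ε > 0, ∃ f : E → ℝ, ContDiff ℝ 1 f ∧ (∀ x, x ∉ K → f x = 0) ∧ (∀ x, ‖f x‖ ≤ B) ∧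
      ∫ x, ‖Df f x‖ ^ 2 ≤ M ∧ ∫ x, ‖f x - w x‖ ^ 2 ≤ ε) :
    ∃ W, Sob K w W := by
  set S : ℕ → Set (E → ℝ) := fun n => {f | ContDiff ℝ 1 f ∧ (∀ x, x ∉ K → f x = 0) ∧
    (∀ x, ‖f x‖ ≤ B) ∧ ∫ x, ‖f x - w x‖ ^ 2 ≤ 1 / ((n:ℝ) + 1)} with hS
  set J : (E → ℝ) → ℝ := fun f => ∫ x, ‖Df f x‖ ^ 2 with hJ
  have hJ0 : ∀ f, 0 ≤ J f := fun f => integral_nonneg fun x => by positivity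
  have hbdd : ∀ n, BddBelow (J '' S n) := fun n => ⟨0, by rintro _ ⟨f, -, rfl⟩; exact hJ0 f⟩
  have hε : ∀ n : ℕ, (0:ℝ) < 1 / ((n:ℝ) + 1) := fun n => by positivity
  have hne : ∀ n, ∃ f ∈ S n, J f ≤ M := fun n => by
    obtain ⟨f, h1, h2, h3, h4, h5⟩ := h _ (hε n)
    exact ⟨f, ⟨h1, h2, h3, h5⟩, h4⟩
  have hSm : ∀ n m, n ≤ m → S m ⊆ S n := fun n m hnm f hf =>
    ⟨hf.1, hf.2.1, hf.2.2.1, hf.2.2.2.trans (by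
      have : (n:ℝ) ≤ m := by exact_mod_cast hnm
      gcongr)⟩
  set d : ℕ → ℝ := fun n => sInf (J '' S n) with hd
  have hdM : ∀ n, d n ≤ M := fun n => by
    obtain ⟨f, hf, hfM⟩ := hne n
    exact (csInf_le (hbdd n) ⟨f, hf, rfl⟩).trans hfM
  have hdm : Monotone d := fun n m hnm => by
    obtain ⟨f, hf, -⟩ := hne m
    exact csInf_le_csInf (hbdd n) ⟨_, f, hf, rfl⟩ (image_mono (hSm n m hnm))
  have hdb : BddAbove (range d) := ⟨M, by rintro _ ⟨n, rfl⟩; exact hdM n⟩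
  have hdt := tendsto_atTop_ciSup hdm hdb
  set D := ⨆ n, d n with hD
  have hdD : ∀ n, d n ≤ D := fun n => le_ciSup hdb n
  have hch : ∀ n, ∃ f ∈ S n, J f < d n + 1 / ((n:ℝ) + 1) := fun n => by
    obtain ⟨f, hf, -⟩ := hne n
    obtain ⟨_, ⟨g, hg, rfl⟩, hlt⟩ := exists_lt_of_csInf_lt (s := J '' S n) ⟨_, f, hf, rfl⟩
      (lt_add_of_pos_right (d n) (hε n))
    exact ⟨g, hg, hlt⟩
  choose f hfS hfJ using hch
  have hfm : ∀ n, MemLp (Df (f n)) 2 := fun n =>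
    contDiff_memLp_fderiv hK (hfS n).1 (hfS n).2.1 2
  have hf2 : ∀ n, MemLp (f n) 2 := fun n => memLp_of_bound_of_eq_zero hK
    (hfS n).1.continuous.aestronglyMeasurable (of_forall (hfS n).2.2.1)
    (of_forall (hfS n).2.1) 2
  have hcau : ∀ n m, n ≤ m → ∫ x, ‖Df (f m) x - Df (f n) x‖ ^ 2
      ≤ 2 * (D - d n) + 4 * (1 / ((n:ℝ) + 1)) := by
    intro n m hnm
    have hmS := hSm n m hnm (hfS m)
    have hadd : ∀ x, Df (fun x => (1/2:ℝ) * (f m x + f n x)) x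
        = (1/2:ℝ) • (Df (f m) x + Df (f n) x) := fun x => by
      have h1 := ((hfS m).1.differentiable one_ne_zero x).hasFDerivAt
      have h2 := ((hfS n).1.differentiable one_ne_zero x).hasFDerivAt
      exact ((h1.add h2).const_mul (1/2:ℝ)).fderiv
    have hmid : (fun x => (1/2:ℝ) * (f m x + f n x)) ∈ S n := by
      refine ⟨contDiff_const.mul ((hfS m).1.add (hfS n).1), fun x hx => ?_, fun x => ?_, ?_⟩
      · show (1/2:ℝ) * (f m x + f n x) = 0
        rw [(hfS m).2.1 x hx, (hfS n).2.1 x hx]; norm_num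
      · have h1 := hmS.2.2.1 x
        have h2 := (hfS n).2.2.1 x
        rw [Real.norm_eq_abs, abs_le] at *
        constructor <;> linarith
      · have i1 := integrable_norm_sq_sub (hf2 m) hw
        have i2 := integrable_norm_sq_sub (hf2 n) hw
        have i3 : Integrable fun x => (1/2:ℝ) * ‖f m x - w x‖ ^ 2 + (1/2:ℝ) * ‖f n x - w x‖ ^ 2 :=
          (i1.const_mul _).add (i2.const_mul _)
        calc ∫ x, ‖(1/2:ℝ) * (f m x + f n x) - w x‖ ^ 2
            ≤ ∫ x, ((1/2:ℝ) * ‖f m x - w x‖ ^ 2 + (1/2:ℝ) * ‖f n x - w x‖ ^ 2) := by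
              refine integral_mono_of_nonneg (of_forall fun x => by positivity) i3
                (of_forall fun x => ?_)
              simp only [Real.norm_eq_abs, sq_abs]
              nlinarith [sq_nonneg (f m x - f n x)]
          _ = (1/2:ℝ) * (∫ x, ‖f m x - w x‖ ^ 2) + (1/2:ℝ) * (∫ x, ‖f n x - w x‖ ^ 2) := by
              rw [← integral_const_mul, ← integral_const_mul]
              exact integral_add (i1.const_mul _) (i2.const_mul _)
          _ ≤ _ := by
              have h1 := hmS.2.2.2
              have h2 := (hfS n).2.2.2
              linarith
    have hJmid : d n ≤ J (fun x => (1/2:ℝ) * (f m x + f n x)) := csInf_le (hbdd n) ⟨_, hmid, rfl⟩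
    have i1 := integrable_norm_sq_sub (hfm m) (hfm n)
    have i2 := integrable_norm_sq_add (hfm m) (hfm n)
    have i3 := integrable_norm_sq (hfm m)
    have i4 := integrable_norm_sq (hfm n)
    have e1 : J (fun x => (1/2:ℝ) * (f m x + f n x))
        = (1/4:ℝ) * ∫ x, ‖Df (f m) x + Df (f n) x‖ ^ 2 := by
      rw [hJ, ← integral_const_mul]
      refine integral_congr_ae (of_forall fun x => ?_)
      simp only [hadd, norm_smul, mul_pow]
      norm_num
    have e2 : (∫ x, ‖Df (f m) x - Df (f n) x‖ ^ 2)
        + (∫ x, ‖Df (f m) x + Df (f n) x‖ ^ 2) = 2 * J (f m) + 2 * J (f n) := by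
      rw [hJ, ← integral_add i1 i2, ← integral_const_mul, ← integral_const_mul,
        ← integral_add (i3.const_mul _) (i4.const_mul _)]
      exact integral_congr_ae (of_forall fun x => dual_parallelogram _ _)
    have h1 := hfJ m
    have h2 := hfJ n
    have h3 := hdD m
    have h4 : 1 / ((m:ℝ) + 1) ≤ 1 / ((n:ℝ) + 1) := by
      have : (n:ℝ) ≤ m := by exact_mod_cast hnm
      gcongr
    linarith
  have hlim0 : Tendsto (fun n : ℕ => 1 / ((n:ℝ) + 1)) atTop (𝓝 0) :=
    tendsto_one_div_add_atTop_nhds_zero_nat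
  obtain ⟨W, hW, hWt⟩ := exists_lim_of_cauchy_two hfm (b := fun n =>
    2 * (D - d n) + 4 * (1 / ((n:ℝ) + 1))) (by
      have h1 := ((hdt.const_sub D).const_mul 2).add (hlim0.const_mul 4)
      simpa using h1) hcau
  have hft : Tendsto (fun n => eLpNorm (f n - w) 2) atTop (𝓝 0) :=
    tendsto_eLpNorm_two (fun n => (hf2 n).sub hw)
      (squeeze_zero (fun n => integral_nonneg fun x => by positivity)
        (fun n => (hfS n).2.2.2) hlim0)
  obtain ⟨ns, hns, hae⟩ := (tendstoInMeasure_of_tendsto_eLpNorm two_ne_zero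
    (fun n => (hf2 n).1) hw.1 hft).exists_seq_tendsto_ae
  exact ⟨W, hK, hW, B, fun n => f (ns n), fun n => (hfS _).1, fun n => (hfS _).2.1,
    fun n => (hfS _).2.2.1, hae, hWt.comp hns.tendsto_atTop⟩

lemma memLp_clm_apply {α F G : Type*} [MeasurableSpace α] {μ : Measure α} [NormedAddCommGroup F]
    [NormedSpace ℝ F] [NormedAddCommGroup G] [NormedSpace ℝ G] {Φ : α → F →L[ℝ] G}
    (hΦ : MemLp Φ r μ) (v : F) : MemLp (fun x => Φ x v) r μ :=
  hΦ.of_le_mul (c := ‖v‖)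
    ((ContinuousLinearMap.apply ℝ G v).continuous.comp_aestronglyMeasurable hΦ.1)
    (of_forall fun x => by rw [mul_comm]; exact (Φ x).le_opNorm v)

lemma dual_norm_sq_eq (L : E →L[ℝ] ℝ) :
    ‖L‖ ^ 2 = ∑ i, (L (𝐞 i)) ^ 2 := by
  set g := (InnerProductSpace.toDual ℝ (E)).symm L with hg
  have h1 : ‖L‖ = ‖g‖ := by rw [hg, LinearIsometryEquiv.norm_map]
  have h2 : ∀ v, L v = ⟪g, v⟫ := fun v => by
    rw [hg, InnerProductSpace.toDual_symm_apply]
  rw [h1, EuclideanSpace.norm_sq_eq]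
  refine Finset.sum_congr rfl fun i _ => ?_
  rw [h2, EuclideanSpace.inner_single_right]
  simp

lemma mollify_translate_sub (n : ℕ) {w : E → ℝ} (hw : LocallyIntegrable w) (v x : E) :
    mollify n w (x + v) - mollify n w x = mollify n (fun y => w (y + v) - w y) x := by
  rw [mollify_apply, mollify_apply, mollify_apply, ← integral_sub
    (integrable_normed_smul_comp n hw _) (integrable_normed_smul_comp n hw _)]
  refine integral_congr_ae (of_forall fun z => ?_)
  simp only [smul_sub]
  rw [show x + v - z = x - z + v by abel]

lemma eLpNorm_fderiv_apply_le {f : E → ℝ} (hf : Differentiable ℝ f) {M : ℝ}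
    (h : ∀ v, eLpNorm (fun x => f (x + v) - f x) 2 ≤ ENNReal.ofReal (M * ‖v‖)) (v : E) :
    eLpNorm (fun x => Df f x v) 2 ≤ ENNReal.ofReal (M * ‖v‖) := by
  have hc := hf.continuous
  have hlim : ∀ x, Tendsto (fun k : ℕ => ((k:ℝ) + 1) • (f (x + (((k:ℝ) + 1)⁻¹) • v) - f x)) atTop
      (𝓝 (Df f x v)) := by
    intro x
    have h1 : HasDerivAt (fun t : ℝ => f (x + t • v)) (Df f x v) 0 := by
      have h2 : HasDerivAt (fun t : ℝ => x + t • v) v 0 := by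
        have := ((hasDerivAt_id (0:ℝ)).smul_const v).const_add x
        simpa using this
      have h3 : HasFDerivAt f (Df f x) (x + (0:ℝ) • v) := by
        simpa using (hf x).hasFDerivAt
      simpa [Function.comp_def] using h3.comp_hasDerivAt (0:ℝ) h2
    have h4 := hasDerivAt_iff_tendsto_slope.1 h1
    have h5 : Tendsto (fun k : ℕ => ((k:ℝ) + 1)⁻¹) atTop (𝓝[≠] 0) := by
      refine tendsto_nhdsWithin_iff.2 ⟨?_, of_forall fun k => ?_⟩
      · simpa only [one_div] using tendsto_one_div_add_atTop_nhds_zero_nat (𝕜 := ℝ)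
      · have : (0:ℝ) < ((k:ℝ) + 1)⁻¹ := by positivity
        exact this.ne'
    refine (h4.comp h5).congr fun k => ?_
    simp only [Function.comp_apply, slope_def_field, sub_zero, zero_smul, add_zero, smul_eq_mul]
    rw [div_inv_eq_mul, mul_comm]
  refine (Lp.eLpNorm_lim_le_liminf_eLpNorm (p := 2)
    (f := fun (k : ℕ) x => ((k:ℝ) + 1) • (f (x + (((k:ℝ) + 1)⁻¹) • v) - f x))
    (fun k => by fun_prop) _ (of_forall hlim)).trans ?_
  refine liminf_le_of_le (by isBoundedDefault) fun b hb => ?_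
  obtain ⟨k, hk⟩ := hb.exists
  refine hk.trans ?_
  have hk0 : (0:ℝ) < (k:ℝ) + 1 := by positivity
  have e : (fun x => ((k:ℝ) + 1) • (f (x + (((k:ℝ) + 1)⁻¹) • v) - f x))
    = ((k:ℝ) + 1) • fun x => (f (x + (((k:ℝ) + 1)⁻¹) • v) - f x) := rfl
  rw [e, eLpNorm_const_smul, Real.enorm_eq_ofReal hk0.le]
  calc _ ≤ ENNReal.ofReal ((k:ℝ) + 1) * ENNReal.ofReal (M * ‖(((k:ℝ) + 1)⁻¹) • v‖) := by
        gcongr; exact h _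
    _ = _ := by
        rw [← ENNReal.ofReal_mul hk0.le, norm_smul, Real.norm_of_nonneg (by positivity)]
        congr 1
        field_simp

lemma Sob.exists_of_translate (hK : IsCompact K) {δ : ℝ} (hδ : 0 < δ) {w : E → ℝ}
    (hw : StronglyMeasurable w) (h0 : ∀ x, x ∉ K → w x = 0) {M : ℝ} (hB : ∀ x, ‖w x‖ ≤ B)
    (hM : 0 ≤ M) (h : ∀ v, eLpNorm (fun x => w (x + v) - w x) 2 ≤ ENNReal.ofReal (M * ‖v‖)) :
    ∃ W, Sob (Metric.cthickening δ K) w W := by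
  have hw2 : MemLp w 2 := memLp_of_bound_of_eq_zero hK hw.aestronglyMeasurable
    (of_forall hB) (of_forall h0) 2
  have hli : LocallyIntegrable w := hw2.locallyIntegrable one_le_two
  have hK' : IsCompact (Metric.cthickening δ K) := hK.cthickening
  refine Sob.of_bounded_energy hK' hw2 (B := B) (M := N * M ^ 2) fun ε hε => ?_
  obtain ⟨n1, hn1⟩ := eventually_atTop.1
    ((tendsto_order.1 (tendsto_bumpSeq_rOut (N := N))).2 δ hδ)
  have ht := tendsto_eLpNorm_mollify_sub hw (r := 2) one_le_two ENNReal.ofNat_ne_top hw2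
  obtain ⟨n2, hn2⟩ := eventually_atTop.1 ((tendsto_order.1 ht).2 (ENNReal.ofReal (√ε))
    (ENNReal.ofReal_pos.2 (Real.sqrt_pos.2 hε)))
  set n := max n1 n2
  have hc : ContDiff ℝ 1 (mollify n w) := contDiff_mollify n hli (k := 1)
  have hz : ∀ x, x ∉ Metric.cthickening δ K → mollify n w x = 0 := fun x hx =>
    mollify_eq_zero_of_notMem_cthickening h0 (hn1 n (le_max_left _ _)).le hx
  have hm2 : MemLp (mollify n w) 2 := memLp_of_bound_of_eq_zero hK'
    hc.continuous.aestronglyMeasurable (of_forall (norm_mollify_le n hB))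
    (of_forall hz) 2
  refine ⟨mollify n w, hc, hz, norm_mollify_le n hB, ?_, ?_⟩
  · have hd : ∀ v, eLpNorm (fun x => mollify n w (x + v) - mollify n w x) 2
        ≤ ENNReal.ofReal (M * ‖v‖) := fun v => by
      simp_rw [mollify_translate_sub n hli v]
      have hs : StronglyMeasurable fun y => w (y + v) - w y :=
        (hw.comp_measurable (measurable_add_const v)).sub hw
      exact (eLpNorm_mollify_le n hs one_le_two ENNReal.ofNat_ne_top).trans (h v)
    have hg := contDiff_memLp_fderiv hK' hc hz 2
    have hgi : ∀ v, MemLp (fun x => Df (mollify n w) x v) 2 := memLp_clm_apply hg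
    calc ∫ x, ‖Df (mollify n w) x‖ ^ 2
        = ∫ x, ∑ i, ‖Df (mollify n w) x (𝐞 i)‖ ^ 2 := by
          refine integral_congr_ae (of_forall fun x => ?_)
          simp only [Real.norm_eq_abs, sq_abs]
          exact dual_norm_sq_eq _
      _ = ∑ i, ∫ x, ‖Df (mollify n w) x (𝐞 i)‖ ^ 2 :=
          integral_finsetSum _ fun i _ => integrable_norm_sq (hgi _)
      _ ≤ ∑ i : Fin N, M ^ 2 := by
          refine Finset.sum_le_sum fun i _ => ?_
          refine integral_norm_sq_le (hgi _) hM ?_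
          have := eLpNorm_fderiv_apply_le (hc.differentiable one_ne_zero) hd
            (𝐞 i)
          simpa using this
      _ = N * M ^ 2 := by simp
  · have h3 := integral_norm_sq_le (hm2.sub hw2) (Real.sqrt_nonneg ε)
      (hn2 n (le_max_right _ _)).le
    rw [Real.sq_sqrt hε.le] at h3
    exact h3

/-- Smooth cut-off of `G` near the origin: vanishes where `V ≤ b`, equals `G` where `V ≥ 2b`. -/
def trunc (H : E → ℝ) (p b : ℝ) (G : E → F) (ξ : E) : F :=
  Real.smoothTransition (V ξ / b - 1) • G ξ

section trunc

lemma trunc_of_le (hb : 0 < b) (h : V ξ ≤ b) : trunc H p b G ξ = 0 := by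
  rw [trunc, Real.smoothTransition.zero_of_nonpos, zero_smul]
  rw [sub_nonpos, div_le_one hb]; exact h

lemma trunc_of_ge (hb : 0 < b) (h : 2 * b ≤ V ξ) :
    trunc H p b G ξ = G ξ := by
  rw [trunc, Real.smoothTransition.one_of_one_le, one_smul]
  rw [le_sub_iff_add_le, le_div_iff₀ hb]; linarith

lemma trunc_zero (hH : Ip) (hp : 1 < p) (hb : 0 < b) : trunc H p b G 0 = 0 :=
  trunc_of_le hb (by rw [hH.V_zero hp]; exact hb.le)

lemma contDiff_trunc (hH : Ip) (hp : 1 < p) (hb : 0 < b)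
    (hG : ∀ ξ, ξ ≠ 0 → ContDiffAt ℝ 1 G ξ) : ContDiff ℝ 1 (trunc H p b G) := by
  rw [contDiff_iff_contDiffAt]
  intro ξ
  by_cases h : ξ = 0
  · subst h
    have h1 : ∀ᶠ y in 𝓝 (0 : E), V y < b :=
      (hH.V_continuous hp).continuousAt.eventually (gt_mem_nhds (by rw [hH.V_zero hp]; exact hb))
    exact (contDiffAt_const (c := (0:F))).congr_of_eventuallyEq
      (h1.mono fun y hy => trunc_of_le hb hy.le)
  · have h1 : ContDiffAt ℝ 1 (V) ξ :=
      (hH.Vsmooth.contDiffAt (isOpen_compl_singleton.mem_nhds h)).of_le (by norm_num)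
    exact (Real.smoothTransition.contDiff.contDiffAt.comp ξ
      ((h1.div_const b).sub contDiffAt_const)).smul (hG ξ h)

end trunc

namespace IsIpNorm

lemma trunc_id_sq_le (hH : Ip) (hp : 1 < p) (ha : 0 < a) (L : ℝ) :
    ∃ K > 0, ∀ ξ η : E, H ξ ≤ L → H η ≤ L →
      ‖trunc H p a id η - trunc H p a id ξ‖ ^ 2
        ≤ K * ⟪∇V η - ∇V ξ, η - ξ⟫ := by
  obtain ⟨c, K, hc, hK, hbd⟩ := hH.exists_bounds
  have hΓ : ContDiff ℝ 1 (trunc H p a (id : E → E)) :=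
    contDiff_trunc hH hp ha fun ξ _ => contDiffAt_id
  set R := max (L / c) 1 with hR
  have hRb : ∀ ξ : E, H ξ ≤ L → ‖ξ‖ ≤ R := fun ξ hξ =>
    ((le_div_iff₀ hc).2 (by rw [mul_comm]; exact (hbd ξ).1.trans hξ)).trans (le_max_left _ _)
  obtain ⟨Λ, hΛ⟩ := (isCompact_closedBall (0 : E) R).exists_bound_of_continuousOn
    (hΓ.continuous_fderiv one_ne_zero).continuousOn
  have hLip : ∀ ξ η : E, ‖ξ‖ ≤ R → ‖η‖ ≤ R →
      ‖trunc H p a id η - trunc H p a id ξ‖ ≤ Λ * ‖η - ξ‖ := fun ξ η h1 h2 =>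
    (convex_closedBall (0 : E) R).norm_image_sub_le_of_norm_fderiv_le
      (fun x _ => hΓ.differentiable one_ne_zero x) hΛ
      (mem_closedBall_zero_iff.2 h1) (mem_closedBall_zero_iff.2 h2)
  obtain ⟨r, hr, hrV⟩ : ∃ r > 0, ∀ ξ : E, a < V ξ → r ≤ ‖ξ‖ := by
    have h1 : ∀ᶠ y in 𝓝 (0 : E), V y < a :=
      (hH.V_continuous hp).continuousAt.eventually (gt_mem_nhds (by rw [hH.V_zero hp]; exact ha))
    obtain ⟨r, hr, h2⟩ := Metric.eventually_nhds_iff.1 h1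
    refine ⟨r, hr, fun ξ hξ => ?_⟩
    by_contra hc
    have := h2 (y := ξ) (by rw [dist_zero_right]; exact not_le.1 hc)
    linarith
  obtain ⟨c', hc', hco⟩ := hH.stress_coercive hp (r := r) (R := R) hr
  have key : ∀ ξ η : E, H ξ ≤ L → H η ≤ L → a < V ξ →
      ‖trunc H p a id η - trunc H p a id ξ‖ ^ 2
        ≤ ((Λ ^ 2 + 1) / c') * ⟪∇V η - ∇V ξ, η - ξ⟫ := by
    intro ξ η h1 h2 h3
    have h4 := hco ξ η (hrV ξ h3) (hRb ξ h1) (hRb η h2)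
    have h5 := hLip ξ η (hRb ξ h1) (hRb η h2)
    calc ‖trunc H p a id η - trunc H p a id ξ‖ ^ 2 ≤ (Λ * ‖η - ξ‖) ^ 2 := by gcongr
      _ ≤ (Λ ^ 2 + 1) * ‖η - ξ‖ ^ 2 := by nlinarith [sq_nonneg ‖η - ξ‖]
      _ = ((Λ ^ 2 + 1) / c') * (c' * ‖η - ξ‖ ^ 2) := by field_simp
      _ ≤ _ := by gcongr
  refine ⟨(Λ ^ 2 + 1) / c', by positivity, fun ξ η h1 h2 => ?_⟩
  by_cases h3 : a < V ξ
  · exact key ξ η h1 h2 h3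
  · by_cases h4 : a < V η
    · have := key η ξ h2 h1 h4
      rw [norm_sub_rev, ← neg_sub (∇V η), ← neg_sub η ξ, inner_neg_neg] at this
      exact this
    · rw [trunc_of_le ha (not_lt.1 h3), trunc_of_le ha (not_lt.1 h4), sub_zero, norm_zero]
      have := hH.inner_stress_sub_nonneg hp ξ η
      have hpos : 0 < (Λ ^ 2 + 1) / c' := by positivity
      nlinarith [mul_nonneg hpos.le this]

end IsIpNorm

lemma Sob.of_components (hK : IsCompact K) (h : ∀ i, ∃ W, Sob K (fun x => w x i) W)
    : ∃ W, Sob K w W := by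
  choose W hW using h
  have key : ∀ s : Finset (Fin N), ∃ Φ, Sob K
      (fun x => ∑ i ∈ s, w x i • (𝐞 i : E)) Φ := by
    intro s
    classical
    induction s using Finset.induction_on with
    | empty =>
      refine ⟨_, Sob.of_contDiff hK (φ := fun _ => (0 : E)) contDiff_const fun _ _ => rfl⟩
    | insert i s his ih =>
      obtain ⟨Φ, hΦ⟩ := ih
      have h1 := ((hW i).prodMk hΦ).clm_comp
        ((ContinuousLinearMap.fst ℝ ℝ (E)).smulRight (𝐞 i : E)
          + ContinuousLinearMap.snd ℝ ℝ (E))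
      refine ⟨_, h1.congr (of_forall fun x => ?_)
        (of_forall fun x => rfl)⟩
      show _ = ∑ j ∈ insert i s, w x j • (𝐞 j : E)
      rw [Finset.sum_insert his]
      rfl
  obtain ⟨Φ, hΦ⟩ := key Finset.univ
  refine ⟨Φ, hΦ.congr (of_forall fun x => ?_) (of_forall fun x => rfl)⟩
  ext j
  simp [Finset.sum_apply, Pi.single_apply]

/-- A `C¹` function vanishing on `(-∞, t]` has vanishing derivative there. -/
lemma deriv_eq_zero_of_vanish (hκ : ContDiff ℝ 1 κ) (h0 : ∀ s ≤ t, κ s = 0) (hs : s ≤ t)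
    : deriv κ s = 0 := by
  have h1 : ∀ s < t, deriv κ s = 0 := fun s hs => by
    have : κ =ᶠ[𝓝 s] fun _ => 0 := by
      filter_upwards [gt_mem_nhds hs] with y hy using h0 y (le_of_lt hy)
    rw [this.deriv_eq]; simp
  have hc : IsClosed {s | deriv κ s = 0} :=
    isClosed_eq (hκ.continuous_deriv le_rfl) continuous_const
  have h2 : closure (Iio t) ⊆ {s | deriv κ s = 0} := hc.closure_subset_iff.2 fun s hs => h1 s hs
  rw [closure_Iio] at h2
  exact h2 hs

lemma WeakDiv.translate {X : E → E} (h : WeakDiv Ω X c) (v : E) :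
    WeakDiv ((fun x => x + v) ⁻¹' Ω) (fun x => X (x + v)) c := by
  simpa only [inv_one, one_smul, sub_neg_eq_add] using h.affine one_pos (-v)

namespace RSol

lemma exists_norm_le (hH : Ip) (h : RS) : ∃ R > 0, ∀ x, ‖q x‖ ≤ R := by
  obtain ⟨c, K, hc, hK, hbd⟩ := hH.exists_bounds
  refine ⟨C / c, div_pos h.C_pos hc, fun x => ?_⟩
  rw [le_div_iff₀ hc, mul_comm]
  exact (hbd _).1.trans (h.le x)

lemma exists_lip (hH : Ip) (h : RS) :
    ∃ M > 0, ∀ x v, |u (x + v) - u x| ≤ M * ‖v‖ := by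
  obtain ⟨c, K, hc, hK, hbd⟩ := hH.dualNorm_exists_bounds
  have hC := h.C_pos
  refine ⟨C * K, by positivity, fun x v => ?_⟩
  have h1 := h.lip (x + v) x
  have h2 := h.lip x (x + v)
  have h3 := hbd v
  have h4 := hbd (-v)
  rw [add_sub_cancel_left] at h1
  rw [sub_add_cancel_left] at h2
  rw [norm_neg] at h4
  rw [abs_le]
  constructor
  · nlinarith
  · nlinarith

lemma isCompact_closure (h : RS) : IsCompact (closure Ω) := h.bounded.isCompact_closure

lemma memLp_q (hH : Ip) (h : RS) (r : ℝ≥0∞) : MemLp q r := by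
  obtain ⟨R, _, hR⟩ := h.exists_norm_le hH
  exact memLp_of_bound_of_eq_zero h.isCompact_closure h.meas.aestronglyMeasurable
    (of_forall hR)
    (of_forall fun x hx => h.q_zero x fun h' => hx (subset_closure h')) r

lemma meas_comp (h : RS) {F : Type*} [NormedAddCommGroup F] {G : E → F}
    (hG : Continuous G) : StronglyMeasurable fun x => G (q x) :=
  hG.comp_stronglyMeasurable h.meas.stronglyMeasurable

lemma exists_comp_bound (hH : Ip) (h : RS) {F : Type*}
    [NormedAddCommGroup F] {G : E → F} (hG : Continuous G) : ∃ B > 0, ∀ x, ‖G (q x)‖ ≤ B := by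
  obtain ⟨R, hR0, hR⟩ := h.exists_norm_le hH
  obtain ⟨B, hB⟩ := (isCompact_closedBall (0 : E) R).exists_bound_of_continuousOn hG.continuousOn
  exact ⟨max B 1, by positivity, fun x =>
    (hB _ (mem_closedBall_zero_iff.2 (hR x))).trans (le_max_left _ _)⟩

lemma memLp_comp (hH : Ip) (h : RS) [NormedSpace ℝ F] (hG : Continuous G)
    (h0 : G 0 = 0) (r : ℝ≥0∞) :
    MemLp (fun x => G (q x)) r := by
  obtain ⟨B, _, hB⟩ := h.exists_comp_bound hH hG
  exact memLp_of_bound_of_eq_zero h.isCompact_closure (h.meas_comp hG).aestronglyMeasurable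
    (of_forall hB)
    (of_forall fun x hx => by
      rw [h.q_zero x fun h' => hx (subset_closure h'), h0]) r

lemma level_subset (h : RS) (ht : 0 < t) : {x | t ≤ u x} ⊆ Ω := by
  intro x hx
  by_contra h'
  have : t ≤ u x := hx
  rw [h.zero x h'] at this
  linarith

lemma isCompact_level (h : RS) (ht : 0 < t) : IsCompact {x | t ≤ u x} :=
  h.isCompact_closure.of_isClosed_subset (isClosed_le continuous_const h.cont)
    ((h.level_subset ht).trans subset_closure)

lemma hasFDerivAt_comp (h : RS) (hκ : ContDiff ℝ 1 κ) (ht : 0 < t)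
    (h0 : ∀ s ≤ t, κ s = 0) (x : E) :
    HasFDerivAt (fun x => κ (u x)) (deriv κ (u x) • innerSL ℝ (q x)) x := by
  by_cases hx : t ≤ u x
  · have h1 := h.grad x (h.level_subset ht hx)
    exact ((hκ.differentiable one_ne_zero (u x)).hasDerivAt).comp_hasFDerivAt x h1
  · push Not at hx
    have h1 : (fun x => κ (u x)) =ᶠ[𝓝 x] fun _ => 0 := by
      filter_upwards [h.cont.continuousAt.eventually (gt_mem_nhds hx)] with y hy
        using h0 _ (le_of_lt hy)
    rw [deriv_eq_zero_of_vanish hκ h0 hx.le, zero_smul]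
    exact (hasFDerivAt_const (0:ℝ) x).congr_of_eventuallyEq h1

lemma exists_comp_u_bound (h : RS) (hκ : Continuous κ) :
    ∃ B > 0, ∀ x, |κ (u x)| ≤ B := by
  obtain ⟨B, hB⟩ := h.isCompact_closure.exists_bound_of_continuousOn
    (hκ.comp h.cont).continuousOn
  refine ⟨max B (|κ 0| + 1), by positivity, fun x => ?_⟩
  by_cases hx : x ∈ closure Ω
  · exact (hB x hx).trans (le_max_left _ _)
  · rw [h.zero x fun h' => hx (subset_closure h')]
    exact (by linarith : |κ 0| ≤ |κ 0| + 1).trans (le_max_right _ _)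

lemma exists_translate_subset (h : RS) (ht : 0 < t) :
    ∃ ε > 0, ∀ v : E, ‖v‖ ≤ ε → ∀ x, t ≤ u x → x + v ∈ Ω := by
  obtain ⟨δ, hδ, hδΩ⟩ := (h.isCompact_level ht).exists_cthickening_subset_open h.isOpen
    (h.level_subset ht)
  refine ⟨δ, hδ, fun v hv x hx => hδΩ (Metric.mem_cthickening_of_dist_le _ x _ _ hx ?_)⟩
  simpa [dist_eq_norm] using hv

set_option maxHeartbeats 1000000 in
lemma energy (hH : Ip) (hp : 1 < p) (h : RS) {η : ℝ → ℝ}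
    (hη : ContDiff ℝ 1 η) (ht : 0 < t) (h0 : ∀ s ≤ t, η s = 0) :
    ∃ ε > 0, ∃ M ≥ 0, ∀ v : E, ‖v‖ ≤ ε →
      ∫ x, η (u x) ^ 2 * ⟪∇V (q (x + v)) - ∇V (q x), q (x + v) - q x⟫
        ≤ M * ‖v‖ ^ 2 := by
  obtain ⟨ε, hε, hεΩ⟩ := h.exists_translate_subset ht
  obtain ⟨L, hL, hlip⟩ := h.exists_lip hH
  obtain ⟨K, hK, hrad⟩ := hH.stress_radial hp C
  obtain ⟨B', hB'0, hB'⟩ := h.exists_comp_u_bound (hη.continuous_deriv le_rfl)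
  obtain ⟨B, hB0, hB⟩ := h.exists_comp_u_bound hη.continuous
  obtain ⟨R, hR0, hR⟩ := h.exists_norm_le hH
  obtain ⟨RY, hRY0, hRY⟩ := h.exists_comp_bound hH (hH.continuous_stress hp)
  set lev := {x | t ≤ u x} with hlev
  have hlc : IsCompact lev := h.isCompact_level ht
  have hYm : Measurable fun x => ∇V (q x) := (h.meas_comp (hH.continuous_stress hp)).measurable
  have hY2 : MemLp (fun x => ∇V (q x)) 2 :=
    h.memLp_comp hH (hH.continuous_stress hp) (hH.stress_zero hp) 2
  refine ⟨ε, hε, 4 * K * B' ^ 2 * L ^ 2 * (volume lev).toReal, by positivity, fun v hv => ?_⟩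
  set Δq : E → E := fun x => q (x + v) - q x with hΔq
  set ΔY : E → E := fun x => ∇V (q (x + v)) - ∇V (q x) with hΔY
  set Δu : E → ℝ := fun x => u (x + v) - u x with hΔu
  have hqv : Measurable fun x => q (x + v) := h.meas.comp (measurable_id.add_const v)
  have hYv : Measurable fun x => ∇V (q (x + v)) := hYm.comp (measurable_id.add_const v)
  have hum : Measurable u := h.cont.measurable
  have hηm : Measurable fun x => η (u x) := hη.continuous.measurable.comp hum
  set φ : E → ℝ := fun x => η (u x) ^ 2 * Δu x with hφ
  have hηz : ∀ x, x ∉ lev → η (u x) = 0 := fun x hx => h0 _ (not_le.1 hx).le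
  have hdz : ∀ x, x ∉ lev → deriv η (u x) = 0 := fun x hx =>
    deriv_eq_zero_of_vanish hη h0 (not_le.1 hx).le
  have hφz : ∀ x, x ∉ lev → φ x = 0 := fun x hx => by simp [hφ, hηz x hx]
  have hφd : ∀ x, HasFDerivAt φ ((η (u x) ^ 2) • innerSL ℝ (Δq x)
      + (2 * η (u x) * deriv η (u x) * Δu x) • innerSL ℝ (q x)) x := by
    intro x
    by_cases hx : t ≤ u x
    · have h1 := (h.hasFDerivAt_comp hη ht h0 x).pow 2
      have h2 : HasFDerivAt (fun x => u (x + v)) (innerSL ℝ (q (x + v))) x :=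
        (hasFDerivAt_comp_add_right v).2 (h.grad _ (hεΩ v hv x hx))
      have h3 := h1.fun_mul (h2.fun_sub (h.grad x (h.level_subset ht hx)))
      refine h3.congr_fderiv ?_
      ext d
      simp [hΔq, hΔu, inner_sub_left]
      ring
    · have hx' : x ∉ lev := hx
      rw [hηz x hx']
      have h1 : φ =ᶠ[𝓝 x] fun _ => 0 := by
        filter_upwards [hlc.isClosed.isOpen_compl.mem_nhds hx'] with y hy using hφz y hy
      simpa using (hasFDerivAt_const (0:ℝ) x).congr_of_eventuallyEq h1
  have hDφ : Df φ = fun x => (η (u x) ^ 2) • innerSL ℝ (Δq x)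
      + (2 * η (u x) * deriv η (u x) * Δu x) • innerSL ℝ (q x) :=
    funext fun x => (hφd x).fderiv
  have hφdiff : Differentiable ℝ φ := fun x => (hφd x).differentiableAt
  have hΔub : ∀ x, |Δu x| ≤ L * ‖v‖ := fun x => hlip x v
  have hφ2 : MemLp (Df φ) 2 := by
    refine memLp_of_bound_of_eq_zero hlc (measurable_fderiv ℝ φ).aestronglyMeasurable
      (B := B ^ 2 * (R + R) + 2 * B * B' * (L * ‖v‖) * R) (of_forall fun x => ?_)
      (of_forall fun x hx => fderiv_eq_zero_of_notMem hlc.isClosed hφz hx) 2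
    rw [hDφ]
    refine (norm_add_le _ _).trans (add_le_add ?_ ?_)
    · rw [norm_smul, innerSL_apply_norm, norm_pow]
      exact mul_le_mul (pow_le_pow_left₀ (norm_nonneg _) (hB x) 2)
        ((norm_sub_le _ _).trans (add_le_add (hR _) (hR _))) (norm_nonneg _) (by positivity)
    · rw [norm_smul, innerSL_apply_norm, norm_mul, norm_mul, norm_mul, Real.norm_ofNat]
      exact mul_le_mul (mul_le_mul (mul_le_mul (mul_le_mul_of_nonneg_left (hB x) two_pos.le)
        (hB' x) (norm_nonneg _) (by positivity)) (hΔub x) (norm_nonneg _) (by positivity))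
        (hR x) (norm_nonneg _) (by positivity)
  have e1 := h.weak.of_differentiable (r := 2) (s := 2) h.isOpen ENNReal.ofNat_ne_top hY2 hlc
    (h.level_subset ht) hφdiff hφz hφ2
  have e2 := (h.weak.translate v).of_differentiable (r := 2) (s := 2)
    (h.isOpen.preimage (continuous_id.add continuous_const)) ENNReal.ofNat_ne_top
    (_root_.MemLp.comp_add_right hY2 v) hlc (fun x hx => hεΩ v hv x hx) hφdiff hφz hφ2
  have i1 : Integrable fun x => Df φ x (∇V (q x)) := integrable_clm_apply (r := 2) (s := 2) hφ2 hY2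
  have i2 : Integrable fun x => Df φ x (∇V (q (x + v))) :=
    integrable_clm_apply (r := 2) (s := 2) hφ2 (_root_.MemLp.comp_add_right hY2 v)
  have e3 : ∫ x, Df φ x (ΔY x) = 0 := by
    simp only [hΔY, map_sub]
    rw [integral_sub i2 i1, e1, e2, sub_self]
  have i3 : Integrable fun x => Df φ x (ΔY x) := by
    simp only [hΔY, map_sub]; exact i2.sub i1
  have i4 : Integrable fun x => η (u x) ^ 2 * ⟪ΔY x, Δq x⟫ := by
    rw [← memLp_one_iff_integrable]
    refine memLp_of_bound_of_eq_zero hlc (B := B ^ 2 * ((RY + RY) * (R + R))) ?_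
      (of_forall fun x => ?_)
      (of_forall fun x hx => by simp [hηz x hx]) 1
    · exact ((hηm.pow_const 2).mul ((hYv.sub hYm).inner (hqv.sub h.meas))).aestronglyMeasurable
    · rw [norm_mul, norm_pow]
      refine mul_le_mul (pow_le_pow_left₀ (norm_nonneg _) (hB x) 2) ?_ (norm_nonneg _) (by positivity)
      refine (norm_inner_le_norm _ _).trans (mul_le_mul ?_ ?_ (norm_nonneg _) (by positivity))
      · exact (norm_sub_le _ _).trans (add_le_add (hRY _) (hRY _))
      · exact (norm_sub_le _ _).trans (add_le_add (hR _) (hR _))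
  have i5 : Integrable (lev.indicator fun _ => 2 * K * B' ^ 2 * (L * ‖v‖) ^ 2) :=
    (integrable_indicator_iff hlc.measurableSet).2 (integrableOn_const hlc.measure_lt_top.ne)
  have key : ∫ x, (1 / 2 * (η (u x) ^ 2 * ⟪ΔY x, Δq x⟫)
      - lev.indicator (fun _ => 2 * K * B' ^ 2 * (L * ‖v‖) ^ 2) x) ≤ 0 := by
    rw [← e3]
    refine integral_mono ((i4.const_mul _).sub i5) i3 fun x => ?_
    simp only [hDφ]
    by_cases hx : x ∈ lev
    · rw [indicator_of_mem hx]
      simp only [ContinuousLinearMap.add_apply, ContinuousLinearMap.smul_apply, innerSL_apply_apply,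
        smul_eq_mul]
      have h1 := hrad (q x) (q (x + v)) (h.le _) (h.le _)
      rw [real_inner_comm (ΔY x) (Δq x), real_inner_comm (ΔY x) (q x)]
      set D := ⟪ΔY x, Δq x⟫ with hD
      set P := ⟪ΔY x, q x⟫ with hP
      have h1' : P ^ 2 ≤ K * D := h1
      have h2 : (deriv η (u x) * Δu x) ^ 2 ≤ B' ^ 2 * (L * ‖v‖) ^ 2 := by
        rw [mul_pow]
        exact mul_le_mul (sq_le_sq' (abs_le.1 (hB' x)).1 (abs_le.1 (hB' x)).2)
          (sq_le_sq' (abs_le.1 (hΔub x)).1 (abs_le.1 (hΔub x)).2) (by positivity) (by positivity)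
      set m := deriv η (u x) * Δu x with hm
      have h3 : 0 ≤ (η (u x) * P + 2 * K * m) ^ 2 := sq_nonneg _
      have h4 : η (u x) ^ 2 * P ^ 2 ≤ η (u x) ^ 2 * (K * D) :=
        mul_le_mul_of_nonneg_left h1' (sq_nonneg _)
      have h5 : K * (1 / 2 * (η (u x) ^ 2 * D) - 2 * K * B' ^ 2 * (L * ‖v‖) ^ 2)
          ≤ K * (η (u x) ^ 2 * D + 2 * η (u x) * deriv η (u x) * Δu x * P) := by
        have : K * (2 * η (u x) * deriv η (u x) * Δu x * P) = 2 * K * (η (u x) * P * m) := by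
          rw [hm]; ring
        rw [mul_add, this]
        nlinarith [mul_le_mul_of_nonneg_left h2 (by positivity : (0:ℝ) ≤ 2 * K ^ 2)]
      exact le_of_mul_le_mul_left h5 hK
    · rw [indicator_of_notMem hx, hηz x hx]; simp
  rw [integral_sub (i4.const_mul _) i5, integral_const_mul, integral_indicator hlc.measurableSet,
    setIntegral_const, smul_eq_mul] at key
  have : volume.real lev = (volume lev).toReal := rfl
  rw [this] at key
  nlinarith

end RSol

namespace RSol

lemma comp_lipschitz (hH : Ip) (h : RS) (hκ : ContDiff ℝ 1 κ) (ht : 0 < t)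
    (h0 : ∀ s ≤ t, κ s = 0) :
    ∃ M > 0, ∀ x v, |κ (u (x + v)) - κ (u x)| ≤ M * ‖v‖ := by
  obtain ⟨B', hB'0, hB'⟩ := h.exists_comp_u_bound (hκ.continuous_deriv le_rfl)
  obtain ⟨R, hR0, hR⟩ := h.exists_norm_le hH
  refine ⟨B' * R, by positivity, fun x v => ?_⟩
  have := convex_univ.norm_image_sub_le_of_norm_hasFDerivWithin_le
    (fun y _ => (h.hasFDerivAt_comp hκ ht h0 y).hasFDerivWithinAt) (C := B' * R)
    (fun y _ => by
      rw [norm_smul, innerSL_apply_norm]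
      exact mul_le_mul (hB' y) (hR y) (norm_nonneg _) hB'0.le) (mem_univ x) (mem_univ (x + v))
  rwa [add_sub_cancel_left] at this

set_option maxHeartbeats 1000000 in
lemma exists_translate_le (hH : Ip) (hp : 1 < p) (h : RS) (ha : 0 < a)
    {η : ℝ → ℝ} (hη : ContDiff ℝ 1 η) (ht : 0 < t) (h0 : ∀ s ≤ t, η s = 0)
    (hw : w = fun x => η (u x) • trunc H p a id (q x)) :
    ∃ M ≥ 0, ∀ v, eLpNorm (fun x => w (x + v) - w x) 2 ≤ ENNReal.ofReal (M * ‖v‖) := by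
  obtain ⟨ε, hε, M, hM, hen⟩ := h.energy hH hp hη ht h0
  obtain ⟨L, hL, hlip⟩ := h.comp_lipschitz hH hη ht h0
  obtain ⟨K, hK, htr⟩ := hH.trunc_id_sq_le hp ha C
  have hΓ : Continuous (trunc H p a (id : E → E)) :=
    (contDiff_trunc hH hp ha fun ξ _ => contDiffAt_id).continuous
  obtain ⟨G, hG0, hG⟩ := h.exists_comp_bound hH hΓ
  obtain ⟨B, hB0, hB⟩ := h.exists_comp_u_bound hη.continuous
  obtain ⟨R, hR0, hR⟩ := h.exists_norm_le hH
  obtain ⟨RY, hRY0, hRY⟩ := h.exists_comp_bound hH (hH.continuous_stress hp)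
  set lev := {x | t ≤ u x} with hlev
  have hlc : IsCompact lev := h.isCompact_level ht
  have hηz : ∀ x, x ∉ lev → η (u x) = 0 := fun x hx => h0 _ (not_le.1 hx).le
  have hum : Measurable u := h.cont.measurable
  have hηm : Measurable fun x => η (u x) := hη.continuous.measurable.comp hum
  have hYm : Measurable fun x => ∇V (q x) :=
    (h.meas_comp (hH.continuous_stress hp)).measurable
  have hwm : Measurable w := hw ▸ hηm.smul (h.meas_comp hΓ).measurable
  have hw2 : MemLp w 2 := by
    refine memLp_of_bound_of_eq_zero hlc hwm.aestronglyMeasurable (B := B * G)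
      (of_forall fun x => ?_) (of_forall fun x hx => by simp [hw, hηz x hx]) 2
    rw [hw, norm_smul]
    exact mul_le_mul (hB x) (hG x) (norm_nonneg _) hB0.le
  set A := (eLpNorm w 2).toReal with hA
  set M1 := 2 * K * M + 4 * G ^ 2 * L ^ 2 * volume.real lev with hM1
  have hM1' : 0 ≤ M1 := by positivity
  refine ⟨2 * A / ε + √M1, by positivity, fun v => ?_⟩
  have hwv : MemLp (fun x => w (x + v)) 2 := _root_.MemLp.comp_add_right hw2 v
  by_cases hv : ‖v‖ ≤ ε
  · have hd2 : MemLp (fun x => w (x + v) - w x) 2 := hwv.sub hw2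
    rw [eLpNorm_two_eq hd2]
    apply ENNReal.ofReal_le_ofReal
    have hqv : Measurable fun x => q (x + v) := h.meas.comp (measurable_id.add_const v)
    have hYv : Measurable fun x => ∇V (q (x + v)) := hYm.comp (measurable_id.add_const v)
    set D : E → ℝ := fun x =>
      η (u x) ^ 2 * ⟪∇V (q (x + v)) - ∇V (q x), q (x + v) - q x⟫ with hD
    have i1 : Integrable D := by
      rw [← memLp_one_iff_integrable]
      refine memLp_of_bound_of_eq_zero hlc (B := B ^ 2 * ((RY + RY) * (R + R))) ?_
        (of_forall fun x => ?_)
        (of_forall fun x hx => by simp [hD, hηz x hx]) 1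
      · exact ((hηm.pow_const 2).mul ((hYv.sub hYm).inner (hqv.sub h.meas))).aestronglyMeasurable
      · rw [norm_mul, norm_pow]
        refine mul_le_mul (pow_le_pow_left₀ (norm_nonneg _) (hB x) 2) ?_ (norm_nonneg _)
          (by positivity)
        refine (norm_inner_le_norm _ _).trans (mul_le_mul ?_ ?_ (norm_nonneg _) (by positivity))
        · exact (norm_sub_le _ _).trans (add_le_add (hRY _) (hRY _))
        · exact (norm_sub_le _ _).trans (add_le_add (hR _) (hR _))
    set ind : E → ℝ := lev.indicator fun _ => 2 * G ^ 2 * (L * ‖v‖) ^ 2 with hind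
    have i2 : Integrable ind :=
      (integrable_indicator_iff hlc.measurableSet).2 (integrableOn_const hlc.measure_lt_top.ne)
    have i3 : Integrable fun x => ind (x + v) := i2.comp_add_right v
    have hind0 : ∀ x, 0 ≤ ind x := fun x => indicator_nonneg (fun _ _ => by positivity) x
    have hpt : ∀ x, ‖w (x + v) - w x‖ ^ 2 ≤ 2 * K * D x + (ind x + ind (x + v)) := by
      intro x
      have hdec : w (x + v) - w x = η (u x) • (trunc H p a id (q (x + v)) - trunc H p a id (q x))
          + (η (u (x + v)) - η (u x)) • trunc H p a id (q (x + v)) := by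
        simp only [hw, smul_sub, sub_smul]; abel
      have h1 : ‖η (u x) • (trunc H p a id (q (x + v)) - trunc H p a id (q x))‖ ^ 2 ≤ K * D x := by
        rw [norm_smul, mul_pow, Real.norm_eq_abs, sq_abs, hD]
        have := mul_le_mul_of_nonneg_left (htr (q x) (q (x + v)) (h.le _) (h.le _))
          (sq_nonneg (η (u x)))
        linarith
      have h2 : 2 * ‖(η (u (x + v)) - η (u x)) • trunc H p a id (q (x + v))‖ ^ 2
          ≤ ind x + ind (x + v) := by
        by_cases hx : x ∈ lev ∨ x + v ∈ lev
        · have h3 : ‖(η (u (x + v)) - η (u x)) • trunc H p a id (q (x + v))‖ ^ 2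
              ≤ G ^ 2 * (L * ‖v‖) ^ 2 := by
            rw [norm_smul, mul_pow, mul_comm]
            exact mul_le_mul (pow_le_pow_left₀ (norm_nonneg _) (hG _) 2)
              (pow_le_pow_left₀ (norm_nonneg _) (hlip x v) 2) (by positivity) (by positivity)
          rcases hx with hx | hx
          · have : ind x = 2 * G ^ 2 * (L * ‖v‖) ^ 2 := indicator_of_mem hx _
            linarith [hind0 (x + v)]
          · have : ind (x + v) = 2 * G ^ 2 * (L * ‖v‖) ^ 2 := indicator_of_mem hx _
            linarith [hind0 x]
        · push Not at hx
          rw [hηz _ hx.1, hηz _ hx.2]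
          simpa using add_nonneg (hind0 x) (hind0 (x + v))
      rw [hdec]
      have h4 := norm_add_le (η (u x) • (trunc H p a id (q (x + v)) - trunc H p a id (q x)))
        ((η (u (x + v)) - η (u x)) • trunc H p a id (q (x + v)))
      nlinarith [norm_nonneg (η (u x) • (trunc H p a id (q (x + v)) - trunc H p a id (q x))
          + (η (u (x + v)) - η (u x)) • trunc H p a id (q (x + v))),
        sq_nonneg (‖η (u x) • (trunc H p a id (q (x + v)) - trunc H p a id (q x))‖
          - ‖(η (u (x + v)) - η (u x)) • trunc H p a id (q (x + v))‖)]
    have hint : ∫ x, ‖w (x + v) - w x‖ ^ 2 ≤ M1 * ‖v‖ ^ 2 := by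
      refine (integral_mono (integrable_norm_sq hd2)
        ((i1.const_mul (2 * K)).add (i2.add i3)) hpt).trans ?_
      have e1 : ∫ x, ind (x + v) = ∫ x, ind x := integral_add_right_eq_self _ v
      have e2 : ∫ x, ind x = volume.real lev * (2 * G ^ 2 * (L * ‖v‖) ^ 2) := by
        rw [hind, integral_indicator hlc.measurableSet, setIntegral_const, smul_eq_mul]
      have e3 : ∫ x, (2 * K * D x + (ind x + ind (x + v)))
          = 2 * K * (∫ x, D x) + ((∫ x, ind x) + ∫ x, ind (x + v)) := by
        have g1 := integral_add (i1.const_mul (2 * K)) (i2.add i3)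
        have g2 := integral_add i2 i3
        rw [integral_const_mul] at g1
        rw [← g2]
        exact g1
      refine e3.le.trans ?_
      rw [e1, e2, hM1]
      have := mul_le_mul_of_nonneg_left (hen v hv) (by positivity : 0 ≤ 2 * K)
      nlinarith
    calc √(∫ x, ‖w (x + v) - w x‖ ^ 2) ≤ √(M1 * ‖v‖ ^ 2) := Real.sqrt_le_sqrt hint
      _ = √M1 * ‖v‖ := by rw [Real.sqrt_mul hM1', Real.sqrt_sq (norm_nonneg _)]
      _ ≤ (2 * A / ε + √M1) * ‖v‖ := by
        gcongr
        have : 0 ≤ 2 * A / ε := by positivity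
        linarith
  · push Not at hv
    have h1 : eLpNorm (fun x => w (x + v) - w x) 2 ≤ eLpNorm w 2 + eLpNorm w 2 := by
      refine (eLpNorm_sub_le hwv.1 hw2.1 one_le_two).trans ?_
      rw [eLpNorm_comp_add_right hw2.1]
    refine h1.trans ?_
    rw [← ENNReal.ofReal_toReal hw2.2.ne, ← ENNReal.ofReal_add (by positivity) (by positivity)]
    apply ENNReal.ofReal_le_ofReal
    have h2 : 2 * A ≤ 2 * A / ε * ‖v‖ := by
      rw [div_mul_eq_mul_div, le_div_iff₀ hε]
      gcongr
    have h3 : 0 ≤ √M1 * ‖v‖ := by positivity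
    rw [add_mul]; linarith

lemma exists_sob (hH : Ip) (hp : 1 < p) (h : RS) (ha : 0 < a) {η : ℝ → ℝ}
    (hη : ContDiff ℝ 1 η) (ht : 0 < t) (h0 : ∀ s ≤ t, η s = 0) :
    ∃ K W, K ⊆ Ω ∧ Sob K (fun x => η (u x) • trunc H p a id (q x)) W := by
  obtain ⟨M, hM, hle⟩ := h.exists_translate_le hH hp ha hη ht h0 rfl
  have hlc : IsCompact {x | t ≤ u x} := h.isCompact_level ht
  obtain ⟨δ, hδ, hδΩ⟩ := hlc.exists_cthickening_subset_open h.isOpen (h.level_subset ht)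
  have hΓ : Continuous (trunc H p a (id : E → E)) :=
    (contDiff_trunc hH hp ha fun ξ _ => contDiffAt_id).continuous
  obtain ⟨G, hG0, hG⟩ := h.exists_comp_bound hH hΓ
  obtain ⟨B, hB0, hB⟩ := h.exists_comp_u_bound hη.continuous
  have hwm : StronglyMeasurable fun x => η (u x) • trunc H p a id (q x) :=
    (hη.continuous.comp h.cont).stronglyMeasurable.smul (h.meas_comp hΓ)
  obtain ⟨W, hW⟩ := Sob.of_components (w := fun x => η (u x) • trunc H p a id (q x))
    hlc.cthickening fun i =>
    Sob.exists_of_translate hlc hδ (w := fun x => (η (u x) • trunc H p a id (q x)) i)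
      ((proj i : E →L[ℝ] ℝ).continuous.comp_stronglyMeasurable hwm)
      (fun x hx => by
        rw [h0 _ (not_le.1 hx).le]; simp) (B := B * G)
      (fun x => (PiLp.norm_apply_le _ i).trans (by
        rw [norm_smul]
        exact mul_le_mul (hB x) (hG x) (norm_nonneg _) hB0.le)) hM fun v =>
      (eLpNorm_mono fun x => by
        have := PiLp.norm_apply_le (η (u (x + v)) • trunc H p a id (q (x + v))
          - η (u x) • trunc H p a id (q x)) i
        simpa using this).trans (hle v)
  exact ⟨_, W, hδΩ, hW⟩

end RSol

section trunc

lemma fderiv_trunc_of_lt (hH : Ip) (hp : 1 < p) (hb : 0 < b) (h : V ξ < b)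
    : Df (trunc H p b G) ξ = 0 := by
  have : trunc H p b G =ᶠ[𝓝 ξ] fun _ => 0 := by
    filter_upwards [(hH.V_continuous hp).continuousAt.eventually (gt_mem_nhds h)] with y hy
      using trunc_of_le hb (le_of_lt hy)
  rw [this.fderiv_eq]; simp

lemma fderiv_trunc_of_gt (hH : Ip) (hp : 1 < p) (hb : 0 < b) (h : 2 * b < V ξ)
    : Df (trunc H p b G) ξ = Df G ξ := by
  have : trunc H p b G =ᶠ[𝓝 ξ] G := by
    filter_upwards [(hH.V_continuous hp).continuousAt.eventually (lt_mem_nhds h)] with y hy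
      using trunc_of_ge hb (le_of_lt hy)
  exact this.fderiv_eq

lemma V_trunc_id_le (hH : Ip) (hp : 1 < p) (ξ : E) :
    V (trunc H p b id ξ) ≤ V ξ := by
  rw [trunc, id, hH.V_smul (Real.smoothTransition.nonneg _)]
  refine mul_le_of_le_one_left (hH.V_nonneg hp ξ) ?_
  exact Real.rpow_le_one (Real.smoothTransition.nonneg _) (Real.smoothTransition.le_one _)
    (by linarith)

end trunc

/-- A truncation `w` of the gradient field `q` which is weakly differentiable, with weak
derivative `S`, and which agrees with `q` where `u ≥ t` and `V(q) ≥ a`. -/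
structure Patch (H : E → ℝ) (p : ℝ) (Ω : Set E) (u : E → ℝ) (q : E → E)
    (t a : ℝ) (K : Set E) (w : E → E) (S : E → E →L[ℝ] E) : Prop where
  sub : K ⊆ Ω
  sob : Sob K w S
  sob_u : ∀ κ : ℝ → ℝ, ContDiff ℝ 1 κ → (∀ s ≤ t, κ s = 0) →
    Sob K (fun x => κ (u x)) (fun x => deriv κ (u x) • innerSL ℝ (q x))
  eq : ∀ x, t ≤ u x → a ≤ V (q x) → w x = q x
  le : ∀ x, t ≤ u x → V (w x) ≤ V (q x)

namespace RSol

lemma exists_patch_u (hH : Ip) (h : RS) (ht : 0 < t) :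
    ∃ K ⊆ Ω, ∀ κ : ℝ → ℝ, ContDiff ℝ 1 κ → (∀ s ≤ t, κ s = 0) →
    Sob K (fun x => κ (u x)) (fun x => deriv κ (u x) • innerSL ℝ (q x)) := by
  have hlc : IsCompact {x | t ≤ u x} := h.isCompact_level ht
  obtain ⟨δ, hδ, hδΩ⟩ := hlc.exists_cthickening_subset_open h.isOpen (h.level_subset ht)
  refine ⟨_, hδΩ, fun κ hκ h0 => ?_⟩
  have hd := fun x => h.hasFDerivAt_comp hκ ht h0 x
  obtain ⟨B', hB'0, hB'⟩ := h.exists_comp_u_bound (hκ.continuous_deriv le_rfl)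
  obtain ⟨R, hR0, hR⟩ := h.exists_norm_le hH
  have hz : ∀ x, x ∉ {x | t ≤ u x} → κ (u x) = 0 := fun x hx => h0 _ (not_le.1 hx).le
  have := Sob.of_differentiable hlc hδ (fun x => (hd x).differentiableAt) hz
    (memLp_of_bound_of_eq_zero hlc (measurable_fderiv ℝ _).aestronglyMeasurable (B := B' * R)
      (of_forall fun x => by
        rw [(hd x).fderiv, norm_smul, innerSL_apply_norm]
        exact mul_le_mul (hB' x) (hR x) (norm_nonneg _) hB'0.le)
      (of_forall fun x hx => fderiv_eq_zero_of_notMem hlc.isClosed hz hx) 2)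
  exact this.congr (of_forall fun _ => rfl)
    (of_forall fun x => (hd x).fderiv)

lemma exists_patch (hH : Ip) (hp : 1 < p) (h : RS) (ht : 0 < t)
    (ha : 0 < a) : ∃ K w S, Patch H p Ω u q t a K w S := by
  set η : ℝ → ℝ := fun s => Real.smoothTransition (2 * s / t - 1) with hη
  have hηc : ContDiff ℝ 1 η := Real.smoothTransition.contDiff.comp
    (((contDiff_const.mul contDiff_id).div_const t).sub contDiff_const)
  have hη0 : ∀ s ≤ t / 2, η s = 0 := fun s hs =>
    Real.smoothTransition.zero_of_nonpos (by rw [sub_nonpos, div_le_one ht]; linarith)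
  have hη1 : ∀ s, t ≤ s → η s = 1 := fun s hs =>
    Real.smoothTransition.one_of_one_le (by
      rw [le_sub_iff_add_le, le_div_iff₀ ht]; linarith)
  obtain ⟨K1, S, hK1, hS⟩ := h.exists_sob hH hp (half_pos ha) hηc (half_pos ht) hη0
  obtain ⟨K2, hK2, hu⟩ := h.exists_patch_u hH ht
  have hK2c : IsCompact K2 := (hu (fun _ => 0) contDiff_const fun _ _ => rfl).isCompact
  have hKc := hS.isCompact.union hK2c
  refine ⟨K1 ∪ K2, _, S, union_subset hK1 hK2, hS.mono hKc subset_union_left,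
    fun κ h1 h2 => (hu κ h1 h2).mono hKc subset_union_right, fun x hx hax => ?_, fun x hx => ?_⟩
  · simp only [hη1 _ hx, one_smul]
    exact trunc_of_ge (half_pos ha) (by linarith)
  · simp only [hη1 _ hx, one_smul]
    exact V_trunc_id_le hH hp _

end RSol

namespace Patch

lemma comp (hH : Ip) (hp : 1 < p) (P : Patch H p Ω u q t a K w S) (hb : 0 < b)
    (hG : ∀ ξ, ξ ≠ 0 → ContDiffAt ℝ 1 G ξ) :
    Sob K (fun x => trunc H p b G (w x))
      (fun x => (Df (trunc H p b G) (w x)).comp (S x)) :=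
  P.sob.comp_contDiff (contDiff_trunc hH hp hb hG) (trunc_zero hH hp hb)

/-- The weak derivative of `κ(u) · (trunc b G)(w)`. -/
def cutDeriv (H : E → ℝ) (p b : ℝ) (u : E → ℝ) (q w : E → E)
    (S : E → E →L[ℝ] E) (κ : ℝ → ℝ) (G : E → ℝ) (x : E) : E →L[ℝ] ℝ :=
  κ (u x) • (Df (trunc H p b G) (w x)).comp (S x)
    + trunc H p b G (w x) • (deriv κ (u x) • innerSL ℝ (q x))

lemma cut (hH : Ip) (hp : 1 < p) (P : Patch H p Ω u q t a K w S) (hb : 0 < b)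
    {G : E → ℝ} (hG : ∀ ξ, ξ ≠ 0 → ContDiffAt ℝ 1 G ξ) (hκ : ContDiff ℝ 1 κ)
    (h0 : ∀ s ≤ t, κ s = 0) :
    Sob K (fun x => κ (u x) * trunc H p b G (w x)) (cutDeriv H p b u q w S κ G) :=
  (P.sob_u κ hκ h0).mul (P.comp hH hp hb hG)

lemma cutDeriv_eq_zero (hH : Ip) (hp : 1 < p) (P : Patch H p Ω u q t a K w S)
    (hb : 0 < b) {G : E → ℝ} (hκ : ContDiff ℝ 1 κ) (h0 : ∀ s ≤ t, κ s = 0)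
    (hx : ¬ (t < u x ∧ b ≤ V (q x))) :
    κ (u x) * trunc H p b G (w x) = 0 ∧ cutDeriv H p b u q w S κ G x = 0 := by
  by_cases hu : t < u x
  · have hV : V (w x) < b :=
      (P.le x hu.le).trans_lt (not_le.1 fun h => hx ⟨hu, h⟩)
    rw [cutDeriv, fderiv_trunc_of_lt hH hp hb hV, trunc_of_le hb hV.le]
    simp
  · rw [cutDeriv, h0 _ (not_lt.1 hu), deriv_eq_zero_of_vanish hκ h0 (not_lt.1 hu)]
    simp

end Patch

lemma euc_sum_single (v : E) :
    v = ∑ i, v i • (𝐞 i : E) := by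
  ext j
  simp [Finset.sum_apply, Pi.single_apply]

lemma clm_apply_eq_sum (L : E →L[ℝ] ℝ) (v : E) :
    L v = ∑ i, v i * L (𝐞 i) := by
  conv_lhs => rw [euc_sum_single v]
  simp

lemma Sob.memLp_apply {φ : E → F} {Φ : E → E →L[ℝ] F} (h : Sob K φ Φ) (v : E) :
    MemLp (fun x => Φ x v) 2 :=
  h.memLp_fderiv.continuousLinearMap_comp (ContinuousLinearMap.apply ℝ F v)

namespace Patch

lemma trunc_eq (P : Patch H p Ω u q t a K w S) (hb : 0 < b) (hab : a ≤ b) (G : E → F)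
    (hx : t ≤ u x) : trunc H p b G (w x) = trunc H p b G (q x) := by
  by_cases h : a ≤ V (q x)
  · rw [P.eq x hx h]
  · push Not at h
    rw [trunc_of_le hb ((P.le x hx).trans (h.le.trans hab)), trunc_of_le hb (h.le.trans hab)]

set_option maxHeartbeats 1000000 in
lemma trace_eq (hH : Ip) (hp : 1 < p) (P : Patch H p Ω u q t a K w S) (ha : 0 < a)
    (hΩ : IsOpen Ω) (ht : ∀ x, t < u x → x ∈ Ω) {F : E → E}
    (hF : ∀ ξ, ξ ≠ 0 → ContDiffAt ℝ 1 F ξ) (hF2 : MemLp (fun x => F (q x)) 2)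
    (hW : WeakDiv Ω (fun x => F (q x)) c) :
    ∀ᵐ x, t < u x → 2 * a < V (q x) →
      ∑ i, (Df F (q x) (S x (𝐞 i))) i = -c := by
  set κ : ℝ → ℝ := fun s => Real.smoothTransition (s - t) with hκ
  have hκc : ContDiff ℝ 1 κ :=
    Real.smoothTransition.contDiff.comp (contDiff_id.sub contDiff_const)
  have hκ0 : ∀ s ≤ t, κ s = 0 := fun s hs =>
    Real.smoothTransition.zero_of_nonpos (by linarith)
  have h2a : 0 < 2 * a := by linarith
  have hρ := P.cut hH hp h2a (G := fun _ => (1:ℝ)) (fun _ _ => contDiffAt_const) hκc hκ0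
  set ρ : E → ℝ := fun x => κ (u x) * trunc H p (2 * a) (fun _ => (1:ℝ)) (w x) with hρdef
  have hFt := P.comp hH hp ha hF
  set Ft : E → E := fun x => trunc H p a F (w x) with hFtdef
  set FD : E → E →L[ℝ] E :=
    fun x => (Df (trunc H p a F) (w x)).comp (S x) with hFD
  have hFi : ∀ i, Sob K (fun x => Ft x i)
      (fun x => (proj i : E →L[ℝ] ℝ).comp (FD x)) := fun i =>
    hFt.clm_comp (proj i : E →L[ℝ] ℝ)
  have hFi2 : ∀ i, MemLp (fun x => (FD x (𝐞 i)) i) 2 := fun i =>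
    (hFi i).memLp_apply (𝐞 i)
  set tr : E → ℝ := fun x => ∑ i, (FD x (𝐞 i)) i with htr
  have htr2 : MemLp tr 2 := memLp_finsetSum _ fun i _ => hFi2 i
  have hf : Integrable fun x => ρ x * (tr x + c) := by
    simp only [mul_add]
    exact ((hρ.memLp 2).integrable_mul htr2).add ((memLp_one_iff_integrable.1 (hρ.memLp 1)).mul_const c)
  have hae : ∀ᵐ x, x ∈ Ω → ρ x * (tr x + c) = 0 := by
    refine hΩ.ae_eq_zero_of_integral_contDiff_smul_eq_zero
      (hf.locallyIntegrable.locallyIntegrableOn _) fun ψ hψ hψc hψΩ => ?_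
    have hK' : IsCompact (K ∪ tsupport ψ) := hρ.isCompact.union hψc
    have hψS : Sob (K ∪ tsupport ψ) ψ (Df ψ) := Sob.of_contDiff hK' (hψ.of_le (by simp))
      fun x hx => image_eq_zero_of_notMem_tsupport fun h => hx (Or.inr h)
    have hφ := hψS.mul (hρ.mono hK' subset_union_left)
    have e1 := hφ.weakDiv (union_subset P.sub hψΩ) hW hF2
    set Φ : E → E →L[ℝ] ℝ := fun x =>
      ψ x • cutDeriv H p (2 * a) u q w S κ (fun _ => (1:ℝ)) x + ρ x • Df ψ x with hΦ
    have e2 : ∀ x, Φ x (F (q x)) = ∑ i, Φ x (𝐞 i) * Ft x i := by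
      intro x
      by_cases hx : t < u x ∧ 2 * a ≤ V (q x)
      · have : F (q x) = Ft x := by
          rw [hFtdef]
          simp only
          rw [P.trunc_eq ha le_rfl F hx.1.le, trunc_of_ge ha hx.2]
        rw [this, clm_apply_eq_sum]
        simp only [mul_comm]
      · have h1 := P.cutDeriv_eq_zero hH hp h2a (G := fun _ => (1:ℝ)) hκc hκ0 hx
        have : Φ x = 0 := by
          have h3 : ρ x = 0 := h1.1
          simp only [hΦ]
          rw [h1.2, h3]; simp
        simp [this]
    have e3 : ∀ i, ∫ x, ψ x * ρ x * (FD x (𝐞 i)) i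
        = - ∫ x, Φ x (𝐞 i) * Ft x i := fun i =>
      hφ.integral_mul_fderiv ((hFi i).mono hK' subset_union_left) (𝐞 i)
    have i1 : ∀ i, Integrable fun x => Φ x (𝐞 i) * Ft x i := fun i =>
      (hφ.memLp_apply (𝐞 i)).integrable_mul ((hFi i).memLp 2)
    have i2 : ∀ i, Integrable fun x => ψ x * ρ x * (FD x (𝐞 i)) i := fun i =>
      (hφ.memLp 2).integrable_mul (hFi2 i)
    have i3 : Integrable fun x => ψ x * ρ x := memLp_one_iff_integrable.1 (hφ.memLp 1)
    have e4 : ∫ x, Φ x (F (q x)) = - ∫ x, ψ x * ρ x * tr x := by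
      simp only [e2, htr, Finset.mul_sum]
      rw [integral_finsetSum _ fun i _ => i1 i, integral_finsetSum _ fun i _ => i2 i,
        ← Finset.sum_neg_distrib]
      exact Finset.sum_congr rfl fun i _ => by rw [e3 i, neg_neg]
    have i4 : Integrable fun x => ψ x * ρ x * tr x := (hφ.memLp 2).integrable_mul htr2
    have e5 : ∀ x, ψ x • (ρ x * (tr x + c)) = ψ x * ρ x * tr x + c * (ψ x * ρ x) := fun x => by
      rw [smul_eq_mul]; ring
    simp only [e5]
    rw [integral_add i4 (i3.const_mul c), integral_const_mul, ← e1, e4, add_neg_cancel]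
  filter_upwards [hae] with x hx htx hax
  have h1 := hx (ht x htx)
  have hwq : w x = q x := P.eq x htx.le (by linarith)
  have h2 : ρ x ≠ 0 := by
    simp only [hρdef, hκ, trunc, hwq]
    refine mul_ne_zero (Real.smoothTransition.pos_of_pos (by linarith)).ne'
      (smul_ne_zero (Real.smoothTransition.pos_of_pos ?_).ne' one_ne_zero)
    rw [sub_pos, lt_div_iff₀ h2a]; linarith
  have h3 : tr x + c = 0 := (mul_eq_zero.1 h1).resolve_left h2
  have h4 : tr x = ∑ i, (Df F (q x) (S x (𝐞 i))) i := by
    simp only [htr, hFD, hwq, fderiv_trunc_of_gt hH hp ha hax]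
    rfl
  rw [← h4]; linarith

end Patch

namespace RSol

lemma trace_hess (hH : Ip) (hp : 1 < p) (h : RS) (ht : 0 < t)
    (ha : 0 < a) (P : Patch H p Ω u q t a K w S) :
    ∀ᵐ x, t < u x → 2 * a < V (q x) →
      ∑ i, (Df (∇V) (q x) (S x (𝐞 i))) i = -1 :=
  P.trace_eq hH hp ha h.isOpen (fun _ hx => h.level_subset ht (le_of_lt hx))
    (fun _ hξ => hH.contDiffAt_stress hξ)
    (h.memLp_comp hH (hH.continuous_stress hp) (hH.stress_zero hp) 2) h.weak

/-- The linear map `ξ ↦ ξ_k e_l - ξ_l e_k`. -/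
def rotMap (k l : Fin N) : E →L[ℝ] E :=
  (proj k : E →L[ℝ] ℝ).smulRight (𝐞 l)
    - (proj l : E →L[ℝ] ℝ).smulRight (𝐞 k)

lemma weakDiv_rotMap (hH : Ip) (h : RS) (k l : Fin N) :
    WeakDiv Ω (fun x => rotMap k l (q x)) 0 := by
  intro φ h1 h2 h3
  rw [zero_mul]
  obtain ⟨m, hm, hmu⟩ : ∃ m > 0, ∀ x ∈ tsupport φ, m ≤ u x := by
    by_cases hne : (tsupport φ).Nonempty
    · obtain ⟨z, hz, hzm⟩ := h2.isCompact.exists_isMinOn hne h.cont.continuousOn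
      exact ⟨u z, h.pos z (h3 hz), fun x hx => hzm hx⟩
    · exact ⟨1, one_pos, fun x hx => (hne ⟨x, hx⟩).elim⟩
  set κ : ℝ → ℝ := fun s => s * Real.smoothTransition (4 * s / m - 1) with hκ
  have hκc : ContDiff ℝ 1 κ := contDiff_id.mul (Real.smoothTransition.contDiff.comp
    (((contDiff_const.mul contDiff_id).div_const m).sub contDiff_const))
  have hκ0 : ∀ s ≤ m / 4, κ s = 0 := fun s hs => by
    simp only [hκ]
    rw [Real.smoothTransition.zero_of_nonpos (by rw [sub_nonpos, div_le_one hm]; linarith), mul_zero]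
  have hκ1 : ∀ s, m ≤ s → deriv κ s = 1 := fun s hs => by
    have : κ =ᶠ[𝓝 s] id := by
      filter_upwards [lt_mem_nhds (show m / 2 < s by linarith)] with y hy
      simp only [hκ, id]
      rw [Real.smoothTransition.one_of_one_le, mul_one]
      rw [le_sub_iff_add_le, le_div_iff₀ hm]; linarith
    rw [this.deriv_eq]; simp
  obtain ⟨K, hK, hu⟩ := h.exists_patch_u hH (t := m / 4) (by linarith)
  have hS := hu κ hκc hκ0
  have hK' : IsCompact (K ∪ tsupport φ) := hS.isCompact.union h2.isCompact
  have hφS : Sob (K ∪ tsupport φ) φ (Df φ) := Sob.of_contDiff hK' h1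
    fun x hx => image_eq_zero_of_notMem_tsupport fun h => hx (Or.inr h)
  have hS' := hS.mono hK' subset_union_left
  have key := hφS.integral_fderiv_mul_fderiv_comm hS' (𝐞 l)
    (𝐞 k)
  have i1 := (hφS.memLp_apply (𝐞 l)).integrable_mul
    (hS'.memLp_apply (𝐞 k))
  have i2 := (hφS.memLp_apply (𝐞 k)).integrable_mul
    (hS'.memLp_apply (𝐞 l))
  have hsub := integral_sub i1 i2
  rw [← sub_eq_zero] at key
  refine (integral_congr_ae (of_forall fun x => ?_)).trans (hsub.trans key)
  by_cases hx : x ∈ tsupport φ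
  · simp [rotMap, hκ1 _ (hmu x hx), EuclideanSpace.inner_single_right]
    ring_nf
  · simp [fderiv_eq_zero_of_notMem (isClosed_tsupport φ)
      (fun x hx => image_eq_zero_of_notMem_tsupport hx) hx]

lemma symm_of_patch (hH : Ip) (hp : 1 < p) (h : RS) (ht : 0 < t)
    (ha : 0 < a) (P : Patch H p Ω u q t a K w S) :
    ∀ᵐ x, t < u x → 2 * a < V (q x) → ∀ v v', ⟪S x v, v'⟫ = ⟪v, S x v'⟫ := by
  have h1 : ∀ k l : Fin N, ∀ᵐ x, t < u x → 2 * a < V (q x) →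
      S x (𝐞 l) k = S x (𝐞 k) l := by
    intro k l
    have := P.trace_eq hH hp ha h.isOpen (fun _ hx => h.level_subset ht (le_of_lt hx))
      (F := rotMap k l) (fun _ _ => (rotMap k l).contDiff.contDiffAt)
      (h.memLp_comp hH (rotMap k l).continuous (map_zero _) 2) (h.weakDiv_rotMap hH k l)
    filter_upwards [this] with x hx h1 h2
    have h3 := hx h1 h2
    rw [ContinuousLinearMap.fderiv] at h3
    simp [rotMap, Pi.single_apply, Finset.sum_sub_distrib] at h3
    linarith
  have h2 : ∀ᵐ x, ∀ k l : Fin N, t < u x → 2 * a < V (q x) →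
      S x (𝐞 l) k = S x (𝐞 k) l :=
    ae_all_iff.2 fun k => ae_all_iff.2 fun l => h1 k l
  filter_upwards [h2] with x hx h3 h4 v v'
  rw [euc_sum_single v, euc_sum_single v']
  simp only [map_sum, map_smul, inner_sum, sum_inner, inner_smul_left, inner_smul_right,
    EuclideanSpace.inner_single_left, EuclideanSpace.inner_single_right]
  simp [hx _ _ h3 h4]

end RSol

section trace

lemma trace_eq_sum_apply (T : E →ₗ[ℝ] E) :
    LinearMap.trace ℝ _ T = ∑ i, T (𝐞 i) i := by
  rw [LinearMap.trace_eq_sum_inner T (EuclideanSpace.basisFun (Fin N) ℝ)]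
  exact Finset.sum_congr rfl fun i _ => by simp [EuclideanSpace.inner_single_left]

lemma trace_comp_eq_sum (T U : E →ₗ[ℝ] E) :
    LinearMap.trace ℝ _ (T ∘ₗ U) =
      ∑ i, ∑ k, U (𝐞 i) k * T (𝐞 k) i := by
  rw [trace_eq_sum_apply]
  refine Finset.sum_congr rfl fun i _ => ?_
  rw [LinearMap.comp_apply]
  conv_lhs => rw [euc_sum_single (U (𝐞 i))]
  simp

/-- The trace of the product of a symmetric operator `A ≥ l` and a nonnegative operator. -/
lemma mul_trace_le_trace_comp {A P : E →ₗ[ℝ] E} (hA : A.IsSymmetric) {l : ℝ}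
    (hl : ∀ v, l * ‖v‖ ^ 2 ≤ ⟪A v, v⟫) (hP : ∀ v, 0 ≤ ⟪v, P v⟫) :
    l * LinearMap.trace ℝ _ P ≤ LinearMap.trace ℝ _ (A ∘ₗ P) := by
  have hn : Module.finrank ℝ (E) = N := by simp [Euc]
  set f := hA.eigenvectorBasis hn
  rw [LinearMap.trace_eq_sum_inner P f, LinearMap.trace_eq_sum_inner _ f, Finset.mul_sum]
  refine Finset.sum_le_sum fun i _ => ?_
  have h1 := hl (f i)
  have h2 : A (f i) = hA.eigenvalues hn i • f i := hA.apply_eigenvectorBasis hn i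
  have hf : ‖f i‖ = 1 := f.norm_eq_one i
  rw [LinearMap.comp_apply, ← hA, h2, real_inner_smul_left]
  rw [h2, real_inner_smul_left, real_inner_self_eq_norm_sq, hf] at h1
  exact mul_le_mul_of_nonneg_right (by linarith) (hP _)

/-- If `A` is symmetric with `l ≤ A ≤ L`, `S` is symmetric and `tr (A S) = -1`, then
`tr ((A S)²) ≥ 1 / N`, and the deficit controls the distance from `A S` to `-1 / N`. -/
lemma trace_sq_gap (hN : 0 < N) {A S : E →ₗ[ℝ] E} (hA : A.IsSymmetric)
    (hS : S.IsSymmetric) {l L : ℝ} (hl0 : 0 < l) (hL0 : 0 < L) (hl : ∀ v, l * ‖v‖ ^ 2 ≤ ⟪A v, v⟫)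
    (hL : ∀ v, ‖A v‖ ≤ L * ‖v‖) (htr : ∑ i, A (S (𝐞 i)) i = -1) :
    (l / L) ^ 2 * ∑ i, ‖A (S (𝐞 i))
        + (1 / N : ℝ) • 𝐞 i‖ ^ 2 ≤
      ∑ i, ∑ k, A (S (𝐞 i)) k * A (S (𝐞 k)) i
        - 1 / N := by
  have hN' : (N : ℝ) ≠ 0 := by positivity
  have hinj : Function.Injective A := by
    rw [← LinearMap.ker_eq_bot, LinearMap.ker_eq_bot']
    intro v hv
    have := hl v
    rw [hv, inner_zero_left] at this
    by_contra h
    have := norm_pos_iff.2 h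
    have : 0 < l * ‖v‖ ^ 2 := by positivity
    linarith
  set R : E →ₗ[ℝ] E := (LinearEquiv.ofInjectiveEndo A hinj).symm.toLinearMap with hR
  have hAR : ∀ v, A (R v) = v := fun v => (LinearEquiv.ofInjectiveEndo A hinj).apply_symm_apply v
  have hRs : R.IsSymmetric := fun v w => by
    conv_lhs => rw [← hAR w, ← hA, hAR]
  set T : E →ₗ[ℝ] E := S + (1 / N : ℝ) • R with hT
  have hTs : ∀ v w, ⟪T v, w⟫ = ⟪v, T w⟫ := fun v w => by
    simp only [hT, LinearMap.add_apply, LinearMap.smul_apply, inner_add_left, inner_add_right,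
      real_inner_smul_left, real_inner_smul_right]
    rw [hS v w, hRs v w]
  have hAT : ∀ v, A (T v) = A (S v) + (1 / N : ℝ) • v := fun v => by
    simp [hT, hAR]
  have hgap : LinearMap.trace ℝ _ ((A ∘ₗ T) ∘ₗ (A ∘ₗ T)) =
      ∑ i, ∑ k, A (S (𝐞 i)) k * A (S (𝐞 k)) i
        - 1 / N := by
    have h1 : (A ∘ₗ T) ∘ₗ (A ∘ₗ T) = (A ∘ₗ S) ∘ₗ (A ∘ₗ S) + (2 / N : ℝ) • (A ∘ₗ S)
        + (1 / N ^ 2 : ℝ) • LinearMap.id := by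
      refine LinearMap.ext fun v => ?_
      simp only [LinearMap.comp_apply, LinearMap.add_apply, LinearMap.smul_apply, hAT, map_add,
        map_smul, LinearMap.id_apply]
      module
    rw [h1, map_add, map_add, map_smul, map_smul, LinearMap.trace_id, trace_comp_eq_sum,
      trace_eq_sum_apply (A ∘ₗ S)]
    simp only [LinearMap.comp_apply, htr]
    have : Module.finrank ℝ (E) = N := by simp [Euc]
    rw [this, smul_eq_mul, smul_eq_mul]
    field_simp
    ring
  have hnn : ∀ v, 0 ≤ ⟪A v, v⟫ := fun v => le_trans (by positivity) (hl v)
  have h2 := mul_trace_le_trace_comp (P := T ∘ₗ A ∘ₗ T) hA hl fun v => by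
    rw [LinearMap.comp_apply, LinearMap.comp_apply, ← hTs, real_inner_comm]
    exact hnn _
  have h3 : LinearMap.trace ℝ _ (T ∘ₗ A ∘ₗ T) =
      ∑ i, ⟪A (T (𝐞 i)), T (𝐞 i)⟫ := by
    rw [LinearMap.trace_eq_sum_inner _ (EuclideanSpace.basisFun (Fin N) ℝ)]
    refine Finset.sum_congr rfl fun i _ => ?_
    rw [LinearMap.comp_apply, LinearMap.comp_apply, ← hTs, real_inner_comm,
      EuclideanSpace.basisFun_apply]
  rw [h3] at h2
  rw [← hgap, show (A ∘ₗ T) ∘ₗ (A ∘ₗ T) = A ∘ₗ T ∘ₗ A ∘ₗ T from rfl]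
  refine le_trans ?_ h2
  rw [Finset.mul_sum, Finset.mul_sum]
  refine Finset.sum_le_sum fun i _ => ?_
  rw [← hAT]
  set v := T (𝐞 i)
  have h4 : ‖A v‖ ^ 2 ≤ (L * ‖v‖) ^ 2 := by gcongr; exact hL v
  calc (l / L) ^ 2 * ‖A v‖ ^ 2 ≤ (l / L) ^ 2 * (L * ‖v‖) ^ 2 := by gcongr
    _ = l * (l * ‖v‖ ^ 2) := by field_simp
    _ ≤ _ := by gcongr; exact hl v

end trace

namespace IsIpNorm

lemma exists_trace_gap (hH : Ip) (hp : 1 < p) (hN : 0 < N) :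
    ∃ c > 0, ∀ ξ, ξ ≠ 0 → ∀ S : E →L[ℝ] E, (∀ v v', ⟪S v, v'⟫ = ⟪v, S v'⟫) →
      ∑ i, Df (∇V) ξ (S (𝐞 i)) i = -1 →
      c * ∑ i, ‖Df (∇V) ξ (S (𝐞 i))
        + (1 / N : ℝ) • 𝐞 i‖ ^ 2 ≤
      ∑ i, ∑ k, Df (∇V) ξ (S (𝐞 i)) k
        * Df (∇V) ξ (S (𝐞 k)) i - 1 / N := by
  obtain ⟨c, hc, hcl⟩ := hH.hess_lower hp
  obtain ⟨K, hK, hKu⟩ := hH.hess_upper hp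
  refine ⟨(c / K) ^ 2, by positivity, fun ξ hξ S hS htr => ?_⟩
  have hn : 0 < ‖ξ‖ ^ (p - 2) := Real.rpow_pos_of_pos (norm_pos_iff.2 hξ) _
  have := trace_sq_gap hN (A := (Df (∇V) ξ).toLinearMap) (S := S.toLinearMap)
    (fun v w => hH.hess_symm hp hξ v w) hS (l := c * ‖ξ‖ ^ (p - 2)) (L := K * ‖ξ‖ ^ (p - 2))
    (by positivity) (by positivity) (fun v => hcl ξ hξ v)
    (fun v => (ContinuousLinearMap.le_opNorm _ v).trans
      (mul_le_mul_of_nonneg_right (hKu ξ hξ) (norm_nonneg _))) htr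
  rwa [mul_div_mul_right _ _ hn.ne'] at this

end IsIpNorm

/-- A smooth monotone step from `0` (for `s ≤ b`) to `1` (for `s ≥ 2b`). -/
def step (b s : ℝ) : ℝ := Real.smoothTransition (s / b - 1)

/-- The primitive of `step b` vanishing at `0`. -/
def ramp (b s : ℝ) : ℝ := ∫ r in (0 : ℝ)..s, step b r

section ramp

lemma step_nonneg (b s : ℝ) : 0 ≤ step b s := Real.smoothTransition.nonneg _

lemma step_le_one (b s : ℝ) : step b s ≤ 1 := Real.smoothTransition.le_one _

lemma step_of_le (hb : 0 < b) (h : s ≤ b) : step b s = 0 :=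
  Real.smoothTransition.zero_of_nonpos (by rw [sub_nonpos, div_le_one hb]; exact h)

lemma step_of_ge (hb : 0 < b) (h : 2 * b ≤ s) : step b s = 1 :=
  Real.smoothTransition.one_of_one_le (by rw [le_sub_iff_add_le, le_div_iff₀ hb]; linarith)

lemma contDiff_step (b : ℝ) {n : ℕ∞} : ContDiff ℝ n (step b) :=
  Real.smoothTransition.contDiff.comp ((contDiff_id.div_const b).sub contDiff_const)

lemma continuous_step (b : ℝ) : Continuous (step b) := (contDiff_step b (n := 1)).continuous

lemma differentiable_step (b : ℝ) : Differentiable ℝ (step b) :=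
  (contDiff_step b (n := 1)).differentiable (by norm_num)

lemma monotone_step (hb : 0 < b) : Monotone (step b) := fun s r h =>
  Real.smoothTransition.monotone (by gcongr)

lemma deriv_step_nonneg (hb : 0 < b) (s : ℝ) : 0 ≤ deriv (step b) s := (monotone_step hb).deriv_nonneg

lemma hasDerivAt_ramp (b s : ℝ) : HasDerivAt (ramp b) (step b s) s :=
  intervalIntegral.integral_hasDerivAt_right ((continuous_step b).intervalIntegrable _ _)
    ((continuous_step b).stronglyMeasurableAtFilter _ _) (continuous_step b).continuousAt

lemma deriv_ramp (b : ℝ) : deriv (ramp b) = step b := funext fun s => (hasDerivAt_ramp b s).deriv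

lemma contDiff_ramp (b : ℝ) : ContDiff ℝ 1 (ramp b) := by
  rw [contDiff_one_iff_deriv]
  exact ⟨fun s => (hasDerivAt_ramp b s).differentiableAt, by rw [deriv_ramp]; exact continuous_step b⟩

lemma ramp_zero_right (b : ℝ) : ramp b 0 = 0 := intervalIntegral.integral_same

lemma ramp_of_le (hb : 0 < b) (h : s ≤ b) : ramp b s = 0 := by
  rw [ramp, intervalIntegral.integral_congr (g := fun _ => 0)]
  · simp
  · intro r hr
    refine step_of_le hb ?_
    rcases le_total 0 s with h0 | h0
    · rw [uIcc_of_le h0] at hr; exact hr.2.trans h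
    · rw [uIcc_of_ge h0] at hr; exact hr.2.trans hb.le

lemma monotone_ramp (b : ℝ) : Monotone (ramp b) :=
  monotone_of_deriv_nonneg (fun s => (hasDerivAt_ramp b s).differentiableAt) fun s => by
    rw [deriv_ramp]; exact step_nonneg b s

lemma ramp_nonneg (hb : 0 < b) (s : ℝ) : 0 ≤ ramp b s := by
  rcases le_total s 0 with h | h
  · rw [ramp_of_le hb (h.trans hb.le)]
  · rw [← ramp_zero_right b]; exact monotone_ramp b h

lemma hasDerivAt_ramp_sub (b s : ℝ) : HasDerivAt (fun s => ramp b s - s) (step b s - 1) s :=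
  (hasDerivAt_ramp b s).sub (hasDerivAt_id s)

lemma antitone_ramp_sub (b : ℝ) : Antitone fun s => ramp b s - s :=
  antitone_of_deriv_nonpos (fun s => (hasDerivAt_ramp_sub b s).differentiableAt) fun s => by
    rw [(hasDerivAt_ramp_sub b s).deriv]
    linarith [step_le_one b s]

lemma ramp_le (h : 0 ≤ s) : ramp b s ≤ s := by
  have := antitone_ramp_sub b h
  simp only [ramp_zero_right] at this
  linarith

lemma sub_le_ramp (hb : 0 < b) (s : ℝ) : s - 2 * b ≤ ramp b s := by
  rcases le_total s (2 * b) with h | h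
  · linarith [ramp_nonneg hb s]
  · have hd := hasDerivAt_ramp_sub b
    have := monotoneOn_of_deriv_nonneg (convex_Ici (2 * b)) (f := fun s => ramp b s - s)
      (fun s _ => (hd s).continuousAt.continuousWithinAt)
      (fun s _ => (hd s).differentiableAt.differentiableWithinAt) (fun s hs => by
        rw [interior_Ici] at hs
        rw [(hd s).deriv, step_of_ge hb (le_of_lt hs), sub_self])
      self_mem_Ici h h
    simp only at this
    linarith [ramp_nonneg hb (2 * b)]

end ramp

lemma sum_sum_mul_apply (B : E →L[ℝ] E) (x y : E) :
    ∑ k, ∑ i, x k * y i * B (𝐞 k) i = ⟪y, B x⟫ := by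
  conv_rhs => rw [euc_sum_single x]
  simp only [map_sum, map_smul, inner_sum, real_inner_smul_right]
  refine Finset.sum_congr rfl fun k _ => ?_
  rw [PiLp.inner_apply, Finset.mul_sum]
  refine Finset.sum_congr rfl fun i _ => ?_
  simp; ring

namespace IsIpNorm

lemma hasFDerivAt_trunc (hH : Ip) {G' : E →L[ℝ] F} (hp : 1 < p)
    (hG : HasFDerivAt G G' ξ) :
    HasFDerivAt (trunc H p b G) (step b (V ξ) • G'
      + (deriv (step b) (V ξ) • innerSL ℝ (∇V ξ)).smulRight (G ξ)) ξ := by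
  have h1 : HasFDerivAt (fun ξ => step b (V ξ))
      (deriv (step b) (V ξ) • innerSL ℝ (∇V ξ)) ξ :=
    (differentiable_step b _).hasDerivAt.comp_hasFDerivAt ξ (hH.hasGradientAt_V hp ξ).hasFDerivAt
  exact h1.smul hG

lemma contDiff_V (hH : Ip) (hp : 1 < p) : ContDiff ℝ 1 (V) := by
  rw [contDiff_one_iff_fderiv]
  refine ⟨hH.differentiable_V hp, ?_⟩
  have : Df (V) = fun ξ => innerSL ℝ (∇V ξ) :=
    funext fun ξ => (hH.hasGradientAt_V hp ξ).hasFDerivAt.fderiv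
  rw [this]
  exact (innerSL ℝ).continuous.comp (hH.continuous_stress hp)

end IsIpNorm

namespace IsIpNorm

lemma cut_trace_ge (hH : Ip) (hp : 1 < p) (hb : 0 < b) (hξ : ξ ≠ 0)
    {S : E →L[ℝ] E} (hS : ∀ v v', ⟪S v, v'⟫ = ⟪v, S v'⟫) {k0 k1 : ℝ} (hk0 : 0 ≤ k0) :
    k0 * step b (V ξ) *
        ∑ i, ∑ k, Df (∇V) ξ (S (𝐞 i)) k
          * Df (∇V) ξ (S (𝐞 k)) i
      + (p - 1) * (k1 * step b (V ξ) * ⟪∇V ξ, S (∇V ξ)⟫) ≤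
    ∑ k, ∑ i, (k0 • (Df (trunc H p b fun ζ => ∇V ζ k) ξ).comp S
        + trunc H p b (fun ζ => ∇V ζ k) ξ • (k1 • innerSL ℝ ξ))
          (𝐞 i)
      * Df (∇V) ξ (S (𝐞 k)) i := by
  set A := Df (∇V) ξ with hA
  set Y := ∇V ξ with hY
  set θ := step b (V ξ) with hθ
  set θ' := deriv (step b) (V ξ) with hθ'
  have hTd : HasFDerivAt (∇V) A ξ :=
    ((hH.contDiffAt_stress hξ).differentiableAt (by norm_num)).hasFDerivAt
  have hTk : ∀ k : Fin N, HasFDerivAt (fun ζ => ∇V ζ k)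
      ((proj k : E →L[ℝ] ℝ).comp A) ξ := fun k =>
    (proj k : E →L[ℝ] ℝ).hasFDerivAt.comp ξ hTd
  have e1 : ∀ k i : Fin N, (k0 • (Df (trunc H p b fun ζ => ∇V ζ k) ξ).comp S
        + trunc H p b (fun ζ => ∇V ζ k) ξ • (k1 • innerSL ℝ ξ))
          (𝐞 i) * A (S (𝐞 k)) i =
      k0 * θ * (A (S (𝐞 i)) k * A (S (𝐞 k)) i)
      + k0 * θ' * (Y k * S Y i * A.comp S (𝐞 k) i)
      + k1 * θ * (Y k * ξ i * A.comp S (𝐞 k) i) := by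
    intro k i
    have h1 : ⟪Y, S (𝐞 i)⟫ = S Y i := by
      rw [← hS]; simp [EuclideanSpace.inner_single_right]
    have h2 : trunc H p b (fun ζ => ∇V ζ k) ξ = θ * Y k := rfl
    rw [(hH.hasFDerivAt_trunc hp (hTk k)).fderiv, h2]
    simp only [_root_.add_apply, _root_.smul_apply, ContinuousLinearMap.comp_apply,
      ContinuousLinearMap.smulRight_apply, innerSL_apply_apply, smul_eq_mul,
      EuclideanSpace.inner_single_right, ← hY, h1, map_one, ← hA, ← hθ,
      ← hθ']
    simp
    ring
  simp only [e1, Finset.sum_add_distrib, ← Finset.mul_sum, sum_sum_mul_apply]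
  rw [Finset.sum_comm]
  have h3 : 0 ≤ ⟪S Y, (A.comp S) Y⟫ := by
    rw [ContinuousLinearMap.comp_apply, real_inner_comm]
    obtain ⟨c, hc, hcl⟩ := hH.hess_lower hp
    exact le_trans (by positivity) (hcl ξ hξ (S Y))
  have h4 : ⟪ξ, (A.comp S) Y⟫ = (p - 1) * ⟪Y, S Y⟫ := by
    rw [ContinuousLinearMap.comp_apply, ← hH.hess_symm hp hξ, hH.hess_self hp hξ,
      real_inner_smul_left]
  have h5 : 0 ≤ k0 * θ' * ⟪S Y, (A.comp S) Y⟫ :=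
    mul_nonneg (mul_nonneg hk0 (deriv_step_nonneg hb _)) h3
  rw [h4]
  have h6 : ∀ a b c d : ℝ, a = d → 0 ≤ b → a + (p - 1) * (k1 * θ * c) ≤ d + b + k1 * θ * ((p - 1) * c) := by
    intro a b c d h1 h2; rw [h1]; linarith
  refine h6 _ _ _ _ ?_ h5
  simp only [mul_comm]

end IsIpNorm

/-- `tr (M²)` for `M = D(T(q)) = DT(q) S`. -/
def traceSq (H : E → ℝ) (p : ℝ) (q : E → E) (S : E → E →L[ℝ] E) (x : E)
    : ℝ :=
  ∑ i, ∑ k, Df (∇V) (q x) (S x (𝐞 i)) k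
    * Df (∇V) (q x) (S x (𝐞 k)) i

namespace Patch

lemma sob_stress (hH : Ip) (hp : 1 < p) (P : Patch H p Ω u q t a K w S) (ha : 0 < a) :
    Sob K (fun x => trunc H p a (∇V) (w x))
      (fun x => (Df (trunc H p a (∇V)) (w x)).comp (S x)) :=
  P.comp hH hp ha fun _ hξ => hH.contDiffAt_stress hξ

lemma fderiv_stress_eq (hH : Ip) (hp : 1 < p) (P : Patch H p Ω u q t a K w S)
    (ha : 0 < a) (hu : t < u x) (hV : 2 * a < V (q x)) :
    (Df (trunc H p a (∇V)) (w x)).comp (S x) =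
      (Df (∇V) (q x)).comp (S x) := by
  rw [P.eq x hu.le (by linarith), fderiv_trunc_of_gt hH hp ha hV]

lemma integrable_traceSq (hH : Ip) (hp : 1 < p) (h : RS)
    (P : Patch H p Ω u q t a K w S) (ht : 0 < t) (ha : 0 < a) (hb : 2 * a < b) :
    Integrable fun x => ramp t (u x) * step b (V (q x)) * traceSq H p q S x := by
  set W : E → E →L[ℝ] E :=
    fun x => (Df (trunc H p a (∇V)) (w x)).comp (S x) with hW
  have hWS : Sob K _ W := P.sob_stress hH hp ha
  have hWi : ∀ i k : Fin N, MemLp (fun x => W x (𝐞 i) k) 2 := fun i k =>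
    (hWS.memLp_apply (𝐞 i)).continuousLinearMap_comp
      (proj k : E →L[ℝ] ℝ)
  obtain ⟨B, hB0, hB⟩ := h.exists_comp_u_bound (contDiff_ramp t).continuous
  have i1 : Integrable fun x => ∑ i, ∑ k, W x (𝐞 i) k
      * W x (𝐞 k) i :=
    integrable_finset_sum _ fun i _ => integrable_finset_sum _ fun k _ =>
      (hWi i k).integrable_mul (hWi k i)
  have hm : AEStronglyMeasurable fun x => ramp t (u x) * step b (V (q x)) := by
    refine ((contDiff_ramp t).continuous.comp h.cont).aestronglyMeasurable.mul ?_
    exact (h.meas_comp ((continuous_step b).comp (hH.V_continuous hp))).aestronglyMeasurable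
  have i2 := i1.bdd_mul (c := B) hm (of_forall fun x => by
    rw [norm_mul, Real.norm_eq_abs, Real.norm_eq_abs, abs_of_nonneg (step_nonneg _ _)]
    exact (mul_le_of_le_one_right (abs_nonneg _) (step_le_one _ _)).trans (hB x))
  refine i2.congr (of_forall fun x => ?_)
  by_cases hx : t < u x ∧ b ≤ V (q x)
  · have := P.fderiv_stress_eq hH hp ha hx.1 (hb.trans_le hx.2)
    simp only [hW, this, traceSq]
    rfl
  · rcases not_and_or.1 hx with hx | hx
    · simp only [ramp_of_le ht (not_lt.1 hx), zero_mul]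
    · simp only [step_of_le (by linarith : 0 < b) (not_le.1 hx).le, mul_zero, zero_mul]

/-- The weak formulation tested with `step t (u) * ramp b (V q)`. -/
lemma integral_step_ramp (hH : Ip) (hp : 1 < p) (h : RS)
    (P : Patch H p Ω u q t a K w S) (ht : 0 < t) (ha : 0 < a) (hb : 2 * a < b) :
    Integrable (fun x => step t (u x) * step b (V (q x)) *
        ⟪∇V (q x), S x (∇V (q x))⟫
      + ramp b (V (q x)) * (deriv (step t) (u x) * H (q x) ^ p)) ∧
    ∫ x, (step t (u x) * step b (V (q x)) *
        ⟪∇V (q x), S x (∇V (q x))⟫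
      + ramp b (V (q x)) * (deriv (step t) (u x) * H (q x) ^ p)) =
    ∫ x, step t (u x) * ramp b (V (q x)) := by
  have hb0 : 0 < b := by linarith
  have hY2 := h.memLp_comp hH (hH.continuous_stress hp) (hH.stress_zero hp) 2
  have hΘ : ContDiff ℝ 1 fun ξ => ramp b (V ξ) := (contDiff_ramp b).comp (hH.contDiff_V hp)
  have s1 := P.sob.comp_contDiff hΘ (by simp only [hH.V_zero hp, ramp_zero_right])
  have s2 := P.sob_u (step t) (contDiff_step t) fun s hs => step_of_le ht hs
  have s3 := s2.mul s1
  have hd : ∀ ξ, Df (fun ξ => ramp b (V ξ)) ξ =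
      step b (V ξ) • innerSL ℝ (∇V ξ) := fun ξ =>
    ((hasDerivAt_ramp b _).comp_hasFDerivAt ξ (hH.hasGradientAt_V hp ξ).hasFDerivAt).fderiv
  have hw := s3.weakDiv P.sub h.weak hY2
  have hi := integrable_clm_apply (r := 2) (s := 2) s3.memLp_fderiv hY2
  have hV : ∀ x, t ≤ u x → ramp b (V (w x)) = ramp b (V (q x)) := fun x hx => by
    by_cases hax : a ≤ V (q x)
    · rw [P.eq x hx hax]
    · push Not at hax
      rw [ramp_of_le hb0, ramp_of_le hb0] <;> linarith [P.le x hx]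
  have heq : ∀ x, (step t (u x) • (Df (fun ξ => ramp b (V ξ)) (w x)).comp (S x)
      + ramp b (V (w x)) • (deriv (step t) (u x) • innerSL ℝ (q x))) (∇V (q x)) =
      step t (u x) * step b (V (q x)) * ⟪∇V (q x), S x (∇V (q x))⟫
      + ramp b (V (q x)) * (deriv (step t) (u x) * H (q x) ^ p) := by
    intro x
    have h0 : ⟪q x, ∇V (q x)⟫ = H (q x) ^ p := by
      rw [real_inner_comm]; exact hH.inner_stress_self hp _
    rw [hd]
    simp only [_root_.add_apply, _root_.smul_apply, ContinuousLinearMap.comp_apply,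
      innerSL_apply_apply, smul_eq_mul, h0]
    by_cases hx : t ≤ u x
    · rw [hV x hx]
      by_cases hax : a ≤ V (q x)
      · rw [P.eq x hx hax]; ring
      · push Not at hax
        rw [step_of_le hb0 (s := V (w x)) (by linarith [P.le x hx]),
          step_of_le hb0 (s := V (q x)) (by linarith)]
        ring
    · push Not at hx
      rw [step_of_le ht hx.le, deriv_eq_zero_of_vanish (contDiff_step t)
        (fun s hs => step_of_le ht hs) hx.le]
      ring
  simp only [heq] at hw hi
  refine ⟨hi, hw.trans ?_⟩
  rw [one_mul]
  refine integral_congr_ae (of_forall fun x => ?_)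
  by_cases hx : t ≤ u x
  · simp only [hV x hx]
  · simp only [step_of_le ht (not_le.1 hx).le, zero_mul]

/-- The weak formulation tested with `step t (u)`. -/
lemma integral_deriv_step (hH : Ip) (hp : 1 < p) (h : RS)
    (P : Patch H p Ω u q t a K w S) (ht : 0 < t) :
    Integrable (fun x => deriv (step t) (u x) * H (q x) ^ p) ∧ Integrable (fun x => step t (u x)) ∧
    ∫ x, deriv (step t) (u x) * H (q x) ^ p = ∫ x, step t (u x) := by
  have hY2 := h.memLp_comp hH (hH.continuous_stress hp) (hH.stress_zero hp) 2
  have s2 := P.sob_u (step t) (contDiff_step t) fun s hs => step_of_le ht hs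
  have hw := s2.weakDiv P.sub h.weak hY2
  have hi := integrable_clm_apply (r := 2) (s := 2) s2.memLp_fderiv hY2
  have heq : ∀ x, (deriv (step t) (u x) • innerSL ℝ (q x)) (∇V (q x)) =
      deriv (step t) (u x) * H (q x) ^ p := fun x => by
    rw [_root_.smul_apply, innerSL_apply_apply, real_inner_comm, hH.inner_stress_self hp,
      smul_eq_mul]
  simp only [heq, one_mul] at hw hi
  exact ⟨hi, memLp_one_iff_integrable.1 (s2.memLp 1), hw⟩

end Patch

namespace Patch

set_option maxHeartbeats 1000000 in
/-- A divergence identity for the vector fields `ramp t (u) * T_k(q)`. -/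
lemma exists_trace_identity (hH : Ip) (hp : 1 < p) (h : RS)
    (P : Patch H p Ω u q t a K w S) (ht : 0 < t) (ha : 0 < a) (hb : 2 * a < b) :
    ∃ f : E → ℝ, Integrable f ∧ ∫ x, f x = 0 ∧ ∀ᵐ x,
      ramp t (u x) * step b (V (q x)) * traceSq H p q S x
        + (p - 1) * (step t (u x) * step b (V (q x)) *
          ⟪∇V (q x), S x (∇V (q x))⟫) ≤ f x := by
  have hb0 : 0 < b := by linarith
  have hκ0 : ∀ s ≤ t, ramp t s = 0 := fun s hs => ramp_of_le ht hs
  have hTk : ∀ k : Fin N, ∀ ξ : E, ξ ≠ 0 → ContDiffAt ℝ 1 (fun ζ => ∇V ζ k) ξ :=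
    fun k ξ hξ => (proj k : E →L[ℝ] ℝ).contDiff.contDiffAt.comp ξ
      (hH.contDiffAt_stress hξ)
  set D : Fin N → E → E →L[ℝ] ℝ := fun k =>
    cutDeriv H p b u q w S (ramp t) (fun ζ => ∇V ζ k) with hD
  have hDS : ∀ k, Sob K _ (D k) := fun k => P.cut hH hp hb0 (hTk k) (contDiff_ramp t) hκ0
  have hD0 : ∀ k x, ¬ (t < u x ∧ b ≤ V (q x)) → D k x = 0 := fun k x hx =>
    (P.cutDeriv_eq_zero hH hp hb0 (contDiff_ramp t) hκ0 hx).2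
  set W : E → E →L[ℝ] E :=
    fun x => (Df (trunc H p a (∇V)) (w x)).comp (S x) with hW
  have hWS : Sob K _ W := P.sob_stress hH hp ha
  set Wi : Fin N → E → E →L[ℝ] ℝ :=
    fun i x => (proj i : E →L[ℝ] ℝ).comp (W x) with hWi
  have hWiS : ∀ i, Sob K _ (Wi i) := fun i => hWS.clm_comp (proj i : E →L[ℝ] ℝ)
  have key : ∀ k i : Fin N, ∫ x, D k x (𝐞 i) * Wi i x (𝐞 k)
      = ∫ x, D k x (𝐞 k) * Wi i x (𝐞 i) := fun k i =>
    (hDS k).integral_fderiv_mul_fderiv_comm (hWiS i) _ _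
  have hint : ∀ k i j l : Fin N, Integrable fun x =>
      D k x (𝐞 j) * Wi i x (𝐞 l) := fun k i j l =>
    ((hDS k).memLp_apply _).integrable_mul ((hWiS i).memLp_apply _)
  have htr := RSol.trace_hess hH hp h ht ha P
  have hsy := RSol.symm_of_patch hH hp h ht ha P
  refine ⟨fun x => ∑ k, ∑ i, D k x (𝐞 i)
    * Wi i x (𝐞 k), ?_, ?_, ?_⟩
  · exact integrable_finset_sum _ fun k _ => integrable_finset_sum _ fun i _ => hint k i i k
  · rw [integral_finsetSum _ fun k _ => integrable_finset_sum _ fun i _ => hint k i i k]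
    refine Finset.sum_eq_zero fun k _ => ?_
    rw [integral_finsetSum _ fun i _ => hint k i i k]
    simp only [key]
    rw [← integral_finsetSum _ fun i _ => hint k i k i]
    refine (integral_congr_ae ?_).trans (b := ∫ x, -D k x (𝐞 k)) ?_
    · filter_upwards [htr] with x hx
      by_cases hax : t < u x ∧ b ≤ V (q x)
      · have h1 := hx hax.1 (hb.trans_le hax.2)
        have h2 : ∀ i, Wi i x (𝐞 i) =
            Df (∇V) (q x) (S x (𝐞 i)) i := fun i => by
          simp only [hWi, hW, P.fderiv_stress_eq hH hp ha hax.1 (hb.trans_le hax.2)]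
          rfl
        simp only [h2]
        rw [← Finset.mul_sum, h1, mul_neg_one]
      · simp [hD0 k x hax]
    · rw [integral_neg, (hDS k).integral_fderiv_eq_zero, neg_zero]
  · filter_upwards [hsy] with x hx
    by_cases hax : t < u x ∧ b ≤ V (q x)
    · have h2 : ∀ i k, Wi i x (𝐞 k) =
          Df (∇V) (q x) (S x (𝐞 k)) i := fun i k => by
        simp only [hWi, hW, P.fderiv_stress_eq hH hp ha hax.1 (hb.trans_le hax.2)]
        rfl
      have hq : q x ≠ 0 := fun h0 => by
        have := hax.2; rw [h0, hH.V_zero hp] at this; linarith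
      have h3 := hH.cut_trace_ge hp hb0 hq (hx hax.1 (hb.trans_le hax.2))
        (k0 := ramp t (u x)) (k1 := step t (u x)) (ramp_nonneg ht _)
      simp only [h2, hD, cutDeriv, deriv_ramp, P.eq x hax.1.le (by linarith)]
      exact h3
    · simp only [hD0 _ x hax, _root_.zero_apply, zero_mul, Finset.sum_const_zero]
      rcases not_and_or.1 hax with hx | hx
      · simp [ramp_of_le ht (not_lt.1 hx), step_of_le ht (not_lt.1 hx)]
      · simp [step_of_le hb0 (not_le.1 hx).le]

end Patch

namespace RSol

lemma V_le (hH : Ip) (hp : 1 < p) (h : RS) (x : E) :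
    V (q x) ≤ C ^ p / p := by
  have h0 : (0:ℝ) < p := by linarith
  exact div_le_div_of_nonneg_right (Real.rpow_le_rpow (hH.nonneg _) (h.le x) h0.le) h0.le

lemma integrable_V (hH : Ip) (hp : 1 < p) (h : RS) :
    Integrable fun x => V (q x) :=
  memLp_one_iff_integrable.1 (h.memLp_comp hH (hH.V_continuous hp) (hH.V_zero hp) 1)

lemma integrable_V_deficit (hH : Ip) (hp : 1 < p) (h : RS) (b : ℝ) :
    IntegrableOn (fun x => C ^ p / p - V (q x) + 2 * b) Ω := by
  have hf : volume Ω ≠ ⊤ := h.bounded.measure_lt_top.ne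
  exact ((integrableOn_const hf).sub (h.integrable_V hH hp).integrableOn).add (integrableOn_const hf)

lemma integral_traceSq_le (hH : Ip) (hp : 1 < p) (h : RS)
    (P : Patch H p Ω u q t a K w S) (ht : 0 < t) (ha : 0 < a) (hb : 2 * a < b) :
    ∫ x, ramp t (u x) * step b (V (q x)) * traceSq H p q S x ≤
      (p - 1) * ∫ x in Ω, (C ^ p / p - V (q x) + 2 * b) := by
  have hb0 : 0 < b := by linarith
  obtain ⟨f, hf, hf0, hle⟩ := P.exists_trace_identity hH hp h ht ha hb
  obtain ⟨hi2, he2⟩ := P.integral_step_ramp hH hp h ht ha hb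
  obtain ⟨hi3, hi4, he3⟩ := P.integral_deriv_step hH hp h ht
  set Θ := ramp b (C ^ p / p) with hΘ
  have hC0 : 0 ≤ C ^ p / p := div_nonneg (Real.rpow_nonneg h.C_pos.le _) (by linarith)
  have i5 : Integrable fun x => step t (u x) * ramp b (V (q x)) := by
    refine hi4.mul_bdd (c := C ^ p / p) (h.meas_comp ((contDiff_ramp b).continuous.comp
      (hH.V_continuous hp))).aestronglyMeasurable (of_forall fun x => ?_)
    rw [Real.norm_eq_abs, abs_of_nonneg (ramp_nonneg hb0 _)]
    exact (ramp_le (hH.V_nonneg hp _)).trans (h.V_le hH hp x)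
  have g1 := hf.sub (hi2.const_mul (p - 1))
  have g2 := g1.add (hi3.const_mul ((p - 1) * Θ))
  have step1 : ∫ x, ramp t (u x) * step b (V (q x)) * traceSq H p q S x ≤
      (p - 1) * (Θ * ∫ x, step t (u x)) - (p - 1) * ∫ x, step t (u x) * ramp b (V (q x)) := by
    have e := integral_add g1 (hi3.const_mul ((p - 1) * Θ))
    have e' := integral_sub hf (hi2.const_mul (p - 1))
    have e'' : ∫ x, (f - fun x => (p - 1) * (step t (u x) * step b (V (q x)) *
        ⟪∇V (q x), S x (∇V (q x))⟫
      + ramp b (V (q x)) * (deriv (step t) (u x) * H (q x) ^ p))) x =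
      -(p - 1) * ∫ x, step t (u x) * ramp b (V (q x)) := by
      refine e'.trans ?_
      rw [integral_const_mul, he2, hf0]; ring
    rw [e'', integral_const_mul, he3] at e
    refine (integral_mono_ae (P.integrable_traceSq hH hp h ht ha hb) g2 ?_).trans
      (e.le.trans (by linarith))
    filter_upwards [hle] with x hx
    have h1 : 0 ≤ deriv (step t) (u x) * H (q x) ^ p :=
      mul_nonneg (deriv_step_nonneg ht _) (Real.rpow_nonneg (hH.nonneg _) _)
    have h2 : ramp b (V (q x)) ≤ Θ := monotone_ramp b (h.V_le hH hp x)
    have h3 : (p - 1) * (ramp b (V (q x)) * (deriv (step t) (u x) * H (q x) ^ p)) ≤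
        (p - 1) * (Θ * (deriv (step t) (u x) * H (q x) ^ p)) := by
      have : 0 ≤ p - 1 := by linarith
      gcongr
    simp only [Pi.add_apply, Pi.sub_apply]
    linarith
  have step2 : Θ * (∫ x, step t (u x)) - ∫ x, step t (u x) * ramp b (V (q x)) ≤
      ∫ x in Ω, (C ^ p / p - V (q x) + 2 * b) := by
    have e := integral_sub (hi4.const_mul Θ) i5
    rw [integral_const_mul] at e
    rw [← e, ← integral_indicator h.isOpen.measurableSet]
    refine integral_mono ((hi4.const_mul Θ).sub i5)
      ((h.integrable_V_deficit hH hp b).integrable_indicator h.isOpen.measurableSet) fun x => ?_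
    by_cases hx : x ∈ Ω
    · rw [indicator_of_mem hx]
      have h1 := step_nonneg t (u x)
      have h2 := step_le_one t (u x)
      have h3 : ramp b (V (q x)) ≤ Θ := monotone_ramp b (h.V_le hH hp x)
      have h4 : Θ ≤ C ^ p / p := ramp_le hC0
      have h5 := sub_le_ramp hb0 (V (q x))
      have h6 : step t (u x) * (Θ - ramp b (V (q x))) ≤ Θ - ramp b (V (q x)) :=
        mul_le_of_le_one_left (by linarith) h2
      change Θ * step t (u x) - step t (u x) * ramp b (V (q x)) ≤ _
      linarith
    · rw [indicator_of_notMem hx, h.zero x hx, step_of_le ht ht.le]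
      simp
  have : 0 ≤ p - 1 := by linarith
  calc _ ≤ _ := step1
    _ = (p - 1) * (Θ * (∫ x, step t (u x)) - ∫ x, step t (u x) * ramp b (V (q x))) := by ring
    _ ≤ _ := by gcongr

end RSol

/-- The squared distance from `M = DT(q) S` to `-1 / N`. -/
def traceGap (H : E → ℝ) (p : ℝ) (q : E → E) (S : E → E →L[ℝ] E) (x : E)
    : ℝ :=
  ∑ i, ‖Df (∇V) (q x) (S x (𝐞 i))
    + (1 / N : ℝ) • 𝐞 i‖ ^ 2

namespace RSol

lemma integrable_ramp_step (hH : Ip) (hp : 1 < p) (h : RS) (ht : 0 < t)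
    (b : ℝ) : Integrable fun x => ramp t (u x) * step b (V (q x)) := by
  obtain ⟨B, hB0, hB⟩ := h.exists_comp_u_bound (contDiff_ramp t).continuous
  refine memLp_one_iff_integrable.1 (memLp_of_bound_of_eq_zero h.isCompact_closure ?_ (B := B)
    (of_forall fun x => ?_) (of_forall fun x hx => ?_) 1)
  · refine ((contDiff_ramp t).continuous.comp h.cont).aestronglyMeasurable.mul ?_
    exact (h.meas_comp ((continuous_step b).comp (hH.V_continuous hp))).aestronglyMeasurable
  · rw [norm_mul, Real.norm_eq_abs, Real.norm_eq_abs, abs_of_nonneg (step_nonneg _ _)]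
    exact (mul_le_of_le_one_right (abs_nonneg _) (step_le_one _ _)).trans (hB x)
  · rw [h.zero x fun hx' => hx (subset_closure hx'), ramp_of_le ht ht.le, zero_mul]

lemma exists_traceGap_bound (hH : Ip) (hp : 1 < p) (hN : 0 < N) : ∃ c > 0,
    ∀ {Ω : Set E} {u : E → ℝ} {q : E → E} {t a b C : ℝ} {K : Set E}
      {w : E → E} {S : E → E →L[ℝ] E}, RS →
      Patch H p Ω u q t a K w S → 0 < t → 0 < a → 2 * a < b →
      Integrable (fun x => ramp t (u x) * step b (V (q x)) * traceGap H p q S x) ∧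
      c * ∫ x, ramp t (u x) * step b (V (q x)) * traceGap H p q S x ≤
      (p - 1) * (∫ x in Ω, (C ^ p / p - V (q x) + 2 * b))
        - 1 / N * ∫ x, ramp t (u x) * step b (V (q x)) := by
  obtain ⟨c, hc, hcg⟩ := hH.exists_trace_gap hp hN
  refine ⟨c, hc, fun {Ω u q t a b C K w S} h P ht ha hb => ?_⟩
  have hb0 : 0 < b := by linarith
  have i1 := P.integrable_traceSq hH hp h ht ha hb
  have i2 := h.integrable_ramp_step hH hp ht b
  have i3 := i1.sub (i2.const_mul (1 / N : ℝ))
  set W : E → E →L[ℝ] E :=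
    fun x => (Df (trunc H p a (∇V)) (w x)).comp (S x) with hW
  have hWS : Sob K _ W := P.sob_stress hH hp ha
  have hle : ∀ᵐ x, c * (ramp t (u x) * step b (V (q x)) * traceGap H p q S x) ≤
      ramp t (u x) * step b (V (q x)) * traceSq H p q S x
        - 1 / N * (ramp t (u x) * step b (V (q x))) := by
    filter_upwards [h.trace_hess hH hp ht ha P, h.symm_of_patch hH hp ht ha P] with x h1 h2
    by_cases hx : t < u x ∧ b ≤ V (q x)
    · have hq : q x ≠ 0 := fun h0 => by
        have := hx.2; rw [h0, hH.V_zero hp] at this; linarith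
      have h3 := hcg (q x) hq (S x) (h2 hx.1 (by linarith [hx.2])) (h1 hx.1 (by linarith [hx.2]))
      have h4 : 0 ≤ ramp t (u x) * step b (V (q x)) :=
        mul_nonneg (ramp_nonneg ht _) (step_nonneg _ _)
      have h5 := mul_le_mul_of_nonneg_left h3 h4
      change _ * (c * traceGap H p q S x) ≤ _ * (traceSq H p q S x - 1 / N) at h5
      linarith
    · rcases not_and_or.1 hx with hx | hx
      · simp [ramp_of_le ht (not_lt.1 hx)]
      · simp [step_of_le hb0 (not_le.1 hx).le]
  have hm : AEStronglyMeasurable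
      fun x => ramp t (u x) * step b (V (q x)) * traceGap H p q S x := by
    have m1 : AEStronglyMeasurable fun x => ramp t (u x) * step b (V (q x)) *
        ∑ i, ‖W x (𝐞 i)
          + (1 / N : ℝ) • 𝐞 i‖ ^ 2 := by
      refine i2.aestronglyMeasurable.mul (Finset.aestronglyMeasurable_fun_sum _ fun i _ => ?_)
      exact (((hWS.memLp_apply _).1.add aestronglyMeasurable_const).norm).pow 2
    refine m1.congr (of_forall fun x => ?_)
    by_cases hx : t < u x ∧ b ≤ V (q x)
    · have := P.fderiv_stress_eq hH hp ha hx.1 (hb.trans_le hx.2)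
      simp only [hW, this, traceGap]
      rfl
    · rcases not_and_or.1 hx with hx | hx
      · simp only [ramp_of_le ht (not_lt.1 hx), zero_mul]
      · simp only [step_of_le hb0 (not_le.1 hx).le, mul_zero, zero_mul]
  have hnn : ∀ x, 0 ≤ ramp t (u x) * step b (V (q x)) * traceGap H p q S x := fun x =>
    mul_nonneg (mul_nonneg (ramp_nonneg ht _) (step_nonneg _ _))
      (Finset.sum_nonneg fun i _ => by positivity)
  have i4 : Integrable fun x => ramp t (u x) * step b (V (q x)) * traceGap H p q S x := by
    refine (i3.const_mul c⁻¹).mono' hm ?_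
    filter_upwards [hle] with x hx
    rw [Real.norm_eq_abs, abs_of_nonneg (hnn x), ← div_eq_inv_mul, le_div_iff₀ hc, mul_comm]
    exact hx
  refine ⟨i4, ?_⟩
  have e1 := integral_mono_ae (i4.const_mul c) i3 hle
  have e2 := integral_sub i1 (i2.const_mul (1 / N : ℝ))
  rw [integral_const_mul] at e1 e2
  have e3 := h.integral_traceSq_le hH hp P ht ha hb
  have e4 := e1.trans e2.le
  linarith

end RSol

/-- `traceGap` controls the operator `M + 1 / N`. -/
lemma norm_le_traceGap (x : E) (j : Fin N) :
    ‖Df (∇V) (q x) (S x (𝐞 j))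
      + (1 / N : ℝ) • 𝐞 j‖ ^ 2 ≤ traceGap H p q S x :=
  Finset.single_le_sum (f := fun i => ‖Df (∇V) (q x) (S x (𝐞 i))
    + (1 / N : ℝ) • 𝐞 i‖ ^ 2) (fun i _ => by positivity)
    (Finset.mem_univ j)

lemma exists_deriv_step_bound : ∃ L > 0, ∀ b > 0, ∀ s, |deriv (step b) s| ≤ L / b := by
  have hc : HasCompactSupport (deriv Real.smoothTransition) := by
    refine HasCompactSupport.intro (isCompact_Icc (a := 0) (b := 1)) fun x hx => ?_
    rw [mem_Icc, not_and_or, not_le, not_le] at hx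
    rcases hx with hx | hx
    · have : Real.smoothTransition =ᶠ[𝓝 x] fun _ => 0 := by
        filter_upwards [gt_mem_nhds hx] with y hy
          using Real.smoothTransition.zero_of_nonpos (le_of_lt hy)
      rw [this.deriv_eq]; simp
    · have : Real.smoothTransition =ᶠ[𝓝 x] fun _ => 1 := by
        filter_upwards [lt_mem_nhds hx] with y hy
          using Real.smoothTransition.one_of_one_le (le_of_lt hy)
      rw [this.deriv_eq]; simp
  obtain ⟨L, hL⟩ := hc.exists_bound_of_continuous
    ((Real.smoothTransition.contDiff (n := 1)).continuous_deriv le_rfl)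
  refine ⟨|L| + 1, by positivity, fun b hb s => ?_⟩
  have h1 : HasDerivAt (step b) (deriv Real.smoothTransition (s / b - 1) * (1 / b)) s := by
    have h2 : HasDerivAt (fun s : ℝ => s / b - 1) (1 / b) s := ((hasDerivAt_id s).div_const b).sub_const 1
    exact ((Real.smoothTransition.contDiff (n := 1)).differentiable (by norm_num) _).hasDerivAt.comp
      s h2
  rw [h1.deriv, abs_mul, abs_of_pos (by positivity : 0 < 1 / b), mul_one_div]
  gcongr
  exact (hL _).trans ((le_abs_self L).trans (by linarith))

namespace IsIpNorm

/-- The derivative of the truncation in `trunc s (∇V) ∘ w` costs at most a multiple of the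
derivative of `∇V ∘ w`, on the set where the truncation is active. -/
lemma exists_trunc_stress_bound (hH : Ip) (hp : 1 < p) : ∃ L > 0, ∀ s > 0,
    ∀ ξ, s ≤ V ξ → ∀ v : E,
      ‖Df (trunc H p s (∇V)) ξ v
        - step s (V ξ) • Df (∇V) ξ v‖ ≤
      {ξ | V ξ ≤ 2 * s}.indicator (fun _ => L) ξ * ‖Df (∇V) ξ v‖ := by
  obtain ⟨L, hL, hLb⟩ := exists_deriv_step_bound
  obtain ⟨c, hc, hcl⟩ := hH.hess_lower hp
  obtain ⟨K, hK, hKb⟩ := hH.norm_stress_le hp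
  obtain ⟨c1, K1, hc1, hK1, hb1⟩ := hH.exists_bounds
  have h0p : (0:ℝ) < p := by linarith
  set k := K * K1 ^ (p - 1) with hk
  have hk0 : 0 < k := by positivity
  refine ⟨L * (k ^ 2 * (c⁻¹ * (2 * p / c1 ^ p))), by positivity, fun s hs ξ hsξ v => ?_⟩
  have hξ : ξ ≠ 0 := fun h0 => by rw [h0, hH.V_zero hp] at hsξ; linarith
  have hn : 0 < ‖ξ‖ := norm_pos_iff.2 hξ
  by_cases h2 : V ξ ≤ 2 * s
  · rw [indicator_of_mem (show ξ ∈ {ξ | V ξ ≤ 2 * s} from h2)]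
    have hTd : HasFDerivAt (∇V) (Df (∇V) ξ) ξ :=
      ((hH.contDiffAt_stress hξ).differentiableAt (by norm_num)).hasFDerivAt
    rw [(hH.hasFDerivAt_trunc hp hTd).fderiv]
    simp only [_root_.add_apply, _root_.smul_apply, ContinuousLinearMap.smulRight_apply,
      add_sub_cancel_left, innerSL_apply_apply, norm_smul, smul_eq_mul, norm_mul, Real.norm_eq_abs]
    set z := ‖Df (∇V) ξ v‖ with hz
    have hY : ‖∇V ξ‖ ≤ k * ‖ξ‖ ^ (p - 1) := by
      refine (hKb ξ).trans ?_
      rw [hk, mul_assoc, ← Real.mul_rpow hK1.le hn.le]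
      exact mul_le_mul_of_nonneg_left (Real.rpow_le_rpow (hH.nonneg _) (hb1 ξ).2 (by linarith)) hK.le
    have hv : c * ‖ξ‖ ^ (p - 2) * ‖v‖ ≤ z := by
      rcases eq_or_ne v 0 with rfl | hv
      · simp [hz]
      · have h3 := (hcl ξ hξ v).trans (real_inner_le_norm _ _)
        have hv' := norm_pos_iff.2 hv
        rw [sq, ← mul_assoc] at h3
        exact le_of_mul_le_mul_right h3 hv'
    have hP : ‖ξ‖ ^ p ≤ 2 * p / c1 ^ p * s := by
      have h3 : (c1 * ‖ξ‖) ^ p ≤ H ξ ^ p := Real.rpow_le_rpow (by positivity) (hb1 ξ).1 h0p.le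
      rw [Real.mul_rpow hc1.le hn.le] at h3
      rw [Vfun, div_le_iff₀ h0p] at h2
      rw [div_mul_eq_mul_div, le_div_iff₀ (by positivity)]
      linarith
    have hin : |⟪∇V ξ, v⟫| ≤ ‖∇V ξ‖ * ‖v‖ := abs_real_inner_le_norm _ _
    have e1 : ‖ξ‖ ^ (p - 1) * ‖ξ‖ ^ (p - 1) = ‖ξ‖ ^ p * ‖ξ‖ ^ (p - 2) := by
      rw [← Real.rpow_add hn, ← Real.rpow_add hn]; congr 1; ring
    have e2 : ‖ξ‖ ^ (p - 2) * ‖v‖ ≤ c⁻¹ * z := by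
      rw [inv_mul_eq_div, le_div_iff₀ hc]; linarith
    calc |deriv (step s) (V ξ)| * |⟪∇V ξ, v⟫| * ‖∇V ξ‖
        ≤ L / s * ((k * ‖ξ‖ ^ (p - 1)) * ‖v‖) * (k * ‖ξ‖ ^ (p - 1)) := by
          gcongr
          · exact hLb s hs _
          · exact hin.trans (by gcongr)
      _ = L / s * k ^ 2 * (‖ξ‖ ^ p * (‖ξ‖ ^ (p - 2) * ‖v‖)) := by
          linear_combination (L / s * k ^ 2 * ‖v‖) * e1
      _ ≤ L / s * k ^ 2 * (2 * p / c1 ^ p * s * (c⁻¹ * z)) := by gcongr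
      _ = _ := by field_simp
  · push Not at h2
    rw [fderiv_trunc_of_gt hH hp hs h2, step_of_ge hs h2.le, one_smul, sub_self, norm_zero,
      indicator_of_notMem (by simpa using h2), zero_mul]

end IsIpNorm

namespace RSol

/-- The part of `Ω` where `b ≤ V(q) ≤ 2b`. -/
def slab (H : E → ℝ) (p : ℝ) (Ω : Set E) (q : E → E) (b : ℝ) : Set E :=
  Ω ∩ {x | b ≤ V (q x) ∧ V (q x) ≤ 2 * b}

lemma measurableSet_slab (hH : Ip) (hp : 1 < p) (h : RS) (b : ℝ) :
    MeasurableSet (slab H p Ω q b) := by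
  have hm : Measurable fun x => V (q x) := (hH.V_continuous hp).measurable.comp h.meas
  exact h.isOpen.measurableSet.inter
    ((measurableSet_le measurable_const hm).inter (measurableSet_le hm measurable_const))

lemma slab_ne_top (h : RS) (b : ℝ) : volume (slab H p Ω q b) ≠ ⊤ :=
  ((measure_mono inter_subset_left).trans_lt h.bounded.measure_lt_top).ne

end RSol

namespace Patch

/-- Integration by parts against the truncated stress. -/
lemma integral_trunc_stress (hH : Ip) (hp : 1 < p) (P : Patch H p Ω u q t a K w S)
    (hb : 0 < b) (hab : a ≤ b) (hφ : ContDiff ℝ 1 φ) (hφc : HasCompactSupport φ)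
    (hu : ∀ x ∈ tsupport φ, t ≤ u x) (i j : Fin N) :
    Integrable (fun x => φ x *
      (Df (trunc H p b (∇V)) (w x) (S x (𝐞 j))) i) ∧
    Integrable (fun x => Df φ x (𝐞 j) * trunc H p b (∇V) (q x) i) ∧
    ∫ x, Df φ x (𝐞 j) * trunc H p b (∇V) (q x) i =
      - ∫ x, φ x *
        (Df (trunc H p b (∇V)) (w x) (S x (𝐞 j))) i := by
  have hZ : Sob K _ _ := P.comp hH hp hb (G := ∇V) fun _ hξ => hH.contDiffAt_stress hξ
  have hK' : IsCompact (K ∪ tsupport φ) := hZ.isCompact.union hφc.isCompact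
  have hφS : Sob (K ∪ tsupport φ) φ (Df φ) := Sob.of_contDiff hK' hφ
    fun x hx => image_eq_zero_of_notMem_tsupport fun h => hx (Or.inr h)
  have hZi := (hZ.mono hK' subset_union_left).clm_comp (proj i : E →L[ℝ] ℝ)
  have e := hφS.integral_mul_fderiv hZi (𝐞 j)
  have i1 := (hφS.memLp 2).integrable_mul (hZi.memLp_apply (𝐞 j))
  have i2 := (hφS.memLp_apply (𝐞 j)).integrable_mul (hZi.memLp 2)
  have h1 : ∀ x, Df φ x (𝐞 j) * trunc H p b (∇V) (q x) i =
      Df φ x (𝐞 j) * trunc H p b (∇V) (w x) i := fun x => by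
    by_cases hx : x ∈ tsupport φ
    · rw [P.trunc_eq hb hab _ (hu x hx)]
    · rw [fderiv_eq_zero_of_notMem (isClosed_tsupport φ)
        (fun x hx => image_eq_zero_of_notMem_tsupport hx) hx]
      simp
  simp only [h1]
  refine ⟨i1, i2, ?_⟩
  rw [eq_neg_iff_add_eq_zero, add_comm, ← eq_neg_iff_add_eq_zero]
  exact e

end Patch

namespace IsIpNorm

set_option maxHeartbeats 1000000 in
/-- Two approximate identities for the truncated stress, with error controlled by the trace gap. -/
lemma exists_stress_identities (hH : Ip) (hp : 1 < p) (hN : 0 < N) : ∃ L > 0,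
    ∀ {Ω : Set E} {u : E → ℝ} {q : E → E} {t a b C : ℝ} {K : Set E}
      {w : E → E} {S : E → E →L[ℝ] E}, RS →
      Patch H p Ω u q t a K w S → 0 < t → 0 < a → 4 * a < b →
      ∀ Ξ, ∫ x, ramp t (u x) * step (b / 2) (V (q x)) * traceGap H p q S x ≤ Ξ →
      ∀ φ : E → ℝ, ContDiff ℝ 1 φ → HasCompactSupport φ → ∀ m, 4 * t ≤ m →
      (∀ x ∈ tsupport φ, m ≤ u x) → ∀ B, (∀ x, |φ x| ≤ B) → ∀ η > 0,
      (∀ i j : Fin N, |(∫ x, Df φ x (𝐞 j)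
            * trunc H p b (∇V) (q x) i)
          - (if i = j then (1 / N : ℝ) else 0) * ∫ x, φ x * step b (V (q x))| ≤
        B * (L * (1 + η) * volume.real (RSol.slab H p Ω q b) + η * volume.real Ω
          + (1 + L) * (2 / (m * η)) * Ξ)) ∧
      |(∫ x, Df φ x (trunc H p b (∇V) (q x)))
          - ∫ x, φ x * step b (V (q x))| ≤
        N * (B * (L * (1 + η) * volume.real (RSol.slab H p Ω q b) + L * (2 / (m * η)) * Ξ)) := by
  obtain ⟨L, hL, hLb⟩ := hH.exists_trunc_stress_bound hp
  obtain ⟨c, hc, hcb⟩ := RSol.exists_traceGap_bound hH hp hN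
  refine ⟨L, hL, fun {Ω u q t a b C K w S} h P ht ha hb Ξ hE φ hφ hφc m hm hu B hB η hη => ?_⟩
  have hb0 : 0 < b := by linarith
  have hm0 : 0 < m := by linarith
  have hB0 : 0 ≤ B := (abs_nonneg _).trans (hB 0)
  obtain ⟨iG, -⟩ := hcb h P ht ha (b := b / 2) (by linarith)
  set G : E → ℝ :=
    fun x => ramp t (u x) * step (b / 2) (V (q x)) * traceGap H p q S x with hG
  have hG0 : ∀ x, 0 ≤ G x := fun x => mul_nonneg (mul_nonneg (ramp_nonneg ht _) (step_nonneg _ _))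
    (Finset.sum_nonneg fun i _ => by positivity)
  set A : E → E →L[ℝ] E := fun x => (Df (∇V) (q x)).comp (S x) with hA
  set D : E → E →L[ℝ] E :=
    fun x => (Df (trunc H p b (∇V)) (w x)).comp (S x) with hD
  set θ : E → ℝ := fun x => step b (V (q x)) with hθ
  set X := RSol.slab H p Ω q b with hX
  set sl : E → ℝ := X.indicator 1 with hsl
  set om : E → ℝ := Ω.indicator 1 with hom
  have hXm := h.measurableSet_slab hH hp b
  have isl : Integrable sl := (integrable_indicator_iff hXm).2 (integrableOn_const (h.slab_ne_top b))
  have iom : Integrable om := (integrable_indicator_iff h.isOpen.measurableSet).2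
    (integrableOn_const h.bounded.measure_lt_top.ne)
  have esl : ∫ x, sl x = volume.real X := by rw [hsl, integral_indicator_one hXm]
  have eom : ∫ x, om x = volume.real Ω := by rw [hom, integral_indicator_one h.isOpen.measurableSet]
  have hsl0 : ∀ x, 0 ≤ sl x := fun x => indicator_nonneg (fun _ _ => zero_le_one) x
  have hom0 : ∀ x, 0 ≤ om x := fun x => indicator_nonneg (fun _ _ => zero_le_one) x
  -- pointwise bounds
  have hactive : ∀ x, φ x ≠ 0 → x ∈ Ω ∧ t < u x ∧ m ≤ u x := fun x hx => by
    have hx' := hu x (subset_tsupport φ hx)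
    exact ⟨h.level_subset hm0 hx', by linarith, hx'⟩
  have hβ : ∀ x j, φ x ≠ 0 → b ≤ V (q x) →
      ‖A x (𝐞 j) + (1 / N : ℝ) • 𝐞 j‖ ≤
        η + 2 / (m * η) * G x := by
    intro x j hx hV
    obtain ⟨hxΩ, hxt, hxm⟩ := hactive x hx
    set β := ‖A x (𝐞 j) + (1 / N : ℝ) • 𝐞 j‖
    have h1 : β ^ 2 ≤ traceGap H p q S x := norm_le_traceGap x j
    have h2 : m / 2 * traceGap H p q S x ≤ G x := by
      simp only [hG]
      rw [step_of_ge (by linarith) (by linarith : 2 * (b / 2) ≤ _), mul_one]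
      exact mul_le_mul_of_nonneg_right (by linarith [sub_le_ramp ht (u x)])
        (le_trans (by positivity) h1)
    have h3 : 2 / (m * η) * G x ≥ β ^ 2 / η := by
      have : 2 / (m * η) * G x ≥ 2 / (m * η) * (m / 2 * β ^ 2) := by
        gcongr; exact (mul_le_mul_of_nonneg_left h1 (by positivity)).trans h2
      refine this.trans' (le_of_eq ?_)
      field_simp
    have h4 : β ≤ η + β ^ 2 / η := by
      rw [← sub_nonneg]
      have : η + β ^ 2 / η - β = ((η - β) ^ 2 + η * β) / η := by field_simp; ring
      rw [this]; positivity
    linarith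
  have hdiff : ∀ x j, φ x ≠ 0 → ‖D x (𝐞 j)
      - θ x • A x (𝐞 j)‖ ≤ L * (1 + η) * sl x + L * (2 / (m * η)) * G x := by
    intro x j hx
    obtain ⟨hxΩ, hxt, hxm⟩ := hactive x hx
    have hnn : 0 ≤ L * (1 + η) * sl x + L * (2 / (m * η)) * G x := by
      have := hsl0 x; have := hG0 x; positivity
    by_cases hV : b ≤ V (q x)
    · have h1 := hLb b hb0 (q x) hV (S x (𝐞 j))
      have h2 : D x (𝐞 j) =
          Df (trunc H p b (∇V)) (q x) (S x (𝐞 j)) := by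
        simp only [hD, P.eq x hxt.le (by linarith)]; rfl
      rw [h2]
      refine h1.trans ?_
      by_cases hV2 : V (q x) ≤ 2 * b
      · rw [indicator_of_mem (show q x ∈ {ξ | V ξ ≤ 2 * b} from hV2)]
        have h3 : sl x = 1 := indicator_of_mem (show x ∈ X from ⟨hxΩ, hV, hV2⟩) _
        have h4 : ‖A x (𝐞 j)‖ ≤ 1 + (η + 2 / (m * η) * G x) := by
          have h5 := norm_sub_le (A x (𝐞 j)
            + (1 / N : ℝ) • 𝐞 j) ((1 / N : ℝ) • 𝐞 j)
          rw [add_sub_cancel_right] at h5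
          have h6 : ‖(1 / N : ℝ) • 𝐞 j‖ ≤ 1 := by
            rw [norm_smul, EuclideanSpace.norm_single, norm_one, mul_one, Real.norm_eq_abs,
              abs_of_nonneg (by positivity), div_le_one (by positivity)]
            exact_mod_cast hN
          linarith [hβ x j hx hV]
        rw [h3]
        have h7 := mul_le_mul_of_nonneg_left h4 hL.le
        refine h7.trans (le_of_eq (by ring))
      · rw [indicator_of_notMem (by simpa using hV2), zero_mul]
        exact hnn
    · push Not at hV
      have h1 : D x = 0 := by
        simp only [hD, fderiv_trunc_of_lt hH hp hb0 ((P.le x hxt.le).trans_lt hV)]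
        simp
      simp only [hθ, h1, step_of_le hb0 hV.le, _root_.zero_apply, zero_smul, sub_zero, norm_zero]
      exact hnn
  have hcoord : ∀ (v : E) (i : Fin N), |v i| ≤ ‖v‖ := fun v i => by
    simpa using PiLp.norm_apply_le v i
  have iθ : Integrable fun x => φ x * θ x := by
    refine (hφ.continuous.integrable_of_hasCompactSupport hφc).mul_bdd (c := 1)
      (h.meas_comp ((continuous_step b).comp (hH.V_continuous hp))).aestronglyMeasurable
      (of_forall fun x => ?_)
    rw [Real.norm_eq_abs, abs_of_nonneg (step_nonneg _ _)]
    exact step_le_one _ _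
  have ibp := fun i j => P.integral_trunc_stress hH hp hb0 (by linarith) hφ hφc
    (fun x hx => by linarith [hu x hx]) i j
  constructor
  · intro i j
    obtain ⟨i1, -, e1⟩ := ibp i j
    set d : ℝ := if i = j then 1 / N else 0 with hd
    have e2 := integral_add i1 (iθ.const_mul d)
    rw [integral_const_mul] at e2
    rw [e1, ← neg_add', abs_neg]
    refine (congrArg abs e2.symm).le.trans ?_
    rw [← Real.norm_eq_abs]
    have idom : Integrable fun x =>
        B * (L * (1 + η) * sl x + η * om x + (1 + L) * (2 / (m * η)) * G x) :=
      (((isl.const_mul _).add (iom.const_mul _)).add (iG.const_mul _)).const_mul _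
    refine (norm_integral_le_of_norm_le idom (of_forall fun x => ?_)).trans ?_
    · rcases eq_or_ne (φ x) 0 with hx | hx
      · simp only [hx, zero_mul, mul_zero, add_zero, norm_zero]
        have := hsl0 x; have := hG0 x; have := hom0 x; positivity
      · obtain ⟨hxΩ, hxt, hxm⟩ := hactive x hx
        have ho : om x = 1 := indicator_of_mem hxΩ _
        have hdj : d = ((1 / N : ℝ) • 𝐞 j : E) i := by
          simp [hd, Pi.single_apply]
        have e3 : φ x * (Df (trunc H p b (∇V)) (w x)
            (S x (𝐞 j))) i + d * (φ x * θ x) =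
            φ x * ((D x (𝐞 j) - θ x • A x (𝐞 j)) i
              + θ x * (A x (𝐞 j)
                + (1 / N : ℝ) • 𝐞 j) i) := by
          rw [hdj]
          simp only [PiLp.sub_apply, PiLp.smul_apply, PiLp.add_apply, smul_eq_mul, hD,
            ContinuousLinearMap.comp_apply]
          ring
        rw [e3, norm_mul]
        refine mul_le_mul (hB x) ?_ (norm_nonneg _) hB0
        refine (norm_add_le _ _).trans ?_
        have h1 := (hcoord _ i).trans (hdiff x j hx)
        have h2 : ‖θ x * (A x (𝐞 j)
                + (1 / N : ℝ) • 𝐞 j) i‖ ≤ η + 2 / (m * η) * G x := by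
          rw [norm_mul, Real.norm_eq_abs, abs_of_nonneg (step_nonneg _ _)]
          by_cases hV : b ≤ V (q x)
          · exact (mul_le_of_le_one_left (norm_nonneg _) (step_le_one _ _)).trans
              ((hcoord _ i).trans (hβ x j hx hV))
          · rw [step_of_le hb0 (not_le.1 hV).le, zero_mul]
            have := hG0 x; positivity
        rw [Real.norm_eq_abs, ho]
        linarith
    · have e4 := integral_add ((isl.const_mul (L * (1 + η))).add (iom.const_mul η))
        (iG.const_mul ((1 + L) * (2 / (m * η))))
      have e5 := integral_add (isl.const_mul (L * (1 + η))) (iom.const_mul η)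
      simp only [Pi.add_apply] at e4
      rw [integral_const_mul, e4, e5, integral_const_mul, integral_const_mul, integral_const_mul,
        esl, eom]
      gcongr
  · have e0 : ∀ x, Df φ x (trunc H p b (∇V) (q x)) =
        ∑ i, Df φ x (𝐞 i) * trunc H p b (∇V) (q x) i := fun x => by
      rw [clm_apply_eq_sum]; simp only [mul_comm]
    simp only [e0]
    rw [integral_finsetSum _ fun i _ => (ibp i i).2.1]
    simp only [(ibp _ _).2.2]
    rw [Finset.sum_neg_distrib, ← integral_finsetSum _ fun i _ => (ibp i i).1, ← neg_add', abs_neg]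
    have isum := integrable_finset_sum Finset.univ fun (i : Fin N) _ => (ibp i i).1
    have e2 := integral_add isum iθ
    refine (congrArg abs e2.symm).le.trans ?_
    rw [← Real.norm_eq_abs]
    have idom : Integrable fun x =>
        N * (B * (L * (1 + η) * sl x + L * (2 / (m * η)) * G x)) :=
      (((isl.const_mul _).add (iG.const_mul _)).const_mul _).const_mul _
    refine (norm_integral_le_of_norm_le idom ?_).trans ?_
    · filter_upwards [h.trace_hess hH hp ht ha P] with x htr
      rcases eq_or_ne (φ x) 0 with hx | hx
      · simp only [hx, zero_mul, mul_zero, add_zero, Finset.sum_const_zero, norm_zero]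
        have := hsl0 x; have := hG0 x; positivity
      · obtain ⟨hxΩ, hxt, hxm⟩ := hactive x hx
        have htr' : θ x * ∑ i, A x (𝐞 i) i = - θ x := by
          by_cases hV : b ≤ V (q x)
          · have := htr hxt (by linarith)
            simp only [hA, ContinuousLinearMap.comp_apply, this, mul_neg_one]
          · simp [hθ, step_of_le hb0 (not_le.1 hV).le]
        have e3 : ∑ i, φ x * (Df (trunc H p b (∇V)) (w x)
            (S x (𝐞 i))) i + φ x * θ x =
            ∑ i, φ x * (D x (𝐞 i) - θ x • A x (𝐞 i)) i := by
          simp only [PiLp.sub_apply, PiLp.smul_apply, smul_eq_mul, hD,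
            ContinuousLinearMap.comp_apply, mul_sub, Finset.sum_sub_distrib, ← Finset.mul_sum, htr']
          ring
        rw [e3]
        refine (norm_sum_le _ _).trans ?_
        refine (Finset.sum_le_card_nsmul _ _ _ fun i _ => ?_).trans (b := Finset.card
          (Finset.univ : Finset (Fin N)) • (B * (L * (1 + η) * sl x + L * (2 / (m * η)) * G x))) ?_
        · rw [norm_mul]
          exact mul_le_mul (hB x) ((hcoord _ i).trans (hdiff x i hx)) (norm_nonneg _) hB0
        · rw [Finset.card_univ, Fintype.card_fin, nsmul_eq_mul]
    · rw [integral_const_mul, integral_const_mul, integral_add (isl.const_mul _) (iG.const_mul _),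
        integral_const_mul, integral_const_mul, esl]
      gcongr

end IsIpNorm

namespace RSol

/-- The indicator of the complement of the critical set. -/
def reg (q : E → E) : E → ℝ := {x | q x ≠ 0}.indicator 1

lemma reg_nonneg (q : E → E) (x : E) : 0 ≤ reg q x :=
  indicator_nonneg (fun _ _ => zero_le_one) x

lemma reg_le_one (q : E → E) (x : E) : reg q x ≤ 1 :=
  indicator_le_self' (fun _ _ => zero_le_one) x

lemma stronglyMeasurable_reg (h : RS) : StronglyMeasurable (reg q) :=
  (measurable_one.indicator (h.meas (measurableSet_singleton 0).compl)).stronglyMeasurable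

lemma tendsto_step_V (hH : Ip) (hp : 1 < p) {k : ℝ} (hk : 0 < k) (x : E) :
    Tendsto (fun s => step (k * s) (V (q x))) (𝓝[>] 0) (𝓝 (reg q x)) := by
  refine tendsto_nhds_of_eventually_eq ?_
  rcases eq_or_ne (q x) 0 with hq | hq
  · filter_upwards [self_mem_nhdsWithin] with s hs
    rw [reg, indicator_of_notMem (by simpa using hq), hq, hH.V_zero hp,
      step_of_le (mul_pos hk hs) (mul_pos hk hs).le]
  · have hV := hH.V_pos hp hq
    filter_upwards [self_mem_nhdsWithin,
      mem_nhdsWithin_of_mem_nhds (Iic_mem_nhds (div_pos hV (mul_pos two_pos hk)))] with s hs hs'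
    rw [mem_Iic, le_div_iff₀ (mul_pos two_pos hk)] at hs'
    rw [reg, indicator_of_mem (by exact hq), Pi.one_apply,
      step_of_ge (mul_pos hk hs) (by linarith)]

lemma tendsto_slab (hH : Ip) (hp : 1 < p) (h : RS) :
    Tendsto (fun s => volume.real (slab H p Ω q s)) (𝓝[>] 0) (𝓝 0) := by
  have e1 : ∀ s, ∫ x, (slab H p Ω q s).indicator (1 : E → ℝ) x = volume.real (slab H p Ω q s) :=
    fun s => integral_indicator_one (h.measurableSet_slab hH hp s)
  have e0 : ∫ _ : E, (0 : ℝ) = 0 := integral_zero _ _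
  simp only [← e1]
  rw [show 𝓝 (0 : ℝ) = 𝓝 (∫ _ : E, (0 : ℝ)) by rw [e0]]
  have hi : Integrable (Ω.indicator (1 : E → ℝ)) :=
    (integrable_indicator_iff h.isOpen.measurableSet).2
      (integrableOn_const (h.bounded.measure_lt_top.ne))
  refine tendsto_integral_filter_of_dominated_convergence _ (of_forall fun s =>
    (measurable_one.indicator (h.measurableSet_slab hH hp s)).aestronglyMeasurable)
    (of_forall fun s => of_forall fun x => ?_) hi
    (of_forall fun x => ?_)
  · rw [Real.norm_of_nonneg (indicator_nonneg (fun _ _ => by simp) x)]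
    exact indicator_le_indicator_of_subset inter_subset_left (fun _ => by simp) x
  · refine tendsto_nhds_of_eventually_eq ?_
    rcases eq_or_ne (q x) 0 with hq | hq
    · filter_upwards [self_mem_nhdsWithin] with s hs
      refine indicator_of_notMem (fun hx => ?_) _
      have := hx.2.1
      rw [hq, hH.V_zero hp] at this
      exact absurd this (not_le.2 hs)
    · have hV := hH.V_pos hp hq
      filter_upwards [mem_nhdsWithin_of_mem_nhds (Iio_mem_nhds (half_pos hV))] with s hs
      refine indicator_of_notMem (fun hx => ?_) _
      have := hx.2.2
      rw [mem_Iio] at hs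
      linarith

lemma tendsto_integral_step (hH : Ip) (hp : 1 < p) (h : RS)
    (hφ : Integrable φ) :
    Tendsto (fun s => ∫ x, φ x * step s (V (q x))) (𝓝[>] 0) (𝓝 (∫ x, φ x * reg q x)) := by
  refine tendsto_integral_filter_of_dominated_convergence (fun x => ‖φ x‖)
    (of_forall fun s => hφ.aestronglyMeasurable.mul
      (h.meas_comp ((continuous_step s).comp (hH.V_continuous hp))).aestronglyMeasurable)
    (of_forall fun s => of_forall fun x => ?_) hφ.norm
    (of_forall fun x => ?_)
  · rw [norm_mul, Real.norm_of_nonneg (step_nonneg _ _)]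
    exact mul_le_of_le_one_right (norm_nonneg _) (step_le_one _ _)
  · simpa using (tendsto_step_V hH hp one_pos x).const_mul (φ x)

lemma integrable_u (h : RS) : Integrable u :=
  h.cont.integrable_of_hasCompactSupport h.hasCompactSupport

lemma tendsto_integral_ramp_step (hH : Ip) (hp : 1 < p) (h : RS) :
    Tendsto (fun s => ∫ x, ramp s (u x) * step (1 / 2 * s) (V (q x))) (𝓝[>] 0)
      (𝓝 (∫ x, u x * reg q x)) := by
  have hu := h.toSol.nonneg hH hp
  refine tendsto_integral_filter_of_dominated_convergence u
    (of_forall fun s => ((contDiff_ramp s).continuous.comp h.cont).aestronglyMeasurable.mul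
      (h.meas_comp ((continuous_step _).comp (hH.V_continuous hp))).aestronglyMeasurable)
    ?_ h.integrable_u (of_forall fun x => ?_)
  · filter_upwards [self_mem_nhdsWithin] with s hs
    refine of_forall fun x => ?_
    rw [Real.norm_of_nonneg (mul_nonneg (ramp_nonneg hs _) (step_nonneg _ _))]
    exact (mul_le_of_le_one_right (ramp_nonneg hs _) (step_le_one _ _)).trans (ramp_le (hu x))
  · refine Tendsto.mul ?_ (tendsto_step_V hH hp one_half_pos x)
    refine tendsto_of_tendsto_of_tendsto_of_le_of_le' (g := fun s => u x - 2 * s) ?_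
      tendsto_const_nhds ?_ (of_forall fun s => ramp_le (hu x))
    · refine Tendsto.mono_left ?_ nhdsWithin_le_nhds
      exact (Continuous.tendsto' (by fun_prop) _ _ (by simp))
    · filter_upwards [self_mem_nhdsWithin] with s hs using sub_le_ramp hs _

lemma tendsto_integral_trunc_stress (hH : Ip) (hp : 1 < p) (h : RS)
    {Λ : E → E →L[ℝ] ℝ} (hΛ : Integrable Λ) :
    Tendsto (fun s => ∫ x, Λ x (trunc H p s (∇V) (q x))) (𝓝[>] 0)
      (𝓝 (∫ x, Λ x (∇V (q x)))) := by
  obtain ⟨B, hB0, hB⟩ := h.exists_comp_bound hH (hH.continuous_stress hp)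
  refine tendsto_integral_filter_of_dominated_convergence (fun x => ‖Λ x‖ * B) ?_
    (of_forall fun s => of_forall fun x => ?_) (hΛ.norm.mul_const B)
    (of_forall fun x => ?_)
  · filter_upwards [self_mem_nhdsWithin] with s hs
    have hm : StronglyMeasurable fun x => trunc H p s (∇V) (q x) :=
      h.meas_comp (((Real.smoothTransition.contDiff (n := 1)).continuous.comp
        (((hH.V_continuous hp).div_const s).sub continuous_const)).smul (hH.continuous_stress hp))
    exact aestronglyMeasurable_clm_apply hΛ.aestronglyMeasurable hm.aestronglyMeasurable
  · refine (Λ x).le_opNorm_of_le (le_trans ?_ (hB x))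
    rw [trunc, norm_smul, Real.norm_of_nonneg (Real.smoothTransition.nonneg _)]
    exact mul_le_of_le_one_left (norm_nonneg _) (Real.smoothTransition.le_one _)
  · refine ((Λ x).continuous.tendsto _).comp ?_
    refine tendsto_nhds_of_eventually_eq ?_
    rcases eq_or_ne (q x) 0 with hq | hq
    · exact of_forall fun s => by simp [trunc, hq, hH.stress_zero hp]
    · have hV := hH.V_pos hp hq
      filter_upwards [self_mem_nhdsWithin,
        mem_nhdsWithin_of_mem_nhds (Iio_mem_nhds (half_pos hV))] with s hs hs'
      rw [mem_Iio] at hs'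
      exact trunc_of_ge hs (by linarith)

/-- The defect whose vanishing forces the stress to be affine. -/
def defect (H : E → ℝ) (p : ℝ) (Ω : Set E) (u : E → ℝ) (q : E → E) (C : ℝ) :
    ℝ :=
  (p - 1) * (∫ x in Ω, (C ^ p / p - V (q x))) - 1 / N * ∫ x, u x * reg q x

/-- The approximate identities for the stress, after removing the truncations. -/
lemma exists_limit_identities (hH : Ip) (hp : 1 < p) (hN : 0 < N)
    (h : RS) : 0 ≤ defect H p Ω u q C ∧
    ∀ φ : E → ℝ, ContDiff ℝ 1 φ → HasCompactSupport φ → tsupport φ ⊆ Ω → ∃ M, ∀ η > 0,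
      (∀ i j : Fin N, |(∫ x, Df φ x (𝐞 j) * ∇V (q x) i)
        - (if i = j then (1 / N : ℝ) else 0) * ∫ x, φ x * reg q x| ≤
        M * (η + defect H p Ω u q C / η)) ∧
      |(∫ x, Df φ x (∇V (q x))) - ∫ x, φ x * reg q x| ≤
        M * (defect H p Ω u q C / η) := by
  obtain ⟨L, hL, hLb⟩ := hH.exists_stress_identities hp hN
  obtain ⟨c, hc, hcb⟩ := RSol.exists_traceGap_bound hH hp hN
  set Ξ : ℝ → ℝ := fun s => 1 / c * ((p - 1) * (∫ x in Ω, (C ^ p / p - V (q x) + s))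
    - 1 / N * ∫ x, ramp s (u x) * step (1 / 2 * s) (V (q x))) with hE
  set D := defect H p Ω u q C with hD
  have hET : Tendsto Ξ (𝓝[>] 0) (𝓝 (1 / c * D)) := by
    refine (Tendsto.sub (Tendsto.const_mul _ ?_)
      ((h.tendsto_integral_ramp_step hH hp).const_mul _)).const_mul _
    have i0 : IntegrableOn (fun x => C ^ p / p - V (q x)) Ω := by
      simpa using h.integrable_V_deficit hH hp 0
    have e1 : ∀ s : ℝ, ∫ x in Ω, (C ^ p / p - V (q x) + s) =
        (∫ x in Ω, (C ^ p / p - V (q x))) + volume.real Ω * s := fun s => by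
      have := integral_add i0 (integrableOn_const (C := s) (h.bounded.measure_lt_top.ne))
      rwa [setIntegral_const, smul_eq_mul] at this
    simp only [e1]
    refine Tendsto.mono_left ?_ nhdsWithin_le_nhds
    exact Continuous.tendsto' (by fun_prop) _ _ (by simp)
  have hmain : ∀ s > 0, ∃ K w S, Patch H p Ω u q s (s / 8) K w S ∧ 0 ≤ Ξ s ∧
      ∫ x, ramp s (u x) * step (s / 2) (V (q x)) * traceGap H p q S x ≤ Ξ s := by
    intro s hs
    obtain ⟨K, w, S, P⟩ := h.exists_patch hH hp hs (a := s / 8) (by linarith)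
    obtain ⟨-, h2⟩ := hcb (b := s / 2) h P hs (by linarith) (by linarith)
    have h3 : ∫ x, ramp s (u x) * step (s / 2) (V (q x)) * traceGap H p q S x ≤ Ξ s := by
      rw [hE]
      simp only
      rw [one_div, ← div_eq_inv_mul, le_div_iff₀ hc, mul_comm _ c]
      simpa [mul_div_cancel₀, div_eq_inv_mul] using h2
    refine ⟨K, w, S, P, le_trans (integral_nonneg fun x => ?_) h3, h3⟩
    exact mul_nonneg (mul_nonneg (ramp_nonneg hs _) (step_nonneg _ _))
      (Finset.sum_nonneg fun i _ => by positivity)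
  have hD0 : 0 ≤ D := by
    have := ge_of_tendsto hET (b := 0) (by
      filter_upwards [self_mem_nhdsWithin] with s hs
      obtain ⟨_, _, _, _, h1, _⟩ := hmain s hs
      exact h1)
    rw [one_div] at this
    exact nonneg_of_mul_nonneg_right this (inv_pos.2 hc)
  refine ⟨hD0, fun φ hφ hφc hφΩ => ?_⟩
  obtain ⟨m, hm, hmu⟩ := IsCompact.exists_forall_le' hφc.isCompact h.cont.continuousOn
    (a := 0) fun x hx => h.pos x (hφΩ hx)
  obtain ⟨B, hB⟩ := hφ.continuous.bounded_above_of_compact_support hφc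
  have hB0 : 0 ≤ B := (norm_nonneg _).trans (hB 0)
  have hφi := hφ.continuous.integrable_of_hasCompactSupport (μ := volume) hφc
  have hd : Integrable fun x => Df φ x :=
    (hφ.continuous_fderiv one_ne_zero).integrable_of_hasCompactSupport (hφc.fderiv ℝ)
  refine ⟨B * volume.real Ω + B * (1 + L) * (2 / m) * (1 / c) + N * (B * L * (2 / m) * (1 / c)),
    fun η hη => ?_⟩
  have hev : ∀ᶠ s in 𝓝[>] (0 : ℝ), 0 < s ∧ 4 * s ≤ m := by
    filter_upwards [self_mem_nhdsWithin,
      mem_nhdsWithin_of_mem_nhds (Iic_mem_nhds (show (0:ℝ) < m / 4 by linarith))] with s hs hs'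
    rw [mem_Iic] at hs'
    exact ⟨hs, by linarith⟩
  have hid := fun {s : ℝ} (hs : 0 < s ∧ 4 * s ≤ m) {K w S} (P : Patch H p Ω u q s (s / 8) K w S) h3 =>
    hLb (b := s) h P hs.1 (by linarith [hs.1]) (by linarith [hs.1]) (Ξ s) h3 φ hφ hφc m hs.2
      (fun x hx => hmu x hx) B hB η hη
  have hφs := h.tendsto_integral_step hH hp hφi
  have hsl := h.tendsto_slab hH hp
  have hDη : 0 ≤ D / η := by positivity
  have hV := measureReal_nonneg (μ := volume) (s := Ω)
  constructor
  · intro i j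
    have hl : Integrable fun x => (Df φ x (𝐞 j)) •
        (proj i : E →L[ℝ] ℝ) :=
      (ContinuousLinearMap.integrable_comp (ContinuousLinearMap.apply ℝ ℝ
        (𝐞 j : E)) hd).smul_const _
    have ht := h.tendsto_integral_trunc_stress hH hp hl
    simp only [_root_.smul_apply, PiLp.proj_apply, smul_eq_mul] at ht
    refine (le_of_tendsto_of_tendsto (ht.sub (hφs.const_mul _)).abs
      ((((hsl.const_mul (L * (1 + η))).add tendsto_const_nhds).add
        (hET.const_mul ((1 + L) * (2 / (m * η))))).const_mul B)
      (hev.mono fun s hs => by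
        obtain ⟨K, w, S, P, -, h3⟩ := hmain s hs.1
        exact (hid hs P h3).1 i j)).trans ?_
    have e : B * (L * (1 + η) * 0 + η * volume.real Ω + (1 + L) * (2 / (m * η)) * (1 / c * D)) =
      B * volume.real Ω * η + B * (1 + L) * (2 / m) * (1 / c) * (D / η) := by field_simp; ring
    rw [e]
    have h1 : 0 ≤ B * (1 + L) * (2 / m) * (1 / c) * η := by positivity
    have h2 : 0 ≤ B * volume.real Ω * (D / η) := by positivity
    have h3 : 0 ≤ N * (B * L * (2 / m) * (1 / c)) * (η + D / η) := by positivity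
    nlinarith
  · have ht := h.tendsto_integral_trunc_stress hH hp hd
    refine (le_of_tendsto_of_tendsto (ht.sub hφs).abs
      ((((hsl.const_mul (L * (1 + η))).add
        (hET.const_mul (L * (2 / (m * η))))).const_mul B).const_mul (N : ℝ))
      (hev.mono fun s hs => by
        obtain ⟨K, w, S, P, -, h3⟩ := hmain s hs.1
        exact (hid hs P h3).2)).trans ?_
    have e : N * (B * (L * (1 + η) * 0 + L * (2 / (m * η)) * (1 / c * D))) =
      N * (B * L * (2 / m) * (1 / c)) * (D / η) := by field_simp; ring
    rw [e]
    refine mul_le_mul_of_nonneg_right (le_add_of_nonneg_left ?_) hDη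
    positivity

lemma eq_zero_of_forall_mul_div {x M D : ℝ} (h : ∀ η > 0, |x| ≤ M * (D / η)) : x = 0 := by
  have ht : Tendsto (fun η => M * (D / η)) atTop (𝓝 0) := by
    simpa using (tendsto_const_nhds.div_atTop tendsto_id).const_mul M
  exact abs_nonpos_iff.1 (ge_of_tendsto ht ((eventually_gt_atTop 0).mono fun η hη => h η hη))

/-- The critical set of the solution is negligible. -/
lemma ae_ne_zero (hH : Ip) (hp : 1 < p) (hN : 0 < N) (h : RS) :
    ∀ᵐ x, x ∈ Ω → reg q x = 1 := by
  have hi : LocallyIntegrableOn (fun x => 1 - reg q x) Ω := by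
    refine (LocallyIntegrable.locallyIntegrableOn ?_ Ω)
    refine (locallyIntegrable_const (1:ℝ)).mono
      (aestronglyMeasurable_const.sub h.stronglyMeasurable_reg.aestronglyMeasurable)
      (of_forall fun x => ?_)
    rw [Real.norm_of_nonneg (sub_nonneg.2 (reg_le_one q x)), norm_one]
    linarith [reg_nonneg q x]
  have := h.isOpen.ae_eq_zero_of_integral_contDiff_smul_eq_zero hi fun φ hφ hφc hφΩ => by
    have hφ1 : ContDiff ℝ 1 φ := hφ.of_le (by exact_mod_cast le_top)
    obtain ⟨-, hM⟩ := h.exists_limit_identities hH hp hN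
    obtain ⟨M, hM⟩ := hM φ hφ1 hφc hφΩ
    have hφi := hφ.continuous.integrable_of_hasCompactSupport (μ := volume) hφc
    have e := eq_zero_of_forall_mul_div fun η hη => (hM η hη).2
    rw [h.weak φ hφ1 hφc hφΩ, one_mul] at e
    have i2 : Integrable fun x => φ x * reg q x := hφi.mul_bdd (c := 1)
      h.stronglyMeasurable_reg.aestronglyMeasurable (of_forall fun x => by
        rw [Real.norm_of_nonneg (reg_nonneg q x)]; exact reg_le_one q x)
    simp only [smul_eq_mul, mul_sub, mul_one]
    exact (integral_sub hφi i2).trans e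
  filter_upwards [this] with x hx hxΩ
  linarith [hx hxΩ]

lemma defect_eq (hH : Ip) (hp : 1 < p) (hN : 0 < N) (h : RS) :
    defect H p Ω u q C =
      (p - 1) * (∫ x in Ω, (C ^ p / p - V (q x))) - 1 / N * ∫ x, u x := by
  rw [defect]
  congr 2
  refine integral_congr_ae ?_
  filter_upwards [h.ae_ne_zero hH hp hN] with x hx
  by_cases hxΩ : x ∈ Ω
  · rw [hx hxΩ, mul_one]
  · rw [h.zero x hxΩ, zero_mul]

/-- If the defect vanishes, then the stress is affine. -/
lemma integral_fderiv_mul_stress (hH : Ip) (hp : 1 < p) (hN : 0 < N)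
    (h : RS) (hD : defect H p Ω u q C ≤ 0) (hφ : ContDiff ℝ 1 φ)
    (hφc : HasCompactSupport φ) (hφΩ : tsupport φ ⊆ Ω) (i j : Fin N) :
    ∫ x, Df φ x (𝐞 j) * ∇V (q x) i =
      (if i = j then (1 / N : ℝ) else 0) * ∫ x, φ x := by
  obtain ⟨h0, hM⟩ := h.exists_limit_identities hH hp hN
  obtain ⟨M, hM⟩ := hM φ hφ hφc hφΩ
  have e : ∫ x, φ x * reg q x = ∫ x, φ x := by
    refine integral_congr_ae ?_
    filter_upwards [h.ae_ne_zero hH hp hN] with x hx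
    by_cases hxΩ : x ∈ Ω
    · rw [hx hxΩ, mul_one]
    · rw [image_eq_zero_of_notMem_tsupport fun h' => hxΩ (hφΩ h'), zero_mul]
  rw [le_antisymm hD h0] at hM
  refine sub_eq_zero.1 (eq_zero_of_forall_mul_div (M := M) (D := 1) fun η hη => ?_)
  rw [← e]
  simpa using (hM η⁻¹ (inv_pos.2 hη)).1 i j

end RSol

/-- The divergence of a vector field. -/
def dvg (Z : E → E) (x : E) : ℝ :=
  ∑ j, Df Z x (𝐞 j) j

section dvg

lemma continuous_dvg {Z : E → E} (hZ : ContDiff ℝ 1 Z) : Continuous (dvg Z) := by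
  have := hZ.continuous_fderiv one_ne_zero
  unfold dvg
  fun_prop

lemma dvg_smul {Z : E → E} (hφ : ContDiff ℝ 1 φ) (hZ : ContDiff ℝ 1 Z) (x : E)
    : dvg (fun x => φ x • Z x) x = Df φ x (Z x) + φ x * dvg Z x := by
  have h1 := (((hφ.differentiable one_ne_zero) x).hasFDerivAt.fun_smul
    ((hZ.differentiable one_ne_zero) x).hasFDerivAt).fderiv
  rw [dvg, h1, dvg, Finset.mul_sum, clm_apply_eq_sum (Df φ x) (Z x), ← Finset.sum_add_distrib]
  refine Finset.sum_congr rfl fun j _ => ?_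
  simp only [_root_.add_apply, _root_.smul_apply, ContinuousLinearMap.smulRight_apply,
    PiLp.add_apply, PiLp.smul_apply, smul_eq_mul]
  ring

lemma integral_apply_eq_neg_dvg {k : E → ℝ} {Λ : E → E →L[ℝ] ℝ} {Z : E → E}
    (hk : Continuous k) (hΛ : LocallyIntegrable Λ) (hd : ∀ x ∈ Ω, HasFDerivAt k (Λ x) x)
    (hZ : ContDiff ℝ 1 Z) (hZc : HasCompactSupport Z) (hZΩ : tsupport Z ⊆ Ω) :
    ∫ x, Λ x (Z x) = - ∫ x, k x * dvg Z x := by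
  have hZj : ∀ j, ContDiff ℝ 1 fun x => Z x j := fun j => (contDiff_piLp_apply 2).comp hZ
  have hDj : ∀ j x, Df (fun x => Z x j) x (𝐞 j) =
      Df Z x (𝐞 j) j := fun j x => by
    have h1 : HasFDerivAt (fun x => Z x j) _ x :=
      (PiLp.proj (𝕜 := ℝ) 2 (fun _ : Fin N => ℝ) j).hasFDerivAt.comp x
        ((hZ.differentiable one_ne_zero) x).hasFDerivAt
    rw [h1.fderiv]
    rfl
  have hZs : ∀ j, tsupport (fun x => Z x j) ⊆ tsupport Z := fun j =>
    closure_mono fun x hx h0 => hx (by simp [h0])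
  have hZcj : ∀ j, HasCompactSupport fun x => Z x j := fun j =>
    hZc.of_isClosed_subset (isClosed_tsupport _) (hZs j)
  have i1 : ∀ j, Integrable fun x => Z x j * Λ x (𝐞 j) := fun j => by
    have h1 := hΛ.integrable_smul_left_of_hasCompactSupport (hZj j).continuous (hZcj j)
    simpa using ContinuousLinearMap.integrable_comp (ContinuousLinearMap.apply ℝ ℝ
        (𝐞 j : E)) h1
  have i2 : ∀ j, Integrable fun x => Df (fun x => Z x j) x (𝐞 j) * k x :=
    fun j => by
      refine Continuous.integrable_of_hasCompactSupport ?_ ?_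
      · exact (((hZj j).continuous_fderiv one_ne_zero).clm_apply continuous_const).mul hk
      · exact ((hZcj j).fderiv_apply ℝ _).mul_right
  have i3 : ∀ j, Integrable fun x => Z x j * k x := fun j =>
    ((hZj j).continuous.mul hk).integrable_of_hasCompactSupport (hZcj j).mul_right
  have e : ∀ j, ∫ x, Z x j * Λ x (𝐞 j) =
      - ∫ x, Df (fun x => Z x j) x (𝐞 j) * k x := fun j =>
    integral_bilinear_hasFDerivAt_right_eq_neg_left_of_integrable (B := ContinuousLinearMap.mul ℝ ℝ)
      (i2 j) (i1 j) (i3 j) (fun x _ => ((hZj j).differentiable one_ne_zero x).hasFDerivAt)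
      fun x hx => hd x (hZΩ (hZs j hx))
  have e0 : ∀ x, Λ x (Z x) = ∑ j, Z x j * Λ x (𝐞 j) := fun x =>
    clm_apply_eq_sum _ _
  simp only [e0, dvg, Finset.mul_sum]
  rw [integral_finsetSum _ fun j _ => i1 j, integral_finsetSum _ fun j _ => by
    simpa only [hDj, mul_comm] using i2 j, ← Finset.sum_neg_distrib]
  refine Finset.sum_congr rfl fun j _ => (e j).trans ?_
  simp only [hDj, mul_comm]

end dvg

namespace RSol

lemma locallyIntegrable_q (hH : Ip) (h : RS) :
    LocallyIntegrable fun x => innerSL ℝ (q x) :=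
  ((innerSL ℝ).integrable_comp (memLp_one_iff_integrable.1 (h.memLp_q hH 1))).locallyIntegrable

lemma eventually_smul_mem (hΩ : IsOpen Ω) (hK : IsCompact K) (hKΩ : K ⊆ Ω) :
    ∀ᶠ l in 𝓝 (1 : ℝ), ∀ x ∈ K, l • x ∈ Ω := by
  refine hK.eventually_forall_of_forall_eventually fun x hx => ?_
  refine Continuous.continuousAt (f := fun z : ℝ × E => z.1 • z.2) (by fun_prop)
    |>.eventually_mem ?_
  exact hΩ.mem_nhds (by simpa using hKΩ hx)

/-- Comparison of the solution with its dilations, by convexity of the energy. -/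
lemma dilation_inequality (hH : Ip) (hp : 1 < p) (h : RS)
    {χ : E → ℝ} (hχ : ContDiff ℝ 1 χ) (hχc : HasCompactSupport χ) (hχΩ : tsupport χ ⊆ Ω)
    (hχ0 : ∀ x, 0 ≤ χ x) {l : ℝ} (hl : 0 < l) (hlΩ : ∀ x ∈ tsupport χ, l • x ∈ Ω) :
    (∫ x, (Df χ x (∇V (q x)) - χ x) * u x) + ∫ x, V (q x) * χ x ≤
      (∫ x, (Df χ x (∇V (q x)) - χ x) * u (l • x)) +
        ∫ x, V (q x) * (l ^ (p - N) * χ (l⁻¹ • x)) := by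
  obtain ⟨R, hR0, hR⟩ := h.exists_norm_le hH
  obtain ⟨Bu, hBu⟩ := h.cont.bounded_above_of_compact_support h.hasCompactSupport
  obtain ⟨Bχ, hBχ⟩ := hχ.continuous.bounded_above_of_compact_support hχc
  obtain ⟨Bd, hBd⟩ := (hχ.continuous_fderiv one_ne_zero).bounded_above_of_compact_support
    (hχc.fderiv ℝ)
  set Y := fun x => ∇V (q x) with hY
  have hYc := hH.continuous_stress hp
  have hY2 : MemLp Y 2 := h.memLp_comp hH hYc (hH.stress_zero hp) 2
  obtain ⟨BY, hBY0, hBY⟩ := h.exists_comp_bound hH hYc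
  set φ := fun x => χ x * (u (l • x) - u x) with hφ
  set Φ : E → E →L[ℝ] ℝ := fun x =>
    χ x • (l • innerSL ℝ (q (l • x)) - innerSL ℝ (q x)) + (u (l • x) - u x) • Df χ x with hΦ
  have hχ0' : ∀ x, x ∉ tsupport χ → χ x = 0 := fun x hx => image_eq_zero_of_notMem_tsupport hx
  have hdχ0 : ∀ x, x ∉ tsupport χ → Df χ x = 0 := fun x hx =>
    image_eq_zero_of_notMem_tsupport fun h' => hx (tsupport_fderiv_subset ℝ h')
  have hd : ∀ x, HasFDerivAt φ (Φ x) x := fun x => by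
    by_cases hx : x ∈ tsupport χ
    · have h1 : HasFDerivAt (fun x => u (l • x)) (l • innerSL ℝ (q (l • x))) x := by
        have := (h.grad _ (hlΩ x hx)).comp x ((hasFDerivAt_id x).const_smul l)
        refine this.congr_fderiv ?_
        ext v; simp
      exact ((hχ.differentiable one_ne_zero x).hasFDerivAt).fun_mul (h1.fun_sub (h.grad x (hχΩ hx)))
    · have h1 : φ =ᶠ[𝓝 x] fun _ => 0 := by
        filter_upwards [(isClosed_tsupport χ).isOpen_compl.mem_nhds hx] with y hy
        simp [hφ, hχ0' y hy]
      have h2 : Φ x = 0 := by simp [hΦ, hχ0' x hx, hdχ0 x hx]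
      rw [h2]
      exact (hasFDerivAt_const 0 x).congr_of_eventuallyEq h1
  have hf : Df φ = Φ := funext fun x => (hd x).fderiv
  have hqlm : Measurable fun x => q (l • x) := h.meas.comp (measurable_const_smul l)
  have hΦ2 : MemLp (Df φ) 2 := by
    refine memLp_of_bound_of_eq_zero hχc.isCompact (measurable_fderiv ℝ φ).aestronglyMeasurable
      (B := Bχ * (l * R + R) + (Bu + Bu) * Bd) (of_forall fun x => ?_)
      (of_forall fun x hx => ?_) 2
    · rw [hf]
      refine (norm_add_le _ _).trans (add_le_add ?_ ?_)
      · rw [norm_smul]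
        refine mul_le_mul (hBχ x) ((norm_sub_le _ _).trans (add_le_add ?_ ?_)) (norm_nonneg _)
          ((norm_nonneg _).trans (hBχ x))
        · rw [norm_smul, Real.norm_of_nonneg hl.le, innerSL_apply_norm]
          exact mul_le_mul_of_nonneg_left (hR _) hl.le
        · rw [innerSL_apply_norm]; exact hR x
      · rw [norm_smul]
        exact mul_le_mul ((norm_sub_le _ _).trans (add_le_add (hBu _) (hBu _))) (hBd x)
          (norm_nonneg _) (by linarith [(norm_nonneg _).trans (hBu x)])
    · rw [hf]; simp [hΦ, hχ0' x hx, hdχ0 x hx]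
  have e1 := h.weak.of_differentiable (r := 2) (s := 2) h.isOpen ENNReal.ofNat_ne_top hY2
    hχc.isCompact hχΩ (fun x => (hd x).differentiableAt) (fun x hx => by simp [hφ, hχ0' x hx]) hΦ2
  rw [hf, one_mul] at e1
  have iχ : Integrable χ := hχ.continuous.integrable_of_hasCompactSupport hχc
  have idχ : Integrable (fun x => Df χ x (Y x)) := by
    refine Integrable.mono' (g := fun x => ‖Df χ x‖ * BY) ?_
      (aestronglyMeasurable_clm_apply (hχ.continuous_fderiv one_ne_zero).aestronglyMeasurable
        hY2.aestronglyMeasurable) (of_forall fun x => (Df χ x).le_opNorm_of_le (hBY x))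
    exact (((hχ.continuous_fderiv one_ne_zero).integrable_of_hasCompactSupport
      (hχc.fderiv ℝ)).norm).mul_const BY
  have iA : Integrable fun x => Df χ x (Y x) - χ x := idχ.sub iχ
  have iA1 : Integrable fun x => (Df χ x (Y x) - χ x) * u x :=
    iA.mul_bdd h.cont.aestronglyMeasurable (of_forall hBu)
  have iA2 : Integrable fun x => (Df χ x (Y x) - χ x) * u (l • x) :=
    iA.mul_bdd (h.cont.comp (continuous_const_smul l)).aestronglyMeasurable
      (of_forall fun x => hBu _)
  obtain ⟨BV, hBV0, hBV⟩ := h.exists_comp_bound hH (hH.V_continuous hp)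
  have iV1 : Integrable fun x => V (q x) * χ x :=
    iχ.bdd_mul (h.meas_comp (hH.V_continuous hp)).aestronglyMeasurable (of_forall hBV)
  have iV2 : Integrable fun x => l ^ p * V (q (l • x)) * χ x := by
    refine iχ.bdd_mul (c := l ^ p * BV) ?_ (of_forall fun x => ?_)
    · exact (((hH.V_continuous hp).measurable.comp hqlm).const_mul _).aestronglyMeasurable
    · rw [norm_mul, Real.norm_of_nonneg (Real.rpow_nonneg hl.le _)]
      exact mul_le_mul_of_nonneg_left (hBV _) (Real.rpow_nonneg hl.le _)
  have e2 : ∫ x, V (q x) * (l ^ (p - N) * χ (l⁻¹ • x)) =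
      ∫ x, l ^ p * V (q (l • x)) * χ x := by
    have h1 := Measure.integral_comp_smul (μ := (volume : Measure (E)))
      (fun x => l ^ p * V (q x) * χ (l⁻¹ • x)) l
    simp only [smul_smul, inv_mul_cancel₀ hl.ne', one_smul, finrank_euclideanSpace,
      Fintype.card_fin] at h1
    rw [h1, ← integral_smul]
    refine integral_congr_ae (of_forall fun x => ?_)
    have h2 : 0 < l ^ N := pow_pos hl N
    simp only [smul_eq_mul, abs_inv, abs_of_pos h2, Real.rpow_sub_natCast hl.ne']
    ring
  have hle : ∫ x, Φ x (Y x) ≤ ∫ x, ((Df χ x (Y x)) * (u (l • x) - u x) +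
      (l ^ p * V (q (l • x)) * χ x - V (q x) * χ x)) := by
    refine integral_mono_ae ?_ ?_ (of_forall fun x => ?_)
    · rw [← hf]; exact integrable_clm_apply (r := 2) (s := 2) hΦ2 hY2
    · refine Integrable.add ?_ (iV2.sub iV1)
      exact idχ.mul_bdd ((h.cont.comp (continuous_const_smul l)).sub h.cont).aestronglyMeasurable
        (c := Bu + Bu) (of_forall fun x =>
          (norm_sub_le _ _).trans (add_le_add (hBu _) (hBu _)))
    · have h1 := hH.V_ge hp (q x) (l • q (l • x))
      rw [hH.V_smul hl.le] at h1
      have h2 := mul_le_mul_of_nonneg_left h1 (hχ0 x)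
      simp only [hΦ, _root_.add_apply, _root_.smul_apply, _root_.sub_apply, innerSL_apply_apply,
        smul_eq_mul, hY]
      rw [inner_sub_right, real_inner_smul_right, real_inner_comm, real_inner_comm (q x)] at h2
      linarith
  rw [e1] at hle
  have e5 := integral_sub (iA2.add iV2) (iA1.add iV1)
  simp only [Pi.add_apply] at e5
  rw [e2, ← integral_add iA1 iV1, ← integral_add iA2 iV2, ← sub_nonneg, ← e5]
  have i4 : Integrable φ := (hχ.continuous.mul ((h.cont.comp (continuous_const_smul l)).sub
    h.cont)).integrable_of_hasCompactSupport hχc.mul_right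
  have e3 : ∀ x, (Df χ x (Y x) - χ x) * u (l • x) + l ^ p * V (q (l • x)) * χ x -
      ((Df χ x (Y x) - χ x) * u x + V (q x) * χ x) =
      ((Df χ x (Y x)) * (u (l • x) - u x) +
      (l ^ p * V (q (l • x)) * χ x - V (q x) * χ x)) - φ x := fun x => by
    simp only [hφ]; ring
  have e4 := integral_congr_ae (μ := volume) (of_forall e3)
  refine le_of_le_of_eq (sub_nonneg.2 hle) (Eq.trans ?_ e4.symm)
  refine (integral_sub ?_ i4).symm
  refine Integrable.add ?_ (iV2.sub iV1)
  exact idχ.mul_bdd ((h.cont.comp (continuous_const_smul l)).sub h.cont).aestronglyMeasurable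
    (c := Bu + Bu) (of_forall fun x =>
      (norm_sub_le _ _).trans (add_le_add (hBu _) (hBu _)))

end RSol

namespace RSol

lemma hasDerivAt_integral_dilate_u (hH : Ip) (h : RS)
    {A : E → ℝ} (hA : Integrable A) (hA0 : ∀ x, x ∉ Ω → A x = 0) :
    HasDerivAt (fun l : ℝ => ∫ x, A x * u (l • x)) (∫ x, A x * ⟪q x, x⟫) 1 := by
  obtain ⟨M, hM0, hM⟩ := h.exists_lip hH
  obtain ⟨R, hR⟩ := h.bounded.exists_norm_le
  have hR1 : ∀ x ∈ Ω, ‖x‖ ≤ max R 0 := fun x hx => (hR x hx).trans (le_max_left _ _)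
  refine (hasDerivAt_integral_of_dominated_loc_of_lip (s := univ)
    (bound := fun x => ‖A x‖ * (M * max R 0)) univ_mem (of_forall fun l => ?_) ?_ ?_ ?_
    (hA.norm.mul_const _) ?_).2
  · exact hA.1.mul (h.cont.comp (continuous_const_smul l)).aestronglyMeasurable
  · obtain ⟨Bu, hBu⟩ := h.cont.bounded_above_of_compact_support h.hasCompactSupport
    exact hA.mul_bdd (c := Bu) (h.cont.comp (continuous_const_smul 1)).aestronglyMeasurable
      (of_forall fun x => hBu _)
  · exact hA.1.mul (h.meas.inner measurable_id).aestronglyMeasurable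
  · refine of_forall fun x => LipschitzOnWith.of_dist_le_mul fun l _ l' _ => ?_
    rw [Real.coe_nnabs, abs_of_nonneg (by positivity), Real.dist_eq, ← mul_sub, abs_mul,
      Real.norm_eq_abs, mul_assoc]
    by_cases hx : x ∈ Ω
    · refine mul_le_mul_of_nonneg_left ?_ (abs_nonneg _)
      have h1 := hM (l' • x) ((l - l') • x)
      rw [← add_smul, add_sub_cancel, norm_smul] at h1
      rw [Real.dist_eq, ← Real.norm_eq_abs (l - l')]
      calc _ ≤ _ := h1
        _ ≤ M * (‖l - l'‖ * max R 0) := by gcongr; exact hR1 x hx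
        _ = _ := by ring
    · simp [hA0 x hx]
  · refine of_forall fun x => ?_
    by_cases hx : x ∈ Ω
    · have h1 : HasDerivAt (fun l : ℝ => l • x) x 1 := by
        simpa using (hasDerivAt_id (1 : ℝ)).smul_const x
      have h2 : HasFDerivAt u (innerSL ℝ (q x)) ((1 : ℝ) • x) := by simpa using h.grad x hx
      simpa using (h2.comp_hasDerivAt 1 h1).const_mul (A x)
    · simpa [hA0 x hx] using hasDerivAt_const (1 : ℝ) (0 : ℝ)

lemma hasDerivAt_integral_dilate_test {k : E → ℝ} (hk : Integrable k)
    (hΩ : Bornology.IsBounded Ω) (hk0 : ∀ x, x ∉ Ω → k x = 0) {χ : E → ℝ}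
    (hχ : ContDiff ℝ 1 χ) (hχc : HasCompactSupport χ) (a : ℝ) :
    HasDerivAt (fun l : ℝ => ∫ x, k x * (l ^ a * χ (l⁻¹ • x)))
      (∫ x, k x * (a * χ x - Df χ x x)) 1 := by
  have hfc := hχ.continuous_fderiv one_ne_zero
  set ψ' : ℝ → E → ℝ := fun l x =>
    a * l ^ (a - 1) * χ (l⁻¹ • x) + l ^ a * Df χ (l⁻¹ • x) (-(l ^ 2)⁻¹ • x) with hψ'
  have hcont : ContinuousOn (fun z : ℝ × E => ψ' z.1 z.2)
      (Icc (1 / 2 : ℝ) (3 / 2) ×ˢ closure Ω) := by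
    intro z hz
    have h0 : z.1 ≠ 0 := by have := hz.1.1; linarith
    refine ContinuousAt.continuousWithinAt ?_
    have e1 : ContinuousAt (fun z : ℝ × E => z.1⁻¹ • z.2) z :=
      (continuousAt_fst.inv₀ h0).smul continuousAt_snd
    have e2 : ContinuousAt (fun z : ℝ × E => -(z.1 ^ 2)⁻¹ • z.2) z :=
      ((continuousAt_fst.pow 2).inv₀ (pow_ne_zero 2 h0)).neg.smul continuousAt_snd
    exact ((continuousAt_const.mul (continuousAt_fst.rpow_const (Or.inl h0))).mul
      (hχ.continuous.continuousAt.comp e1)).add ((continuousAt_fst.rpow_const (Or.inl h0)).mul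
      (((hfc.continuousAt (x := z.1⁻¹ • z.2)).comp (f := fun z : ℝ × E => z.1⁻¹ • z.2) e1).clm_apply
        e2))
  obtain ⟨B, hB⟩ := (isCompact_Icc.prod hΩ.isCompact_closure).exists_bound_of_continuousOn hcont
  have hs : Icc (1 / 2 : ℝ) (3 / 2) ∈ 𝓝 (1 : ℝ) := Icc_mem_nhds (by norm_num) (by norm_num)
  have key := (hasDerivAt_integral_of_dominated_loc_of_deriv_le (s := Icc (1 / 2 : ℝ) (3 / 2))
    (μ := volume) (F := fun l x => k x * (l ^ a * χ (l⁻¹ • x))) (F' := fun l x => k x * ψ' l x)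
    (bound := fun x => ‖k x‖ * B) hs (of_forall fun l => ?_) ?_ ?_ ?_
    (hk.norm.mul_const _) ?_).2
  · refine key.congr_deriv (integral_congr_ae (of_forall fun x => ?_))
    simp [hψ', sub_eq_add_neg]
  · exact hk.1.mul (continuous_const.mul
      (hχ.continuous.comp (continuous_const_smul _))).aestronglyMeasurable
  · obtain ⟨Bχ, hBχ⟩ := hχ.continuous.bounded_above_of_compact_support hχc
    refine hk.mul_bdd (c := Bχ) (continuous_const.mul
      (hχ.continuous.comp (continuous_const_smul _))).aestronglyMeasurable
      (of_forall fun x => ?_)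
    simpa using hBχ x
  · refine hk.1.mul (Continuous.aestronglyMeasurable ?_)
    have := hχ.continuous
    simp only [hψ', inv_one, one_smul, Real.one_rpow, one_pow, neg_smul]
    fun_prop
  · refine of_forall fun x l hl => ?_
    rw [norm_mul]
    by_cases hx : x ∈ Ω
    · exact mul_le_mul_of_nonneg_left (hB (l, x) ⟨hl, subset_closure hx⟩) (norm_nonneg _)
    · simp [hk0 x hx]
  · refine of_forall fun x l hl => ?_
    have h0 : l ≠ 0 := by have := hl.1; linarith
    have h1 : HasDerivAt (fun l : ℝ => l⁻¹ • x) (-(l ^ 2)⁻¹ • x) l := (hasDerivAt_inv h0).smul_const x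
    have h2 := ((hχ.differentiable one_ne_zero (l⁻¹ • x)).hasFDerivAt).comp_hasDerivAt l h1
    exact ((Real.hasDerivAt_rpow_const (Or.inl h0)).mul h2).const_mul (k x)

set_option maxHeartbeats 1000000 in
/-- The Pohozaev identity with a cutoff. -/
lemma integral_pohozaev (hH : Ip) (hp : 1 < p) (h : RS)
    {χ : E → ℝ} (hχ : ContDiff ℝ 1 χ) (hχc : HasCompactSupport χ) (hχΩ : tsupport χ ⊆ Ω)
    (hχ0 : ∀ x, 0 ≤ χ x) :
    ∫ x, χ x * ((p - N) * V (q x) + N * u x) =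
      ∫ x, (V (q x) * Df χ x x - Df χ x (∇V (q x)) * ⟪q x, x⟫ -
        u x * Df χ x x) := by
  have hfc := hχ.continuous_fderiv one_ne_zero
  obtain ⟨Bχ, hBχ⟩ := hχ.continuous.bounded_above_of_compact_support hχc
  have iY : Integrable fun x => Df χ x (∇V (q x)) :=
    integrable_clm_apply (r := 2) (s := 2) (hfc.memLp_of_hasCompactSupport (hχc.fderiv ℝ))
      (h.memLp_comp hH (hH.continuous_stress hp) (hH.stress_zero hp) 2)
  have iχ : Integrable χ := hχ.continuous.integrable_of_hasCompactSupport hχc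
  have iV := h.integrable_V hH hp
  have hnot : ∀ x, x ∉ Ω → x ∉ tsupport χ := fun x hx h' => hx (hχΩ h')
  have hA0 : ∀ x, x ∉ Ω → Df χ x (∇V (q x)) - χ x = 0 := fun x hx => by
    rw [image_eq_zero_of_notMem_tsupport (hnot x hx), h.q_zero x hx, hH.stress_zero hp]; simp
  have hV0 : ∀ x, x ∉ Ω → V (q x) = 0 := fun x hx => by rw [h.q_zero x hx, hH.V_zero hp]
  have d1 := h.hasDerivAt_integral_dilate_u hH (iY.sub iχ) hA0
  have d2 := hasDerivAt_integral_dilate_test iV h.bounded hV0 hχ hχc (p - N)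
  simp only [Pi.sub_apply] at d1
  have hmin : IsLocalMin (fun l : ℝ => (∫ x, (Df χ x (∇V (q x)) - χ x) * u (l • x)) +
      ∫ x, V (q x) * (l ^ (p - N) * χ (l⁻¹ • x))) 1 := by
    filter_upwards [eventually_smul_mem h.isOpen hχc.isCompact hχΩ, lt_mem_nhds one_pos]
      with l hl hl0
    have := h.dilation_inequality hH hp hχ hχc hχΩ hχ0 hl0 hl
    simpa using this
  have e0 := hmin.hasDerivAt_eq_zero (d1.add d2)
  have hZ : ContDiff ℝ 1 fun x => χ x • x := hχ.smul contDiff_id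
  have e1 := integral_apply_eq_neg_dvg h.cont (h.locallyIntegrable_q hH) h.grad hZ
    hχc.smul_right ((tsupport_smul_subset_left _ _).trans hχΩ)
  have hdv : ∀ x, dvg (fun x : E => χ x • x) x = Df χ x x + N * χ x := fun x => by
    rw [show (fun x : E => χ x • x) = fun x => χ x • id x from rfl, dvg_smul hχ contDiff_id x]
    simp [dvg, mul_comm]
  simp only [hdv, innerSL_apply_apply, inner_smul_right] at e1
  have iqx : ∀ {G : E → ℝ}, Integrable G → (∀ x, x ∉ Ω → G x = 0) →
      Integrable fun x => G x * ⟪q x, x⟫ := fun {G} hG hG0 => by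
    obtain ⟨R, hR0, hR⟩ := h.exists_norm_le hH
    obtain ⟨B, hB⟩ := h.bounded.exists_norm_le
    refine hG.mul_bdd (c := R * max B 0) (h.meas.inner measurable_id).aestronglyMeasurable
      (of_forall fun x => ?_)
    by_cases hx : x ∈ Ω
    · exact (norm_inner_le_norm _ _).trans (mul_le_mul (hR x) ((hB x hx).trans (le_max_left _ _))
        (norm_nonneg _) hR0.le)
    · rw [h.q_zero x hx, inner_zero_left, norm_zero]
      positivity
  have hχ0' : ∀ x, x ∉ Ω → χ x = 0 := fun x hx => image_eq_zero_of_notMem_tsupport (hnot x hx)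
  have hY0 : ∀ x, x ∉ Ω → Df χ x (∇V (q x)) = 0 := fun x hx => by
    rw [h.q_zero x hx, hH.stress_zero hp, _root_.map_zero]
  have hfx : Continuous fun x => Df χ x x := hfc.clm_apply continuous_id
  have hfxc : HasCompactSupport fun x => Df χ x x := (hχc.fderiv ℝ).mono fun x hx h' =>
    hx (by simp [h'])
  obtain ⟨Bx, hBx⟩ := hfx.bounded_above_of_compact_support hfxc
  have i1 := iqx iY hY0
  have i2 := iqx iχ hχ0'
  have i3 := iV.mul_bdd (c := Bχ) hχ.continuous.aestronglyMeasurable (of_forall hBχ)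
  have i4 := iV.mul_bdd (c := Bx) hfx.aestronglyMeasurable (of_forall hBx)
  have i5 := h.integrable_u.mul_bdd (c := Bχ) hχ.continuous.aestronglyMeasurable
    (of_forall hBχ)
  have i6 := h.integrable_u.mul_bdd (c := Bx) hfx.aestronglyMeasurable (of_forall hBx)
  have a1 : ∫ x, χ x * ((p - N) * V (q x) + N * u x) =
      (p - N) * (∫ x, V (q x) * χ x) + N * ∫ x, u x * χ x := by
    rw [← integral_const_mul, ← integral_const_mul,
      ← integral_add (i3.const_mul _) (i5.const_mul _)]
    exact integral_congr_ae (of_forall fun x => by ring)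
  have a2 : ∫ x, (V (q x) * Df χ x x - Df χ x (∇V (q x)) * ⟪q x, x⟫ -
      u x * Df χ x x) = (∫ x, V (q x) * Df χ x x) -
        (∫ x, Df χ x (∇V (q x)) * ⟪q x, x⟫) - ∫ x, u x * Df χ x x := by
    rw [← integral_sub i4 i1]
    exact integral_sub (i4.sub i1) i6
  have a3 : ∫ x, (Df χ x (∇V (q x)) - χ x) * ⟪q x, x⟫ =
      (∫ x, Df χ x (∇V (q x)) * ⟪q x, x⟫) - ∫ x, χ x * ⟪q x, x⟫ := by
    rw [← integral_sub i1 i2]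
    exact integral_congr_ae (of_forall fun x => by ring)
  have a4 : ∫ x, V (q x) * ((p - N) * χ x - Df χ x x) =
      (p - N) * (∫ x, V (q x) * χ x) - ∫ x, V (q x) * Df χ x x := by
    rw [← integral_const_mul, ← integral_sub (i3.const_mul _) i4]
    exact integral_congr_ae (of_forall fun x => by ring)
  have a5 : ∫ x, u x * (Df χ x x + N * χ x) =
      (∫ x, u x * Df χ x x) + N * ∫ x, u x * χ x := by
    rw [← integral_const_mul, ← integral_add i6 (i5.const_mul _)]
    exact integral_congr_ae (of_forall fun x => by ring)
  rw [a1, a2]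
  rw [a3, a4] at e0
  rw [a5] at e1
  linarith

end RSol

section

section layer

variable {w : Euc N → ℝ}

/-- The density of `w` in the layer `0 < g ≤ 2ε`, at the scale of its integral over the layer. -/
def layerDensity (g w : E → ℝ) (ε : ℝ) : E → ℝ≥0∞ :=
  {x | 0 < g x ∧ g x ≤ 2 * ε}.indicator fun x => ENNReal.ofReal (|w x| / ε ^ 2)

lemma measurable_layerDensity (hg : Continuous g) (hw : Continuous w) (ε : ℝ) :
    Measurable (layerDensity g w ε) := by
  refine Measurable.indicator (by fun_prop) ?_
  exact (measurableSet_lt measurable_const hg.measurable).inter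
    (measurableSet_le hg.measurable measurable_const)

lemma exists_slope (hg : ContDiff ℝ 1 g) {y : E} (hy : Df g y ≠ 0) :
    ∃ e : E, ∃ c > 0, ∃ ρ > 0, ∃ r > 0, ∀ x, ∀ s₁ ∈ Icc 0 r, x + s₁ • e ∈ Metric.ball y ρ →
      ∀ s ∈ Icc (-r) r, ∀ s' ∈ Icc (-r) r, s ≤ s' →
        c * (s' - s) ≤ g (x + s' • e) - g (x + s • e) := by
  obtain ⟨e, he⟩ : ∃ e, 0 < Df g y e := by
    obtain ⟨v, hv⟩ := ContinuousLinearMap.exists_ne_zero hy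
    rcases lt_or_gt_of_ne hv with h | h
    · exact ⟨-v, by simpa using h⟩
    · exact ⟨v, h⟩
  have hc : ∀ᶠ x in 𝓝 y, Df g y e / 2 < Df g x e :=
    ((hg.continuous_fderiv one_ne_zero).clm_apply continuous_const).continuousAt.eventually_const_lt
      (half_lt_self he)
  obtain ⟨R, hR, hball⟩ := Metric.eventually_nhds_iff_ball.1 hc
  refine ⟨e, _, half_pos he, R / 4, by positivity, R / (4 * (‖e‖ + 1)), by positivity, ?_⟩
  intro x s₁ hs₁ hx s hs s' hs' hss
  set r := R / (4 * (‖e‖ + 1)) with hr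
  have hre : r * ‖e‖ ≤ R / 4 := by
    rw [hr, div_mul_eq_mul_div, div_le_div_iff₀ (by positivity) (by norm_num)]
    nlinarith [norm_nonneg e]
  have hin : ∀ s ∈ Icc (-r) r, x + s • e ∈ Metric.ball y R := fun s hs => by
    have h1 : x + s • e - y = (x + s₁ • e - y) + (s - s₁) • e := by rw [sub_smul]; abel
    rw [mem_ball_iff_norm, h1]
    rw [mem_ball_iff_norm] at hx
    have h2 : |s - s₁| ≤ 2 * r := by
      rw [abs_le]; constructor <;> linarith [hs.1, hs.2, hs₁.1, hs₁.2]
    have h3 : ‖(s - s₁) • e‖ ≤ R / 2 := by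
      rw [norm_smul, Real.norm_eq_abs]
      nlinarith [mul_le_mul_of_nonneg_right h2 (norm_nonneg e)]
    linarith [norm_add_le (x + s₁ • e - y) ((s - s₁) • e)]
  have hd : ∀ s, HasDerivAt (fun s : ℝ => g (x + s • e)) (Df g (x + s • e) e) s := fun s => by
    have h1 : HasDerivAt (fun s : ℝ => x + s • e) e s := by
      simpa using ((hasDerivAt_id s).smul_const e).const_add x
    exact ((hg.differentiable one_ne_zero _).hasFDerivAt).comp_hasDerivAt s h1
  refine (convex_Icc (-r) r).mul_sub_le_image_sub_of_le_deriv
    (fun s _ => (hd s).continuousAt.continuousWithinAt)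
    (fun s _ => (hd s).differentiableAt.differentiableWithinAt) (fun s hs => ?_) s hs s' hs' hss
  rw [(hd s).deriv]
  exact (hball _ (hin s (interior_subset hs))).le

lemma lintegral_segment_layer_le {e : E} {r D : ℝ} (hc : 0 < c) (hr : 0 < r)
    (hε : 0 < ε) (hεr : 2 * ε ≤ c * r) (hg : Continuous g)
    (hslope : ∀ s ∈ Icc (-r) r, ∀ s' ∈ Icc (-r) r, s ≤ s' →
        c * (s' - s) ≤ g (x + s' • e) - g (x + s • e))
    (hD : ∀ s₀ ∈ Icc (-r) r, g (x + s₀ • e) = 0 → ∀ s ∈ Icc s₀ (s₀ + 2 * ε / c), 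
      0 ≤ g (x + s • e) → |w (x + s • e)| ≤ D * (s - s₀)) (hD0 : 0 ≤ D) :
    ∫⁻ s in Icc 0 r, layerDensity g w ε (x + s • e) ≤ ENNReal.ofReal (D * (2 / c) ^ 2) := by
  by_cases h0 : ∃ s₀ ∈ Icc (-r) r, g (x + s₀ • e) = 0
  · obtain ⟨s₀, hs₀, hz⟩ := h0
    have hle : ∀ s ∈ Icc 0 r, layerDensity g w ε (x + s • e) ≤
        (Icc s₀ (s₀ + 2 * ε / c)).indicator (fun _ => ENNReal.ofReal (D * (2 * ε / c) / ε ^ 2)) s := by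
      intro s hs
      by_cases hx : x + s • e ∈ {x | 0 < g x ∧ g x ≤ 2 * ε}
      swap
      · rw [layerDensity, indicator_of_notMem hx]; exact zero_le
      rw [layerDensity, indicator_of_mem hx]
      have hs' : s ∈ Icc (-r) r := ⟨by linarith [hs.1], hs.2⟩
      have h1 : s₀ ≤ s := by
        by_contra h'
        push Not at h'
        have := hslope s hs' s₀ hs₀ h'.le
        rw [hz] at this
        nlinarith [hx.1, mul_pos hc (sub_pos.2 h')]
      have h2 := hslope s₀ hs₀ s hs' h1
      rw [hz] at h2
      have h3 : s - s₀ ≤ 2 * ε / c := by rw [le_div_iff₀ hc]; linarith [hx.2]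
      have hmem : s ∈ Icc s₀ (s₀ + 2 * ε / c) := ⟨h1, by linarith⟩
      rw [indicator_of_mem hmem]
      gcongr
      exact (hD s₀ hs₀ hz s hmem hx.1.le).trans (by gcongr)
    refine (setLIntegral_mono' measurableSet_Icc hle).trans ((setLIntegral_le_lintegral _ _).trans ?_)
    rw [lintegral_indicator_const measurableSet_Icc, Real.volume_Icc, ← ENNReal.ofReal_mul
      (by positivity)]
    refine (congrArg ENNReal.ofReal ?_).le
    field_simp
    ring
  · have : ∀ s ∈ Icc 0 r, layerDensity g w ε (x + s • e) = 0 := fun s hs => by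
      rw [layerDensity]
      refine indicator_of_notMem (fun hx => h0 ?_) _
      have h1 := hslope (s - r) ⟨by linarith [hs.1], by linarith [hs.2]⟩ s
        ⟨by linarith [hs.1], hs.2⟩ (by linarith)
      have h2 : g (x + (s - r) • e) ≤ 0 := by linarith [hx.2, (by ring : c * (s - (s - r)) = c * r)]
      have hcont : ContinuousOn (fun s : ℝ => g (x + s • e)) (Icc (s - r) s) := by fun_prop
      obtain ⟨s₀, hs₀, hz⟩ := intermediate_value_Icc (by linarith) hcont ⟨h2, hx.1.le⟩
      exact ⟨s₀, ⟨by linarith [hs₀.1, hs.1], hs₀.2.trans hs.2⟩, hz⟩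
    rw [setLIntegral_congr_fun measurableSet_Icc this]
    simp

lemma exists_nhds_tendsto_layer (hg : ContDiff ℝ 1 g) (hw : Continuous w) (hB0 : 0 ≤ B)
    (hB : ∀ x y, 0 ≤ g x → g y = 0 → |w x| ≤ B * ‖x - y‖)
    (ho : ∀ y, g y = 0 → ∀ δ > 0, ∀ᶠ x in 𝓝 y, 0 ≤ g x → |w x| ≤ δ * ‖x - y‖) {y : E}
    (hy : Df g y ≠ 0) :
    ∃ U ∈ 𝓝 y, Tendsto (fun ε => ∫⁻ x in U, layerDensity g w ε x) (𝓝[>] 0) (𝓝 0) := by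
  obtain ⟨e, c, hc, ρ, hρ, r, hr, hslope⟩ := exists_slope hg hy
  set U := Metric.ball y ρ with hU
  refine ⟨U, Metric.ball_mem_nhds y hρ, ?_⟩
  set ψ : ℝ → E → ℝ≥0∞ := fun ε => U.indicator (layerDensity g w ε) with hψ
  have hψm : ∀ ε, Measurable (ψ ε) := fun ε =>
    (measurable_layerDensity hg.continuous hw ε).indicator measurableSet_ball
  set I : ℝ → E → ℝ≥0∞ := fun ε x => ∫⁻ s in Icc 0 r, ψ ε (x + s • e) with hI
  have hIm : ∀ ε, Measurable (I ε) := fun ε => by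
    have : Measurable fun z : E × ℝ => ψ ε (z.1 + z.2 • e) := (hψm ε).comp (by fun_prop)
    exact this.lintegral_prod_right'
  have hfub : ∀ ε, ∫⁻ x, I ε x = (∫⁻ x in U, layerDensity g w ε x) * ENNReal.ofReal r := fun ε => by
    have : Measurable fun z : E × ℝ => ψ ε (z.1 + z.2 • e) := (hψm ε).comp (by fun_prop)
    rw [hI, lintegral_lintegral_swap this.aemeasurable]
    simp_rw [lintegral_add_right_eq_self (ψ ε)]
    rw [lintegral_const, hψ, lintegral_indicator measurableSet_ball]
    simp [hU]
  have hIle : ∀ ε x, I ε x ≠ 0 → ∃ s₁ ∈ Icc 0 r, x + s₁ • e ∈ U := fun ε x h0 => by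
    by_contra h'
    push Not at h'
    refine h0 ?_
    rw [hI]
    have : ∀ s ∈ Icc 0 r, ψ ε (x + s • e) = 0 := fun s hs => indicator_of_notMem (h' s hs) _
    simp only
    rw [setLIntegral_congr_fun measurableSet_Icc this]
    simp
  have hIle' : ∀ ε x, I ε x ≤ ∫⁻ s in Icc 0 r, layerDensity g w ε (x + s • e) := fun ε x =>
    lintegral_mono fun s => indicator_le_self _ _ _
  have hsmall : ∀ᶠ ε in 𝓝[>] (0 : ℝ), 0 < ε ∧ 2 * ε ≤ c * r := by
    filter_upwards [self_mem_nhdsWithin, mem_nhdsWithin_of_mem_nhds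
      (gt_mem_nhds (show 0 < c * r / 2 by positivity))] with ε h1 h2 using ⟨h1, by linarith⟩
  have hbd : ∀ᶠ ε in 𝓝[>] (0 : ℝ), ∀ x, I ε x ≤
      (Metric.ball y (ρ + r * ‖e‖)).indicator
        (fun _ => ENNReal.ofReal (B * ‖e‖ * (2 / c) ^ 2)) x := by
    filter_upwards [hsmall] with ε hε x
    by_cases h0 : I ε x = 0
    · rw [h0]; exact zero_le
    obtain ⟨s₁, hs₁, hx⟩ := hIle ε x h0
    rw [indicator_of_mem]
    · refine (hIle' ε x).trans (lintegral_segment_layer_le hc hr hε.1 hε.2 hg.continuous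
        (hslope x s₁ hs₁ hx) (fun s₀ hs₀ hz s hs hs' => ?_) (by positivity))
      refine (hB _ _ hs' hz).trans (le_of_eq ?_)
      rw [add_sub_add_left_eq_sub, ← sub_smul, norm_smul, Real.norm_of_nonneg (sub_nonneg.2 hs.1)]
      ring
    · rw [mem_ball_iff_norm] at hx ⊢
      have h1 : x - y = (x + s₁ • e - y) - s₁ • e := by abel
      rw [h1]
      refine (norm_sub_le _ _).trans_lt (add_lt_add_of_lt_of_le hx ?_)
      rw [norm_smul, Real.norm_of_nonneg hs₁.1]
      exact mul_le_mul_of_nonneg_right hs₁.2 (norm_nonneg _)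
  have hpt : ∀ x, Tendsto (fun ε => I ε x) (𝓝[>] 0) (𝓝 0) := fun x => by
    by_cases h1 : ∃ s₁ ∈ Icc 0 r, x + s₁ • e ∈ U
    swap
    · refine tendsto_const_nhds.congr fun ε => ?_
      by_contra h'
      exact h1 (hIle ε x (Ne.symm h'))
    obtain ⟨s₁, hs₁, hx⟩ := h1
    have hsl := hslope x s₁ hs₁ hx
    have hev : ∀ δ > 0, ∀ᶠ ε in 𝓝[>] (0 : ℝ), I ε x ≤ ENNReal.ofReal (δ * ‖e‖ * (2 / c) ^ 2) := by
      intro δ hδ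
      by_cases h0 : ∃ s₀ ∈ Icc (-r) r, g (x + s₀ • e) = 0
      · obtain ⟨s₀, hs₀, hz⟩ := h0
        have h2 : ∀ᶠ s in 𝓝 s₀, 0 ≤ g (x + s • e) →
            |w (x + s • e)| ≤ δ * ‖x + s • e - (x + s₀ • e)‖ :=
          (by fun_prop : Continuous fun s : ℝ => x + s • e).continuousAt.eventually (ho _ hz δ hδ)
        obtain ⟨η, hη, hη'⟩ := Metric.eventually_nhds_iff.1 h2
        filter_upwards [hsmall, mem_nhdsWithin_of_mem_nhds
          (gt_mem_nhds (show 0 < η * c / 2 by positivity))] with ε hε hε2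
        refine (hIle' ε x).trans (lintegral_segment_layer_le hc hr hε.1 hε.2 hg.continuous
          hsl (fun t₀ ht₀ hzt s hs hs' => ?_) (by positivity))
        have ht : t₀ = s₀ := by
          rcases le_total t₀ s₀ with h3 | h3
          · have := hsl t₀ ht₀ s₀ hs₀ h3
            rw [hz, hzt] at this
            nlinarith
          · have := hsl s₀ hs₀ t₀ ht₀ h3
            rw [hz, hzt] at this
            nlinarith
        rw [ht] at hs ⊢
        have h5 : dist s s₀ < η := by
          rw [Real.dist_eq, abs_of_nonneg (sub_nonneg.2 hs.1)]
          have : 2 * ε / c < η := by rw [div_lt_iff₀ hc]; linarith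
          linarith [hs.2]
        refine (hη' h5 hs').trans (le_of_eq ?_)
        rw [add_sub_add_left_eq_sub, ← sub_smul, norm_smul, Real.norm_of_nonneg (sub_nonneg.2 hs.1)]
        ring
      · filter_upwards [hsmall] with ε hε
        exact (hIle' ε x).trans (lintegral_segment_layer_le hc hr hε.1 hε.2 hg.continuous
          hsl (fun t₀ ht₀ hzt => absurd ⟨t₀, ht₀, hzt⟩ h0) (by positivity))
    refine ENNReal.tendsto_nhds_zero.2 fun η hη => ?_
    have hlim : Tendsto (fun δ : ℝ => ENNReal.ofReal (δ * ‖e‖ * (2 / c) ^ 2)) (𝓝[>] 0) (𝓝 0) := by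
      refine tendsto_nhdsWithin_of_tendsto_nhds ?_
      have : Continuous fun δ : ℝ => ENNReal.ofReal (δ * ‖e‖ * (2 / c) ^ 2) :=
        ENNReal.continuous_ofReal.comp (by fun_prop)
      simpa using this.tendsto 0
    obtain ⟨δ, hδη, hδ⟩ := ((hlim.eventually_le_const hη).and self_mem_nhdsWithin).exists
    filter_upwards [hev δ hδ] with ε hε using hε.trans hδη
  have hlim : Tendsto (fun ε => ∫⁻ x, I ε x) (𝓝[>] 0) (𝓝 (∫⁻ _ : E, (0 : ℝ≥0∞))) :=
    tendsto_lintegral_filter_of_dominated_convergence _ (of_forall hIm)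
      (hbd.mono fun ε h => of_forall h) (by
        rw [lintegral_indicator_const measurableSet_ball]
        exact ENNReal.mul_ne_top ENNReal.ofReal_ne_top measure_ball_lt_top.ne)
      (of_forall hpt)
  simp only [hfub, lintegral_zero] at hlim
  have hr0 : ENNReal.ofReal r ≠ 0 := by simpa using hr
  have := ENNReal.Tendsto.mul_const (b := (ENNReal.ofReal r)⁻¹) hlim
    (Or.inr (ENNReal.inv_ne_top.2 hr0))
  simpa only [mul_assoc, ENNReal.mul_inv_cancel hr0 ENNReal.ofReal_ne_top, mul_one, zero_mul] using this

lemma tendsto_layer (hg : ContDiff ℝ 1 g) (hgc : IsCompact {x | 0 ≤ g x})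
    (hreg : ∀ y, g y = 0 → Df g y ≠ 0) (hw : Continuous w) (hB0 : 0 ≤ B)
    (hB : ∀ x y, 0 ≤ g x → g y = 0 → |w x| ≤ B * ‖x - y‖)
    (ho : ∀ y, g y = 0 → ∀ δ > 0, ∀ᶠ x in 𝓝 y, 0 ≤ g x → |w x| ≤ δ * ‖x - y‖) :
    Tendsto (fun ε => ∫⁻ x, layerDensity g w ε x) (𝓝[>] 0) (𝓝 0) := by
  have hK : IsCompact {x | g x = 0} :=
    hgc.of_isClosed_subset (isClosed_eq hg.continuous continuous_const) fun x hx => (hx : g x = 0).ge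
  obtain ⟨U, hU, hT⟩ : ∃ U ∈ 𝓝ˢ {x | g x = 0},
      Tendsto (fun ε => ∫⁻ x in U, layerDensity g w ε x) (𝓝[>] 0) (𝓝 0) := by
    refine hK.induction_on (p := fun s => ∃ U ∈ 𝓝ˢ s,
      Tendsto (fun ε => ∫⁻ x in U, layerDensity g w ε x) (𝓝[>] 0) (𝓝 0)) ?_ ?_ ?_ ?_
    · exact ⟨∅, by simp, by simp⟩
    · exact fun s t hst ⟨U, hU, hT⟩ => ⟨U, nhdsSet_mono hst hU, hT⟩
    · rintro s t ⟨U, hU, hT⟩ ⟨W, hV, hT'⟩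
      refine ⟨U ∪ W, ?_, ?_⟩
      · rw [nhdsSet_union]
        exact union_mem_sup hU hV
      · refine tendsto_of_tendsto_of_tendsto_of_le_of_le tendsto_const_nhds
          (by simpa using hT.add hT') (fun _ => zero_le) fun ε => lintegral_union_le _ _ _
    · intro y hy
      obtain ⟨U, hU, hT⟩ := exists_nhds_tendsto_layer hg hw hB0 hB ho (hreg y hy)
      obtain ⟨W, hVU, hVo, hyV⟩ := mem_nhds_iff.1 hU
      exact ⟨W, mem_nhdsWithin_of_mem_nhds (hVo.mem_nhds hyV), U,
        mem_of_superset (hVo.mem_nhdsSet.2 subset_rfl) hVU, hT⟩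
  obtain ⟨W, hVo, hKV, hVU⟩ := mem_nhdsSet_iff_exists.1 hU
  obtain ⟨δ, hδ, hδ'⟩ : ∃ δ > 0, ∀ x, 0 ≤ g x → g x < δ → x ∈ W := by
    rcases ({x | 0 ≤ g x} \ W).eq_empty_or_nonempty with h0 | h0
    · exact ⟨1, one_pos, fun x hx _ => by_contra fun h' =>
        eq_empty_iff_forall_notMem.1 h0 x ⟨hx, h'⟩⟩
    · obtain ⟨z, hz, hmin⟩ := (hgc.diff hVo).exists_isMinOn h0 hg.continuous.continuousOn
      refine ⟨g z, lt_of_le_of_ne hz.1 fun h' => hz.2 (hKV h'.symm), fun x hx hlt => ?_⟩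
      by_contra h'
      exact absurd (hmin ⟨hx, h'⟩) (not_le.2 hlt)
  refine hT.congr' ?_
  filter_upwards [mem_nhdsWithin_of_mem_nhds (gt_mem_nhds (half_pos hδ))] with ε hε
  refine setLIntegral_eq_of_support_subset fun x hx => hVU ?_
  have h1 : x ∈ {x | 0 < g x ∧ g x ≤ 2 * ε} := by_contra fun h' => hx (indicator_of_notMem h' _)
  exact hδ' x h1.1.le (by linarith [h1.2])

end layer

end

/-- A defining function `g` of `Ω` with `H(∇g) = 1` on the boundary, with a `C¹` extension `m` of
the dual normal. -/
structure Collar (H : E → ℝ) (p : ℝ) (Ω : Set E) (g : E → ℝ) (m : E → E)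
    : Prop where
  cg : ContDiff ℝ 1 g
  cm : ContDiff ℝ 1 m
  mem_iff : ∀ x, x ∈ Ω ↔ 0 < g x
  front : ∀ x, x ∈ frontier Ω ↔ g x = 0
  unit : ∀ x, g x = 0 → H (gradient g x) = 1
  dual : ∀ x, g x = 0 → m x = ∇V (gradient g x)

lemma IsC2alphaDomain.exists_collar (hH : Ip) (hp : 1 < p) (hb : Bornology.IsBounded Ω)
    (h : IsC2alphaDomain Ω) :
    ∃ g m, Collar H p Ω g m := by
  obtain ⟨-, f, hf, -, hΩ, hfr, hreg⟩ := h
  set F := gradient f with hF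
  have hFc : ContDiff ℝ 1 F :=
    (InnerProductSpace.toDual ℝ (E)).symm.contDiff.comp (hf.fderiv_right (by norm_num))
  have hcomp : IsCompact (frontier Ω) :=
    hb.isCompact_closure.of_isClosed_subset isClosed_frontier frontier_subset_closure
  obtain ⟨a, ha, hab⟩ := hcomp.exists_forall_le' (f := fun x => V (F x))
    ((hH.V_continuous hp).comp hFc.continuous).continuousOn (a := 0)
    fun x hx => hH.V_pos hp (hreg x hx)
  set γ : E → ℝ := fun x => 1 + trunc H p (a / 2) (fun ξ => (H ξ)⁻¹ - 1) (F x) with hγ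
  have hHs : ∀ ξ, ξ ≠ 0 → ContDiffAt ℝ 1 H ξ := fun ξ hξ =>
    (hH.smooth.contDiffAt (isOpen_compl_singleton.mem_nhds hξ)).of_le (by norm_num)
  have hγc : ContDiff ℝ 1 γ := contDiff_const.add
    ((contDiff_trunc hH hp (half_pos ha) fun ξ hξ =>
      ((hHs ξ hξ).inv (hH.pos ξ hξ).ne').sub contDiffAt_const).comp hFc)
  have hγ0 : ∀ x, 0 < γ x := fun x => by
    by_cases h0 : F x = 0
    · simp [hγ, h0, trunc_zero hH hp (half_pos ha)]
    · have h1 := inv_pos.2 (hH.pos _ h0)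
      have h2 := Real.smoothTransition.nonneg (V (F x) / (a / 2) - 1)
      have h3 := Real.smoothTransition.le_one (V (F x) / (a / 2) - 1)
      simp only [hγ, trunc, smul_eq_mul]
      rcases h2.eq_or_lt with h4 | h4
      · rw [← h4]; norm_num
      · nlinarith [mul_pos h4 h1]
  have hγf : ∀ x, f x = 0 → γ x = (H (F x))⁻¹ := fun x hx => by
    simp only [hγ]
    rw [trunc_of_ge (half_pos ha)]
    · ring
    · have := hab x (hfr ▸ hx)
      linarith
  set g : E → ℝ := fun x => -f x * γ x with hg
  set v : E → E := fun x => -(γ x • F x) with hv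
  have hg0 : ∀ x, g x = 0 ↔ f x = 0 := fun x => by simp [hg, (hγ0 x).ne']
  have hgrad : ∀ x, f x = 0 → gradient g x = v x := fun x hx => by
    refine HasGradientAt.gradient (hasGradientAt_iff_hasFDerivAt.2 ?_)
    have h1 := (hf.differentiable (by norm_num) x).hasGradientAt.hasFDerivAt.fun_neg.fun_mul
      (hγc.differentiable one_ne_zero x).hasFDerivAt
    refine h1.congr_fderiv ?_
    simp [hx, hv, hF]
  have hv1 : ∀ x, f x = 0 → H (v x) = 1 := fun x hx => by
    have h0 : 0 < H (F x) := hH.pos _ (hreg x (hfr ▸ hx))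
    simp only [hv, hH.map_neg, hγf x hx, hH.homog_pos (inv_nonneg.2 h0.le)]
    exact inv_mul_cancel₀ h0.ne'
  have hp0 : 0 < 1 / (2 * p) := by positivity
  refine ⟨g, fun x => trunc H p (1 / (2 * p)) (∇V) (v x), ⟨hf.of_le (by norm_num) |>.neg.mul
    hγc, (contDiff_trunc hH hp hp0 fun ξ hξ => hH.contDiffAt_stress hξ).comp (hγc.smul hFc).neg,
    fun x => ?_, fun x => ?_, fun x hx => ?_, fun x hx => ?_⟩⟩
  · rw [hΩ]
    exact ⟨fun hx => mul_pos (neg_pos.2 hx) (hγ0 x), fun hx => neg_pos.1 (pos_of_mul_pos_left hx (hγ0 x).le)⟩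
  · rw [hfr, hg0]; rfl
  · rw [hgrad x ((hg0 x).1 hx), hv1 x ((hg0 x).1 hx)]
  · rw [hgrad x ((hg0 x).1 hx), trunc_of_ge hp0]
    rw [Vfun, hv1 x ((hg0 x).1 hx), Real.one_rpow]
    exact le_of_eq (by field_simp)

namespace IsIpNorm

/-- Equality in the dual inequality only holds along the ray. -/
lemma eq_smul_of_inner_stress (hH : Ip) (hp : 1 < p) {e q : E} (hC : 0 < C)
    (he : H e = 1) (hq : H q ≤ C) (h : ⟪∇V e, q⟫ = C) : q = C • e := by
  set ξ := C⁻¹ • q with hξ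
  have h1 : H ξ ≤ 1 := by
    rw [hξ, hH.homog_pos (inv_nonneg.2 hC.le), inv_mul_le_iff₀ hC]; linarith
  have h2 : ⟪∇V e, ξ⟫ = 1 := by
    rw [hξ, inner_smul_right, h, inv_mul_cancel₀ hC.ne']
  have h3 : ⟪∇V e, e⟫ = 1 := by rw [hH.inner_stress_self hp, he, Real.one_rpow]
  have hle : ∀ z w : E, H z ≤ 1 → H w ≤ 1 → ⟪∇V z, w⟫ ≤ 1 := fun z w hz hw =>
    (hH.inner_stress_le hp z w).trans (mul_le_one₀ (Real.rpow_le_one (hH.nonneg _) hz (by linarith))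
      (hH.nonneg _) hw)
  have hz1 : H ξ = 1 := by
    refine le_antisymm h1 ?_
    have := hH.inner_stress_le hp e ξ
    rwa [h2, he, Real.one_rpow, one_mul] at this
  by_contra hne
  have hne' : e ≠ ξ := fun h' => hne (by rw [h', hξ, smul_inv_smul₀ hC.ne'])
  set z := (1 / 2 : ℝ) • (e + ξ) with hz
  have hzle : H z ≤ 1 := by
    rw [hz, hH.homog_pos (by norm_num)]; linarith [hH.add_le e ξ]
  have hTe : ⟪∇V e, z⟫ = 1 := by
    rw [hz, inner_smul_right, inner_add_right, h2, h3]; norm_num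
  have hz2 : H z = 1 := by
    refine le_antisymm hzle ?_
    have := hH.inner_stress_le hp e z
    rwa [hTe, he, Real.one_rpow, one_mul] at this
  have hne2 : e ≠ z := fun h' => hne' (by
    have h4 : (1 / 2 : ℝ) • e = (1 / 2 : ℝ) • ξ := by
      have h5 : e = (1 / 2 : ℝ) • e + (1 / 2 : ℝ) • ξ := by rw [← smul_add, ← hz, ← h']
      have h6 : e = (1 / 2 : ℝ) • e + (1 / 2 : ℝ) • e := by rw [← add_smul]; norm_num
      exact add_left_cancel (h6.symm.trans h5)
    exact smul_right_injective _ (by norm_num : (1 / 2 : ℝ) ≠ 0) h4)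
  have h7 := hH.stress_strictMono hp hne2
  have h8 : ⟪∇V z, z⟫ = 1 := by rw [hH.inner_stress_self hp, hz2, Real.one_rpow]
  have h9 : ⟪∇V z, e⟫ + ⟪∇V z, ξ⟫ = 2 := by
    rw [hz, inner_smul_right, inner_add_right] at h8
    rw [hz]; linarith
  have h10 := hle z ξ hzle h1
  rw [inner_sub_left, inner_sub_right, inner_sub_right, h8, hTe, h3] at h7
  have h11 := hle z e hzle he.le
  linarith

end IsIpNorm

namespace Collar

lemma closure_eq (h : Collar H p Ω g m) : closure Ω = {x | 0 ≤ g x} := by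
  ext x
  have h2 : closure Ω = Ω ∪ frontier Ω := closure_eq_self_union_frontier Ω
  rw [h2, mem_union, h.mem_iff, h.front, mem_setOf_eq, le_iff_lt_or_eq, eq_comm (a := (0 : ℝ))]

lemma continuous_gradient (h : Collar H p Ω g m) : Continuous (gradient g) :=
  (InnerProductSpace.toDual ℝ (E)).symm.continuous.comp (h.cg.continuous_fderiv one_ne_zero)

lemma fderiv_apply (h : Collar H p Ω g m) (x v : E) : Df g x v = ⟪gradient g x, v⟫ := by
  rw [gradient, InnerProductSpace.toDual_symm_apply]

lemma gradient_ne_zero (hH : Ip) (h : Collar H p Ω g m) {y : E} (hy : g y = 0) :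
    gradient g y ≠ 0 := fun h0 => by
  have := h.unit y hy
  rw [h0, hH.map_zero] at this
  exact zero_ne_one this

/-- A continuous function on `closure Ω × K` positive over the boundary stays positive near it. -/
lemma exists_pos_of_boundary (h : Collar H p Ω g m) (hb : Bornology.IsBounded Ω)
    (hK : IsCompact K) {F : E × E → ℝ} (hF : Continuous F)
    (h0 : ∀ y, g y = 0 → ∀ q ∈ K, 0 < F (y, q)) :
    ∃ ε > 0, ∀ x, 0 ≤ g x → g x < ε → ∀ q ∈ K, 0 < F (x, q) := by
  have hS : IsCompact ((closure Ω ×ˢ K) ∩ {z | F z ≤ 0}) :=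
    (hb.isCompact_closure.prod hK).inter_right (isClosed_le hF continuous_const)
  obtain ⟨ε, hε, hle⟩ := hS.exists_forall_le' (f := fun z => g z.1)
    (h.cg.continuous.comp continuous_fst).continuousOn (a := 0) (by
      rintro ⟨x, q⟩ ⟨⟨hx, hq⟩, hF0⟩
      rw [h.closure_eq] at hx
      exact lt_of_le_of_ne hx fun h' => not_lt.2 hF0 (h0 x h'.symm q hq))
  refine ⟨ε, hε, fun x hx hxε q hq => ?_⟩
  by_contra h'
  exact not_lt.2 (hle (x, q) ⟨⟨by rw [h.closure_eq]; exact hx, hq⟩, not_lt.1 h'⟩) hxε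

end Collar

section step

lemma eventuallyEq_deriv_step (hb : 0 < b) (h : s ∉ Icc b (2 * b)) :
    deriv (step b) =ᶠ[𝓝 s] fun _ => 0 := by
  filter_upwards [isClosed_Icc.isOpen_compl.mem_nhds h] with t ht
  by_cases h1 : t < b
  · have : step b =ᶠ[𝓝 t] fun _ => 0 := by
      filter_upwards [gt_mem_nhds h1] with r hr using step_of_le hb hr.le
    rw [this.deriv_eq, deriv_const]
  · have h2 : 2 * b < t := by
      by_contra h'
      exact ht ⟨not_lt.1 h1, not_lt.1 h'⟩
    have : step b =ᶠ[𝓝 t] fun _ => 1 := by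
      filter_upwards [lt_mem_nhds h2] with r hr using step_of_ge hb hr.le
    rw [this.deriv_eq, deriv_const]

lemma contDiff_deriv_step (b : ℝ) : ContDiff ℝ 1 (deriv (step b)) :=
  ((contDiff_succ_iff_deriv (n := 1)).1 (contDiff_step b (n := 2))).2.2

lemma exists_deriv_deriv_step_bound :
    ∃ K > 0, ∀ b > 0, ∀ s, |deriv (deriv (step b)) s| ≤ K / b ^ 2 := by
  have hS : ContDiff ℝ 2 Real.smoothTransition := Real.smoothTransition.contDiff
  have hS1 : ContDiff ℝ 1 (deriv Real.smoothTransition) :=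
    ((contDiff_succ_iff_deriv (n := 1)).1 hS).2.2
  obtain ⟨K, hK⟩ := (isCompact_Icc (a := (0 : ℝ)) (b := 1)).exists_bound_of_continuousOn
    (hS1.continuous_deriv le_rfl).continuousOn
  have hd : ∀ b s : ℝ, HasDerivAt (fun s => s / b - 1) (1 / b) s := fun b s =>
    ((hasDerivAt_id s).div_const b).sub_const 1
  have e1 : ∀ b, deriv (step b) = fun s => deriv Real.smoothTransition (s / b - 1) * (1 / b) :=
    fun b => funext fun s =>
      ((hS.differentiable (by norm_num) _).hasDerivAt.comp s (hd b s)).deriv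
  have e2 : ∀ b s, deriv (deriv (step b)) s =
      deriv (deriv Real.smoothTransition) (s / b - 1) * (1 / b) * (1 / b) := fun b s => by
    rw [e1]
    exact (((hS1.differentiable one_ne_zero _).hasDerivAt.comp s (hd b s)).mul_const (1 / b)).deriv
  refine ⟨max K 1, by positivity, fun b hb s => ?_⟩
  by_cases hs : s ∈ Icc b (2 * b)
  · have h1 : s / b - 1 ∈ Icc (0 : ℝ) 1 :=
      ⟨by rw [sub_nonneg, one_le_div hb]; exact hs.1,
        by rw [sub_le_iff_le_add, div_le_iff₀ hb]; linarith [hs.2]⟩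
    have hb' : |1 / b| = 1 / b := abs_of_pos (by positivity)
    rw [e2, abs_mul, abs_mul, hb', mul_one_div, mul_one_div, div_div, ← sq]
    gcongr
    exact (hK _ h1).trans (le_max_left _ _)
  · rw [(eventuallyEq_deriv_step hb hs).deriv_eq, deriv_const, abs_zero]
    positivity

end step

namespace Collar

lemma boundary_gradient (hH : Ip) (hC : 0 < C) (h : Collar H p Ω g m)
    (hu : ∀ x, 0 ≤ u x) (hu0 : ∀ y, g y = 0 → u y = 0) {y : E} (hy : g y = 0)
    (hξ : H ξ = C) (hd : HasFDerivWithinAt u (innerSL ℝ ξ) (closure Ω) y) :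
    ξ = C • gradient g y := by
  set a := gradient g y with ha
  have ha0 : a ≠ 0 := h.gradient_ne_zero hH hy
  have hna : 0 < ‖a‖ ^ 2 := by positivity
  have hmin : IsLocalMinOn u (closure Ω) y := of_forall fun x => by
    rw [hu0 y hy]; exact hu x
  have h1 : ∀ v, 0 < ⟪a, v⟫ → 0 ≤ ⟪ξ, v⟫ := fun v hv => by
    have hg' : HasDerivAt (fun s : ℝ => g (y + s • v)) ⟪a, v⟫ 0 := by
      have h2 : HasDerivAt (fun s : ℝ => y + s • v) v 0 := by
        simpa using ((hasDerivAt_id (0 : ℝ)).smul_const v).const_add y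
      have h3 := ((h.cg.differentiable one_ne_zero (y + (0 : ℝ) • v)).hasFDerivAt).comp_hasDerivAt 0 h2
      rw [h.fderiv_apply, zero_smul, add_zero] at h3
      exact h3
    have h4 : ∀ᶠ s in 𝓝[>] (0 : ℝ), y + s • v ∈ closure Ω := by
      have h5 := (hasDerivWithinAt_iff_tendsto_slope' self_notMem_Ioi).1
        (hg'.hasDerivWithinAt (s := Ioi 0))
      filter_upwards [h5.eventually_const_lt hv, self_mem_nhdsWithin] with s hs hs0
      rw [h.closure_eq, mem_setOf_eq]
      have hs0' : (0 : ℝ) < s := hs0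
      rw [slope_def_field, zero_smul, add_zero, hy, sub_zero, sub_zero] at hs
      exact ((div_pos_iff_of_pos_right hs0').1 hs).le
    have := hmin.hasFDerivWithinAt_nonneg hd (mem_posTangentConeAt_of_frequently_mem h4.frequently)
    simpa using this
  have h2 : ∀ v, ⟪a, v⟫ = 0 → 0 ≤ ⟪ξ, v⟫ := fun v hv => by
    have hlim : Tendsto (fun δ : ℝ => ⟪ξ, v + δ • a⟫) (𝓝[>] 0) (𝓝 ⟪ξ, v⟫) := by
      refine tendsto_nhdsWithin_of_tendsto_nhds ?_
      have : Continuous fun δ : ℝ => ⟪ξ, v + δ • a⟫ := by fun_prop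
      simpa using this.tendsto 0
    refine ge_of_tendsto hlim ?_
    filter_upwards [self_mem_nhdsWithin] with δ hδ
    refine h1 _ ?_
    rw [inner_add_right, hv, inner_smul_right, real_inner_self_eq_norm_sq, zero_add]
    exact mul_pos hδ hna
  set l := ⟪a, ξ⟫ / ‖a‖ ^ 2 with hl
  have hv0 : ⟪a, ξ - l • a⟫ = 0 := by
    rw [inner_sub_right, inner_smul_right, real_inner_self_eq_norm_sq, hl,
      div_mul_cancel₀ _ hna.ne', sub_self]
  have h3 : ξ = l • a := by
    have h4 := h2 (-(ξ - l • a)) (by rw [inner_neg_right, hv0, neg_zero])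
    have h5 : ⟪ξ, ξ - l • a⟫ = ‖ξ - l • a‖ ^ 2 := by
      rw [← real_inner_self_eq_norm_sq]
      conv_rhs => rw [inner_sub_left, inner_smul_left, hv0]
      simp
    rw [inner_neg_right, h5] at h4
    have h6 : ‖ξ - l • a‖ = 0 := by
      have := sq_nonneg ‖ξ - l • a‖
      exact pow_eq_zero_iff two_ne_zero |>.1 (by linarith)
    exact sub_eq_zero.1 (norm_eq_zero.1 h6)
  have hl0 : 0 ≤ l := by
    refine div_nonneg ?_ hna.le
    rw [real_inner_comm]
    exact h1 a (by rw [real_inner_self_eq_norm_sq]; exact hna)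
  rw [h3, hH.homog_pos hl0, h.unit y hy, mul_one] at hξ
  rw [h3, hξ]

lemma tendsto_layer_sub (hH : Ip) (hp : 1 < p) (h : Collar H p Ω g m)
    (hr : RS) :
    Tendsto (fun ε => ∫⁻ x, layerDensity g (fun x => u x - C * g x) ε x) (𝓝[>] 0) (𝓝 0) := by
  have hu0 : ∀ y, g y = 0 → u y = 0 := fun y hy => hr.zero y (by rw [h.mem_iff, hy]; exact lt_irrefl _)
  have hgd := h.cg.differentiable one_ne_zero
  obtain ⟨R, hR⟩ := (hr.isCompact_closure).isBounded.subset_closedBall (0 : E)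
  obtain ⟨D, hD⟩ := (isCompact_closedBall (0 : E) R).exists_bound_of_continuousOn
    (h.cg.continuous_fderiv one_ne_zero).continuousOn
  obtain ⟨M, hM0, hM⟩ := hr.exists_lip hH
  have hcl := h.closure_eq
  refine tendsto_layer h.cg (hcl ▸ hr.isCompact_closure) (fun y hy h0 =>
    h.gradient_ne_zero hH hy (by rw [gradient, h0, _root_.map_zero])) (hr.cont.sub
    (continuous_const.mul h.cg.continuous)) (B := M + C * max D 0)
    (add_nonneg hM0.le (mul_nonneg hr.C_pos.le (le_max_right _ _))) (fun x y hx hy => ?_)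
    fun y hy δ hδ => ?_
  · have h1 := hM y (x - y)
    rw [add_sub_cancel, hu0 y hy, sub_zero] at h1
    have hx' : x ∈ closure Ω := hcl ▸ hx
    have hy' : y ∈ closure Ω := hcl ▸ (hy.ge : 0 ≤ g y)
    have h2 := (convex_closedBall (0 : E) R).norm_image_sub_le_of_norm_fderiv_le
      (fun x _ => hgd x) hD (hR hy') (hR hx')
    rw [hy, sub_zero, Real.norm_eq_abs] at h2
    have h3 : |g x| ≤ max D 0 * ‖x - y‖ :=
      h2.trans (mul_le_mul_of_nonneg_right (le_max_left _ _) (norm_nonneg _))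
    calc |u x - C * g x| ≤ |u x| + |C * g x| := abs_sub _ _
      _ ≤ M * ‖x - y‖ + C * (max D 0 * ‖x - y‖) := by
        rw [abs_mul, abs_of_pos hr.C_pos]
        gcongr
        exact hr.C_pos.le
      _ = _ := by ring
  · obtain ⟨ξ, hξ, hd⟩ := hr.bdry y ((h.front y).2 hy)
    rw [h.boundary_gradient hH hr.C_pos (hr.nonneg hH hp) hu0 hy hξ hd] at hd
    have h1 := hd.sub ((hgd y).hasFDerivAt.hasFDerivWithinAt.const_mul C)
    have h2 := (h1.isLittleO.def hδ)
    rw [eventually_nhdsWithin_iff] at h2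
    filter_upwards [h2] with x hx hx0
    have h3 := hx (hcl ▸ hx0)
    simp only [hu0 y hy, hy, _root_.sub_apply, _root_.smul_apply, innerSL_apply_apply,
      inner_smul_left, h.fderiv_apply, smul_eq_mul, Pi.sub_apply] at h3
    simpa using h3
end Collar

lemma tendsto_integral_layer {w : E → ℝ} {θ : ℝ → E → ℝ} {K : ℝ}
    (hθ : ∀ᶠ ε in 𝓝[>] (0 : ℝ), ∀ x, |θ ε x| ≤ {x | 0 < g x ∧ g x ≤ 2 * ε}.indicator
      (fun _ => K / ε ^ 2) x) (hT : Tendsto (fun ε => ∫⁻ x, layerDensity g w ε x) (𝓝[>] 0) (𝓝 0)) :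
    Tendsto (fun ε => ∫ x, w x * θ ε x) (𝓝[>] 0) (𝓝 0) := by
  rw [tendsto_zero_iff_norm_tendsto_zero]
  have h1 := (ENNReal.Tendsto.const_mul hT (Or.inr (ENNReal.ofReal_ne_top (r := K))))
  rw [mul_zero] at h1
  have h2 : Tendsto (fun ε => ‖∫ x, w x * θ ε x‖ₑ) (𝓝[>] 0) (𝓝 0) := by
    refine tendsto_of_tendsto_of_tendsto_of_le_of_le' tendsto_const_nhds h1
      (of_forall fun _ => zero_le) ?_
    filter_upwards [hθ] with ε hε
    refine (enorm_integral_le_lintegral_enorm _).trans ?_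
    rw [← lintegral_const_mul' _ _ ENNReal.ofReal_ne_top]
    refine lintegral_mono fun x => ?_
    have h3 := hε x
    by_cases hx : x ∈ {x | 0 < g x ∧ g x ≤ 2 * ε}
    · rw [indicator_of_mem hx] at h3
      rw [layerDensity, indicator_of_mem hx, ← ENNReal.ofReal_mul', Real.enorm_eq_ofReal_abs, abs_mul]
      · refine ENNReal.ofReal_le_ofReal ((mul_le_mul_of_nonneg_left h3 (abs_nonneg _)).trans ?_)
        exact le_of_eq (by ring)
      · positivity
    · rw [indicator_of_notMem hx] at h3
      rw [abs_nonpos_iff.1 h3, mul_zero, enorm_zero]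
      exact zero_le
  have h3 := (ENNReal.tendsto_toReal ENNReal.zero_ne_top).comp h2
  simpa [Function.comp_def] using h3

namespace Collar

lemma isCompact_superlevel (h : Collar H p Ω g m) (hb : Bornology.IsBounded Ω) (hε : 0 < ε)
    : IsCompact {x | ε ≤ g x} :=
  hb.isCompact_closure.of_isClosed_subset (isClosed_le continuous_const h.cg.continuous)
    fun x (hx : ε ≤ g x) => by rw [h.closure_eq]; exact hε.le.trans hx

lemma support_cutoff (h : Collar H p Ω g m) (hb : Bornology.IsBounded Ω) {F : Type*}
    [NormedAddCommGroup F] {Z : E → F} (hε : 0 < ε) (h0 : ∀ x, g x < ε → Z x = 0) :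
    HasCompactSupport Z ∧ tsupport Z ⊆ Ω := by
  have hK := h.isCompact_superlevel hb hε
  have hs : tsupport Z ⊆ {x | ε ≤ g x} :=
    closure_minimal (fun x hx => by_contra fun h' => hx (h0 x (not_le.1 h'))) hK.isClosed
  exact ⟨hK.of_isClosed_subset (isClosed_tsupport _) hs,
    hs.trans fun x (hx : ε ≤ g x) => (h.mem_iff x).2 (hε.trans_le hx)⟩

lemma integrable_cutoff (h : Collar H p Ω g m) (hb : Bornology.IsBounded Ω) {f : E → ℝ}
    (hε : 0 < ε) (hf : Continuous f) (h0 : ∀ x, g x < ε → f x = 0) : Integrable f :=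
  hf.integrable_of_hasCompactSupport (h.support_cutoff hb hε h0).1

lemma fderiv_comp (h : Collar H p Ω g m) (hκ : ContDiff ℝ 1 κ) (x v : E) :
    Df (fun x => κ (g x)) x v = deriv κ (g x) * ⟪gradient g x, v⟫ := by
  have h1 := ((hκ.differentiable one_ne_zero (g x)).hasDerivAt).comp_hasFDerivAt x
    (h.cg.differentiable one_ne_zero x).hasFDerivAt
  rw [show (fun x => κ (g x)) = κ ∘ g from rfl, h1.fderiv, _root_.smul_apply, h.fderiv_apply,
    smul_eq_mul]

lemma deriv_step_eq_zero (hε : 0 < ε) (hs : s < ε) : deriv (step ε) s = 0 :=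
  (eventuallyEq_deriv_step hε fun h => not_lt.2 h.1 hs).eq_of_nhds

/-- The divergence theorem for a vector field cut off by `step ε ∘ g`. -/
lemma integral_deriv_step_inner (h : Collar H p Ω g m) (hb : Bornology.IsBounded Ω)
    {Z : E → E} (hZ : ContDiff ℝ 1 Z) (hε : 0 < ε) :
    ∫ x, deriv (step ε) (g x) * ⟪gradient g x, Z x⟫ = - ∫ x, step ε (g x) * dvg Z x := by
  have hχ : ContDiff ℝ 1 fun x => step ε (g x) := (contDiff_step ε (n := 1)).comp h.cg
  have hs := h.support_cutoff hb (Z := fun x => step ε (g x) • Z x) hε fun x hx => by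
    rw [step_of_le hε hx.le, zero_smul]
  have e := integral_apply_eq_neg_dvg (k := fun _ => (1 : ℝ)) (Λ := fun _ => 0) continuous_const
    continuous_const.locallyIntegrable (fun x _ => hasFDerivAt_const 1 x) (hχ.smul hZ)
    hs.1 hs.2
  rw [show (fun x => step ε (g x)) • Z = fun x => step ε (g x) • Z x from rfl] at e
  simp only [_root_.zero_apply, integral_zero, one_mul, dvg_smul hχ hZ,
    h.fderiv_comp (contDiff_step ε (n := 1))] at e
  have hgc := h.continuous_gradient
  have hd := continuous_dvg hZ
  have hZc := hZ.continuous
  have hgc' := h.cg.continuous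
  have i1 : Integrable fun x => deriv (step ε) (g x) * ⟪gradient g x, Z x⟫ :=
    h.integrable_cutoff hb hε (((contDiff_deriv_step ε).continuous.comp hgc').mul (hgc.inner hZc))
      fun x hx => by rw [deriv_step_eq_zero hε hx, zero_mul]
  have i2 : Integrable fun x => step ε (g x) * dvg Z x :=
    h.integrable_cutoff hb hε (hχ.continuous.mul hd) fun x hx => by
      rw [step_of_le hε hx.le, zero_mul]
  have e' := integral_add i1 i2
  linarith

lemma exists_integral_deriv_step_le (hH : Ip) (hp : 1 < p) (h : Collar H p Ω g m)
    (hb : Bornology.IsBounded Ω) : ∃ B > 0, ∀ᶠ ε in 𝓝[>] (0 : ℝ),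
      ∫ x, deriv (step ε) (g x) ≤ B := by
  have hgc := h.continuous_gradient
  have hmc := h.cm.continuous
  have hgc' := h.cg.continuous
  obtain ⟨ε₀, hε₀, hpos⟩ := h.exists_pos_of_boundary hb (isCompact_singleton (x := (0 : E)))
    (F := fun z => ⟪gradient g z.1, m z.1⟫ - 1 / 2) (by fun_prop) fun y hy _ _ => by
      simp only
      rw [h.dual y hy, real_inner_comm, hH.inner_stress_self hp, h.unit y hy, Real.one_rpow]
      norm_num
  have hmeas : MeasurableSet (closure Ω) := isClosed_closure.measurableSet
  have hI : IntegrableOn (fun x => |dvg m x|) (closure Ω) :=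
    (continuous_dvg h.cm).abs.continuousOn.integrableOn_compact hb.isCompact_closure
  refine ⟨2 * (∫ x in closure Ω, |dvg m x|) + 1, by
    have : 0 ≤ ∫ x in closure Ω, |dvg m x| := integral_nonneg fun _ => abs_nonneg _
    positivity, ?_⟩
  filter_upwards [self_mem_nhdsWithin, mem_nhdsWithin_of_mem_nhds (gt_mem_nhds (half_pos hε₀))]
    with ε hε hε2
  have hε : 0 < ε := hε
  have hβ : Continuous fun x => deriv (step ε) (g x) := (contDiff_deriv_step ε).continuous.comp hgc'
  have i1 : Integrable fun x => deriv (step ε) (g x) :=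
    h.integrable_cutoff hb hε hβ fun x hx => deriv_step_eq_zero hε hx
  have i2 : Integrable fun x => deriv (step ε) (g x) * ⟪gradient g x, m x⟫ :=
    h.integrable_cutoff hb hε (hβ.mul (hgc.inner hmc)) fun x hx => by
      rw [deriv_step_eq_zero hε hx, zero_mul]
  have e := h.integral_deriv_step_inner hb h.cm hε
  have h1 : ∫ x, deriv (step ε) (g x) ≤ ∫ x, 2 * (deriv (step ε) (g x) * ⟪gradient g x, m x⟫) := by
    refine integral_mono i1 (i2.const_mul 2) fun x => ?_
    simp only
    by_cases hx : g x ∈ Icc ε (2 * ε)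
    · have h2 := hpos x (hε.le.trans hx.1) (by linarith [hx.2]) 0 rfl
      nlinarith [deriv_step_nonneg hε (g x)]
    · rw [(eventuallyEq_deriv_step hε hx).eq_of_nhds]; simp
  rw [integral_const_mul, e] at h1
  have h2 : -∫ x, step ε (g x) * dvg m x ≤ ∫ x in closure Ω, |dvg m x| := by
    rw [← integral_neg, ← integral_indicator hmeas]
    have i3 : Integrable fun x => step ε (g x) * dvg m x :=
      h.integrable_cutoff hb hε (((contDiff_step ε (n := 1)).continuous.comp hgc').mul
        (continuous_dvg h.cm)) fun x hx => by rw [step_of_le hε hx.le, zero_mul]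
    refine integral_mono i3.neg (hI.integrable_indicator hmeas) fun x => ?_
    simp only
    by_cases hx : x ∈ closure Ω
    · rw [indicator_of_mem hx]
      have := neg_abs_le (step ε (g x) * dvg m x)
      rw [abs_mul, abs_of_nonneg (step_nonneg _ _)] at this
      nlinarith [step_le_one ε (g x), abs_nonneg (dvg m x)]
    · rw [h.closure_eq, mem_setOf_eq, not_le] at hx
      rw [step_of_le hε (hx.le.trans hε.le), zero_mul, neg_zero]
      exact indicator_nonneg (fun _ _ => abs_nonneg _) _
  linarith

lemma tendsto_integral_normal (hH : Ip) (hp : 1 < p) (h : Collar H p Ω g m)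
    (hr : RS) :
    Tendsto (fun ε => ∫ x, deriv (step ε) (g x) * (C * ⟪m x, gradient g x⟫ - ⟪m x, q x⟫))
      (𝓝[>] 0) (𝓝 0) := by
  have hgc := h.continuous_gradient
  have hmc := h.cm.continuous
  have hgc' := h.cg.continuous
  obtain ⟨L, hL, hLb⟩ := exists_deriv_step_bound
  obtain ⟨L', hL', hLb'⟩ := exists_deriv_deriv_step_bound
  obtain ⟨A, hA⟩ := hr.isCompact_closure.exists_bound_of_continuousOn (f := fun x =>
    ⟪gradient g x, m x⟫) (hgc.inner hmc).continuousOn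
  obtain ⟨A', hA'⟩ := hr.isCompact_closure.exists_bound_of_continuousOn
    (continuous_dvg h.cm).continuousOn
  have hβ (ε : ℝ) : ContDiff ℝ 1 fun x => deriv (step ε) (g x) :=
    (contDiff_deriv_step ε).comp h.cg
  have hT := tendsto_integral_layer (K := L' * |A| + L * |A'|) (θ := fun ε =>
    dvg fun x => deriv (step ε) (g x) • m x) ?_ (h.tendsto_layer_sub hH hp hr)
  · refine hT.congr' ?_
    filter_upwards [self_mem_nhdsWithin] with ε hε
    have hε : 0 < ε := hε
    have hs := h.support_cutoff hr.bounded (Z := fun x => deriv (step ε) (g x) • m x) hε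
      fun x hx => by rw [deriv_step_eq_zero hε hx, zero_smul]
    have e := integral_apply_eq_neg_dvg (Ω := Ω) (k := fun x => u x - C * g x)
      (Λ := fun x => innerSL ℝ (q x) - C • Df g x)
      (hr.cont.sub (continuous_const.mul hgc')) ((hr.locallyIntegrable_q hH).sub
        ((h.cg.continuous_fderiv one_ne_zero).const_smul C).locallyIntegrable)
      (fun x hx => (hr.grad x hx).sub ((h.cg.differentiable one_ne_zero x).hasFDerivAt.const_mul C))
      ((hβ ε).smul h.cm) hs.1 hs.2
    rw [eq_neg_iff_add_eq_zero, add_comm, ← eq_neg_iff_add_eq_zero, ← integral_neg] at e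
    refine e.trans ?_
    refine integral_congr_ae (of_forall fun x => ?_)
    simp only [_root_.sub_apply, _root_.smul_apply, innerSL_apply_apply, h.fderiv_apply,
      Pi.smul_apply', inner_smul_right, smul_eq_mul, real_inner_comm (m x)]
    ring
  · filter_upwards [self_mem_nhdsWithin, mem_nhdsWithin_of_mem_nhds (gt_mem_nhds one_pos)]
      with ε hε hε1 x
    have hε : 0 < ε := hε
    rw [dvg_smul (hβ ε) h.cm, h.fderiv_comp (contDiff_deriv_step ε)]
    by_cases hx : g x ∈ Icc ε (2 * ε)
    · rw [indicator_of_mem (show x ∈ {x | 0 < g x ∧ g x ≤ 2 * ε} from ⟨hε.trans_le hx.1, hx.2⟩)]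
      have hxc : x ∈ closure Ω := by rw [h.closure_eq]; exact hε.le.trans hx.1
      have h1 := hA x hxc
      have h2 := hA' x hxc
      rw [Real.norm_eq_abs] at h1 h2
      calc _ ≤ |deriv (deriv (step ε)) (g x) * ⟪gradient g x, m x⟫| +
            |deriv (step ε) (g x) * dvg m x| := abs_add_le _ _
        _ ≤ L' / ε ^ 2 * |A| + L / ε * |A'| := by
          rw [abs_mul, abs_mul]
          exact add_le_add
            (mul_le_mul (hLb' ε hε _) (h1.trans (le_abs_self _)) (abs_nonneg _) (by positivity))
            (mul_le_mul (hLb ε hε _) (h2.trans (le_abs_self _)) (abs_nonneg _) (by positivity))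
        _ ≤ L' / ε ^ 2 * |A| + L / ε ^ 2 * |A'| := by
          gcongr
          nlinarith
        _ = _ := by ring
    · rw [(eventuallyEq_deriv_step hε hx).eq_of_nhds, (eventuallyEq_deriv_step hε hx).deriv_eq,
        deriv_const, zero_mul, zero_mul, add_zero, abs_zero]
      exact indicator_nonneg (fun _ _ => by positivity) _

end Collar

lemma IsCompact.exists_lt_add_mul {X : Type*} [TopologicalSpace X] {S : Set X}
    (hS : IsCompact S) {Φ D : X → ℝ} (hΦ : Continuous Φ) (hD : Continuous D)
    (h0 : ∀ z ∈ S, 0 ≤ D z) (h1 : ∀ z ∈ S, D z = 0 → Φ z = 0) {τ : ℝ} (hτ : 0 < τ) :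
    ∃ K ≥ 0, ∀ z ∈ S, |Φ z| < τ + K * D z := by
  have hS' : IsCompact (S ∩ {z | τ ≤ |Φ z|}) := hS.inter_right (isClosed_le continuous_const hΦ.abs)
  obtain ⟨δ, hδ, hδD⟩ := hS'.exists_forall_le' hD.continuousOn (a := 0) fun z hz =>
    (h0 z hz.1).lt_of_ne' fun h => by
      have := hz.2.out
      rw [h1 z hz.1 h, abs_zero] at this
      exact this.not_gt hτ
  obtain ⟨M, hM⟩ := hS.exists_bound_of_continuousOn hΦ.continuousOn
  refine ⟨|M| / δ, by positivity, fun z hz => ?_⟩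
  by_cases h : τ ≤ |Φ z|
  · have h2 : |M| / δ * δ ≤ |M| / δ * D z := by gcongr; exact hδD z ⟨hz, h⟩
    rw [div_mul_cancel₀ _ hδ.ne'] at h2
    have h3 := hM z hz
    rw [Real.norm_eq_abs] at h3
    linarith [le_abs_self M]
  · have : 0 ≤ |M| / δ * D z := mul_nonneg (by positivity) (h0 z hz)
    linarith

lemma dvg_id (x : E) : dvg id x = N := by
  simp [dvg]

namespace Collar

lemma integrable_cutoff_comp (hH : Ip) (h : Collar H p Ω g m) (hr : RS)
    {β : E → ℝ} (hε : 0 < ε) (hβ : Continuous β) (h0 : ∀ x, g x < ε → β x = 0)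
    {G : E × E → ℝ} (hG : Continuous G) :
    Integrable fun x => β x * G (x, q x) := by
  obtain ⟨R, _, hR⟩ := hr.exists_norm_le hH
  obtain ⟨B, hB⟩ := (hr.isCompact_closure.prod (isCompact_closedBall (0 : E) R))
    |>.exists_bound_of_continuousOn (f := fun z => β z.1 * G z) (by fun_prop)
  have h1 : ∀ x ∉ closure Ω, β x * G (x, q x) = 0 := fun x hx => by
    rw [h.closure_eq, mem_setOf_eq, not_le] at hx
    rw [h0 x (hx.trans hε), zero_mul]
  refine memLp_one_iff_integrable.1 (memLp_of_bound_of_eq_zero (B := |B|) hr.isCompact_closure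
    (hβ.measurable.mul (hG.measurable.comp (measurable_id.prodMk hr.meas))).aestronglyMeasurable
    (of_forall fun x => ?_) (of_forall h1) 1)
  by_cases hx : x ∈ closure Ω
  · exact (hB (x, q x) ⟨hx, mem_closedBall_zero_iff.2 (hR x)⟩).trans (le_abs_self B)
  · change ‖β x * G (x, q x)‖ ≤ _
    rw [h1 x hx, norm_zero]
    exact abs_nonneg B

lemma tendsto_integral_boundary (hH : Ip) (hp : 1 < p) (h : Collar H p Ω g m)
    (hr : RS) {Φ : E × E → ℝ} (hΦ : Continuous Φ)
    (h0 : ∀ x, g x = 0 → Φ (x, C • gradient g x) = 0) :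
    Tendsto (fun ε => ∫ x, deriv (step ε) (g x) * Φ (x, q x)) (𝓝[>] 0) (𝓝 0) := by
  have hgc := h.continuous_gradient
  have hmc := h.cm.continuous
  have hgc' := h.cg.continuous
  have hHc := hH.continuous
  obtain ⟨c, _, hc, _, hcK⟩ := hH.exists_bounds
  have hK : IsCompact {ξ : E | H ξ ≤ C} :=
    (isCompact_closedBall (0 : E) (C / c)).of_isClosed_subset
      (isClosed_le hHc continuous_const) fun ξ (hξ : H ξ ≤ C) => by
        rw [mem_closedBall_zero_iff, le_div_iff₀ hc]
        linarith [(hcK ξ).1]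
  have hF : IsCompact {x | g x = 0} := hr.isCompact_closure.of_isClosed_subset
    (isClosed_eq hgc' continuous_const) fun x (hx : g x = 0) => by rw [h.closure_eq]; exact hx.ge
  set D : E × E → ℝ := fun z => C * ⟪m z.1, gradient g z.1⟫ - ⟪m z.1, z.2⟫ with hDdef
  have hD : Continuous D := by fun_prop
  have hDb : ∀ z ∈ {x | g x = 0} ×ˢ {ξ : E | H ξ ≤ C},
      D z = C - ⟪∇V (gradient g z.1), z.2⟫ := fun z hz => by
    change C * ⟪m z.1, gradient g z.1⟫ - ⟪m z.1, z.2⟫ = _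
    rw [h.dual _ hz.1, hH.inner_stress_self hp, h.unit _ hz.1, Real.one_rpow, mul_one]
  obtain ⟨B, hB, hBε⟩ := h.exists_integral_deriv_step_le hH hp hr.bounded
  have hT := h.tendsto_integral_normal hH hp hr
  rw [Metric.tendsto_nhds]
  intro η hη
  obtain ⟨K, hK0, hKΦ⟩ := (hF.prod hK).exists_lt_add_mul hΦ hD
    (fun z hz => by
      have h1 := hH.inner_stress_le hp (gradient g z.1) z.2
      rw [h.unit _ hz.1, Real.one_rpow, one_mul] at h1
      rw [hDb z hz]
      linarith [hz.2.out])
    (fun z hz hz0 => by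
      have h2 := hH.eq_smul_of_inner_stress hp hr.C_pos (h.unit _ hz.1) hz.2
        (by rw [hDb z hz] at hz0; linarith)
      have h3 := h0 z.1 hz.1
      rwa [← h2] at h3) (show 0 < η / (4 * B) by positivity)
  obtain ⟨ε₀, hε₀, hpos⟩ := h.exists_pos_of_boundary hr.bounded hK
    (F := fun z => η / (4 * B) + K * D z - |Φ z|) (by fun_prop) fun y hy ξ hξ =>
      sub_pos.2 (hKΦ (y, ξ) ⟨hy, hξ⟩)
  have hT' := (hT.const_mul K).eventually (gt_mem_nhds (show K * 0 < η / 4 by simpa using by positivity))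
  filter_upwards [hT', hBε, self_mem_nhdsWithin,
    mem_nhdsWithin_of_mem_nhds (gt_mem_nhds (half_pos hε₀))] with ε h1 h2 hε hε2
  have hε : 0 < ε := hε
  have hβ : Continuous fun x => deriv (step ε) (g x) := (contDiff_deriv_step ε).continuous.comp hgc'
  have i0 : Integrable fun x => deriv (step ε) (g x) :=
    h.integrable_cutoff hr.bounded hε hβ fun x hx => deriv_step_eq_zero hε hx
  have i1 : Integrable fun x => deriv (step ε) (g x) * D (x, q x) :=
    h.integrable_cutoff_comp hH hr hε hβ (fun x hx => deriv_step_eq_zero hε hx) hD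
  have i2 : Integrable fun x => η / (4 * B) * deriv (step ε) (g x) +
      K * (deriv (step ε) (g x) * D (x, q x)) := (i0.const_mul _).add (i1.const_mul _)
  have h3 : |∫ x, deriv (step ε) (g x) * Φ (x, q x)| ≤ ∫ x, (η / (4 * B) * deriv (step ε) (g x) +
      K * (deriv (step ε) (g x) * D (x, q x))) := by
    refine (abs_integral_le_integral_abs).trans ?_
    refine integral_mono_of_nonneg (of_forall fun _ => abs_nonneg _) i2
      (of_forall fun x => ?_)
    simp only
    rw [abs_mul, abs_of_nonneg (deriv_step_nonneg hε _)]
    by_cases hx : g x ∈ Icc ε (2 * ε)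
    · have h4 := hpos x (hε.le.trans hx.1) (by linarith [hx.2]) (q x) (hr.le x)
      nlinarith [deriv_step_nonneg hε (g x)]
    · rw [(eventuallyEq_deriv_step hε hx).eq_of_nhds]; simp
  have h4 := integral_add (i0.const_mul (η / (4 * B))) (i1.const_mul K)
  rw [integral_const_mul, integral_const_mul] at h4
  rw [dist_zero_right, Real.norm_eq_abs]
  have h5 : η / (4 * B) * ∫ x, deriv (step ε) (g x) ≤ η / 4 := by
    calc _ ≤ η / (4 * B) * B := by gcongr
      _ = η / 4 := by field_simp
  linarith

/-- The Pohozaev identity for a solution with constant anisotropic normal derivative. -/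
lemma integral_pohozaev_eq_zero (hH : Ip) (hp : 1 < p) (h : Collar H p Ω g m)
    (hr : RS) :
    ∫ x in Ω, ((p - N) * V (q x) + N * u x - N * ((p - 1) / p * C ^ p)) = 0 := by
  have hgc := h.continuous_gradient
  have hgc' := h.cg.continuous
  have hVc := hH.V_continuous hp
  have hTc := hH.continuous_stress hp
  have huc := hr.cont
  set κ := (p - 1) / p * C ^ p with hκ
  have hC := hr.C_pos
  have hlim := h.tendsto_integral_boundary hH hp hr (Φ := fun z =>
      (V z.2 - u z.1 + κ) * ⟪gradient g z.1, z.1⟫ -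
        ⟪gradient g z.1, ∇V z.2⟫ * ⟪z.2, z.1⟫) (by fun_prop) fun x hx => by
    have hux : u x = 0 := hr.zero x fun h' => by rw [h.mem_iff, hx] at h'; exact lt_irrefl _ h'
    simp only
    rw [hH.V_smul hC.le, hH.stress_smul hp hC, inner_smul_right,
      real_inner_comm (∇V _) (gradient g x), hH.inner_stress_self hp, Vfun, h.unit x hx, hux, real_inner_smul_left, Real.one_rpow,
      Real.rpow_sub_one hC.ne', hκ]
    field_simp
    ring
  have hI : IntegrableOn (fun x => (p - N) * V (q x) + N * u x - N * κ) Ω := by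
    have hfin : volume Ω ≠ ⊤ := hr.bounded.measure_lt_top.ne
    exact ((((hr.integrable_V hH hp).const_mul _).add (hr.integrable_u.const_mul _)).integrableOn).sub
      (integrableOn_const hfin)
  have hlim' : Tendsto (fun ε => ∫ x in Ω, step ε (g x) * ((p - N) * V (q x) + N * u x - N * κ))
      (𝓝[>] 0) (𝓝 (∫ x in Ω, ((p - N) * V (q x) + N * u x - N * κ))) := by
    refine tendsto_integral_filter_of_dominated_convergence _ (of_forall fun ε =>
      ((continuous_step ε).comp hgc').aestronglyMeasurable.mul hI.aestronglyMeasurable)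
      (of_forall fun ε => of_forall fun x => ?_) hI.norm ?_
    · rw [norm_mul, Real.norm_eq_abs (step _ _), abs_of_nonneg (step_nonneg _ _)]
      exact mul_le_of_le_one_left (norm_nonneg _) (step_le_one _ _)
    · filter_upwards [ae_restrict_mem hr.isOpen.measurableSet] with x hx
      have hgx := (h.mem_iff x).1 hx
      refine tendsto_const_nhds.congr' ?_
      filter_upwards [self_mem_nhdsWithin, mem_nhdsWithin_of_mem_nhds (gt_mem_nhds (half_pos hgx))]
        with ε hε hε2
      rw [step_of_ge hε (by linarith), one_mul]
  refine tendsto_nhds_unique hlim' (hlim.congr' ?_)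
  filter_upwards [self_mem_nhdsWithin] with ε hε
  have hε : 0 < ε := hε
  have hχ : ContDiff ℝ 1 fun x => step ε (g x) := (contDiff_step ε (n := 1)).comp h.cg
  have hs := h.support_cutoff hr.bounded (Z := fun x => step ε (g x)) hε fun x hx =>
    step_of_le hε hx.le
  have e1 := hr.integral_pohozaev hH hp hχ hs.1 hs.2 fun x => step_nonneg _ _
  have e2 := h.integral_deriv_step_inner hr.bounded (contDiff_id (𝕜 := ℝ)) hε
  simp only [dvg_id, id_eq, h.fderiv_comp (contDiff_step ε (n := 1))] at e1 e2
  rw [setIntegral_eq_integral_of_forall_compl_eq_zero fun x hx => by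
    rw [step_of_le hε (not_lt.1 fun h' => hx ((h.mem_iff x).2 (hε.trans h'))), zero_mul]]
  have hβ : Continuous fun x => deriv (step ε) (g x) := (contDiff_deriv_step ε).continuous.comp hgc'
  have h0 : ∀ x, g x < ε → step ε (g x) = 0 := fun x hx => step_of_le hε hx.le
  have i1 := h.integrable_cutoff_comp hH hr hε hχ.continuous h0
    (G := fun z => (p - N) * V z.2 + N * u z.1) (by fun_prop)
  have i2 := h.integrable_cutoff hr.bounded hε (f := fun x => step ε (g x) * N)
    (hχ.continuous.mul continuous_const) fun x hx => by rw [h0 x hx, zero_mul]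
  have i3 := h.integrable_cutoff_comp hH hr hε hβ (fun x hx => deriv_step_eq_zero hε hx)
    (G := fun z => (V z.2 - u z.1) * ⟪gradient g z.1, z.1⟫ -
        ⟪gradient g z.1, ∇V z.2⟫ * ⟪z.2, z.1⟫) (by fun_prop)
  have i4 := h.integrable_cutoff hr.bounded hε (f := fun x => deriv (step ε) (g x) *
    ⟪gradient g x, x⟫) (hβ.mul (by fun_prop)) fun x hx => by
      rw [deriv_step_eq_zero hε hx, zero_mul]
  calc _ = (∫ x, deriv (step ε) (g x) * ((V (q x) - u x) * ⟪gradient g x, x⟫ -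
        ⟪gradient g x, ∇V (q x)⟫ * ⟪q x, x⟫)) +
        κ * ∫ x, deriv (step ε) (g x) * ⟪gradient g x, x⟫ := by
        rw [← integral_const_mul, ← integral_add i3 (i4.const_mul κ)]
        exact integral_congr_ae (of_forall fun x => by simp only; ring)
    _ = (∫ x, step ε (g x) * ((p - N) * V (q x) + N * u x)) -
        κ * ∫ x, step ε (g x) * N := by
        rw [e1, e2, mul_neg, ← sub_eq_add_neg]
        congr 1
        exact integral_congr_ae (of_forall fun x => by simp only; ring)
    _ = _ := by
        rw [← integral_const_mul, ← integral_sub i1 (i2.const_mul κ)]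
        exact integral_congr_ae (of_forall fun x => by simp only; ring)

end Collar

namespace RSol

lemma integral_step_mul_V (hH : Ip) (hp : 1 < p) (h : RS) (ht : 0 < t)
    : p * ∫ x, step t (u x) * V (q x) = ∫ x, ramp t (u x) := by
  have hlc := h.isCompact_level ht
  have hd := fun x => h.hasFDerivAt_comp (contDiff_ramp t) ht (fun s hs => ramp_of_le ht hs) x
  have hz : ∀ x, x ∉ {x | t ≤ u x} → ramp t (u x) = 0 := fun x hx => ramp_of_le ht (not_le.1 hx).le
  obtain ⟨R, _, hR⟩ := h.exists_norm_le hH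
  have e := h.weak.of_differentiable (r := 2) (s := 2) h.isOpen ENNReal.ofNat_ne_top
    (h.memLp_comp hH (hH.continuous_stress hp) (hH.stress_zero hp) 2) hlc (h.level_subset ht)
    (fun x => (hd x).differentiableAt) hz
    (memLp_of_bound_of_eq_zero hlc (measurable_fderiv ℝ _).aestronglyMeasurable (B := R)
      (of_forall fun x => by
        rw [(hd x).fderiv, norm_smul, innerSL_apply_norm, deriv_ramp,
          Real.norm_of_nonneg (step_nonneg _ _)]
        exact (mul_le_of_le_one_left (norm_nonneg _) (step_le_one _ _)).trans (hR x))
      (of_forall fun x hx => fderiv_eq_zero_of_notMem hlc.isClosed hz hx) 2)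
  rw [one_mul] at e
  refine Eq.trans ?_ e
  rw [← integral_const_mul]
  refine integral_congr_ae (of_forall fun x => ?_)
  simp only [(hd x).fderiv, deriv_ramp, _root_.smul_apply, innerSL_apply_apply, smul_eq_mul]
  rw [real_inner_comm, hH.inner_stress_self hp, Vfun]
  field_simp

lemma mul_integral_V (hH : Ip) (hp : 1 < p) (h : RS) :
    p * ∫ x, V (q x) = ∫ x, u x := by
  have hu := h.toSol.nonneg hH hp
  have h1 : Tendsto (fun t => p * ∫ x, step t (u x) * V (q x)) (𝓝[>] 0)
      (𝓝 (p * ∫ x, V (q x))) := by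
    refine Tendsto.const_mul p ?_
    refine tendsto_integral_filter_of_dominated_convergence _ (of_forall fun t =>
      ((continuous_step t).comp h.cont).aestronglyMeasurable.mul
        (h.integrable_V hH hp).aestronglyMeasurable) (of_forall fun t =>
        of_forall fun x => ?_) (h.integrable_V hH hp).norm
        (of_forall fun x => ?_)
    · rw [norm_mul, Real.norm_of_nonneg (step_nonneg _ _)]
      exact mul_le_of_le_one_left (norm_nonneg _) (step_le_one _ _)
    · by_cases hx : x ∈ Ω
      · refine tendsto_const_nhds.congr' ?_
        filter_upwards [self_mem_nhdsWithin, mem_nhdsWithin_of_mem_nhds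
          (gt_mem_nhds (half_pos (h.pos x hx)))] with t ht ht2
        rw [step_of_ge ht (by linarith), one_mul]
      · simp [h.q_zero x hx, hH.V_zero hp]
  have h2 : Tendsto (fun t => ∫ x, ramp t (u x)) (𝓝[>] 0) (𝓝 (∫ x, u x)) := by
    refine tendsto_integral_filter_of_dominated_convergence u (of_forall fun t =>
      ((contDiff_ramp t).continuous.comp h.cont).aestronglyMeasurable) ?_ h.integrable_u
      (of_forall fun x => ?_)
    · filter_upwards [self_mem_nhdsWithin] with t ht
      refine of_forall fun x => ?_
      rw [Real.norm_of_nonneg (ramp_nonneg ht _)]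
      exact ramp_le (hu x)
    · refine tendsto_of_tendsto_of_tendsto_of_le_of_le' (g := fun s => u x - 2 * s) ?_
        tendsto_const_nhds ?_ (of_forall fun s => ramp_le (hu x))
      · refine Tendsto.mono_left ?_ nhdsWithin_le_nhds
        exact (Continuous.tendsto' (by fun_prop) _ _ (by simp))
      · filter_upwards [self_mem_nhdsWithin] with s hs using sub_le_ramp hs _
  refine tendsto_nhds_unique h1 (h2.congr' ?_)
  filter_upwards [self_mem_nhdsWithin] with t ht
  exact (h.integral_step_mul_V hH hp ht).symm

lemma defect_eq_zero (hH : Ip) (hp : 1 < p) (hN : 0 < N) (h : RS)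
    (hΩ : IsC2alphaDomain Ω) : defect H p Ω u q C = 0 := by
  obtain ⟨g, m, hc⟩ := hΩ.exists_collar hH hp h.bounded
  have e1 := hc.integral_pohozaev_eq_zero hH hp h
  have e2 := h.mul_integral_V hH hp
  have iV := h.integrable_V hH hp
  have eV : ∫ x in Ω, V (q x) = ∫ x, V (q x) :=
    setIntegral_eq_integral_of_forall_compl_eq_zero fun x hx => by rw [h.q_zero x hx, hH.V_zero hp]
  have eu : ∫ x in Ω, u x = ∫ x, u x :=
    setIntegral_eq_integral_of_forall_compl_eq_zero h.zero
  have ic (c : ℝ) : IntegrableOn (fun _ => c) Ω := integrableOn_const h.bounded.measure_lt_top.ne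
  have e3 := integral_sub (((iV.const_mul (p - N)).add (h.integrable_u.const_mul (N : ℝ))).integrableOn
    (s := Ω)) (ic (N * ((p - 1) / p * C ^ p)))
  have e4 := integral_add ((iV.const_mul (p - N)).integrableOn (s := Ω))
    ((h.integrable_u.const_mul (N : ℝ)).integrableOn (s := Ω))
  have e5 := integral_sub (ic (C ^ p / p)) (iV.integrableOn (s := Ω))
  simp only [Pi.add_apply] at e3 e4
  rw [e1, e4, integral_const_mul, integral_const_mul, eV, eu, setIntegral_const, smul_eq_mul,
    ← e2] at e3
  rw [h.defect_eq hH hp hN, e5, eV, ← e2, setIntegral_const, smul_eq_mul]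
  have hN' : (0 : ℝ) < N := by exact_mod_cast hN
  have hp0 : 0 < p := by linarith
  field_simp at e3 ⊢
  linarith

end RSol

section

open scoped Convolution

section

lemma fderiv_mollify_eq_zero {f : E → ℝ} (hf : LocallyIntegrable f)
    (h : ∀ φ : E → ℝ, ContDiff ℝ 1 φ → HasCompactSupport φ → tsupport φ ⊆ Ω → (∀ x, 0 ≤ φ x) →
      ∀ j, ∫ x, Df φ x (𝐞 j) * f x = 0) {n : ℕ} {y : E}
    (hy : Metric.closedBall y (bumpSeq N n).rOut ⊆ Ω) : Df (mollify n f) y = 0 := by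
  set ρ := (bumpSeq N n).normed volume with hρ
  have hρ1 : ContDiff ℝ 1 ρ := (bumpSeq N n).contDiff_normed
  have hρc : HasCompactSupport ρ := (bumpSeq N n).hasCompactSupport_normed
  have hd := hρc.hasFDerivAt_convolution_left (ContinuousLinearMap.lsmul ℝ ℝ) hρ1 hf y
  have hd' : Df (mollify n f) y = _ := hd.fderiv
  rw [hd']
  set ψ : E → ℝ := fun x => ρ (y - x) with hψ
  have hψ1 : ContDiff ℝ 1 ψ := hρ1.comp (contDiff_const.sub contDiff_id)
  have hts : tsupport ψ ⊆ Metric.closedBall y (bumpSeq N n).rOut := by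
    refine closure_minimal (fun x hx => ?_) Metric.isClosed_closedBall
    have h1 : y - x ∈ Function.support ρ := hx
    rw [hρ, (bumpSeq N n).support_normed_eq] at h1
    rw [mem_ball_zero_iff] at h1
    rw [Metric.mem_closedBall, dist_comm, dist_eq_norm]
    exact h1.le
  have hψc : HasCompactSupport ψ :=
    (isCompact_closedBall _ _).of_isClosed_subset (isClosed_tsupport _) hts
  have hdψ : ∀ x v, Df ψ x v = - Df ρ (y - x) v := fun x v => by
    have h1 : HasFDerivAt ψ _ x := ((hρ1.differentiable one_ne_zero) (y - x)).hasFDerivAt.comp x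
      ((hasFDerivAt_id x).const_sub y)
    rw [h1.fderiv]
    simp
  have hce : ConvolutionExistsAt (Df ρ) f y
      ((ContinuousLinearMap.lsmul ℝ ℝ).precompL (E)) volume :=
    (hρc.fderiv ℝ).convolutionExists_left _ (hρ1.continuous_fderiv one_ne_zero) hf y
  refine ContinuousLinearMap.coe_injective
    ((EuclideanSpace.basisFun (Fin N) ℝ).toBasis.ext fun j => ?_)
  simp only [OrthonormalBasis.coe_toBasis, EuclideanSpace.basisFun_apply,
    ContinuousLinearMap.coe_coe, _root_.zero_apply]
  rw [convolution, ContinuousLinearMap.integral_apply hce]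
  have h2 := h ψ hψ1 hψc (hts.trans hy) (fun x => (bumpSeq N n).nonneg_normed _) j
  rw [← integral_sub_left_eq_self _ volume y, ← neg_eq_zero, ← integral_neg, ← h2]
  refine integral_congr_ae (of_forall fun x => ?_)
  simp only [hdψ, sub_sub_cancel]
  simp [ContinuousLinearMap.precompL_apply]

lemma ae_const_of_integral_fderiv_mul_eq_zero (hΩ : IsOpen Ω) (hΩc : IsPreconnected Ω)
    {f : E → ℝ} (hf : LocallyIntegrable f)
    (h : ∀ φ : E → ℝ, ContDiff ℝ 1 φ → HasCompactSupport φ → tsupport φ ⊆ Ω → (∀ x, 0 ≤ φ x) →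
      ∀ j, ∫ x, Df φ x (𝐞 j) * f x = 0) :
    ∃ c, ∀ᵐ x, x ∈ Ω → f x = c := by
  rcases Ω.eq_empty_or_nonempty with rfl | ⟨x₀, hx₀⟩
  · exact ⟨0, by simp⟩
  have hS := ae_tendsto_mollify hf
  set S : Set E := {x | Tendsto (fun n => mollify n f x) atTop (𝓝 (f x))}
  have hloc : ∀ x ∈ Ω, ∃ c, ∀ᶠ z in 𝓝 x, z ∈ S → f z = c := by
    intro x hx
    obtain ⟨ε, hε, hb⟩ := Metric.isOpen_iff.1 hΩ x hx
    have hn : ∀ᶠ n in atTop, (bumpSeq N n).rOut < ε / 2 :=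
      tendsto_bumpSeq_rOut.eventually (gt_mem_nhds (by positivity))
    have key : ∀ z ∈ Metric.ball x (ε / 2), ∀ w ∈ Metric.ball x (ε / 2), z ∈ S → w ∈ S →
        f z = f w := by
      intro z hz w hw hzS hwS
      refine tendsto_nhds_unique (Tendsto.congr' ?_ hzS) hwS
      filter_upwards [hn] with n hn
      refine Metric.isOpen_ball.is_const_of_fderiv_eq_zero (𝕜 := ℝ)
        (convex_ball x (ε / 2)).isPreconnected
        ((contDiff_mollify n hf (k := 1)).differentiable one_ne_zero).differentiableOn
        (fun v hv => fderiv_mollify_eq_zero hf h ?_) hz hw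
      refine (Metric.closedBall_subset_ball' ?_).trans hb
      rw [Metric.mem_ball] at hv
      linarith
    have hd : Dense S := Measure.dense_of_ae hS
    obtain ⟨w, hw, hwS⟩ := hd.exists_mem_open Metric.isOpen_ball
      ⟨x, Metric.mem_ball_self (half_pos hε)⟩
    exact ⟨f w, by
      filter_upwards [Metric.ball_mem_nhds x (half_pos hε)] with z hz hzS
      exact key z hz w hwS hzS hw⟩
  have huniq : ∀ x c d, (∀ᶠ z in 𝓝 x, z ∈ S → f z = c) → (∀ᶠ z in 𝓝 x, z ∈ S → f z = d) →
      c = d := by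
    intro x c d hc hd
    obtain ⟨w, hw⟩ := (mem_closure_iff_frequently.1
      ((Measure.dense_of_ae hS).closure_eq ▸ mem_univ x)).and_eventually (hc.and hd) |>.exists
    rw [← hw.2.1 hw.1, hw.2.2 hw.1]
  have hP := fun y (hy : y ∈ Ω) => hΩc.induction₂ (fun x y => ∃ c, (∀ᶠ z in 𝓝 x, z ∈ S → f z = c) ∧
      ∀ᶠ z in 𝓝 y, z ∈ S → f z = c)
    (fun x hx => by
      obtain ⟨c, hc⟩ := hloc x hx
      filter_upwards [nhdsWithin_le_nhds hc.eventually_nhds] with y hy using ⟨c, hc, hy⟩)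
    (fun x y z _ _ _ ⟨c, h1, h2⟩ ⟨d, h3, h4⟩ => ⟨c, h1, by rwa [huniq y c d h2 h3]⟩)
    (fun x y _ _ ⟨c, h1, h2⟩ => ⟨c, h2, h1⟩) hx₀ hy
  obtain ⟨c, hc⟩ := hloc x₀ hx₀
  refine ⟨c, hS.mono fun y hy hyΩ => ?_⟩
  obtain ⟨d, h1, h2⟩ := hP y hyΩ
  rw [huniq x₀ c d hc h1]
  exact h2.self_of_nhds hy

end

end

section

open scoped Convolution

lemma dvg_smul_single (hφ : ContDiff ℝ 1 φ) (j : Fin N) (x : E) :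
    dvg (fun x => φ x • (𝐞 j : E)) x =
      Df φ x (𝐞 j) := by
  rw [dvg_smul hφ contDiff_const]
  simp [dvg]

lemma integral_mul_apply_single {k : E → ℝ} {Λ : E → E →L[ℝ] ℝ} (hk : Continuous k)
    (hΛ : LocallyIntegrable Λ) (hd : ∀ x ∈ Ω, HasFDerivAt k (Λ x) x) (hφ : ContDiff ℝ 1 φ)
    (hφc : HasCompactSupport φ) (hφΩ : tsupport φ ⊆ Ω) (j : Fin N)
    : ∫ x, φ x * Λ x (𝐞 j) =
      - ∫ x, Df φ x (𝐞 j) * k x := by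
  have h := integral_apply_eq_neg_dvg (Z := fun x => φ x • (𝐞 j : E))
    hk hΛ hd (hφ.smul contDiff_const) hφc.smul_right
    ((tsupport_smul_subset_left _ _).trans hφΩ)
  simp only [map_smul, smul_eq_mul, dvg_smul_single hφ] at h
  simp only [h, mul_comm]

lemma add_eq_const_of_subgradient {W : E → ℝ} (hΩ : IsOpen Ω) (hΩc : IsPreconnected Ω)
    (hu : Continuous u) (hW : Continuous W) (hq : Integrable q)
    (hd : ∀ x ∈ Ω, HasFDerivAt u (innerSL ℝ (q x)) x)
    (h : ∀ᵐ x, x ∈ Ω → ∀ y, W x - ⟪q x, y - x⟫ ≤ W y) : ∃ c, ∀ x ∈ Ω, W x + u x = c := by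
  have hWu : Continuous fun x => W x + u x := hW.add hu
  obtain ⟨c, hc⟩ := ae_const_of_integral_fderiv_mul_eq_zero hΩ hΩc hWu.locallyIntegrable
    fun φ hφ hφc hφΩ hφ0 j => by
    set ψ : E → ℝ := fun x => φ (-x) with hψ
    have hψ1 : ContDiff ℝ 1 ψ := hφ.comp contDiff_neg
    have hψc : HasCompactSupport ψ := hφc.comp_homeomorph (Homeomorph.neg (E))
    have hdψ : ∀ x v, Df ψ (-x) v = - Df φ x v := fun x v => by
      have h1 : HasFDerivAt ψ _ (-x) :=
        ((hφ.differentiable one_ne_zero) (- -x)).hasFDerivAt.comp (-x) (hasFDerivAt_id (-x)).neg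
      rw [h1.fderiv]
      simp
    have iq : Integrable fun x => φ x • q x := by
      obtain ⟨B, hB⟩ := hφc.exists_bound_of_continuous hφ.continuous
      exact hq.bdd_smul B hφ.continuous.aestronglyMeasurable (of_forall hB)
    set m := ∫ x, φ x • q x
    let g : E → ℝ := W ⋆[ContinuousLinearMap.mul ℝ ℝ, volume] ψ 
    have hgd := hψc.hasFDerivAt_convolution_right (ContinuousLinearMap.mul ℝ ℝ)
      (hW.locallyIntegrable (μ := volume)) hψ1 0
    have hm : ∀ z, ⟪m, z⟫ = ∫ x, φ x * ⟪q x, z⟫ := fun z => by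
      rw [real_inner_comm, ← integral_inner iq]
      simp only [real_inner_smul_right, real_inner_comm]
    have iW : ∀ z : E, Integrable fun x => φ x * W (x + z) := fun z =>
      (hφ.continuous.mul (hW.comp (by fun_prop))).integrable_of_hasCompactSupport hφc.mul_right
    have hgz : ∀ z, g z = ∫ x, φ x * W (x + z) := fun z => by
      change convolution W ψ (ContinuousLinearMap.mul ℝ ℝ) volume z = _
      rw [convolution, ← integral_add_right_eq_self _ z]
      refine integral_congr_ae (of_forall fun x => ?_)
      simp [hψ, mul_comm]
    have hmin : ∀ z, g 0 ≤ g z + ⟪m, z⟫ := fun z => by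
      have i1 : Integrable fun x => φ x * ⟪q x, z⟫ := by
        simpa [real_inner_smul_left] using iq.inner_const (𝕜 := ℝ) z
      rw [hgz, hgz, hm, ← integral_add (iW z) i1]
      refine integral_mono_ae (iW 0) ((iW z).add i1) ?_
      filter_upwards [h] with x hx
      by_cases hxΩ : x ∈ Ω
      · have := mul_le_mul_of_nonneg_left (hx hxΩ (x + z)) (hφ0 x)
        simp only [add_sub_cancel_left, add_zero] at this ⊢
        linarith
      · have : φ x = 0 := image_eq_zero_of_notMem_tsupport fun h' => hxΩ (hφΩ h')
        simp [this]
    have hG := hgd.add (innerSL ℝ m).hasFDerivAt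
    have h0 := IsLocalMin.hasFDerivAt_eq_zero (of_forall fun z => by
      simpa using hmin z) hG
    have hce : ConvolutionExistsAt W (Df ψ) 0
        ((ContinuousLinearMap.mul ℝ ℝ).precompR (E)) volume :=
      (hψc.fderiv ℝ).convolutionExists_right _ hW.locallyIntegrable
        (hψ1.continuous_fderiv one_ne_zero) 0
    have h1 := DFunLike.congr_fun h0 (𝐞 j)
    rw [_root_.add_apply, convolution, ContinuousLinearMap.integral_apply hce, innerSL_apply_apply,
      hm] at h1
    have h2 := integral_mul_apply_single hu
      ((innerSL ℝ).integrable_comp hq).locallyIntegrable hd hφ hφc hφΩ j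
    simp only [innerSL_apply_apply] at h2
    have hc1 := hφ.continuous_fderiv one_ne_zero
    have i3 : ∀ k : E → ℝ, Continuous k → Integrable fun x =>
        Df φ x (𝐞 j) * k x := fun k hk =>
      ((hc1.clm_apply continuous_const).mul hk).integrable_of_hasCompactSupport
        (hφc.fderiv_apply ℝ _).mul_right
    simp only [mul_add]
    rw [integral_add (i3 W hW) (i3 u hu)]
    rw [h2] at h1
    have h3 : ∀ x, (ContinuousLinearMap.mul ℝ ℝ).precompR (E) (W x) (Df ψ (0 - x))
        (𝐞 j) = - (Df φ x (𝐞 j) * W x) :=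
      fun x => by
        rw [zero_sub]
        change W x * Df ψ (-x) (𝐞 j) = _
        rw [hdψ]
        ring
    simp only [h3, integral_neg, _root_.zero_apply] at h1
    linarith
  exact ⟨c, Measure.eqOn_open_of_ae_eq ((ae_restrict_iff' hΩ.measurableSet).2 hc) hΩ
    hWu.continuousOn continuousOn_const⟩

/-- The potential `x ↦ a H₀(x - x₀) ^ (p / (p - 1))` with gradient map inverse to
`ξ ↦ x₀ + N • stress ξ`. -/
def wulffPot (H : E → ℝ) (p : ℝ) (x₀ x : E) : ℝ :=
  (p - 1) * dualNorm H (x - x₀) ^ (p / (p - 1)) / (p * (N : ℝ) ^ (1 / (p - 1)))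

lemma continuous_wulffPot (hH : Ip) (hp : 1 < p) (x₀ : E)
    : Continuous (wulffPot H p x₀) := by
  have : 0 < p - 1 := by linarith
  unfold wulffPot
  refine (continuous_const.mul (Continuous.rpow_const ?_ fun x => Or.inr (by positivity))).div_const _
  exact hH.continuous_dualNorm.comp (continuous_sub_right x₀)

lemma wulffPot_subgradient (hH : Ip) (hp : 1 < p) (hN : 0 < N) {x₀ : E}
    (hx : ∇V ξ = -(1 / N : ℝ) • (x - x₀)) (y : E) :
    wulffPot H p x₀ x - ⟪ξ, y - x⟫ ≤ wulffPot H p x₀ y := by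
  have hn : (0:ℝ) < N := by exact_mod_cast hN
  have hp1 : 0 < p - 1 := by linarith
  have hp0 : 0 < p := by linarith
  have hx' : x - x₀ = -((N:ℝ) • ∇V ξ) := by
    rw [hx, smul_smul]
    simp [hn.ne']
  set h := H ξ
  have hh : 0 ≤ h := hH.nonneg ξ
  have hNp : (0:ℝ) < (N:ℝ) ^ (1 / (p - 1)) := by positivity
  have e1 : wulffPot H p x₀ x ≤ (p - 1) / p * N * h ^ p := by
    have h1 : dualNorm H (x - x₀) ≤ N * h ^ (p - 1) := by
      rw [hx', hH.dualNorm_neg, hH.dualNorm_smul hn.le]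
      exact mul_le_mul_of_nonneg_left (hH.dualNorm_stress_le hp ξ) hn.le
    have h2 := Real.rpow_le_rpow (hH.dualNorm_nonneg _) h1 (show 0 ≤ p / (p - 1) by positivity)
    rw [Real.mul_rpow hn.le (by positivity), ← Real.rpow_mul hh, mul_div_cancel₀ _ hp1.ne'] at h2
    have h3 : (N:ℝ) ^ (p / (p - 1)) = N * (N:ℝ) ^ (1 / (p - 1)) := by
      rw [← Real.rpow_one_add' hn.le (by positivity)]
      congr 1
      field_simp
      ring
    rw [h3] at h2
    rw [wulffPot, div_le_iff₀ (by positivity)]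
    calc _ ≤ (p - 1) * (N * (N:ℝ) ^ (1 / (p - 1)) * h ^ p) := by gcongr
      _ = _ := by field_simp
  have e2 : ⟪ξ, x - x₀⟫ = - (N * h ^ p) := by
    rw [hx', inner_neg_right, real_inner_smul_right, real_inner_comm, hH.inner_stress_self hp]
  have e3 : -⟪ξ, y - x₀⟫ ≤ dualNorm H (y - x₀) * h := by
    have := hH.inner_le_dualNorm (y - x₀) (-ξ)
    rwa [inner_neg_right, hH.map_neg, real_inner_comm] at this
  have e4 : dualNorm H (y - x₀) * h ≤ N * h ^ p / p + wulffPot H p x₀ y := by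
    set d := dualNorm H (y - x₀) with hd'
    have hd : 0 ≤ d := hH.dualNorm_nonneg _
    have hr : (0:ℝ) < (N:ℝ) ^ (1 / p) := by positivity
    have hy := Real.young_inequality_of_nonneg (a := (N:ℝ) ^ (1 / p) * h)
      (b := d / (N:ℝ) ^ (1 / p)) (by positivity) (by positivity)
      (Real.HolderConjugate.conjExponent hp)
    rw [Real.mul_rpow hr.le hh, Real.div_rpow hd hr.le, ← Real.rpow_mul hn.le,
      one_div_mul_cancel hp0.ne', Real.rpow_one, ← Real.rpow_mul hn.le, Real.conjExponent] at hy
    have h5 : 1 / p * (p / (p - 1)) = 1 / (p - 1) := by field_simp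
    rw [h5] at hy
    calc d * h = (N:ℝ) ^ (1 / p) * h * (d / (N:ℝ) ^ (1 / p)) := by field_simp
      _ ≤ _ := hy
      _ = _ := by rw [wulffPot, ← hd']; field_simp
  have e5 : ⟪ξ, y - x⟫ = ⟪ξ, y - x₀⟫ - ⟪ξ, x - x₀⟫ := by rw [← inner_sub_right]; congr 1; abel
  rw [e5, e2]
  have e6 : (p - 1) / p * N * h ^ p = N * h ^ p - N * h ^ p / p := by field_simp
  linarith

end

namespace RSol

lemma exists_stress_eq (hH : Ip) (hp : 1 < p) (hN : 0 < N) (h : RS)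
    (hΩc : IsPreconnected Ω) (hD : defect H p Ω u q C ≤ 0) :
    ∃ x₀, ∀ᵐ x, x ∈ Ω → ∇V (q x) = -(1 / N : ℝ) • (x - x₀) := by
  have hn : (N:ℝ) ≠ 0 := by exact_mod_cast hN.ne'
  have hY := h.memLp_comp hH (hH.continuous_stress hp) (hH.stress_zero hp) 1
  have hYi : ∀ i, LocallyIntegrable fun x => ∇V (q x) i := fun i =>
    ((proj i : E →L[ℝ] ℝ).integrable_comp
      (memLp_one_iff_integrable.1 hY)).locallyIntegrable
  have hcoord : ∀ i : Fin N, Continuous fun x : E => x i := fun i => by fun_prop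
  have key : ∀ i : Fin N, ∃ c, ∀ᵐ x, x ∈ Ω → ∇V (q x) i + 1 / N * x i = c := fun i => by
    refine ae_const_of_integral_fderiv_mul_eq_zero h.isOpen hΩc
      ((hYi i).add ((hcoord i).const_mul (1 / N : ℝ)).locallyIntegrable)
      fun φ hφ hφc hφΩ _ j => ?_
    have h1 := h.integral_fderiv_mul_stress hH hp hN hD hφ hφc hφΩ i j
    have h2 := integral_mul_apply_single (Ω := Ω)
      (Λ := fun _ => (proj i : E →L[ℝ] ℝ)) (hcoord i)
      continuous_const.locallyIntegrable
      (fun x _ => (proj i : E →L[ℝ] ℝ).hasFDerivAt)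
      hφ hφc hφΩ j
    have hc1 : Continuous fun x => Df φ x (𝐞 j) :=
      (hφ.continuous_fderiv one_ne_zero).clm_apply continuous_const
    have hcs : HasCompactSupport fun x => Df φ x (𝐞 j) :=
      hφc.fderiv_apply ℝ _
    have i1 : Integrable fun x => Df φ x (𝐞 j) * ∇V (q x) i :=
      (hYi i).integrable_smul_left_of_hasCompactSupport hc1 hcs
    have i2 : Integrable fun x => Df φ x (𝐞 j) * x i :=
      (hc1.mul (hcoord i)).integrable_of_hasCompactSupport hcs.mul_right
    have e : ∀ x, Df φ x (𝐞 j) *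
        (∇V (q x) i + 1 / N * x i) =
        Df φ x (𝐞 j) * ∇V (q x) i +
        1 / N * (Df φ x (𝐞 j) * x i) := fun x => by ring
    simp only [e]
    rw [integral_add i1 (i2.const_mul _), integral_const_mul, h1]
    rw [← neg_eq_iff_eq_neg.2 h2, integral_mul_const]
    by_cases hij : i = j <;> simp [hij, mul_comm]
  choose c hc using key
  refine ⟨WithLp.toLp 2 fun i => N * c i, ?_⟩
  filter_upwards [eventually_all.2 hc] with x hx hxΩ
  ext i
  have := hx i hxΩ
  simp only [PiLp.smul_apply, PiLp.sub_apply, smul_eq_mul]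
  rw [← this]
  field_simp
  ring

lemma eq_wulff (hH : Ip) (hp : 1 < p) (hN : 0 < N) (h : RS)
    (hΩ : IsConnected Ω) (hD : defect H p Ω u q C ≤ 0) :
    ∃ x₀ r, 0 < r ∧ Ω = {x | dualNorm H (x - x₀) < r} ∧ ∀ x ∈ Ω, u x =
      (p - 1) * (r ^ (p / (p - 1)) - dualNorm H (x - x₀) ^ (p / (p - 1))) /
        (p * (N : ℝ) ^ (1 / (p - 1))) := by
  have hn : (0:ℝ) < N := by exact_mod_cast hN
  have hp1 : 0 < p - 1 := by linarith
  have hp0 : 0 < p := by linarith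
  obtain ⟨x₀, hx₀⟩ := h.exists_stress_eq hH hp hN hΩ.isPreconnected hD
  have hWc := continuous_wulffPot hH hp x₀
  obtain ⟨k, hk⟩ := add_eq_const_of_subgradient h.isOpen hΩ.isPreconnected h.cont hWc
    (memLp_one_iff_integrable.1 (h.memLp_q hH 1)) h.grad
    (hx₀.mono fun x hx hxΩ y => wulffPot_subgradient hH hp hN (hx hxΩ) y)
  have hkcl : ∀ x ∈ closure Ω, wulffPot H p x₀ x + u x = k := fun x hx =>
    closure_minimal hk (isClosed_eq (hWc.add h.cont) continuous_const) hx
  set a : ℝ := (p - 1) / (p * (N : ℝ) ^ (1 / (p - 1))) with ha'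
  have ha : 0 < a := by positivity
  have hW : ∀ x, wulffPot H p x₀ x = a * dualNorm H (x - x₀) ^ (p / (p - 1)) := fun x => by
    rw [wulffPot, ha']; ring
  have hW0 : ∀ x, 0 ≤ wulffPot H p x₀ x := fun x => by
    rw [hW]
    have := hH.dualNorm_nonneg (x - x₀)
    positivity
  obtain ⟨z, hz⟩ := hΩ.nonempty
  have hkpos : 0 < k := by linarith [hk z hz, hW0 z, h.pos z hz]
  set r : ℝ := (k / a) ^ ((p - 1) / p) with hr'
  have hr : 0 < r := by positivity
  have hrk : a * r ^ (p / (p - 1)) = k := by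
    rw [hr', ← Real.rpow_mul (by positivity), div_mul_div_cancel₀ hp0.ne', div_self hp1.ne',
      Real.rpow_one, mul_div_cancel₀ _ ha.ne']
  have hiff : ∀ x, wulffPot H p x₀ x < k ↔ dualNorm H (x - x₀) < r := fun x => by
    rw [hW, ← hrk, mul_lt_mul_iff_right₀ ha,
      Real.rpow_lt_rpow_iff (hH.dualNorm_nonneg _) hr.le (by positivity)]
  have hsub : Ω ⊆ {x | dualNorm H (x - x₀) < r} := fun x hx =>
    (hiff x).1 (by linarith [hk x hx, h.pos x hx])
  have hconv : Convex ℝ {x | dualNorm H (x - x₀) < r} := by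
    intro x hx y hy s t hs ht hst
    have e : s • x + t • y - x₀ = s • (x - x₀) + t • (y - x₀) := by
      rw [smul_sub, smul_sub, sub_add_sub_comm, ← add_smul, hst, one_smul]
    change dualNorm H _ < r
    rw [e]
    refine (hH.dualNorm_add_le _ _).trans_lt ?_
    rw [hH.dualNorm_smul hs, hH.dualNorm_smul ht]
    have := convex_Iio r hx hy hs ht hst
    simpa using this
  have hsup : {x | dualNorm H (x - x₀) < r} ⊆ Ω := by
    refine hconv.isPreconnected.subset_left_of_subset_union h.isOpen
      isClosed_closure.isOpen_compl (disjoint_compl_right_iff_subset.2 subset_closure)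
      (fun x hx => ?_) ⟨z, hsub hz, hz⟩
    by_contra hc
    rw [mem_union, not_or, mem_compl_iff, not_not] at hc
    have := hkcl x hc.2
    rw [h.zero x hc.1, add_zero] at this
    exact ((hiff x).2 hx).ne this
  refine ⟨x₀, r, hr, hsub.antisymm hsup, fun x hx => ?_⟩
  have e : u x = a * r ^ (p / (p - 1)) - a * dualNorm H (x - x₀) ^ (p / (p - 1)) := by
    rw [hrk, ← hW]
    linarith [hk x hx]
  rw [e, ha']
  ring

end RSol

end

/-- Serrin-type overdetermined problem for the Finsler `p`-Laplacian. -/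
theorem wulff_shape_interior_overdetermined
    {N : ℕ} (hN : 2 ≤ N) {p : ℝ} (hp : 1 < p)
    {Ω : Set (Euc N)} (hΩconn : IsConnected Ω) (hΩbd : Bornology.IsBounded Ω)
    (hΩreg : IsC2alphaDomain Ω)
    {H : Euc N → ℝ} (hH : IsIpNorm p H)
    {u : Euc N → ℝ} (hu : IsInteriorSol H p Ω u)
    {C : ℝ} (hC : 0 < C) (hover : ∀ x ∈ frontier Ω, H (gradient u x) = C) :
    ∃ (x₀ : Euc N) (r : ℝ), 0 < r ∧ Ω = {x | dualNorm H (x - x₀) < r} ∧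
      ∀ x ∈ Ω, u x = (p - 1) * (r ^ (p / (p - 1)) - dualNorm H (x - x₀) ^ (p / (p - 1)))
        / (p * (N : ℝ) ^ (1 / (p - 1))) := by
  have hN0 : 0 < N := by omega
  have h := IsInteriorSol.exists_rSol hN0 hp hΩreg.1 hΩbd hH hu hC hover
  obtain ⟨x₀, r, hr, hΩ, hux⟩ :=
    h.eq_wulff hH hp hN0 hΩconn (h.defect_eq_zero hH hp hN0 hΩreg).le
  exact ⟨x₀, r, hr, hΩ, fun x hx => by rw [← hux x hx, indicator_of_mem hx]⟩

end
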